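/- For all real numbers $x \ge 10$ and $2 \le y \le \sqrt{x}$, the number of positive integers $n \le x$ having no prime factor $\le y$ is less than $0.6\, x/\log y$. -/

import Mathlib

open Finset
open scoped Classical

/-- `Phi x y` is the number of integers `n ∈ [1, x]` having no prime factor `≤ y`. -/
noncomputable def Phi (x y : ℝ) : ℕ :=
  ((Finset.Icc 1 ⌊x⌋₊).filter (fun n => ∀ p : ℕ, p.Prime → p ∣ n → y < (p : ℝ))).card


section
namespace PS
open ArithmeticFunction (vonMangoldt vonMangoldt_nonneg vonMangoldt_sum)
open Real (log)

/-- log factorial -/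
noncomputable def Tf (n : ℕ) : ℝ := ∑ k ∈ Ioc 0 n, Real.log k

noncomputable def psi (n : ℕ) : ℝ := ∑ m ∈ Ioc 0 n, vonMangoldt m

lemma Tf_eq (n : ℕ) : Tf n = ∑ m ∈ Ioc 0 n, vonMangoldt m * ((n / m : ℕ) : ℝ) := by
  have := ArithmeticFunction.sum_Ioc_mul_zeta_eq_sum (R := ℝ) vonMangoldt n
  rw [← this, Tf, ArithmeticFunction.vonMangoldt_mul_zeta]
  simp [ArithmeticFunction.log_apply]

lemma Tf_div (n d : ℕ) (hd : 0 < d) :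
    Tf (n / d) = ∑ m ∈ Ioc 0 n, vonMangoldt m * ((n / m / d : ℕ) : ℝ) := by
  rw [Tf_eq]
  have hs : Ioc 0 (n / d) ⊆ Ioc 0 n := Ioc_subset_Ioc_right (Nat.div_le_self n d)
  rw [← sum_subset hs]
  · refine sum_congr rfl fun m _ => ?_
    rw [Nat.div_div_eq_div_mul, Nat.div_div_eq_div_mul, mul_comm d m]
  · intro m hm hm'
    simp only [mem_Ioc, not_and, not_le] at hm hm'
    have h1 := hm' hm.1
    have : n / m / d = 0 := by
      rw [Nat.div_div_eq_div_mul, mul_comm, ← Nat.div_div_eq_div_mul]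
      exact Nat.div_eq_of_lt h1
    simp [this]

/-- `∑_m Λ(m) [n/m ≥ s] = ψ(n/s)` -/
lemma psi_div (n s : ℕ) (hs : 0 < s) :
    ∑ m ∈ Ioc 0 n, vonMangoldt m * (if s ≤ n / m then (1:ℝ) else 0) = psi (n / s) := by
  have hsub : Ioc 0 (n / s) ⊆ Ioc 0 n := Ioc_subset_Ioc_right (Nat.div_le_self n s)
  rw [psi, ← sum_subset hsub]
  · refine sum_congr rfl fun m hm => ?_
    simp only [mem_Ioc] at hm
    rw [if_pos, mul_one]
    rw [Nat.le_div_iff_mul_le hm.1, mul_comm]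
    exact (Nat.le_div_iff_mul_le hs).1 hm.2
  · intro m hm hm'
    simp only [mem_Ioc, not_and, not_le] at hm hm'
    rw [if_neg, mul_zero]
    rw [Nat.le_div_iff_mul_le hm.1, mul_comm, ← Nat.le_div_iff_mul_le hs]
    exact not_le.2 (hm' hm.1)

lemma psi_mono : Monotone psi := by
  intro a b h
  exact sum_le_sum_of_subset_of_nonneg (Ioc_subset_Ioc_right h) (fun _ _ _ => vonMangoldt_nonneg)

lemma psi_nonneg (n : ℕ) : 0 ≤ psi n := sum_nonneg fun _ _ => vonMangoldt_nonneg

lemma Tf_eq_log (n : ℕ) : Tf n = Real.log (n.factorial : ℝ) := by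
  induction n with
  | zero => simp [Tf]
  | succ n ih =>
    rw [Tf, sum_Ioc_succ_top (Nat.zero_le n), ← Tf, ih, Nat.factorial_succ, Nat.cast_mul,
      Real.log_mul (by positivity) (by positivity), add_comm]

/-- upper bound log n! -/
lemma Tf_le (n : ℕ) (hn : 1 ≤ n) : Tf n ≤ n * log n - n + log n / 2 + 1 := by
  induction n, hn using Nat.le_induction with
  | base => simp [Tf]
  | succ n hn ih =>
    rw [Tf, sum_Ioc_succ_top (Nat.zero_le n), ← Tf]
    have hn0 : (0:ℝ) < n := by exact_mod_cast hn
    -- need (n+1/2)(log(n+1) - log n) ≥ 1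
    have key : 1 ≤ (n + 1/2) * (log (n+1) - log n) := by
      have h := Real.sum_range_le_log_div (x := 1/(2*n+1)) (by positivity)
        (by rw [div_lt_one (by positivity)]; linarith) 1
      have e : (1 + 1/(2*(n:ℝ)+1)) / (1 - 1/(2*n+1)) = (n+1)/n := by
        have : (2*(n:ℝ)+1) ≠ 0 := by positivity
        field_simp
        ring
      rw [e, Real.log_div (by positivity) (by positivity)] at h
      simp at h
      have : (n + 1/2) * (2 * (2*(n:ℝ)+1)⁻¹) = 1 := by field_simp
      nlinarith
    push_cast
    nlinarith

lemma Tf_ge (n : ℕ) (hn : 1 ≤ n) : n * log n - n + log n / 2 + 0.9 ≤ Tf n := by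
  have h := Stirling.le_log_factorial_stirling (n := n) (by omega)
  rw [← Tf_eq_log] at h
  have : 1.8 ≤ log (2 * Real.pi) := by
    rw [Real.le_log_iff_exp_le (by positivity)]
    have h1 : Real.exp 1.8 = Real.exp 1 * Real.exp 0.8 := by rw [← Real.exp_add]; norm_num
    have h2 := Real.exp_one_lt_d9
    have h3 : Real.exp 0.8 ≤ 2.2256 := by
      have := Real.exp_bound' (x := 0.8) (by norm_num) (by norm_num) (n := 8) (by norm_num)
      refine this.trans ?_
      norm_num [Finset.sum_range_succ, Nat.factorial]
    have := Real.pi_gt_d4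
    have h4 : 0 < Real.exp 0.8 := Real.exp_pos _
    rw [h1]
    nlinarith
  linarith

/-- `g y = y log y - y` vs `T ⌊n/d⌋` -/
lemma Tf_div_bounds (n d : ℕ) (hd : 0 < d) (hnd : d ≤ n) :
    |Tf (n / d) - ((n:ℝ)/d * log ((n:ℝ)/d) - (n:ℝ)/d)| ≤ log ((n:ℝ)/d) / 2 + 1 := by
  set k := n / d with hk
  set y : ℝ := (n:ℝ)/d with hy
  have hd0 : (0:ℝ) < d := by exact_mod_cast hd
  have hk1 : 1 ≤ k := by rw [hk]; exact (Nat.one_le_div_iff hd).2 hnd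
  have hky : (k:ℝ) ≤ y := Nat.cast_div_le
  have hyk : y ≤ k + 1 := by
    rw [hy, div_le_iff₀ hd0]
    have : n < (k+1) * d := by
      have := Nat.div_add_mod n d; have := Nat.mod_lt n hd
      rw [hk]; nlinarith
    exact_mod_cast this.le
  have hk0 : (1:ℝ) ≤ k := by exact_mod_cast hk1
  have hy0 : (0:ℝ) < y := by linarith
  have h1 := Tf_le k hk1
  have h2 := Tf_ge k hk1
  have hlogk : log k ≤ log y := Real.log_le_log (by linarith) hky
  have hlk0 : 0 ≤ log k := Real.log_nonneg hk0
  -- log y - log k ≤ (y-k)/k, and y(log y - log k) ≥ y - k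
  have h3 : log y - log k ≤ y / k - 1 := by
    rw [← Real.log_div (by linarith) (by linarith)]
    exact Real.log_le_sub_one_of_pos (by positivity)
  have h4 : 1 - k / y ≤ log y - log k := by
    have := Real.log_le_sub_one_of_pos (x := k / y) (by positivity)
    rw [Real.log_div (by linarith) (by linarith)] at this
    linarith
  have h4' : y - k ≤ y * (log y - log k) := by
    have := mul_le_mul_of_nonneg_left h4 hy0.le
    have e : y * (1 - k/y) = y - k := by field_simp
    linarith
  have h3' : k * (log y - log k) ≤ y - k := by
    have := mul_le_mul_of_nonneg_left h3 (by linarith : (0:ℝ) ≤ k)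
    have e : k * (y/k - 1) = y - k := by field_simp
    linarith
  have hyk0 : 0 ≤ y - k := by linarith
  have hyk1 : y - k ≤ 1 := by linarith
  have hy1 : 0 ≤ log y := by linarith
  rw [abs_le]
  constructor
  · have h5 : log y - log k ≤ 1 := by
      have : y / k ≤ 2 := by rw [div_le_iff₀ (by linarith)]; linarith
      linarith
    nlinarith
  · nlinarith
end PS
end


section
namespace PS

/-- packed vectors: digits of width `w` bits -/
def pk (w : ℕ) (f : ℕ → ℕ) (n : ℕ) : ℕ := ∑ t ∈ range n, f t * 2 ^ (w * t)

lemma pk_add (w : ℕ) (f g : ℕ → ℕ) (n : ℕ) : pk w f n + pk w g n = pk w (fun t => f t + g t) n := by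
  simp [pk, ← sum_add_distrib, add_mul]

lemma pk_smul (w c : ℕ) (f : ℕ → ℕ) (n : ℕ) : c * pk w f n = pk w (fun t => c * f t) n := by
  simp [pk, mul_sum, mul_assoc]

lemma pk_congr {w : ℕ} {f g : ℕ → ℕ} {n : ℕ} (h : ∀ t < n, f t = g t) : pk w f n = pk w g n :=
  sum_congr rfl fun t ht => by rw [h t (mem_range.1 ht)]

lemma pk_split (w : ℕ) (f : ℕ → ℕ) (a b : ℕ) :
    pk w f (a + b) = pk w f a + pk w (fun t => f (a + t)) b * 2 ^ (w * a) := by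
  simp only [pk, sum_range_add, sum_mul]
  congr 1
  refine sum_congr rfl fun t _ => ?_
  rw [mul_add, pow_add]; ring

lemma pk_lt {w : ℕ} {f : ℕ → ℕ} {n : ℕ} (h : ∀ t < n, f t < 2 ^ w) : pk w f n < 2 ^ (w * n) := by
  induction n with
  | zero => simp [pk]
  | succ n ih =>
    have h1 := ih fun t ht => h t (by omega)
    have h2 := h n (by omega)
    rw [pk, sum_range_succ, ← pk]
    have : 2 ^ (w * (n + 1)) = 2 ^ w * 2 ^ (w * n) := by rw [← pow_add]; ring_nf
    rw [this]
    nlinarith [Nat.two_pow_pos (w * n)]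

lemma pk_mod {w : ℕ} {f : ℕ → ℕ} {n m : ℕ} (hmn : m ≤ n) (h : ∀ t < m, f t < 2 ^ w) :
    pk w f n % 2 ^ (w * m) = pk w f m := by
  obtain ⟨k, rfl⟩ := Nat.exists_eq_add_of_le hmn
  rw [pk_split, Nat.add_mul_mod_self_right]
  exact Nat.mod_eq_of_lt (pk_lt h)

/-- evaluate `s` to a literal in the kernel before passing it on -/
def force (s : ℕ) (k : ℕ → ℕ) : ℕ := Nat.rec (k 0) (fun m _ => k (Nat.succ m)) s

@[simp] lemma force_eq (s : ℕ) (k : ℕ → ℕ) : force s k = k s := by cases s <;> rfl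

/-- repeat a pattern `2^i` times; `D` is the bit length of the pattern -/
def rp (D P : ℕ) (i : ℕ) : ℕ :=
  Nat.rec P (fun i r => force r (fun v => Nat.add v (Nat.mul v (Nat.pow 2 (Nat.mul D (Nat.pow 2 i)))))) i

lemma rp_succ (D P i : ℕ) : rp D P (i + 1) = rp D P i + rp D P i * 2 ^ (D * 2 ^ i) := by
  simp only [rp, force_eq]; rfl

lemma rp_eq (w d : ℕ) (f : ℕ → ℕ) (hf : ∀ t, f (t + d) = f t) (i : ℕ) :
    rp (w * d) (pk w f d) i = pk w f (d * 2 ^ i) := by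
  have hf' : ∀ k t, f (d * k + t) = f t := by
    intro k
    induction k with
    | zero => simp
    | succ k ih => intro t; rw [mul_add, mul_one, add_right_comm, hf, ih]
  induction i with
  | zero => simp [rp]
  | succ i ih =>
    rw [rp_succ, ih, pow_succ, mul_two, mul_add, pk_split]
    simp only [hf', mul_assoc]

/-- digitwise comparison -/
lemma pk_land {w : ℕ} {c : ℕ → ℕ} {n : ℕ} (hc : ∀ t < n, c t < 2 ^ (w + 1))
    (h : Nat.land (pk (w + 1) c n) (pk (w + 1) (fun _ => 2 ^ w) n) = pk (w + 1) (fun _ => 2 ^ w) n) :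
    ∀ t < n, 2 ^ w ≤ c t := by
  induction n with
  | zero => simp
  | succ n ih =>
    have e : ∀ f : ℕ → ℕ, pk (w + 1) f (n + 1) = pk (w+1) f n + f n * 2 ^ ((w + 1) * n) := by
      intro f; rw [pk, sum_range_succ, ← pk]
    have hcl : pk (w+1) c n < 2 ^ ((w+1) * n) := pk_lt fun t ht => hc t (by omega)
    have hhl : pk (w+1) (fun _ => 2 ^ w) n < 2 ^ ((w+1) * n) :=
      pk_lt fun t ht => Nat.pow_lt_pow_right (by norm_num) (by omega)
    change ((pk (w + 1) c (n+1) : ℕ) &&& pk (w + 1) (fun _ => 2 ^ w) (n+1)) = _ at h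
    rw [e, e] at h
    have hm : ((pk (w+1) c n + c n * 2 ^ ((w + 1) * n)) &&& (pk (w+1) (fun _ => 2 ^ w) n + 2 ^ w * 2 ^ ((w + 1) * n))) % 2 ^ ((w + 1) * n)
        = (pk (w+1) c n &&& pk (w+1) (fun _ => 2 ^ w) n) := by
      rw [Nat.and_mod_two_pow, Nat.add_mul_mod_self_right, Nat.add_mul_mod_self_right,
        Nat.mod_eq_of_lt hcl, Nat.mod_eq_of_lt hhl]
    have hd : ((pk (w+1) c n + c n * 2 ^ ((w + 1) * n)) &&& (pk (w+1) (fun _ => 2 ^ w) n + 2 ^ w * 2 ^ ((w + 1) * n))) / 2 ^ ((w + 1) * n)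
        = (c n &&& 2 ^ w) := by
      rw [Nat.and_div_two_pow, Nat.add_mul_div_right _ _ (Nat.two_pow_pos _),
        Nat.add_mul_div_right _ _ (Nat.two_pow_pos _), Nat.div_eq_of_lt hcl, Nat.div_eq_of_lt hhl]
      simp
    rw [h] at hm hd
    rw [Nat.add_mul_mod_self_right, Nat.mod_eq_of_lt hhl] at hm
    rw [Nat.add_mul_div_right _ _ (Nat.two_pow_pos _), Nat.div_eq_of_lt hhl, zero_add] at hd
    intro t ht
    rcases Nat.lt_succ_iff_lt_or_eq.1 ht with h1 | rfl
    · exact ih (fun t ht => hc t (by omega)) hm.symm t h1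
    · rw [hd]; exact Nat.and_le_left

/-- from the packed check `B + H - A` has all top bits ⇒ `a ≤ b` digitwise -/
lemma pk_le_of_check {w : ℕ} {a b : ℕ → ℕ} {n : ℕ} (ha : ∀ t < n, a t < 2 ^ w)
    (hb : ∀ t < n, b t < 2 ^ w)
    (h : Nat.land (pk (w + 1) b n + pk (w + 1) (fun _ => 2 ^ w) n - pk (w + 1) a n)
      (pk (w + 1) (fun _ => 2 ^ w) n) = pk (w + 1) (fun _ => 2 ^ w) n) :
    ∀ t < n, a t ≤ b t := by
  have e : pk (w + 1) b n + pk (w + 1) (fun _ => 2 ^ w) n - pk (w + 1) a n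
      = pk (w + 1) (fun t => b t + 2 ^ w - a t) n := by
    rw [pk_add, Nat.sub_eq_iff_eq_add, pk_add]
    · exact pk_congr fun t ht => by have := ha t ht; omega
    · exact sum_le_sum fun t ht => Nat.mul_le_mul_right _ (by have := ha t (mem_range.1 ht); dsimp only; omega)
  rw [e] at h
  intro t ht
  have := pk_land (c := fun t => b t + 2 ^ w - a t) (fun t ht => by
    have := hb t ht; rw [pow_succ]; omega) h t ht
  have := ha t ht
  omega
end PS
end


section
namespace PS

def cp : List (ℕ × ℕ × ℕ) :=
  [(1, 16, 1000000), (6, 13, 166667), (10, 12, 100000), (14, 12, 71429), (15, 12, 64199), (21, 11,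
  28790), (22, 11, 45455), (26, 11, 38462), (33, 11, 19994), (35, 11, 24567), (38, 11, 26316),
  (39, 11, 25641), (45, 10, 823), (46, 10, 21739), (51, 10, 17532), (55, 10, 17310), (57, 10,
  16391), (58, 10, 17241), (63, 10, 6276), (64, 10, 734), (65, 10, 15385), (68, 10, 15149), (69,
  10, 14493), (72, 10, 5947), (74, 10, 6221), (77, 10, 12987), (82, 9, 12195), (85, 9, 9277), (86,
  9, 3146), (87, 9, 11494), (88, 9, 1151), (91, 9, 9355), (93, 9, 10247), (94, 9, 10638), (95, 9,
  10526), (96, 9, 489), (99, 9, 3436), (102, 9, 6309), (104, 9, 452), (106, 9, 9434), (109, 9,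
  5271), (111, 9, 4862), (115, 9, 5375), (118, 9, 8795), (119, 9, 4628), (122, 9, 48), (123, 9,
  8130), (124, 9, 8017), (129, 9, 6568), (132, 9, 93), (133, 9, 3047), (134, 9, 3675), (135, 9,
  2297), (136, 9, 918), (140, 9, 6968), (141, 9, 4579), (143, 9, 2649), (145, 9, 6897), (146, 9,
  2009), (147, 9, 1149), (148, 9, 3646), (150, 9, 2377), (152, 9, 39), (155, 9, 6148), (159, 8,
  4560), (160, 8, 6014), (161, 8, 6211), (168, 8, 3588), (170, 8, 3664), (171, 8, 384), (172, 8,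
  3581), (175, 8, 92), (176, 8, 70), (177, 8, 5650), (178, 8, 2276), (180, 8, 3961), (185, 8,
  7715), (187, 8, 2385), (194, 8, 6060), (199, 8, 2550), (200, 8, 8984)]
def cn : List (ℕ × ℕ × ℕ) :=
  [(2, 15, 500001), (3, 14, 333333), (5, 13, 200000), (7, 13, 142857), (11, 12, 90909), (13, 12,
  76923), (17, 12, 58824), (19, 12, 52632), (23, 11, 43478), (29, 11, 34483), (30, 11, 32099),
  (31, 11, 30742), (32, 11, 1468), (34, 11, 15813), (36, 11, 11894), (37, 11, 27027), (41, 10,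
  24390), (42, 10, 14395), (43, 10, 20614), (44, 10, 2582), (47, 10, 21277), (53, 10, 18868), (56,
  10, 2760), (59, 10, 16949), (61, 10, 96), (62, 10, 663), (66, 10, 9997), (67, 10, 7351), (70,
  10, 12284), (71, 10, 14085), (73, 10, 916), (75, 10, 4753), (78, 10, 12821), (79, 9, 1073), (80,
  9, 11440), (84, 9, 2056), (89, 9, 4553), (90, 9, 7020), (92, 9, 1003), (97, 9, 10309), (101, 9,
  9901), (103, 9, 8207), (105, 9, 5992), (107, 9, 232), (110, 9, 3147), (112, 9, 2460), (113, 9,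
  1473), (114, 9, 14817), (116, 9, 1514), (117, 9, 7847), (120, 9, 238), (126, 9, 3138), (127, 9,
  2481), (128, 9, 5045), (130, 9, 7692), (131, 9, 1766), (137, 9, 7299), (138, 9, 7246), (149, 9,
  6711), (151, 9, 5960), (154, 9, 6494), (157, 8, 3056), (158, 8, 1016), (163, 8, 6135), (165, 8,
  3484), (167, 8, 3140), (169, 8, 564), (173, 8, 3359), (174, 8, 10485), (179, 8, 1186), (182, 8,
  5955), (184, 8, 1823), (186, 8, 3401), (188, 8, 59), (190, 8, 5263), (191, 8, 5236), (192, 8,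
  245), (193, 8, 305), (195, 8, 1581), (196, 8, 220), (197, 8, 192), (198, 8, 2724)]
def dl : List (ℕ × ℕ) :=
  [(2, 2), (4, 1), (10, 1), (15, 37006), (16, 2), (17, 8), (19, 7), (20, 2), (21, 395408), (33,
  340134), (34, 1537652), (35, 140154), (36, 428183), (38, 1), (40, 1), (51, 105858), (55, 47941),
  (56, 154555), (57, 65720), (58, 31), (71, 3), (75, 3), (76, 2), (78, 24), (87, 5), (88, 12311),
  (91, 148659), (92, 92278), (93, 30), (94, 49), (95, 38), (96, 31), (100, 2), (101, 1), (105,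
  39), (106, 2), (215, 5369), (217, 953000), (221, 56), (707, 724863), (713, 20), (721, 1522),
  (722, 2), (724, 1), (808, 195), (927, 228270), (928, 222631), (936, 59), (965, 24), (1147, 5),
  (1271, 690791), (1276, 43), (1278, 34), (2516, 88), (2518, 1), (3059, 360675), (3157, 603510),
  (3158, 2), (3159, 918098), (3160, 245297), (3162, 99190), (3179, 79164), (3298, 291850), (3306,
  81312), (3312, 314042), (16059, 773775), (34661, 268660), (40000, 43820060)]

def sumv (L : List (ℕ × ℕ × ℕ)) (t : ℕ) : ℕ := (L.map fun x => x.2.2 * (t % x.1)).sum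
def stepv (L : List (ℕ × ℕ)) (t : ℕ) : ℕ := (L.map fun x => if x.1 ≤ t then x.2 else 0).sum

def pid (d : ℕ) : ℕ := Nat.rec 0 (fun t r => Nat.add r (Nat.mul t (Nat.pow 2 (Nat.mul 28 t)))) d
lemma pid_eq (d : ℕ) : pid d = pk 28 id d := by
  induction d with
  | zero => rfl
  | succ d ih =>
    rw [pk, sum_range_succ, ← pk, ← ih]; rfl
lemma pid_eq' (d : ℕ) : pid d = pk 28 (fun t => t % d) d := by
  rw [pid_eq]; exact pk_congr fun t ht => (Nat.mod_eq_of_lt ht).symm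

def packL (L : List (ℕ × ℕ × ℕ)) : ℕ :=
  List.rec 0 (fun x _ r => Nat.add r (Nat.mul x.2.2 (rp (Nat.mul 28 x.1) (pid x.1) x.2.1))) L
def packS (o : ℕ) (L : List (ℕ × ℕ)) : ℕ :=
  List.rec 0 (fun x _ r => Nat.add r (Nat.mul x.2 (Nat.mul o (Nat.pow 2 (Nat.mul 28 x.1))))) L

lemma pk_modeq {w : ℕ} {f : ℕ → ℕ} {n m : ℕ} (hmn : m ≤ n) :
    pk w f n ≡ pk w f m [MOD 2 ^ (w * m)] := by
  obtain ⟨k, rfl⟩ := Nat.exists_eq_add_of_le hmn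
  rw [pk_split]
  unfold Nat.ModEq
  rw [Nat.add_mul_mod_self_right]

lemma packL_eq (n : ℕ) (L : List (ℕ × ℕ × ℕ)) (h : ∀ x ∈ L, n ≤ x.1 * 2 ^ x.2.1) :
    packL L ≡ pk 28 (sumv L) n [MOD 2 ^ (28 * n)] := by
  induction L with
  | nil => simp [packL, sumv, pk]; rfl
  | cons x L ih =>
    have e : packL (x :: L) = packL L + x.2.2 * rp (28 * x.1) (pid x.1) x.2.1 := rfl
    have e2 : pk 28 (sumv (x :: L)) n = pk 28 (sumv L) n + x.2.2 * pk 28 (fun t => t % x.1) n := by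
      rw [pk_smul, pk_add]
      exact pk_congr fun t _ => by simp [sumv, add_comm]
    rw [e, e2]
    refine Nat.ModEq.add (ih fun y hy => h y (List.mem_cons_of_mem _ hy)) (Nat.ModEq.mul_left _ ?_)
    rw [pid_eq', rp_eq 28 x.1 (fun t => t % x.1) (by intro t; simp)]
    exact pk_modeq (h x List.mem_cons_self)

lemma packS_eq (n k : ℕ) (hk : n ≤ k) (L : List (ℕ × ℕ)) :
    packS (pk 28 (fun _ => 1) k) L ≡ pk 28 (stepv L) n [MOD 2 ^ (28 * n)] := by
  induction L with
  | nil => simp [packS, stepv, pk]; rfl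
  | cons x L ih =>
    have e : packS (pk 28 (fun _ => 1) k) (x :: L) = packS (pk 28 (fun _ => 1) k) L + x.2 * (pk 28 (fun _ => 1) k * 2 ^ (28 * x.1)) := rfl
    have e2 : pk 28 (stepv (x :: L)) n = pk 28 (stepv L) n + x.2 * pk 28 (fun t => if x.1 ≤ t then 1 else 0) n := by
      rw [pk_smul, pk_add]
      exact pk_congr fun t _ => by simp [stepv, add_comm]
    rw [e, e2]
    refine Nat.ModEq.add ih (Nat.ModEq.mul_left _ ?_)
    have e3 : pk 28 (fun _ => 1) k * 2 ^ (28 * x.1) = pk 28 (fun t => if x.1 ≤ t then 1 else 0) (x.1 + k) := by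
      rw [pk_split]
      have : pk 28 (fun t => if x.1 ≤ t then 1 else 0) x.1 = 0 := by
        rw [pk]; refine sum_eq_zero fun t ht => ?_
        rw [if_neg (by simpa using ht), zero_mul]
      rw [this]; simp
    rw [e3]
    exact pk_modeq (by omega)

def chkF (cp cn : List (ℕ × ℕ × ℕ)) (dl one : List (ℕ × ℕ)) (k n : ℕ) : ℕ :=
  force (rp 28 1 k) fun o =>
  force (Nat.pow 2 (Nat.mul 28 n)) fun m =>
  force (Nat.mod (Nat.mul (Nat.pow 2 27) o) m) fun H =>
  Bool.rec 0 1 (Nat.beq (Nat.land (Nat.sub (Nat.add (Nat.mod (Nat.add (packL cn) (packS o dl)) m) H)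
    (Nat.mod (Nat.add (packL cp) (packS o one)) m)) H) H)

set_option maxRecDepth 100000 in
theorem chk3_ok : chkF cp cn dl [(1, 1000000)] 16 40000 = 1 := by decide +kernel
end PS
end


section
namespace PS

def lgt (n k : ℕ) : ℕ := Nat.div 2000000000000000 (Nat.mul (Nat.succ (Nat.mul 2 k)) (Nat.pow (Nat.succ (Nat.mul 2 n)) (Nat.succ (Nat.mul 2 k))))
def lgs (n : ℕ) : ℕ := Nat.rec 0 (fun k r => Nat.add r (lgt n k)) 16
/-- `10^15 log (m+1)`, rounded down -/
def lgL (m : ℕ) : ℕ := Nat.rec 0 (fun m r => Nat.add r (lgs (Nat.succ m))) m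

lemma lgs_eq (n : ℕ) : lgs n = ∑ k ∈ range 16, lgt n k := by
  have : ∀ K, (Nat.rec 0 (fun k r => Nat.add r (lgt n k)) K : ℕ) = ∑ k ∈ range K, lgt n k := by
    intro K
    induction K with
    | zero => rfl
    | succ K ih => rw [sum_range_succ, ← ih]; rfl
  exact this 16

lemma lgL_succ (m : ℕ) : lgL (m + 1) = lgL m + lgs (m + 1) := rfl

lemma lgt_eq (n k : ℕ) : lgt n k = 2000000000000000 / ((2 * k + 1) * (2 * n + 1) ^ (2 * k + 1)) := rfl

lemma log_step (n : ℕ) (hn : 1 ≤ n) :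
    (lgs n : ℝ) / 10 ^ 15 ≤ Real.log (n + 1) - Real.log n ∧
    Real.log (n + 1) - Real.log n ≤ ((lgs n : ℝ) + 17) / 10 ^ 15 := by
  have hn0 : (1:ℝ) ≤ n := by exact_mod_cast hn
  set z : ℝ := 1 / (2 * n + 1) with hz
  have hz0 : 0 ≤ z := by positivity
  have hz3 : z ≤ 1 / 3 := by
    rw [hz]; apply one_div_le_one_div_of_le <;> linarith
  have hz1 : z < 1 := by linarith
  have hl : Real.log ((1 + z) / (1 - z)) = Real.log (n + 1) - Real.log n := by
    rw [← Real.log_div (by positivity) (by positivity)]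
    congr 1
    have : (1 - z) = 2 * n / (2 * n + 1) := by rw [hz]; field_simp; ring
    rw [this, hz]; field_simp; ring
  have h1 := Real.sum_range_le_log_div hz0 hz1 16
  have h2 := Real.log_div_le_sum_range_add hz0 hz1 16
  rw [hl] at h1 h2
  have hterm : ∀ k : ℕ, z ^ (2 * k + 1) / (2 * k + 1) * (2 * 10 ^ 15)
      = (2000000000000000 : ℕ) / (((2 * k + 1) * (2 * n + 1) ^ (2 * k + 1) : ℕ) : ℝ) := by
    intro k; rw [hz, div_pow, one_pow]; push_cast; field_simp; norm_num
  have hlo : (lgs n : ℝ) ≤ (∑ i ∈ range 16, z ^ (2 * i + 1) / (2 * i + 1)) * (2 * 10 ^ 15) := by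
    rw [lgs_eq, sum_mul]; push_cast
    refine sum_le_sum fun k _ => ?_
    rw [hterm, lgt_eq]; exact Nat.cast_div_le
  have hhi : (∑ i ∈ range 16, z ^ (2 * i + 1) / (2 * i + 1)) * (2 * 10 ^ 15) ≤ (lgs n : ℝ) + 16 := by
    rw [lgs_eq, sum_mul]; push_cast
    have : (16:ℝ) = ∑ k ∈ range 16, (1:ℝ) := by simp
    rw [this, ← sum_add_distrib]
    refine sum_le_sum fun k _ => ?_
    rw [hterm, lgt_eq]
    rw [← Nat.floor_div_eq_div (K := ℝ)]
    exact (Nat.lt_floor_add_one _).le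
  have hr : z ^ (2 * 16 + 1) / (1 - z ^ 2) * (2 * 10 ^ 15) ≤ 1 := by
    have a : z ^ (2 * 16 + 1) ≤ (1/3) ^ (2 * 16 + 1) := by gcongr
    have b : (8/9 : ℝ) ≤ 1 - z ^ 2 := by nlinarith
    calc z ^ (2 * 16 + 1) / (1 - z ^ 2) * (2 * 10 ^ 15) ≤ (1/3) ^ (2 * 16 + 1) / (8/9) * (2 * 10 ^ 15) := by
          gcongr
      _ ≤ 1 := by norm_num
  constructor
  · rw [div_le_iff₀ (by positivity)]; linarith
  · rw [le_div_iff₀ (by positivity)]; linarith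

lemma lgL_le (m : ℕ) : (lgL m : ℝ) / 10 ^ 15 ≤ Real.log (m + 1) := by
  induction m with
  | zero => simp [lgL]
  | succ m ih =>
    have := (log_step (m + 1) (by omega)).1
    rw [lgL_succ]; push_cast at this ⊢
    rw [add_div]; linarith
lemma le_lgL (m : ℕ) : Real.log (m + 1) ≤ ((lgL m : ℝ) + 17 * m) / 10 ^ 15 := by
  induction m with
  | zero => simp [lgL]
  | succ m ih =>
    have := (log_step (m + 1) (by omega)).2
    rw [lgL_succ]; push_cast at this ⊢
    have e : ((lgL m : ℝ) + lgs (m+1) + 17 * (m + 1)) / 10 ^ 15 = (lgL m + 17 * m) / 10 ^ 15 + (lgs (m+1) + 17) / 10 ^ 15 := by ring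
    rw [e]; linarith

def sumlg (L : List (ℕ × ℕ × ℕ)) : ℕ :=
  List.rec 0 (fun x _ r => Nat.add r (Nat.mul x.2.2 (lgL (Nat.sub x.1 1)))) L

set_option maxRecDepth 100000 in
theorem sumlg_ok : Nat.ble (sumlg cn) (Nat.add (sumlg cp) (905475 * 10 ^ 15)) = true := by decide +kernel
end PS
end


section
open ArithmeticFunction
namespace PS

lemma sumv_le (L : List (ℕ × ℕ × ℕ)) (t : ℕ) (h : ∀ x ∈ L, 0 < x.1) :
    sumv L t ≤ (L.map fun x => x.2.2 * (x.1 - 1)).sum := by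
  refine List.sum_le_sum fun x hx => Nat.mul_le_mul_left _ ?_
  have := Nat.mod_lt t (h x hx); omega
lemma stepv_le (L : List (ℕ × ℕ)) (t : ℕ) :
    stepv L t ≤ (L.map fun x => x.2).sum := by
  refine List.sum_le_sum fun x hx => ?_
  split_ifs <;> simp

lemma pk_one (k : ℕ) : rp 28 1 k = pk 28 (fun _ => 1) (2 ^ k) := by
  have := rp_eq 28 1 (fun _ => 1) (fun _ => rfl) k
  rw [one_mul] at this
  rw [← this]; congr 1

lemma cp_pos : ∀ x ∈ cp, 0 < x.1 ∧ x.1 ≤ 200 ∧ 40000 ≤ x.1 * 2 ^ x.2.1 := by decide +kernel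
lemma cn_pos : ∀ x ∈ cn, 0 < x.1 ∧ x.1 ≤ 200 ∧ 40000 ≤ x.1 * 2 ^ x.2.1 := by decide +kernel
lemma dl_pos : ∀ x ∈ dl, 0 < x.1 ∧ x.1 ≤ 40000 := by decide +kernel

lemma ineqF (cp cn : List (ℕ × ℕ × ℕ)) (dl one : List (ℕ × ℕ)) (k n : ℕ) (hkn : n ≤ 2 ^ k)
    (hcp : ∀ x ∈ cp, 0 < x.1 ∧ n ≤ x.1 * 2 ^ x.2.1) (hcn : ∀ x ∈ cn, 0 < x.1 ∧ n ≤ x.1 * 2 ^ x.2.1)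
    (b3 : (cp.map fun x => x.2.2 * (x.1 - 1)).sum + (one.map (fun x : ℕ × ℕ => x.2)).sum < 2 ^ 27)
    (b4 : (cn.map fun x => x.2.2 * (x.1 - 1)).sum + (dl.map (fun x : ℕ × ℕ => x.2)).sum < 2 ^ 27)
    (e : chkF cp cn dl one k n = 1) (t : ℕ) (h : t < n) :
    sumv cp t + stepv one t ≤ sumv cn t + stepv dl t := by
  simp only [chkF, force_eq] at e
  have e' : Nat.land (((packL cn + packS (rp 28 1 k) dl) % 2 ^ (28 * n))
      + ((2 ^ 27 * rp 28 1 k) % 2 ^ (28 * n)) -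
    ((packL cp + packS (rp 28 1 k) one) % 2 ^ (28 * n)))
      ((2 ^ 27 * rp 28 1 k) % 2 ^ (28 * n)) = ((2 ^ 27 * rp 28 1 k) % 2 ^ (28 * n)) := by
      apply Nat.eq_of_beq_eq_true
      revert e
      generalize hb : Nat.beq _ _ = b
      intro e
      cases b
      · exact absurd e (by simp)
      · rfl
  have hH : (2 ^ 27 * rp 28 1 k) % 2 ^ (28 * n) = pk (27+1) (fun _ => 2 ^ 27) n := by
      have : 2 ^ 27 * (rp 28 1 k) = pk 28 (fun _ => 2 ^ 27) (2 ^ k) := by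
        rw [pk_one, pk_smul]; simp only [mul_one]
      rw [this]
      exact pk_mod hkn (fun t _ => by norm_num)
  have q1 : ∀ t, sumv cp t + stepv one t < 2 ^ 27 := by
    intro t
    have b1 := sumv_le cp t (fun x hx => (hcp x hx).1)
    have b2 := stepv_le one t
    omega
  have q2 : ∀ t, sumv cn t + stepv dl t < 2 ^ 27 := by
    intro t
    have b1 := sumv_le cn t (fun x hx => (hcn x hx).1)
    have b2 := stepv_le dl t
    omega
  have hP : (packL cp + packS (rp 28 1 k) one) % 2 ^ (28 * n)
        = pk (27+1) (fun t => sumv cp t + stepv one t) n := by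
      rw [← pk_add]
      have h1 := packL_eq n cp (fun x hx => (hcp x hx).2)
      have h2 := packS_eq n (2^k) hkn one
      rw [← pk_one] at h2
      have h3 := h1.add h2
      refine Eq.trans h3 (Nat.mod_eq_of_lt ?_)
      rw [pk_add]
      exact pk_lt fun t _ => (q1 t).trans (by norm_num)
  have hN : (packL cn + packS (rp 28 1 k) dl) % 2 ^ (28 * n)
        = pk (27+1) (fun t => sumv cn t + stepv dl t) n := by
      rw [← pk_add]
      have h1 := packL_eq n cn (fun x hx => (hcn x hx).2)
      have h2 := packS_eq n (2^k) hkn dl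
      rw [← pk_one] at h2
      have h3 := h1.add h2
      refine Eq.trans h3 (Nat.mod_eq_of_lt ?_)
      rw [pk_add]
      exact pk_lt fun t _ => (q2 t).trans (by norm_num)
  rw [hH, hP, hN] at e'
  exact pk_le_of_check (w := 27) (n := n) (fun t _ => q1 t) (fun t _ => q2 t) e' t h

lemma b3_ok : (cp.map fun x => x.2.2 * (x.1 - 1)).sum + ([(1, 1000000)].map (fun x : ℕ × ℕ => x.2)).sum < 2 ^ 27 := by decide +kernel
lemma b4_ok : (cn.map fun x => x.2.2 * (x.1 - 1)).sum + (dl.map (fun x : ℕ × ℕ => x.2)).sum < 2 ^ 27 := by decide +kernel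
lemma b5_ok : (cp.map fun x => x.2.2 * (x.1 - 1)).sum + 1000000 ≤ (dl.map (fun x : ℕ × ℕ => x.2)).sum := by decide +kernel

lemma ineqA (t : ℕ) (ht : 1 ≤ t) : sumv cp t + 1000000 ≤ sumv cn t + stepv dl t := by
  rcases lt_or_ge t 40000 with h | h
  · have := ineqF cp cn dl [(1, 1000000)] 16 40000 (by norm_num)
      (fun x hx => ⟨(cp_pos x hx).1, (cp_pos x hx).2.2⟩) (fun x hx => ⟨(cn_pos x hx).1, (cn_pos x hx).2.2⟩)
      b3_ok b4_ok chk3_ok t h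
    have e : stepv [(1, 1000000)] t = 1000000 := by simp [stepv, ht]
    rwa [e] at this
  · have b1 := sumv_le cp t (fun x hx => (cp_pos x hx).1)
    have b2 : stepv dl t = (dl.map fun x => x.2).sum := by
      unfold stepv
      congr 1
      refine List.map_congr_left fun x hx => ?_
      rw [if_pos ((dl_pos x hx).2.trans h)]
    have b3 := b5_ok
    omega

/-- `∑ v d T(n/d)` over a list -/
noncomputable def ST (n : ℕ) (L : List (ℕ × ℕ × ℕ)) : ℝ := (L.map fun x => (x.2.2 * x.1 : ℕ) * Tf (n / x.1)).sum

lemma sum_sumv (n : ℕ) (L : List (ℕ × ℕ × ℕ)) (h : ∀ x ∈ L, 0 < x.1) :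
    ∑ m ∈ Ioc 0 n, vonMangoldt m * (sumv L (n / m) : ℝ) =
      ((L.map fun x => x.2.2).sum : ℕ) * Tf n - ST n L := by
  induction L with
  | nil => simp [sumv, ST]
  | cons x L ih =>
    have ih' := ih fun y hy => h y (List.mem_cons_of_mem _ hy)
    have hx := h x List.mem_cons_self
    have e : ∀ m, vonMangoldt m * (sumv (x :: L) (n / m) : ℝ) =
        (x.2.2 : ℝ) * (vonMangoldt m * ((n / m : ℕ) : ℝ)) - (x.2.2 * x.1 : ℕ) * (vonMangoldt m * ((n / m / x.1 : ℕ):ℝ))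
          + vonMangoldt m * (sumv L (n / m) : ℝ) := by
      intro m
      have : ((n / m : ℕ):ℝ) = x.1 * ((n / m / x.1 : ℕ) : ℝ) + ((n / m % x.1 : ℕ):ℝ) := by
        exact_mod_cast (Nat.div_add_mod (n/m) x.1).symm
      have e2 : sumv (x :: L) (n / m) = x.2.2 * (n / m % x.1) + sumv L (n/m) := by simp [sumv]
      rw [e2]; push_cast; rw [this]; ring
    simp only [e]
    rw [sum_add_distrib, sum_sub_distrib, ih', ← mul_sum, ← mul_sum, ← Tf_eq, ← Tf_div n _ hx]
    simp only [ST, List.map_cons, List.sum_cons]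
    push_cast; ring

lemma sum_stepv (n : ℕ) (L : List (ℕ × ℕ)) (h : ∀ x ∈ L, 0 < x.1) :
    ∑ m ∈ Ioc 0 n, vonMangoldt m * (stepv L (n / m) : ℝ) = (L.map fun x => (x.2 : ℝ) * psi (n / x.1)).sum := by
  induction L with
  | nil => simp [stepv]
  | cons x L ih =>
    have ih' := ih fun y hy => h y (List.mem_cons_of_mem _ hy)
    have hx := h x List.mem_cons_self
    simp only [List.map_cons, List.sum_cons]
    rw [← ih', ← psi_div n _ hx, mul_sum, ← sum_add_distrib]
    refine sum_congr rfl fun m _ => ?_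
    simp only [stepv, List.map_cons, List.sum_cons]
    split_ifs <;> push_cast <;> ring

lemma psi_rec0 (n : ℕ) : 1000000 * psi n ≤ ST n cp - ST n cn + (dl.map fun x => (x.2 : ℝ) * psi (n / x.1)).sum := by
  have h1 := sum_sumv n cp (fun x hx => (cp_pos x hx).1)
  have h2 := sum_sumv n cn (fun x hx => (cn_pos x hx).1)
  have h3 := sum_stepv n dl (fun x hx => (dl_pos x hx).1)
  have h4 : (cp.map fun x => x.2.2).sum = (cn.map fun x => x.2.2).sum := by decide +kernel
  rw [h4] at h1
  have h5 : ∑ m ∈ Ioc 0 n, vonMangoldt m * ((sumv cp (n/m) : ℝ) + 1000000) ≤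
      ∑ m ∈ Ioc 0 n, vonMangoldt m * ((sumv cn (n/m) : ℝ) + stepv dl (n/m)) := by
    refine sum_le_sum fun m hm => mul_le_mul_of_nonneg_left ?_ vonMangoldt_nonneg
    rw [mem_Ioc] at hm
    exact_mod_cast ineqA (n/m) (Nat.div_pos hm.2 hm.1)
  simp only [mul_add, sum_add_distrib] at h5
  rw [← sum_mul, ← psi, h1, h2, h3] at h5
  linarith

noncomputable def rl (L : List (ℕ × ℕ × ℕ)) (f : ℕ → ℝ) : ℝ := (L.map fun x => (x.2.2 : ℝ) * f x.1).sum

lemma rl_le {L : List (ℕ × ℕ × ℕ)} {f g : ℕ → ℝ} (h : ∀ x ∈ L, f x.1 ≤ g x.1) : rl L f ≤ rl L g :=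
  List.sum_le_sum fun x hx => mul_le_mul_of_nonneg_left (h x hx) (Nat.cast_nonneg _)
lemma rl_lin (L : List (ℕ × ℕ × ℕ)) (a b : ℝ) (f g : ℕ → ℝ) :
    rl L (fun d => a * f d + b * g d) = a * rl L f + b * rl L g := by
  induction L with
  | nil => simp [rl]
  | cons x L ih => simp only [rl, List.map_cons, List.sum_cons] at ih ⊢; rw [ih]; ring

lemma ST_eq (n : ℕ) (L : List (ℕ × ℕ × ℕ)) : ST n L = rl L (fun d => d * Tf (n / d)) := by
  simp [ST, rl, mul_assoc]

lemma sumlg_eq (L : List (ℕ × ℕ × ℕ)) : (sumlg L : ℝ) / 10 ^ 15 = rl L (fun d => (lgL (d - 1) : ℝ) / 10 ^ 15) := by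
  induction L with
  | nil => simp [rl, sumlg]
  | cons x L ih =>
    have e : sumlg (x :: L) = sumlg L + x.2.2 * lgL (x.1 - 1) := rfl
    rw [e]; simp only [rl, List.map_cons, List.sum_cons] at ih ⊢; rw [← ih]; push_cast; ring

lemma log_lo (d : ℕ) (hd : 0 < d) : (lgL (d - 1) : ℝ) / 10 ^ 15 ≤ Real.log d := by
  have := lgL_le (d - 1)
  rwa [Nat.cast_sub hd, Nat.cast_one, sub_add_cancel] at this
lemma log_hi (d : ℕ) (hd : 0 < d) : Real.log d ≤ ((lgL (d - 1) : ℝ) + 17 * (d - 1)) / 10 ^ 15 := by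
  have := le_lgL (d - 1)
  rwa [Nat.cast_sub hd, Nat.cast_one, sub_add_cancel] at this

def sumlg2 (L : List (ℕ × ℕ × ℕ)) : ℕ :=
  List.rec 0 (fun x _ r => Nat.add r (Nat.mul x.2.2 (Nat.mul x.1 (lgL (Nat.sub x.1 1))))) L
lemma sumlg2_eq (L : List (ℕ × ℕ × ℕ)) : (sumlg2 L : ℝ) / 10 ^ 15 = rl L (fun d => d * ((lgL (d - 1) : ℝ) / 10 ^ 15)) := by
  induction L with
  | nil => simp [rl, sumlg2]
  | cons x L ih =>
    have e : sumlg2 (x :: L) = sumlg2 L + x.2.2 * (x.1 * lgL (x.1 - 1)) := rfl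
    rw [e]; simp only [rl, List.map_cons, List.sum_cons] at ih ⊢; rw [← ih]; push_cast; ring

set_option maxRecDepth 100000 in
theorem sumlg2_ok : Nat.ble (451000000 * 10 ^ 15) (sumlg2 cn + sumlg2 cp) = true := by decide +kernel
end PS
end


section
open ArithmeticFunction
namespace PS

lemma rl_congr {L : List (ℕ × ℕ × ℕ)} {f g : ℕ → ℝ} (h : ∀ x ∈ L, f x.1 = g x.1) : rl L f = rl L g :=
  le_antisymm (rl_le fun x hx => (h x hx).le) (rl_le fun x hx => (h x hx).ge)

lemma rl_one (L : List (ℕ × ℕ × ℕ)) : rl L (fun _ => 1) = ((L.map fun x => x.2.2).sum : ℕ) := by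
  induction L with
  | nil => simp [rl]
  | cons x L ih => simp only [rl, List.map_cons, List.sum_cons] at ih ⊢; rw [ih]; push_cast; ring
lemma rl_id (L : List (ℕ × ℕ × ℕ)) : rl L (fun d => d) = ((L.map fun x => x.2.2 * x.1).sum : ℕ) := by
  induction L with
  | nil => simp [rl]
  | cons x L ih => simp only [rl, List.map_cons, List.sum_cons] at ih ⊢; rw [ih]; push_cast; ring

lemma dT (n d : ℕ) (hd : 0 < d) (hdn : d ≤ n) :
    |(d:ℝ) * Tf (n / d) - n * (Real.log n - Real.log d - 1)| ≤ d * ((Real.log n - Real.log d) / 2 + 1) := by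
  have h := Tf_div_bounds n d hd hdn
  have hd0 : (0:ℝ) < d := by exact_mod_cast hd
  have hn0 : (0:ℝ) < n := by exact_mod_cast (hd.trans_le hdn)
  rw [Real.log_div hn0.ne' hd0.ne'] at h
  have e : (d:ℝ) * Tf (n / d) - n * (Real.log n - Real.log d - 1) =
    d * (Tf (n / d) - ((n:ℝ) / d * (Real.log n - Real.log d) - (n:ℝ)/d)) := by field_simp
  rw [e, abs_mul, abs_of_pos hd0]
  exact mul_le_mul_of_nonneg_left h hd0.le

lemma sums_ok : (cp.map fun x => x.2.2).sum = 2043827 ∧ (cn.map fun x => x.2.2).sum = 2043827 ∧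
  (cp.map fun x => x.2.2 * x.1).sum + (cn.map fun x => x.2.2 * x.1).sum = 106841473 := by decide +kernel

lemma psi_rec1 (n : ℕ) (hn : 200 ≤ n) : 1000000 * psi n ≤ 905476 * n +
    (106841473 * (Real.log n / 2 + 1) - 225500000) + (dl.map fun x => (x.2 : ℝ) * psi (n / x.1)).sum := by
  have h0 := psi_rec0 n
  rw [ST_eq, ST_eq] at h0
  obtain ⟨s1, s2, s3⟩ := sums_ok
  set lg : ℕ → ℝ := fun d => Real.log d with hlg
  have hP : rl cp (fun d => d * Tf (n / d)) ≤ rl cp (fun d =>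
      1 * ((n * (Real.log n - 1)) * (1:ℝ) + (-(n:ℝ)) * lg d) + 1 * ((Real.log n / 2 + 1) * (d:ℝ) + (-(1/2)) * (d * lg d))) := by
    refine rl_le fun x hx => ?_
    have := (abs_le.1 (dT n x.1 (cp_pos x hx).1 ((cp_pos x hx).2.1.trans hn))).2
    simp only [hlg]; linarith
  have hN : rl cn (fun d =>
      1 * ((n * (Real.log n - 1)) * (1:ℝ) + (-(n:ℝ)) * lg d) + (-1) * ((Real.log n / 2 + 1) * (d:ℝ) + (-(1/2)) * (d * lg d))) ≤ rl cn (fun d => d * Tf (n / d)) := by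
    refine rl_le fun x hx => ?_
    have := (abs_le.1 (dT n x.1 (cn_pos x hx).1 ((cn_pos x hx).2.1.trans hn))).1
    simp only [hlg]; linarith
  simp only [rl_lin, rl_one, rl_id] at hP hN
  rw [s1] at hP
  rw [s2] at hN
  have a1 : (sumlg cp : ℝ) / 10 ^ 15 ≤ rl cp lg := by
    rw [sumlg_eq]; exact rl_le fun x hx => log_lo _ (cp_pos x hx).1
  have a2 : rl cn lg ≤ (sumlg cn : ℝ) / 10 ^ 15 + 1 := by
    have : rl cn lg ≤ rl cn (fun d => 1 * ((lgL (d - 1) : ℝ) / 10 ^ 15) + (4000 / 10 ^ 15) * 1) := by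
      refine rl_le fun x hx => ?_
      have := log_hi x.1 (cn_pos x hx).1
      have h2 : ((x.1 : ℕ):ℝ) ≤ 200 := by exact_mod_cast (cn_pos x hx).2.1
      simp only [hlg]
      refine this.trans ?_
      rw [add_div, one_mul]
      gcongr
      linarith
    rw [rl_lin, rl_one, s2, ← sumlg_eq] at this
    refine this.trans ?_
    norm_num
  have a3 := Nat.le_of_ble_eq_true sumlg_ok
  have a3' : (sumlg cn : ℝ) ≤ sumlg cp + 905475 * 10 ^ 15 := by exact_mod_cast a3
  have a4 : rl cn lg ≤ rl cp lg + 905476 := by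
    have : (sumlg cn : ℝ) / 10 ^ 15 ≤ sumlg cp / 10 ^ 15 + 905475 := by
      rw [div_add' _ _ _ (by norm_num)]; gcongr
    linarith
  have b1 : (sumlg2 cp : ℝ) / 10 ^ 15 ≤ rl cp (fun d => d * lg d) := by
    rw [sumlg2_eq]; exact rl_le fun x hx => mul_le_mul_of_nonneg_left (log_lo _ (cp_pos x hx).1) (Nat.cast_nonneg _)
  have b2 : (sumlg2 cn : ℝ) / 10 ^ 15 ≤ rl cn (fun d => d * lg d) := by
    rw [sumlg2_eq]; exact rl_le fun x hx => mul_le_mul_of_nonneg_left (log_lo _ (cn_pos x hx).1) (Nat.cast_nonneg _)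
  have b3 := Nat.le_of_ble_eq_true sumlg2_ok
  have b3' : (451000000 * 10 ^ 15 : ℝ) ≤ (sumlg2 cn : ℝ) + sumlg2 cp := by exact_mod_cast b3
  have b4 : (451000000 : ℝ) ≤ rl cp (fun d => d * lg d) + rl cn (fun d => d * lg d) := by
    have : (451000000 : ℝ) ≤ (sumlg2 cn : ℝ) / 10 ^ 15 + sumlg2 cp / 10 ^ 15 := by
      rw [← add_div, le_div_iff₀ (by norm_num)]; exact b3'
    linarith
  have s3' : (((cp.map fun x => x.2.2 * x.1).sum : ℕ) : ℝ) + ((cn.map fun x => x.2.2 * x.1).sum : ℕ) = 106841473 := by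
    exact_mod_cast s3
  have hn0 : (0:ℝ) ≤ n := Nat.cast_nonneg n
  have c1 : (n:ℝ) * rl cn lg ≤ n * (rl cp lg + 905476) := mul_le_mul_of_nonneg_left a4 hn0
  have c2 : (Real.log n / 2 + 1) * (((cp.map fun x => x.2.2 * x.1).sum : ℕ) : ℝ) + (Real.log n / 2 + 1) * (((cn.map fun x => x.2.2 * x.1).sum : ℕ):ℝ) = 106841473 * (Real.log n / 2 + 1) := by
    rw [← mul_add, s3']; ring
  linarith

/-- upper rounded `∑ Δ/s` in units of 10^-12 -/
def dsum (L : List (ℕ × ℕ)) : ℕ := (L.map fun x => (x.2 * 10 ^ 6) / x.1 + 1).sum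

def dlA : List (ℕ × ℕ) := dl.filter fun x => x.1 ≤ 100
def dlB : List (ℕ × ℕ) := dl.filter fun x => ¬ x.1 ≤ 100
lemma dl_split : dl = dlA ++ dlB := by decide +kernel
lemma dsum_ok : dsum dlA ≤ 102370000000 ∧ dsum dlB ≤ 8570000000 := by decide +kernel
lemma dlA_pos : ∀ x ∈ dlA, 0 < x.1 ∧ x.1 ≤ 100 := by decide +kernel

lemma list_bd (n : ℕ) (L : List (ℕ × ℕ)) (c : ℝ) (hc : 0 ≤ c) (hL : ∀ x ∈ L, 0 < x.1)
    (h : ∀ x ∈ L, psi (n / x.1) ≤ c * (n / x.1 : ℕ)) :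
    (L.map fun x => (x.2 : ℝ) * psi (n / x.1)).sum ≤ c * n * (dsum L / 10 ^ 6) := by
  have : c * n * (dsum L / 10 ^ 6) = (L.map fun x => c * n * ((((x.2 * 10 ^ 6) / x.1 + 1 : ℕ):ℝ) / 10 ^ 6)).sum := by
    induction L with
    | nil => simp [dsum]
    | cons x L ih =>
      have ih' := ih (fun y hy => hL y (List.mem_cons_of_mem _ hy)) (fun y hy => h y (List.mem_cons_of_mem _ hy))
      simp only [dsum, List.map_cons, List.sum_cons] at ih' ⊢
      rw [← ih']; push_cast; ring
  rw [this]
  refine List.sum_le_sum fun x hx => ?_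
  have hx0 : (0:ℝ) < x.1 := by exact_mod_cast hL x hx
  have h1 := h x hx
  have h2 : ((n / x.1 : ℕ):ℝ) ≤ n / x.1 := Nat.cast_div_le
  have h3 : (x.2 : ℝ) * 10 ^ 6 / x.1 ≤ (((x.2 * 10 ^ 6) / x.1 + 1 : ℕ):ℝ) := by
    have := (Nat.lt_floor_add_one (((x.2 * 10 ^ 6 : ℕ):ℝ) / (x.1 : ℝ))).le
    rw [Nat.floor_div_eq_div] at this
    push_cast at this ⊢; norm_num at this ⊢; exact this
  calc (x.2 : ℝ) * psi (n / x.1) ≤ x.2 * (c * (n / x.1)) := by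
        gcongr; exact h1.trans (by gcongr)
    _ = c * n * ((x.2 : ℝ) * 10 ^ 6 / x.1 / 10 ^ 6) := by field_simp
    _ ≤ _ := by gcongr

theorem psi_up (h1 : ∀ t : ℕ, t ≤ 524288 → psi t ≤ 1.04 * t)
    (h2 : ∀ t : ℕ, 5000 ≤ t → t ≤ 524288 → psi t ≤ 1.02 * t) :
    ∀ t : ℕ, 5000 ≤ t → psi t ≤ 1.02 * t := by
  intro n
  induction n using Nat.strong_induction_on with
  | _ n ih =>
    intro hn
    rcases le_or_gt n 524288 with h | h
    · exact h2 n hn h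
    have hall : ∀ t < n, psi t ≤ 1.04 * t := by
      intro t ht
      rcases le_or_gt t 524288 with h' | h'
      · exact h1 t h'
      · have := ih t ht (by omega)
        have h0 : (0:ℝ) ≤ t := Nat.cast_nonneg t
        linarith
    have hr := psi_rec1 n (by omega)
    have hA : (dlA.map fun x => (x.2 : ℝ) * psi (n / x.1)).sum ≤ 1.02 * n * (dsum dlA / 10 ^ 6) := by
      refine list_bd n dlA 1.02 (by norm_num) (fun x hx => (dlA_pos x hx).1) fun x hx => ?_
      obtain ⟨p1, p2⟩ := dlA_pos x hx
      have : 5000 ≤ n / x.1 := by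
        rw [Nat.le_div_iff_mul_le p1]; nlinarith
      rcases Nat.lt_or_ge (n / x.1) n with h' | h'
      · exact ih _ h' this
      · exfalso
        have hx1 : ∀ x ∈ dlA, 2 ≤ x.1 := by decide +kernel
        have := Nat.div_lt_self (show 0 < n by omega) (hx1 x hx)
        omega
    have hB : (dlB.map fun x => (x.2 : ℝ) * psi (n / x.1)).sum ≤ 1.04 * n * (dsum dlB / 10 ^ 6) := by
      have hx1 : ∀ x ∈ dlB, 2 ≤ x.1 := by decide +kernel
      refine list_bd n dlB 1.04 (by norm_num) (fun x hx => by have := hx1 x hx; omega) fun x hx => ?_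
      exact hall _ (Nat.div_lt_self (show 0 < n by omega) (hx1 x hx))
    rw [dl_split, List.map_append, List.sum_append] at hr
    have d1 : (dsum dlA : ℝ) ≤ 102370000000 := by exact_mod_cast dsum_ok.1
    have d2 : (dsum dlB : ℝ) ≤ 8570000000 := by exact_mod_cast dsum_ok.2
    have hn0 : (524288:ℝ) ≤ n := by exact_mod_cast h.le
    have hA' : 1.02 * (n:ℝ) * (dsum dlA / 10 ^ 6) ≤ 1.02 * n * (102370000000 / 10 ^ 6) := by gcongr
    have hB' : 1.04 * (n:ℝ) * (dsum dlB / 10 ^ 6) ≤ 1.04 * n * (8570000000 / 10 ^ 6) := by gcongr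
    have hlog : Real.log n ≤ Real.log 524288 + ((n:ℝ) / 524288 - 1) := by
      have := Real.log_le_sub_one_of_pos (show (0:ℝ) < n / 524288 by positivity)
      rw [Real.log_div (by positivity) (by norm_num)] at this
      linarith
    have hl2 : Real.log 524288 ≤ 13.1698 := by
      rw [show (524288:ℝ) = 2 ^ 19 by norm_num, Real.log_pow]
      have := Real.log_two_lt_d9
      push_cast; linarith
    have e : (n:ℝ) / 524288 = n * (1 / 524288) := by ring
    rw [e] at hlog
    norm_num at hA' hB' hlog ⊢
    linarith
end PS
end


section
open ArithmeticFunction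
namespace PS

/-- lcm check: `lcm(1..t) 1000^t ≤ 2829^t`, absorbing state 0 -/
def lcmchk (n : ℕ) : ℕ :=
  Nat.rec 1 (fun n r => force r fun l => force (Nat.div (Nat.mul l (Nat.succ n)) (Nat.gcd l (Nat.succ n))) fun l' =>
    Bool.rec 0 l' (Nat.ble (Nat.mul l' (Nat.pow 1000 (Nat.succ n))) (Nat.pow 2829 (Nat.succ n)))) n

set_option maxRecDepth 100000 in
lemma lcmchk_ok : Nat.ble 1 (lcmchk 1000) = true := by decide +kernel

lemma lcmchk_succ (n : ℕ) : lcmchk (n+1) = Bool.rec 0 (Nat.lcm (lcmchk n) (n+1)) (Nat.ble (Nat.lcm (lcmchk n) (n+1) * 1000 ^ (n+1)) (2829 ^ (n+1))) := by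
  simp only [lcmchk, force_eq]; rfl

lemma lcmchk_spec (n : ℕ) (h : 1 ≤ lcmchk n) : lcmchk n = Nat.lcmUpto n ∧
    ∀ t ≤ n, Nat.lcmUpto t * 1000 ^ t ≤ 2829 ^ t := by
  induction n with
  | zero => 
    refine ⟨by simp [lcmchk, Nat.lcmUpto], ?_⟩
    intro t ht; obtain rfl : t = 0 := by omega
    simp [Nat.lcmUpto]
  | succ n ih =>
    have hL : Nat.lcmUpto (n+1) = Nat.lcm (Nat.lcmUpto n) (n+1) := by
      unfold Nat.lcmUpto
      rw [show Icc 1 (n+1) = insert (n+1) (Icc 1 n) by ext; simp only [mem_Icc, mem_insert]; omega, Finset.lcm_insert]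
      exact Nat.lcm_comm _ _
    rw [lcmchk_succ] at h ⊢
    cases hb : Nat.ble (Nat.lcm (lcmchk n) (n+1) * 1000 ^ (n+1)) (2829 ^ (n+1)) with
    | false => rw [hb] at h; simp at h
    | true =>
      rw [hb] at h
      simp only at h ⊢
      have h1 : 1 ≤ lcmchk n := by
        rcases Nat.eq_zero_or_pos (lcmchk n) with h0 | h0
        · rw [h0] at h; simp at h
        · exact h0
      obtain ⟨i1, i2⟩ := ih h1
      refine ⟨by rw [hL, i1], ?_⟩
      intro t ht
      rcases Nat.lt_or_ge t (n+1) with h' | h'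
      · exact i2 t (by omega)
      · obtain rfl : t = n + 1 := by omega
        rw [hL, ← i1]; exact Nat.le_of_ble_eq_true hb

lemma lcmchk_ok' : 1 ≤ lcmchk 1000 := by
  generalize hg : lcmchk 1000 = g
  have := lcmchk_ok
  rw [hg] at this
  exact Nat.le_of_ble_eq_true this

lemma psi_eq (n : ℕ) : psi n = Chebyshev.psi n := by simp [psi, Chebyshev.psi]

lemma psi_small (t : ℕ) (ht : t ≤ 1000) : psi t ≤ 1.04 * t := by
  rw [psi_eq, Chebyshev.psi_eq_log_lcmUpto]
  have h := (lcmchk_spec 1000 lcmchk_ok').2 t ht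
  have h' : (Nat.lcmUpto t : ℝ) ≤ 2.829 ^ t := by
    have : (Nat.lcmUpto t : ℝ) * 1000 ^ t ≤ 2829 ^ t := by exact_mod_cast h
    have e : (2.829:ℝ) ^ t = 2829 ^ t / 1000 ^ t := by rw [← div_pow]; norm_num
    rw [e, le_div_iff₀ (by positivity)]; exact this
  have hp : (0:ℝ) < Nat.lcmUpto t := by exact_mod_cast Nat.lcmUpto_pos t
  calc Real.log (Nat.lcmUpto t) ≤ Real.log (2.829 ^ t) := Real.log_le_log hp h'
    _ = t * Real.log 2.829 := by rw [Real.log_pow]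
    _ ≤ t * 1.04 := by
      gcongr
      rw [Real.log_le_iff_le_exp (by norm_num)]
      have := Real.sum_le_exp_of_nonneg (x := 1.04) (by norm_num) 9
      refine le_trans ?_ this
      norm_num [Finset.sum_range_succ, Nat.factorial]
    _ = _ := by ring

lemma root_le (t T b : ℝ) (k : ℕ) (hk : 1 ≤ k) (hT : 0 < T) (hb : 0 ≤ b) (htT : T ≤ t) (h : T ≤ b ^ k) :
    t ^ ((k:ℝ)⁻¹) ≤ b * (t / T) := by
  have h1 : 1 ≤ t / T := by rw [le_div_iff₀ hT]; linarith
  have hk0 : (0:ℝ) < k := by exact_mod_cast hk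
  calc t ^ ((k:ℝ)⁻¹) = (T * (t / T)) ^ ((k:ℝ)⁻¹) := by congr 1; field_simp
    _ = T ^ ((k:ℝ)⁻¹) * (t / T) ^ ((k:ℝ)⁻¹) := Real.mul_rpow hT.le (by linarith)
    _ ≤ (b ^ k) ^ ((k:ℝ)⁻¹) * (t / T) ^ (1:ℝ) := by
      apply mul_le_mul
      · exact Real.rpow_le_rpow hT.le h (by positivity)
      · apply Real.rpow_le_rpow_of_exponent_le h1
        rw [inv_le_one₀ hk0]; exact_mod_cast hk
      · positivity
      · positivity
    _ = b * (t / T) := by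
      rw [Real.rpow_one, Real.pow_rpow_inv_natCast hb (by omega)]

noncomputable def th (n : ℕ) : ℝ := ∑ p ∈ Ioc 0 n with p.Prime, Real.log p

lemma th_eq (n : ℕ) : th n = Chebyshev.theta n := by simp [th, Chebyshev.theta]

lemma psi_small_real (x : ℝ) (h0 : 0 ≤ x) (hx : x ≤ 1000) : Chebyshev.psi x ≤ 1.04 * x := by
  rw [Chebyshev.psi_eq_psi_coe_floor, ← psi_eq]
  refine (psi_small _ ?_).trans ?_
  · have := Nat.floor_le h0
    exact_mod_cast this.trans hx
  · have := Nat.floor_le h0; gcongr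

lemma psi_sub_th (t : ℕ) (h1 : 1 ≤ t) (h : t ≤ 1000000) : psi t - th t ≤
    1.04 * ((t:ℝ) ^ (((2:ℕ):ℝ)⁻¹) + (t:ℝ) ^ (((3:ℕ):ℝ)⁻¹) + (t:ℝ) ^ (((5:ℕ):ℝ)⁻¹)) := by
  rw [psi_eq, th_eq]
  refine (Chebyshev.psi_sub_theta_le_psi_add_psi_add_psi t).trans ?_
  have h1' : (1:ℝ) ≤ t := by exact_mod_cast h1
  have key : ∀ k : ℕ, 2 ≤ k → Chebyshev.psi ((t:ℝ) ^ (k:ℝ)⁻¹) ≤ 1.04 * (t:ℝ) ^ (k:ℝ)⁻¹ := by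
    intro k hk
    apply psi_small_real _ (by positivity)
    calc (t:ℝ) ^ (k:ℝ)⁻¹ ≤ (t:ℝ) ^ (2:ℝ)⁻¹ := by
          apply Real.rpow_le_rpow_of_exponent_le h1'
          apply inv_anti₀ (by norm_num); exact_mod_cast hk
      _ ≤ (1000 ^ 2) ^ (2:ℝ)⁻¹ := by
          apply Real.rpow_le_rpow (by positivity) _ (by norm_num)
          have : (t:ℝ) ≤ 1000000 := by exact_mod_cast h
          linarith
      _ = 1000 := by
        have := Real.pow_rpow_inv_natCast (x := 1000) (n := 2) (by norm_num) (by norm_num)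
        exact_mod_cast this
  have k2 := key 2 le_rfl
  have k3 := key 3 (by norm_num)
  have k5 := key 5 (by norm_num)
  push_cast at k2 k3 k5 ⊢
  linarith

theorem psi_all (h1 : ∀ t : ℕ, t ≤ 5199 → th t ≤ 0.988 * t)
    (h3 : ∀ t : ℕ, t ≤ 524288 → th t ≤ t) :
    (∀ t : ℕ, 5000 ≤ t → psi t ≤ 1.02 * t) ∧ (∀ t : ℕ, psi t ≤ 1.04 * t) := by
  have a1 : ∀ t : ℕ, 1000 ≤ t → t ≤ 524288 → psi t ≤ th t + 0.04748 * t := by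
    intro t ht1 ht2
    have ht : (1000:ℝ) ≤ t := by exact_mod_cast ht1
    have := psi_sub_th t (by omega) (by omega)
    have r2 := root_le t 1000 31.63 2 (by norm_num) (by norm_num) (by norm_num) ht (by norm_num)
    have r3 := root_le t 1000 10 3 (by norm_num) (by norm_num) (by norm_num) ht (by norm_num)
    have r5 := root_le t 1000 4 5 (by norm_num) (by norm_num) (by norm_num) ht (by norm_num)
    linarith
  have a2 : ∀ t : ℕ, 5000 ≤ t → t ≤ 524288 → psi t ≤ th t + 0.0195 * t := by
    intro t ht1 ht2
    have ht : (5000:ℝ) ≤ t := by exact_mod_cast ht1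
    have := psi_sub_th t (by omega) (by omega)
    have r2 := root_le t 5000 70.72 2 (by norm_num) (by norm_num) (by norm_num) ht (by norm_num)
    have r3 := root_le t 5000 17.1 3 (by norm_num) (by norm_num) (by norm_num) ht (by norm_num)
    have r5 := root_le t 5000 5.5 5 (by norm_num) (by norm_num) (by norm_num) ht (by norm_num)
    linarith
  have b2 : ∀ t : ℕ, 5000 ≤ t → t ≤ 524288 → psi t ≤ 1.02 * t := by
    intro t ht1 ht2
    have := a2 t ht1 ht2
    have := h3 t ht2
    linarith
  have b1 : ∀ t : ℕ, t ≤ 524288 → psi t ≤ 1.04 * t := by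
    intro t ht2
    have h0 : (0:ℝ) ≤ t := Nat.cast_nonneg t
    rcases le_or_gt t 1000 with h | h
    · exact psi_small t h
    rcases le_or_gt t 5199 with h' | h'
    · have := a1 t h.le ht2
      have := h1 t h'
      linarith
    · have := b2 t (by omega) ht2
      linarith
  have c := psi_up b1 b2
  refine ⟨c, fun t => ?_⟩
  rcases le_or_gt t 524288 with h | h
  · exact b1 t h
  · have := c t (by omega)
    have h0 : (0:ℝ) ≤ t := Nat.cast_nonneg t
    linarith

lemma th_le_psi (t : ℕ) : th t ≤ psi t := by rw [psi_eq, th_eq]; exact Chebyshev.theta_le_psi _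

lemma psi_low (n : ℕ) (hn : 30 ≤ n) : 0.9212 * n - 5 * (Real.log n / 2 + 1) ≤ psi n := by
  have e : Tf n - Tf (n/2) - Tf (n/3) - Tf (n/5) + Tf (n/30) ≤ psi n := by
    rw [Tf_eq n, Tf_div n 2 (by norm_num), Tf_div n 3 (by norm_num), Tf_div n 5 (by norm_num), Tf_div n 30 (by norm_num),
      ← sum_sub_distrib, ← sum_sub_distrib, ← sum_sub_distrib, ← sum_add_distrib, psi]
    refine sum_le_sum fun m hm => ?_
    have : (((n/m:ℕ):ℝ) - ((n/m/2:ℕ):ℝ) - ((n/m/3:ℕ):ℝ) - ((n/m/5:ℕ):ℝ) + ((n/m/30:ℕ):ℝ)) ≤ 1 := by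
      have : (n/m) + (n/m/30) ≤ 1 + (n/m/2) + (n/m/3) + (n/m/5) := by omega
      have : ((n/m:ℕ):ℝ) + ((n/m/30:ℕ):ℝ) ≤ 1 + ((n/m/2:ℕ):ℝ) + ((n/m/3:ℕ):ℝ) + ((n/m/5:ℕ):ℝ) := by exact_mod_cast this
      linarith
    have h := mul_le_mul_of_nonneg_left this (vonMangoldt_nonneg (n := m))
    linarith
  have d1 := (abs_le.1 (dT n 1 (by norm_num) (by omega))).1
  have d2 := (abs_le.1 (dT n 2 (by norm_num) (by omega))).2
  have d3 := (abs_le.1 (dT n 3 (by norm_num) (by omega))).2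
  have d5 := (abs_le.1 (dT n 5 (by norm_num) (by omega))).2
  have d30 := (abs_le.1 (dT n 30 (by norm_num) (by omega))).1
  push_cast at d1 d2 d3 d5 d30
  rw [Nat.div_one, Real.log_one] at d1
  have l30 : Real.log 30 = Real.log 2 + Real.log 3 + Real.log 5 := by
    rw [← Real.log_mul (by norm_num) (by norm_num), ← Real.log_mul (by norm_num) (by norm_num)]; norm_num
  have l2 : (0.693147 : ℝ) ≤ Real.log 2 := by have := Real.log_two_gt_d9; linarith
  have l3 : (1.0986 : ℝ) ≤ Real.log 3 := by
    have := log_lo 3 (by norm_num)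
    refine le_trans ?_ this
    have : 1098600000000000 ≤ lgL (3 - 1) := by decide +kernel
    have : (1098600000000000:ℝ) ≤ lgL (3-1) := by exact_mod_cast this
    rw [le_div_iff₀ (by norm_num)]; linarith
  have l5 : (1.6094 : ℝ) ≤ Real.log 5 := by
    have := log_lo 5 (by norm_num)
    refine le_trans ?_ this
    have : 1609400000000000 ≤ lgL (5 - 1) := by decide +kernel
    have : (1609400000000000:ℝ) ≤ lgL (5-1) := by exact_mod_cast this
    rw [le_div_iff₀ (by norm_num)]; linarith
  have hn0 : (0:ℝ) ≤ n := Nat.cast_nonneg n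
  have hc : (0.9212:ℝ) ≤ Real.log 2 / 2 + Real.log 3 / 3 + Real.log 5 / 5 - Real.log 30 / 30 := by
    rw [l30]; linarith
  have := mul_le_mul_of_nonneg_right hc hn0
  have l30' : 0 ≤ Real.log 30 := Real.log_nonneg (by norm_num)
  have hln : 0 ≤ Real.log n := Real.log_nonneg (by exact_mod_cast (show 1 ≤ n by omega))
  linarith

theorem th_low (hpsi : ∀ t : ℕ, psi t ≤ 1.04 * t) (n : ℕ) (hn : 524288 ≤ n) : 0.919 * n ≤ th n := by
  have hn' : (524288:ℝ) ≤ n := by exact_mod_cast hn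
  have key : ∀ k : ℕ, Chebyshev.psi ((n:ℝ) ^ (k:ℝ)⁻¹) ≤ 1.04 * (n:ℝ) ^ (k:ℝ)⁻¹ := by
    intro k
    rw [Chebyshev.psi_eq_psi_coe_floor, ← psi_eq]
    refine (hpsi _).trans ?_
    have := Nat.floor_le (show 0 ≤ (n:ℝ) ^ (k:ℝ)⁻¹ by positivity); gcongr
  have h := Chebyshev.psi_sub_theta_le_psi_add_psi_add_psi n
  rw [← psi_eq, ← th_eq] at h
  have k2 := key 2
  have k3 := key 3
  have k5 := key 5
  have r2 := root_le n 524288 724.1 2 (by norm_num) (by norm_num) (by norm_num) hn' (by norm_num)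
  have r3 := root_le n 524288 80.7 3 (by norm_num) (by norm_num) (by norm_num) hn' (by norm_num)
  have r5 := root_le n 524288 14 5 (by norm_num) (by norm_num) (by norm_num) hn' (by norm_num)
  have hl := psi_low n (by omega)
  have hlog : Real.log n ≤ Real.log 524288 + ((n:ℝ) / 524288 - 1) := by
    have := Real.log_le_sub_one_of_pos (show (0:ℝ) < n / 524288 by positivity)
    rw [Real.log_div (by positivity) (by norm_num)] at this
    linarith
  have hl2 : Real.log 524288 ≤ 13.1698 := by
    rw [show (524288:ℝ) = 2 ^ 19 by norm_num, Real.log_pow]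
    have := Real.log_two_lt_d9
    push_cast; linarith
  push_cast at k2 k3 k5 r2 r3 r5
  linarith
end PS
end


section
namespace PS

/-- product of the primes below 1000 -/
def prim : ℕ := 19590340644999083431262508198206381046123972390589368223882605328968666316379870661851951648789482321596229559115436019149189529725215266728292282990852649023362731392404017939142010958261393634959471483757196721672243410067118516227661133135192488848989914892157188308679896875137439519338903968094905549750386407106033836586660683539201011635917900039904495065203299749542985993134669814805318474080581207891125910
/-- segment constants (units 1e-5), packed in 20 bit digits: c, tau, slo, shi -/
def prm (n : ℕ) : ℕ := Bool.rec (Bool.rec (Bool.rec (Bool.rec (Bool.rec (Bool.rec (Bool.rec (Bool.rec (Bool.rec (Bool.rec (Bool.rec (Bool.rec (Bool.rec (Bool.rec (Bool.rec (115226543666189613144921) 115212707709833373032190 (Nat.ble n 524288)) 114700809601914540925133 (Nat.ble n 23910)) 114247710752414549156519 (Nat.ble n 7999)) 113879927935925698438176 (Nat.ble n 5199)) 113726588933809432962884 (Nat.ble n 2980)) 113523672840246504991776 (Nat.ble n 1999)) 113136291448895282621955 (Nat.ble n 1399)) 111812736528066548871089 (Nat.ble n 999)) 111695136457619236992038 (Nat.ble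 n 723)) 111042582180126459443615 (Nat.ble n 511)) 110544518444167257409055 (Nat.ble n 366)) 109246325700770569145765 (Nat.ble n 239)) 106675308588257718061163 (Nat.ble n 190)) 105043923901676834016901 (Nat.ble n 148)) 109242865631143805347349 (Nat.ble n 126)

/-- guard -/
def gd (b : Bool) (x : ℕ) : ℕ := Bool.rec 0 x b
lemma gd_ne {b : Bool} {x : ℕ} (h : gd b x ≠ 0) : b = true ∧ gd b x = x := by
  cases b
  · exact absurd rfl h
  · exact ⟨rfl, rfl⟩

def dlg (g s : ℕ) : ℕ := Nat.add (Nat.add (Nat.div (Nat.mul 2000000000 g) s)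
  (Nat.div (Nat.mul 2000000000 (Nat.pow g 3)) (Nat.mul 3 (Nat.pow s 3))))
  (Nat.div (Nat.mul 2000000000 (Nat.pow g 5)) (Nat.mul 5 (Nat.pow s 5)))

def pak (k P L T S : ℕ) : ℕ := Nat.add (Nat.mul (Nat.add (Nat.mul (Nat.add (Nat.mul (Nat.add (Nat.mul k 18446744073709551616) P) 18446744073709551616) L) 18446744073709551616) T) 18446744073709551616) S

def nw3 (n k L T S T' S' r : ℕ) : ℕ :=
  gd (Nat.ble (Nat.add T' (Nat.mul 9 (Nat.pow k 2))) (Nat.mul (Nat.mul 10000 n) (Nat.div r 1152921504606846976)))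
  (gd (Nat.ble (Nat.mul (Nat.mul 10000 n) (Nat.mod (Nat.div r 1099511627776) 1048576)) T)
  (gd (Nat.ble (Nat.add (Nat.add L (Nat.mul 9 k)) (Nat.mul 10000 (Nat.mod (Nat.div r 1048576) 1048576))) (Nat.add S 1400000000))
  (gd (Nat.ble (Nat.add (Nat.add S' (Nat.mul 10 k)) 1400000000) (Nat.add L (Nat.mul 10000 (Nat.mod r 1048576))))
   (gd (Nat.ble S' 18446744073709551615) (gd (Nat.ble T' 18446744073709551615) (gd (Nat.ble L 18446744073709551615) (gd (Nat.ble n 18446744073709551615) (pak k n L T' S'))))))))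

def nw2 (n k P L T S : ℕ) : ℕ :=
  gd (Nat.ble (Nat.mul 50 (Nat.sub n P)) (Nat.mul 3 (Nat.add n P)))
   (force (Nat.add L (dlg (Nat.sub n P) (Nat.add n P))) fun L' =>
    force (Nat.succ k) fun k' => force (Nat.add T L') fun T' => force (Nat.add S (Nat.div L' n)) fun S' =>
    force (prm n) fun r => nw3 n k' L' T S T' S' r)

def nw (n S : ℕ) : ℕ :=
  force (Nat.div S 115792089237316195423570985008687907853269984665640564039457584007913129639936) fun k =>
  force (Nat.mod (Nat.div S 6277101735386680763835789423207666416102355444464034512896) 18446744073709551616) fun P =>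
  force (Nat.mod (Nat.div S 340282366920938463463374607431768211456) 18446744073709551616) fun L =>
  force (Nat.mod (Nat.div S 18446744073709551616) 18446744073709551616) fun T =>
  force (Nat.mod S 18446744073709551616) fun S => nw2 n k P L T S

def stp (pr j S : ℕ) : ℕ := force (Nat.succ (Nat.mul 2 j)) fun n => Bool.rec S (nw n S) (Nat.beq (Nat.gcd n pr) 1)

def run (step : ℕ → ℕ → ℕ) (d : ℕ) : ℕ → ℕ → ℕ :=
  Nat.rec (fun lo S => step lo S) (fun d r lo S => force (r lo S) (fun S1 => force (Nat.add lo (Nat.pow 2 d)) (fun lo1 => r lo1 S1))) d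

set_option maxRecDepth 100000
theorem run_0 : run (stp 200560490130) 9 51 3010594320170221081646832885501510805464223348804199144363563390922670902036686 = 21768912776615444746680530430474959235462306785952990208890338471584258136430568 := by decide +kernel
theorem run_1 : run (stp prim) 18 563 21768912776615444746680530430474959235462306785952990208890338471584258136430568 = 5033945287503084283142370747955483141628010442166808716191202449784887124995675383 := by decide +kernel
theorem run_2 : run (stp prim) 17 262707 5033945287503084283142370747955483141628010442166808716191202449784887124995675383 = 7298028008360327853904921112541151663678012464394579318194538145139877104333023314 := by decide +kernel
theorem run_3 : run (stp prim) 16 393779 7298028008360327853904921112541151663678012464394579318194538145139877104333023314 = 8410558401752461860357305752554815835707204291492633412245504695884911870766638099 := by decide +kernel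
theorem run_4 : run (stp prim) 15 459315 8410558401752461860357305752554815835707204291492633412245504695884911870766638099 = 8957676023398780884145054796051167734301510954000429669670843144118203125319471700 := by decide +kernel
theorem run_5 : run (stp prim) 13 492083 8957676023398780884145054796051167734301510954000429669670843144118203125319471700 = 9094426480788051311043224043603298950264502433692554157166622839803327381164051793 := by decide +kernel
end PS
end


section
namespace PS

/-- sum of log p / p -/
noncomputable def sg (n : ℕ) : ℝ := ∑ p ∈ Ioc 0 n with p.Prime, Real.log p / p

lemma th_succ (n : ℕ) : th (n+1) = th n + if (n+1).Prime then Real.log ((n+1 : ℕ) : ℝ) else 0 := by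
  unfold th
  rw [sum_filter, sum_filter, ← Finset.insert_Ioc_right_eq_Ioc_add_one (Nat.zero_le n), sum_insert (by simp)]; ring
lemma sg_succ (n : ℕ) : sg (n+1) = sg n + if (n+1).Prime then Real.log ((n+1 : ℕ) : ℝ) / ((n+1 : ℕ) : ℝ) else 0 := by
  unfold sg
  rw [sum_filter, sum_filter, ← Finset.insert_Ioc_right_eq_Ioc_add_one (Nat.zero_le n), sum_insert (by simp)]; ring

lemma th_gap (P n : ℕ) (hPn : P ≤ n) (h : ∀ p, p.Prime → P < p → n < p) : th n = th P ∧ sg n = sg P := by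
  induction n, hPn using Nat.le_induction with
  | base => exact ⟨rfl, rfl⟩
  | succ n hn ih =>
    have hp : ¬ (n+1).Prime := fun hp => absurd (h _ hp (by omega)) (by omega)
    rw [th_succ, sg_succ, if_neg hp, if_neg hp, add_zero, add_zero]
    exact ih fun p hp h1 => by have := h p hp h1; omega

/-- facts recorded for a prime -/
def Good (n : ℕ) : Prop :=
  th n ≤ ((prm n / 1152921504606846976 : ℕ) : ℝ) / 10 ^ 5 * n ∧
  ((prm n / 1099511627776 % 1048576 : ℕ) : ℝ) / 10 ^ 5 * n ≤ th (n-1) ∧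
  Real.log n + ((prm n / 1048576 % 1048576 : ℕ) : ℝ) / 10 ^ 5 ≤ sg (n-1) + 1.4 ∧
  sg n + 1.4 ≤ Real.log n + ((prm n % 1048576 : ℕ) : ℝ) / 10 ^ 5

def Inv (lo S : ℕ) : Prop := ∃ k P L T U : ℕ, S = pak k P L T U ∧ P ≤ 18446744073709551615 ∧ L ≤ 18446744073709551615 ∧
  T ≤ 18446744073709551615 ∧ U ≤ 18446744073709551615 ∧ P.Prime ∧ P < 2 * lo ∧ (∀ p, p.Prime → P < p → 2 * lo ≤ p) ∧ 1 ≤ k ∧ k ≤ P ∧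
  (L : ℝ) / 10 ^ 9 ≤ Real.log P ∧ Real.log P ≤ (L + 9 * k) / 10 ^ 9 ∧
  (T : ℝ) / 10 ^ 9 ≤ th P ∧ th P ≤ (T + 9 * k ^ 2) / 10 ^ 9 ∧
  (U : ℝ) / 10 ^ 9 ≤ sg P ∧ sg P ≤ (U + 10 * k) / 10 ^ 9

lemma dlg_eq (g s : ℕ) : dlg g s = 2000000000 * g / s + 2000000000 * g ^ 3 / (3 * s ^ 3) + 2000000000 * g ^ 5 / (5 * s ^ 5) := rfl

lemma dlg_bd (P n : ℕ) (hP : 1 ≤ P) (hPn : P < n) (hz : 50 * (n - P) ≤ 3 * (n + P)) :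
    (dlg (n - P) (n + P) : ℝ) / 10 ^ 9 ≤ Real.log n - Real.log P ∧
    Real.log n - Real.log P ≤ (dlg (n - P) (n + P) + 9) / 10 ^ 9 := by
  have hP0 : (0:ℝ) < P := by exact_mod_cast hP
  have hn0 : (P:ℝ) < n := by exact_mod_cast hPn
  set g := n - P with hg
  set s := n + P with hs
  have hgr : (g:ℝ) = n - P := by rw [hg, Nat.cast_sub hPn.le]
  have hsr : (s:ℝ) = n + P := by rw [hs]; push_cast; ring
  have hs0 : (0:ℝ) < s := by rw [hsr]; linarith
  set z : ℝ := g / s with hzd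
  have hz0 : 0 ≤ z := by positivity
  have hz3 : z ≤ 3 / 50 := by
    rw [hzd, div_le_div_iff₀ hs0 (by norm_num)]
    have : (50:ℝ) * g ≤ 3 * s := by exact_mod_cast hz
    linarith
  have hl : Real.log ((1 + z) / (1 - z)) = Real.log n - Real.log P := by
    rw [← Real.log_div (by linarith) (by positivity)]
    congr 1
    have h1 : (1 - z) = 2 * P / s := by rw [hzd]; field_simp; rw [hgr, hsr]; ring
    have h2 : (1 + z) = 2 * n / s := by rw [hzd]; field_simp; rw [hgr, hsr]; ring
    rw [h1, h2]; field_simp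
  have h1 := Real.sum_range_le_log_div hz0 (by linarith) 3
  have h2 := Real.log_div_le_sum_range_add hz0 (by linarith) 3
  rw [hl] at h1 h2
  simp only [sum_range_succ, sum_range_zero] at h1 h2
  norm_num at h1 h2
  have e1 : z * 2000000000 = ((2000000000 * g : ℕ) : ℝ) / (s : ℕ) := by rw [hzd]; push_cast; ring
  have e3 : z ^ 3 / 3 * 2000000000 = ((2000000000 * g ^ 3 : ℕ) : ℝ) / (3 * s ^ 3 : ℕ) := by rw [hzd]; push_cast; field_simp
  have e5 : z ^ 5 / 5 * 2000000000 = ((2000000000 * g ^ 5 : ℕ) : ℝ) / (5 * s ^ 5 : ℕ) := by rw [hzd]; push_cast; field_simp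
  have key : ∀ a b : ℕ, ((a / b : ℕ) : ℝ) ≤ (a:ℝ) / b ∧ (a:ℝ) / b ≤ ((a / b : ℕ) : ℝ) + 1 := by
    intro a b
    refine ⟨Nat.cast_div_le, ?_⟩
    rw [← Nat.floor_div_eq_div (K := ℝ)]
    exact (Nat.lt_floor_add_one _).le
  have k1 := key (2000000000 * g) s
  have k3 := key (2000000000 * g ^ 3) (3 * s ^ 3)
  have k5 := key (2000000000 * g ^ 5) (5 * s ^ 5)
  rw [← e1] at k1
  rw [← e3] at k3
  rw [← e5] at k5
  have hr : z ^ 7 / (1 - z ^ 2) * (2 * 10 ^ 9) ≤ 6 := by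
    have a : z ^ 7 ≤ (3/50) ^ 7 := by gcongr
    have b : (1 - (3/50)^2 : ℝ) ≤ 1 - z ^ 2 := by nlinarith
    calc z ^ 7 / (1 - z ^ 2) * (2 * 10 ^ 9) ≤ (3/50) ^ 7 / (1 - (3/50)^2) * (2 * 10 ^ 9) := by
          gcongr
      _ ≤ 6 := by norm_num
  rw [dlg_eq]; 
  rw [Nat.cast_add, Nat.cast_add]
  constructor
  · rw [div_le_iff₀ (by positivity)]; linarith
  · rw [le_div_iff₀ (by positivity)]; linarith

lemma pak_eq (k P L T S : ℕ) : pak k P L T S = (((k * 18446744073709551616 + P) * 18446744073709551616 + L) * 18446744073709551616 + T) * 18446744073709551616 + S := rfl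

lemma nw_pak (n k P L T U : ℕ) (hP : P ≤ 18446744073709551615) (hL : L ≤ 18446744073709551615)
    (hT : T ≤ 18446744073709551615) (hU : U ≤ 18446744073709551615) : nw n (pak k P L T U) = nw2 n k P L T U := by
  unfold nw
  simp only [force_eq]
  rw [pak_eq]
  change nw2 n (_ / _) (_ / _ % _) (_ / _ % _) (_ / _ % _) (_ % _) = _
  congr 1 <;> omega

lemma nw_spec (n k P L T U : ℕ) (hk : 1 ≤ k) (hkP : k ≤ P) (hP : P.Prime) (hPn : P < n) (hn : n.Prime)
    (hg : ∀ p, p.Prime → P < p → n ≤ p)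
    (i1 : (L : ℝ) / 10 ^ 9 ≤ Real.log P) (i2 : Real.log P ≤ (L + 9 * k) / 10 ^ 9)
    (i3 : (T : ℝ) / 10 ^ 9 ≤ th P) (i4 : th P ≤ (T + 9 * k ^ 2) / 10 ^ 9)
    (i5 : (U : ℝ) / 10 ^ 9 ≤ sg P) (i6 : sg P ≤ (U + 10 * k) / 10 ^ 9)
    (h : nw2 n k P L T U ≠ 0) (lo : ℕ) (hlo : n = 2 * lo + 1) : Good n ∧ Inv (lo + 1) (nw2 n k P L T U) := by
  unfold nw2 at h ⊢
  simp only [force_eq] at h ⊢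
  obtain ⟨c1, d1⟩ := gd_ne h
  rw [d1] at h ⊢
  have hz : 50 * (n - P) ≤ 3 * (n + P) := Nat.le_of_ble_eq_true c1
  obtain ⟨l1, l2⟩ := dlg_bd P n hP.one_le hPn hz
  unfold nw3 at h ⊢
  generalize hL' : Nat.add L (dlg (Nat.sub n P) (Nat.add n P)) = L' at h ⊢
  have hL'' : (L' : ℝ) = L + dlg (n - P) (n + P) := by
    rw [← hL']; exact Nat.cast_add _ _
  generalize hk' : Nat.succ k = k' at h ⊢
  generalize hT' : Nat.add T L' = T' at h ⊢
  generalize hU' : Nat.add U (Nat.div L' n) = U' at h ⊢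
  obtain ⟨c2, d2⟩ := gd_ne h
  rw [d2] at h ⊢
  obtain ⟨c3, d3⟩ := gd_ne h
  rw [d3] at h ⊢
  obtain ⟨c4, d4⟩ := gd_ne h
  rw [d4] at h ⊢
  obtain ⟨c5, d5⟩ := gd_ne h
  rw [d5] at h ⊢
  obtain ⟨c6, d6⟩ := gd_ne h
  rw [d6] at h ⊢
  obtain ⟨c7, d7⟩ := gd_ne h
  rw [d7] at h ⊢
  obtain ⟨c8, d8⟩ := gd_ne h
  rw [d8] at h ⊢
  obtain ⟨c9, d9⟩ := gd_ne h
  rw [d9] at h ⊢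
  have hk2 : (k' : ℝ) = k + 1 := by rw [← hk']; push_cast; ring
  have hT2 : (T' : ℝ) = T + L' := by rw [← hT']; exact Nat.cast_add _ _
  have hU2 : (U' : ℝ) = U + (L' / n : ℕ) := by rw [← hU']; exact Nat.cast_add _ _
  have hk1 : (1:ℝ) ≤ k := by exact_mod_cast hk
  have hn1 : (1:ℝ) ≤ n := by exact_mod_cast hn.one_le
  obtain ⟨g1, g2⟩ := th_gap P (n-1) (by omega) fun p hp h1 => by have := hg p hp h1; have := hn.two_le; omega
  have e1 : th n = th P + Real.log n := by
    have := th_succ (n-1)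
    rw [show n - 1 + 1 = n by have := hn.two_le; omega, if_pos hn, g1] at this
    exact this
  have e2 : sg n = sg P + Real.log n / n := by
    have := sg_succ (n-1)
    rw [show n - 1 + 1 = n by have := hn.two_le; omega, if_pos hn, g2] at this
    exact this
  have j1 : (L' : ℝ) / 10 ^ 9 ≤ Real.log n := by rw [hL'', add_div]; linarith
  have j2 : Real.log n ≤ (L' + 9 * k') / 10 ^ 9 := by
    rw [hL'', hk2]; 
    have : ((L:ℝ) + dlg (n - P) (n + P) + 9 * (k + 1)) / 10 ^ 9 = (L + 9 * k) / 10 ^ 9 + (dlg (n - P) (n + P) + 9) / 10 ^ 9 := by ring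
    linarith
  have j3 : (T' : ℝ) / 10 ^ 9 ≤ th n := by rw [hT2, add_div, e1]; linarith
  have j4 : th n ≤ (T' + 9 * k' ^ 2) / 10 ^ 9 := by
    rw [e1, hT2]
    have : ((T:ℝ) + L' + 9 * k' ^ 2) / 10 ^ 9 - (T + 9 * k ^ 2) / 10 ^ 9 - (L' + 9 * k') / 10 ^ 9 = 9 * k / 10 ^ 9 := by
      rw [hk2]; ring
    have : 0 ≤ 9 * (k:ℝ) / 10 ^ 9 := by positivity
    linarith
  have f1 : ((L' / n : ℕ) : ℝ) ≤ (L' : ℝ) / n := Nat.cast_div_le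
  have f2 : (L' : ℝ) / n ≤ ((L' / n : ℕ) : ℝ) + 1 := by
    rw [← Nat.floor_div_eq_div (K := ℝ)]
    exact (Nat.lt_floor_add_one _).le
  have j5 : (U' : ℝ) / 10 ^ 9 ≤ sg n := by
    rw [e2, hU2, add_div]
    have : ((L' / n : ℕ) : ℝ) / 10 ^ 9 ≤ Real.log n / n := by
      calc ((L' / n : ℕ) : ℝ) / 10 ^ 9 ≤ ((L':ℝ) / n) / 10 ^ 9 := by gcongr
        _ = (L':ℝ) / 10 ^ 9 / n := by ring
        _ ≤ _ := by gcongr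
    linarith
  have j6 : sg n ≤ (U' + 10 * k') / 10 ^ 9 := by
    rw [e2, hU2]
    have : Real.log n / n ≤ (((L' / n : ℕ) : ℝ) + 1 + 9 * k' / n) / 10 ^ 9 := by
      calc Real.log n / n ≤ ((L' + 9 * k') / 10 ^ 9) / n := by gcongr
        _ = (L' / n + 9 * k' / n) / 10 ^ 9 := by field_simp
        _ ≤ _ := by gcongr
    have h9 : 9 * (k':ℝ) / n ≤ 9 := by
      rw [div_le_iff₀ (by linarith)]
      have : (k':ℝ) ≤ n := by exact_mod_cast (by omega : k' ≤ n)
      linarith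
    have : (((L' / n : ℕ) : ℝ) + 1 + 9 * k' / n) / 10 ^ 9 ≤ (((L' / n : ℕ) : ℝ) + 10) / 10 ^ 9 := by
      gcongr ?_ / _; linarith
    have : ((U:ℝ) + (L' / n : ℕ) + 10 * k') / 10 ^ 9 = (U + 10 * k) / 10 ^ 9 + (((L' / n : ℕ) : ℝ) + 10) / 10 ^ 9 := by
      rw [hk2]; ring
    linarith
  refine ⟨⟨?_, ?_, ?_, ?_⟩, k', n, L', T', U', rfl, Nat.le_of_ble_eq_true c9, Nat.le_of_ble_eq_true c8, Nat.le_of_ble_eq_true c7,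
    Nat.le_of_ble_eq_true c6, hn, by omega, ?_, by omega, by omega, j1, j2, j3, j4, j5, j6⟩
  · have : T' + 9 * k' ^ 2 ≤ 10000 * n * (prm n / 1152921504606846976) := Nat.le_of_ble_eq_true c2
    have : (T':ℝ) + 9 * k' ^ 2 ≤ 10000 * n * (prm n / 1152921504606846976 : ℕ) := by exact_mod_cast this
    linarith
  · have : 10000 * n * (prm n / 1099511627776 % 1048576) ≤ T := Nat.le_of_ble_eq_true c3
    have : 10000 * (n:ℝ) * (prm n / 1099511627776 % 1048576 : ℕ) ≤ T := by exact_mod_cast this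
    rw [g1]; linarith
  · have : L' + 9 * k' + 10000 * (prm n / 1048576 % 1048576) ≤ U + 1400000000 := Nat.le_of_ble_eq_true c4
    have : (L':ℝ) + 9 * k' + 10000 * (prm n / 1048576 % 1048576 : ℕ) ≤ U + 1400000000 := by exact_mod_cast this
    rw [g2]; linarith
  · have : U' + 10 * k' + 1400000000 ≤ L' + 10000 * (prm n % 1048576) := Nat.le_of_ble_eq_true c5
    have : (U':ℝ) + 10 * k' + 1400000000 ≤ L' + 10000 * (prm n % 1048576 : ℕ) := by exact_mod_cast this
    linarith
  · intro p hp hpn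
    omega

/-- soundness of a primality filter on an interval -/
def PrOk (pr lo hi : ℕ) : Prop := ∀ j, lo ≤ j → j < hi → (Nat.gcd (2*j+1) pr = 1 ↔ (2*j+1).Prime)

lemma stp_eq (pr j S : ℕ) : stp pr j S = Bool.rec S (nw (2*j+1) S) (Nat.beq (Nat.gcd (2*j+1) pr) 1) := by
  simp only [stp, force_eq]; rfl

lemma nw2_zero (n L T U : ℕ) (hn : 1 ≤ n) : nw2 n 0 0 L T U = 0 := by
  unfold nw2
  have : Nat.ble (Nat.mul 50 (Nat.sub n 0)) (Nat.mul 3 (Nat.add n 0)) = false := by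
    rw [Bool.eq_false_iff, ne_eq, Nat.ble_eq]
    change ¬ (50 * (n - 0) ≤ 3 * (n + 0)); omega
  rw [this]; rfl

lemma stp_zero (pr j : ℕ) : stp pr j 0 = 0 := by
  rw [stp_eq]
  have : nw (2*j+1) 0 = 0 := by
    have := nw_pak (2*j+1) 0 0 0 0 0 (by norm_num) (by norm_num) (by norm_num) (by norm_num)
    rw [nw2_zero _ _ _ _ (by omega)] at this
    exact this
  rw [this]
  cases Nat.beq (Nat.gcd (2*j+1) pr) 1 <;> rfl

lemma run_succ (step : ℕ → ℕ → ℕ) (d lo S : ℕ) : run step (d+1) lo S = run step d (lo + 2 ^ d) (run step d lo S) := by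
  simp only [run, force_eq]; rfl

lemma stp_spec (pr lo S : ℕ) (hlo : 51 ≤ lo) (hp : PrOk pr lo (lo+1)) (hI : Inv lo S) (h : stp pr lo S ≠ 0) :
    Inv (lo+1) (stp pr lo S) ∧ ((2*lo+1).Prime → Good (2*lo+1)) := by
  obtain ⟨k, P, L, T, U, rfl, b1, b2, b3, b4, hP, hPl, hg, hk, hkP, i1, i2, i3, i4, i5, i6⟩ := hI
  rw [stp_eq] at h ⊢
  have hq := hp lo le_rfl (by omega)
  have heven : ¬ (2 * lo).Prime := by
    intro hh
    have := hh.eq_one_or_self_of_dvd 2 ⟨lo, rfl⟩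
    omega
  cases hb : Nat.beq (Nat.gcd (2*lo+1) pr) 1 with
  | false =>
    have hnp : ¬ (2*lo+1).Prime := by
      intro hh
      have h1 := hq.2 hh
      rw [h1] at hb
      simp at hb
    simp only
    refine ⟨⟨k, P, L, T, U, rfl, b1, b2, b3, b4, hP, by omega, ?_, hk, hkP, i1, i2, i3, i4, i5, i6⟩, fun hh => absurd hh hnp⟩
    intro p hp hpP
    have h1 := hg p hp hpP
    rcases Nat.lt_or_ge p (2 * lo + 2) with h2 | h2
    · have : p = 2 * lo ∨ p = 2 * lo + 1 := by omega
      rcases this with rfl | rfl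
      · exact absurd hp heven
      · exact absurd hp hnp
    · omega
  | true =>
    have hpp : (2*lo+1).Prime := hq.1 (Nat.eq_of_beq_eq_true hb)
    rw [hb] at h
    simp only at h ⊢
    rw [nw_pak _ _ _ _ _ _ b1 b2 b3 b4] at h ⊢
    have := nw_spec (2*lo+1) k P L T U hk hkP hP (by omega) hpp (fun p hp h1 => by
      have h2 := hg p hp h1
      rcases Nat.lt_or_ge p (2 * lo + 1) with h3 | h3
      · obtain rfl : p = 2 * lo := by omega
        exact absurd hp heven
      · exact h3) i1 i2 i3 i4 i5 i6 h lo rfl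
    exact ⟨this.2, fun _ => this.1⟩

lemma run_zero (pr d : ℕ) : ∀ lo, run (stp pr) d lo 0 = 0 := by
  induction d with
  | zero => intro lo; exact stp_zero pr lo
  | succ d ih => intro lo; rw [run_succ, ih, ih]

lemma run_spec (pr d : ℕ) : ∀ lo S, 51 ≤ lo → PrOk pr lo (lo+2^d) → Inv lo S → run (stp pr) d lo S ≠ 0 →
    Inv (lo+2^d) (run (stp pr) d lo S) ∧ ∀ n, n.Prime → 2*lo ≤ n → n < 2*(lo+2^d) → Good n := by
  induction d with
  | zero =>
    intro lo S hlo hp hI h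
    have := stp_spec pr lo S hlo hp hI h
    refine ⟨this.1, ?_⟩
    intro n hn h1 h2
    rcases Nat.lt_or_ge (2*lo) n with h3 | h3
    · obtain rfl : n = 2 * lo + 1 := by omega
      exact this.2 hn
    · obtain rfl : n = 2 * lo := by omega
      have := hn.eq_one_or_self_of_dvd 2 ⟨lo, rfl⟩
      omega
  | succ d ih =>
    intro lo S hlo hp hI h
    rw [run_succ] at h ⊢
    have e : lo + 2 ^ (d+1) = lo + 2 ^ d + 2 ^ d := by rw [pow_succ]; ring
    rw [e] at hp ⊢
    have h1 : run (stp pr) d lo S ≠ 0 := by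
      intro h0; rw [h0, run_zero] at h; exact h rfl
    obtain ⟨a1, a2⟩ := ih lo S hlo (fun j h1 h2 => hp j h1 (by omega)) hI h1
    obtain ⟨c1, c2⟩ := ih (lo + 2 ^ d) _ (le_trans hlo (Nat.le_add_right _ _)) (fun j h1 h2 => hp j (by omega) h2) a1 h
    refine ⟨c1, fun n hn h1 h2 => ?_⟩
    rcases Nat.lt_or_ge n (2 * (lo + 2 ^ d)) with h3 | h3
    · exact a2 n hn h1 h3
    · exact c2 n hn h3 h2

lemma run_spec' (pr d lo hi S S' : ℕ) (hlo : 51 ≤ lo) (hhi : hi = lo + 2 ^ d) (hp : PrOk pr lo hi) (hI : Inv lo S) (hr : run (stp pr) d lo S = S')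
    (h0 : S' ≠ 0) : Inv hi S' ∧ ∀ n, n.Prime → 2*lo ≤ n → n < 2*hi → Good n := by
  subst hhi; subst hr
  exact run_spec pr d lo S hlo hp hI h0

end PS
end


section
namespace PS

lemma prOk_of (pr M lo hi : ℕ) (h1 : ∀ p < M, 2 ≤ p → Nat.gcd p pr ≠ 1) (h2 : pr ∣ M.factorial) (h0 : 1 ≤ lo) (hlo : M < 2 * lo + 1)
    (hhi : 2 * hi ≤ M * M) : PrOk pr lo hi := by
  intro j hj1 hj2
  constructor
  · intro hg
    by_contra hn
    have hm := Nat.minFac_prime (show 2*j+1 ≠ 1 by omega)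
    have hsq := Nat.minFac_sq_le_self (show 0 < 2*j+1 by omega) hn
    have hlt : (2*j+1).minFac < M := by
      by_contra hc
      push Not at hc
      have : M * M ≤ (2*j+1).minFac * (2*j+1).minFac := Nat.mul_le_mul hc hc
      rw [sq] at hsq
      omega
    have h3 := h1 _ hlt hm.two_le
    have h4 : (2*j+1).minFac ∣ pr := by
      by_contra hc
      exact h3 ((Nat.Prime.coprime_iff_not_dvd hm).2 hc)
    have := Nat.dvd_gcd (Nat.minFac_dvd (2*j+1)) h4
    rw [hg] at this
    exact hm.one_lt.ne' (Nat.dvd_one.1 this)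
  · intro hp
    refine (Nat.Prime.coprime_iff_not_dvd hp).2 fun hd => ?_
    have := (Nat.Prime.dvd_factorial hp).1 (hd.trans h2)
    omega

def fct (n : ℕ) : ℕ := Nat.rec 1 (fun n r => Nat.mul (Nat.succ n) r) n
lemma fct_eq (n : ℕ) : fct n = n.factorial := by
  induction n with
  | zero => rfl
  | succ n ih => rw [Nat.factorial_succ, ← ih]; rfl

set_option maxRecDepth 100000 in
lemma prim_a : ∀ p < 1009, 2 ≤ p → Nat.gcd p prim ≠ 1 := by decide +kernel
set_option maxRecDepth 100000 in
lemma prim_b : Nat.beq (Nat.mod (fct 1009) prim) 0 = true := by decide +kernel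
lemma prim_b' : prim ∣ Nat.factorial 1009 := by
  rw [← fct_eq]
  have := prim_b
  generalize fct 1009 = a at *
  generalize prim = b at *
  exact Nat.dvd_of_mod_eq_zero (Nat.eq_of_beq_eq_true this)
lemma prim0_a : ∀ p < 37, 2 ≤ p → Nat.gcd p 200560490130 ≠ 1 := by decide +kernel
lemma prim0_b : 200560490130 ∣ Nat.factorial 37 := by decide +kernel

/-- list of primes up to 101 -/
def pl : List ℕ := [2,3,5,7,11,13,17,19,23,29,31,37,41,43,47,53,59,61,67,71,73,79,83,89,97,101]
lemma pl_eq : (Ioc 0 101).filter Nat.Prime = pl.toFinset := by decide +kernel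
lemma pl_nodup : pl.Nodup := by decide +kernel
lemma th101 : th 101 = (pl.map fun p : ℕ => Real.log p).sum := by
  unfold th
  have : ({p ∈ Ioc 0 101 | p.Prime} : Finset ℕ) = pl.toFinset := by
    rw [← pl_eq]
  rw [this, List.sum_toFinset _ pl_nodup]
lemma sg101 : sg 101 = (pl.map fun p : ℕ => Real.log p / p).sum := by
  unfold sg
  have : ({p ∈ Ioc 0 101 | p.Prime} : Finset ℕ) = pl.toFinset := by
    rw [← pl_eq]
  rw [this, List.sum_toFinset _ pl_nodup]

lemma sum_bd (L : List ℕ) (f : ℕ → ℝ) (a b : ℕ → ℕ) (h : ∀ p ∈ L, (a p : ℝ) / 10 ^ 15 ≤ f p ∧ f p ≤ (b p : ℝ) / 10 ^ 15) :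
    ((L.map a).sum : ℕ) / (10 ^ 15 : ℝ) ≤ (L.map f).sum ∧ (L.map f).sum ≤ ((L.map b).sum : ℕ) / (10 ^ 15 : ℝ) := by
  induction L with
  | nil => simp
  | cons x L ih =>
    have h1 := ih fun p hp => h p (by simp [hp])
    have h2 := h x (by simp)
    simp only [List.map_cons, List.sum_cons, Nat.cast_add, add_div]
    constructor <;> linarith

lemma pl_pos : ∀ p ∈ pl, 1 ≤ p := by decide +kernel
def q1 (p : ℕ) : ℕ := lgL (p-1)
def q2 (p : ℕ) : ℕ := Nat.add (lgL (p-1)) (Nat.mul 17 (p-1))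
def q3 (p : ℕ) : ℕ := Nat.div (lgL (p-1)) p
def q4 (p : ℕ) : ℕ := Nat.succ (Nat.div (Nat.add (lgL (p-1)) (Nat.mul 17 (p-1))) p)

lemma ini_a : 4615120513 * 10 ^ 6 ≤ lgL 100 ∧ lgL 100 + 1700 ≤ (4615120513 + 9 * 26) * 10 ^ 6 := by decide +kernel
lemma ini_b : 88343510912 * 10 ^ 6 ≤ (pl.map q1).sum ∧ (pl.map q2).sum ≤ (88343510912 + 9 * 26 ^ 2) * 10 ^ 6 := by decide +kernel
lemma ini_c : 3415165134 * 10 ^ 6 ≤ (pl.map q3).sum ∧ (pl.map q4).sum ≤ (3415165134 + 10 * 26) * 10 ^ 6 := by decide +kernel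

lemma sc (A B : ℕ) (x : ℝ) (h : A * 10 ^ 6 ≤ B) (hx : (B : ℝ) / 10 ^ 15 ≤ x) : (A : ℝ) / 10 ^ 9 ≤ x := by
  have : (A : ℝ) * 10 ^ 6 ≤ B := by exact_mod_cast h
  linarith
lemma sc' (A B : ℕ) (x : ℝ) (h : B ≤ A * 10 ^ 6) (hx : x ≤ (B : ℝ) / 10 ^ 15) : x ≤ (A : ℝ) / 10 ^ 9 := by
  have : (B : ℝ) ≤ A * 10 ^ 6 := by exact_mod_cast h
  linarith

lemma ini_th : ((pl.map q1).sum : ℕ) / (10 ^ 15 : ℝ) ≤ th 101 ∧ th 101 ≤ ((pl.map q2).sum : ℕ) / (10 ^ 15 : ℝ) := by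
  rw [th101]
  apply sum_bd
  intro p hp
  have hp1 := pl_pos p hp
  refine ⟨log_lo p hp1, ?_⟩
  have e : (q2 p : ℝ) = lgL (p-1) + 17 * (p - 1) := by
    have : q2 p = lgL (p-1) + 17 * (p-1) := rfl
    rw [this]; push_cast [hp1]; ring
  rw [e]; exact log_hi p hp1

lemma ini_sg : ((pl.map q3).sum : ℕ) / (10 ^ 15 : ℝ) ≤ sg 101 ∧ sg 101 ≤ ((pl.map q4).sum : ℕ) / (10 ^ 15 : ℝ) := by
  rw [sg101]
  apply sum_bd
  intro p hp
  have hp1 := pl_pos p hp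
  have hp0 : (0:ℝ) < p := by exact_mod_cast hp1
  constructor
  · have : (q3 p : ℝ) ≤ (lgL (p-1) : ℝ) / p := Nat.cast_div_le
    calc (q3 p : ℝ) / 10 ^ 15 ≤ ((lgL (p-1) : ℝ) / p) / 10 ^ 15 := by gcongr
      _ = ((lgL (p-1) : ℝ) / 10 ^ 15) / p := by ring
      _ ≤ _ := by gcongr; exact log_lo p hp1
  · have e : ((lgL (p-1) : ℝ) + 17 * (p - 1)) / p ≤ q4 p := by
      have h1 : q4 p = (lgL (p-1) + 17 * (p-1)) / p + 1 := rfl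
      rw [h1, ← Nat.floor_div_eq_div (K := ℝ)]
      push_cast [hp1]
      exact (Nat.lt_floor_add_one _).le
    calc Real.log p / p ≤ (((lgL (p-1) : ℝ) + 17 * (p - 1)) / 10 ^ 15) / p := by gcongr; exact log_hi p hp1
      _ = (((lgL (p-1) : ℝ) + 17 * (p - 1)) / p) / 10 ^ 15 := by ring
      _ ≤ _ := by gcongr

lemma inv0 : Inv 51 3010594320170221081646832885501510805464223348804199144363563390922670902036686 := by
  refine ⟨26, 101, 4615120513, 88343510912, 3415165134, by decide +kernel, by norm_num, by norm_num, by norm_num, by norm_num, by norm_num, by norm_num, ?_, by norm_num, by norm_num, ?_, ?_, ?_, ?_, ?_, ?_⟩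
  · intro p _ h; omega
  · exact sc _ _ _ ini_a.1 (log_lo 101 (by norm_num))
  · have h := log_hi 101 (by norm_num)
    have := sc' _ (lgL 100 + 1700) (Real.log (101 : ℕ)) ini_a.2 (by rw [Nat.cast_add]; norm_num at h ⊢; exact h)
    norm_num at this ⊢; exact this
  · exact sc _ _ _ ini_b.1 ini_th.1
  · have := sc' _ _ _ ini_b.2 ini_th.2
    norm_num at this ⊢; exact this
  · exact sc _ _ _ ini_c.1 ini_sg.1
  · have := sc' _ _ _ ini_c.2 ini_sg.2
    norm_num at this ⊢; exact this

theorem good_all (n : ℕ) (hn : n.Prime) (h1 : 102 ≤ n) (h2 : n < 1000550) : Good n := by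
  have r0 := run_spec' _ 9 51 563 _ _ (by norm_num) (by norm_num) (prOk_of _ 37 51 563 prim0_a prim0_b (by norm_num) (by norm_num) (by norm_num)) inv0 run_0 (by norm_num)
  have r1 := run_spec' _ 18 563 262707 _ _ (by norm_num) (by norm_num) (prOk_of _ 1009 _ _ prim_a prim_b' (by norm_num) (by norm_num) (by norm_num)) r0.1 run_1 (by norm_num)
  have r2 := run_spec' _ 17 262707 393779 _ _ (by norm_num) (by norm_num) (prOk_of _ 1009 _ _ prim_a prim_b' (by norm_num) (by norm_num) (by norm_num)) r1.1 run_2 (by norm_num)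
  have r3 := run_spec' _ 16 393779 459315 _ _ (by norm_num) (by norm_num) (prOk_of _ 1009 _ _ prim_a prim_b' (by norm_num) (by norm_num) (by norm_num)) r2.1 run_3 (by norm_num)
  have r4 := run_spec' _ 15 459315 492083 _ _ (by norm_num) (by norm_num) (prOk_of _ 1009 _ _ prim_a prim_b' (by norm_num) (by norm_num) (by norm_num)) r3.1 run_4 (by norm_num)
  have r5 := run_spec' _ 13 492083 500275 _ _ (by norm_num) (by norm_num) (prOk_of _ 1009 _ _ prim_a prim_b' (by norm_num) (by norm_num) (by norm_num)) r4.1 run_5 (by norm_num)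
  rcases Nat.lt_or_ge n 1126 with g | g
  · exact r0.2 n hn (by omega) g
  rcases Nat.lt_or_ge n 525414 with g | g
  · exact r1.2 n hn (by omega) g
  rcases Nat.lt_or_ge n 787558 with g | g
  · exact r2.2 n hn (by omega) g
  rcases Nat.lt_or_ge n 918630 with g | g
  · exact r3.2 n hn (by omega) g
  rcases Nat.lt_or_ge n 984166 with g | g
  · exact r4.2 n hn (by omega) g
  exact r5.2 n hn (by omega) (by omega)
end PS
end


section
namespace PS

lemma ble_t (n b x y : ℕ) (h : n ≤ b) : (@Bool.rec (fun _ => ℕ) x y (Nat.ble n b)) = y := by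
  rw [Nat.ble_eq_true_of_le h]
lemma ble_f (n b x y : ℕ) (h : b < n) : (@Bool.rec (fun _ => ℕ) x y (Nat.ble n b)) = x := by
  have : Nat.ble n b = false := by
    rw [Bool.eq_false_iff, ne_eq, Nat.ble_eq]; omega
  rw [this]

lemma prm_val (n : ℕ) : ∃ c t s h : ℕ, prm n / 1152921504606846976 = c ∧ prm n / 1099511627776 % 1048576 = t ∧
    prm n / 1048576 % 1048576 = s ∧ prm n % 1048576 = h ∧ (
    (n ≤ 126 ∧ c = 94753 ∧ t = 85770 ∧ s = 18043 ∧ h = 26133) ∨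
    (126 < n ∧ n ≤ 148 ∧ c = 91111 ∧ t = 84306 ∧ s = 14408 ∧ h = 20101) ∨
    (148 < n ∧ n ≤ 190 ∧ c = 92526 ∧ t = 84995 ∧ s = 13153 ∧ h = 18539) ∨
    (190 < n ∧ n ≤ 239 ∧ c = 94756 ∧ t = 86957 ∧ s = 11025 ∧ h = 19877) ∨
    (239 < n ∧ n ≤ 366 ∧ c = 95882 ∧ t = 89803 ∧ s = 10344 ∧ h = 17951) ∨
    (366 < n ∧ n ≤ 511 ∧ c = 96314 ∧ t = 91300 ∧ s = 10475 ∧ h = 14751) ∨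
    (511 < n ∧ n ≤ 723 ∧ c = 96880 ∧ t = 91942 ∧ s = 9366 ∧ h = 13350) ∨
    (723 < n ∧ n ≤ 999 ∧ c = 96982 ∧ t = 93831 ∧ s = 9317 ∧ h = 12209) ∨
    (999 < n ∧ n ≤ 1399 ∧ c = 98130 ∧ t = 94771 ∧ s = 8500 ∧ h = 11779) ∨
    (1399 < n ∧ n ≤ 1999 ∧ c = 98466 ∧ t = 94558 ∧ s = 7831 ∧ h = 11296) ∨
    (1999 < n ∧ n ≤ 2980 ∧ c = 98642 ∧ t = 96294 ∧ s = 7771 ∧ h = 10052) ∨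
    (2980 < n ∧ n ≤ 5199 ∧ c = 98775 ∧ t = 96696 ∧ s = 7657 ∧ h = 9248) ∨
    (5199 < n ∧ n ≤ 7999 ∧ c = 99094 ∧ t = 97475 ∧ s = 7379 ∧ h = 8871) ∨
    (7999 < n ∧ n ≤ 23910 ∧ c = 99487 ∧ t = 98110 ∧ s = 7014 ∧ h = 8397) ∨
    (23910 < n ∧ n ≤ 524288 ∧ c = 99931 ∧ t = 98983 ∧ s = 6767 ∧ h = 7934) ∨
    (524288 < n ∧ c = 99943 ∧ t = 99800 ∧ s = 6727 ∧ h = 7001)) := by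
  rcases Nat.lt_or_ge 126 n with g0 | g0
  swap
  · have e : prm n = 109242865631143805347349 := by
      unfold prm; rw [ble_t _ _ _ _ (by omega)]
    rw [e]; exact ⟨94753, 85770, 18043, 26133, by norm_num, by norm_num, by norm_num, by norm_num, Or.inl ⟨by omega, rfl, rfl, rfl, rfl⟩⟩
  rcases Nat.lt_or_ge 148 n with g1 | g1
  swap
  · have e : prm n = 105043923901676834016901 := by
      unfold prm; rw [ble_f _ _ _ _ (by omega), ble_t _ _ _ _ (by omega)]
    rw [e]; exact ⟨91111, 84306, 14408, 20101, by norm_num, by norm_num, by norm_num, by norm_num, Or.inr (Or.inl ⟨by omega, by omega, rfl, rfl, rfl, rfl⟩)⟩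
  rcases Nat.lt_or_ge 190 n with g2 | g2
  swap
  · have e : prm n = 106675308588257718061163 := by
      unfold prm; rw [ble_f _ _ _ _ (by omega), ble_f _ _ _ _ (by omega), ble_t _ _ _ _ (by omega)]
    rw [e]; exact ⟨92526, 84995, 13153, 18539, by norm_num, by norm_num, by norm_num, by norm_num, Or.inr (Or.inr (Or.inl ⟨by omega, by omega, rfl, rfl, rfl, rfl⟩))⟩
  rcases Nat.lt_or_ge 239 n with g3 | g3
  swap
  · have e : prm n = 109246325700770569145765 := by
      unfold prm; rw [ble_f _ _ _ _ (by omega), ble_f _ _ _ _ (by omega), ble_f _ _ _ _ (by omega), ble_t _ _ _ _ (by omega)]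
    rw [e]; exact ⟨94756, 86957, 11025, 19877, by norm_num, by norm_num, by norm_num, by norm_num, Or.inr (Or.inr (Or.inr (Or.inl ⟨by omega, by omega, rfl, rfl, rfl, rfl⟩)))⟩
  rcases Nat.lt_or_ge 366 n with g4 | g4
  swap
  · have e : prm n = 110544518444167257409055 := by
      unfold prm; rw [ble_f _ _ _ _ (by omega), ble_f _ _ _ _ (by omega), ble_f _ _ _ _ (by omega), ble_f _ _ _ _ (by omega), ble_t _ _ _ _ (by omega)]
    rw [e]; exact ⟨95882, 89803, 10344, 17951, by norm_num, by norm_num, by norm_num, by norm_num, Or.inr (Or.inr (Or.inr (Or.inr (Or.inl ⟨by omega, by omega, rfl, rfl, rfl, rfl⟩))))⟩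
  rcases Nat.lt_or_ge 511 n with g5 | g5
  swap
  · have e : prm n = 111042582180126459443615 := by
      unfold prm; rw [ble_f _ _ _ _ (by omega), ble_f _ _ _ _ (by omega), ble_f _ _ _ _ (by omega), ble_f _ _ _ _ (by omega), ble_f _ _ _ _ (by omega), ble_t _ _ _ _ (by omega)]
    rw [e]; exact ⟨96314, 91300, 10475, 14751, by norm_num, by norm_num, by norm_num, by norm_num, Or.inr (Or.inr (Or.inr (Or.inr (Or.inr (Or.inl ⟨by omega, by omega, rfl, rfl, rfl, rfl⟩)))))⟩
  rcases Nat.lt_or_ge 723 n with g6 | g6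
  swap
  · have e : prm n = 111695136457619236992038 := by
      unfold prm; rw [ble_f _ _ _ _ (by omega), ble_f _ _ _ _ (by omega), ble_f _ _ _ _ (by omega), ble_f _ _ _ _ (by omega), ble_f _ _ _ _ (by omega), ble_f _ _ _ _ (by omega), ble_t _ _ _ _ (by omega)]
    rw [e]; exact ⟨96880, 91942, 9366, 13350, by norm_num, by norm_num, by norm_num, by norm_num, Or.inr (Or.inr (Or.inr (Or.inr (Or.inr (Or.inr (Or.inl ⟨by omega, by omega, rfl, rfl, rfl, rfl⟩))))))⟩
  rcases Nat.lt_or_ge 999 n with g7 | g7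
  swap
  · have e : prm n = 111812736528066548871089 := by
      unfold prm; rw [ble_f _ _ _ _ (by omega), ble_f _ _ _ _ (by omega), ble_f _ _ _ _ (by omega), ble_f _ _ _ _ (by omega), ble_f _ _ _ _ (by omega), ble_f _ _ _ _ (by omega), ble_f _ _ _ _ (by omega), ble_t _ _ _ _ (by omega)]
    rw [e]; exact ⟨96982, 93831, 9317, 12209, by norm_num, by norm_num, by norm_num, by norm_num, Or.inr (Or.inr (Or.inr (Or.inr (Or.inr (Or.inr (Or.inr (Or.inl ⟨by omega, by omega, rfl, rfl, rfl, rfl⟩)))))))⟩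
  rcases Nat.lt_or_ge 1399 n with g8 | g8
  swap
  · have e : prm n = 113136291448895282621955 := by
      unfold prm; rw [ble_f _ _ _ _ (by omega), ble_f _ _ _ _ (by omega), ble_f _ _ _ _ (by omega), ble_f _ _ _ _ (by omega), ble_f _ _ _ _ (by omega), ble_f _ _ _ _ (by omega), ble_f _ _ _ _ (by omega), ble_f _ _ _ _ (by omega), ble_t _ _ _ _ (by omega)]
    rw [e]; exact ⟨98130, 94771, 8500, 11779, by norm_num, by norm_num, by norm_num, by norm_num, Or.inr (Or.inr (Or.inr (Or.inr (Or.inr (Or.inr (Or.inr (Or.inr (Or.inl ⟨by omega, by omega, rfl, rfl, rfl, rfl⟩))))))))⟩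
  rcases Nat.lt_or_ge 1999 n with g9 | g9
  swap
  · have e : prm n = 113523672840246504991776 := by
      unfold prm; rw [ble_f _ _ _ _ (by omega), ble_f _ _ _ _ (by omega), ble_f _ _ _ _ (by omega), ble_f _ _ _ _ (by omega), ble_f _ _ _ _ (by omega), ble_f _ _ _ _ (by omega), ble_f _ _ _ _ (by omega), ble_f _ _ _ _ (by omega), ble_f _ _ _ _ (by omega), ble_t _ _ _ _ (by omega)]
    rw [e]; exact ⟨98466, 94558, 7831, 11296, by norm_num, by norm_num, by norm_num, by norm_num, Or.inr (Or.inr (Or.inr (Or.inr (Or.inr (Or.inr (Or.inr (Or.inr (Or.inr (Or.inl ⟨by omega, by omega, rfl, rfl, rfl, rfl⟩)))))))))⟩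
  rcases Nat.lt_or_ge 2980 n with g10 | g10
  swap
  · have e : prm n = 113726588933809432962884 := by
      unfold prm; rw [ble_f _ _ _ _ (by omega), ble_f _ _ _ _ (by omega), ble_f _ _ _ _ (by omega), ble_f _ _ _ _ (by omega), ble_f _ _ _ _ (by omega), ble_f _ _ _ _ (by omega), ble_f _ _ _ _ (by omega), ble_f _ _ _ _ (by omega), ble_f _ _ _ _ (by omega), ble_f _ _ _ _ (by omega), ble_t _ _ _ _ (by omega)]
    rw [e]; exact ⟨98642, 96294, 7771, 10052, by norm_num, by norm_num, by norm_num, by norm_num, Or.inr (Or.inr (Or.inr (Or.inr (Or.inr (Or.inr (Or.inr (Or.inr (Or.inr (Or.inr (Or.inl ⟨by omega, by omega, rfl, rfl, rfl, rfl⟩))))))))))⟩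
  rcases Nat.lt_or_ge 5199 n with g11 | g11
  swap
  · have e : prm n = 113879927935925698438176 := by
      unfold prm; rw [ble_f _ _ _ _ (by omega), ble_f _ _ _ _ (by omega), ble_f _ _ _ _ (by omega), ble_f _ _ _ _ (by omega), ble_f _ _ _ _ (by omega), ble_f _ _ _ _ (by omega), ble_f _ _ _ _ (by omega), ble_f _ _ _ _ (by omega), ble_f _ _ _ _ (by omega), ble_f _ _ _ _ (by omega), ble_f _ _ _ _ (by omega), ble_t _ _ _ _ (by omega)]
    rw [e]; exact ⟨98775, 96696, 7657, 9248, by norm_num, by norm_num, by norm_num, by norm_num, Or.inr (Or.inr (Or.inr (Or.inr (Or.inr (Or.inr (Or.inr (Or.inr (Or.inr (Or.inr (Or.inr (Or.inl ⟨by omega, by omega, rfl, rfl, rfl, rfl⟩)))))))))))⟩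
  rcases Nat.lt_or_ge 7999 n with g12 | g12
  swap
  · have e : prm n = 114247710752414549156519 := by
      unfold prm; rw [ble_f _ _ _ _ (by omega), ble_f _ _ _ _ (by omega), ble_f _ _ _ _ (by omega), ble_f _ _ _ _ (by omega), ble_f _ _ _ _ (by omega), ble_f _ _ _ _ (by omega), ble_f _ _ _ _ (by omega), ble_f _ _ _ _ (by omega), ble_f _ _ _ _ (by omega), ble_f _ _ _ _ (by omega), ble_f _ _ _ _ (by omega), ble_f _ _ _ _ (by omega), ble_t _ _ _ _ (by omega)]
    rw [e]; exact ⟨99094, 97475, 7379, 8871, by norm_num, by norm_num, by norm_num, by norm_num, Or.inr (Or.inr (Or.inr (Or.inr (Or.inr (Or.inr (Or.inr (Or.inr (Or.inr (Or.inr (Or.inr (Or.inr (Or.inl ⟨by omega, by omega, rfl, rfl, rfl, rfl⟩))))))))))))⟩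
  rcases Nat.lt_or_ge 23910 n with g13 | g13
  swap
  · have e : prm n = 114700809601914540925133 := by
      unfold prm; rw [ble_f _ _ _ _ (by omega), ble_f _ _ _ _ (by omega), ble_f _ _ _ _ (by omega), ble_f _ _ _ _ (by omega), ble_f _ _ _ _ (by omega), ble_f _ _ _ _ (by omega), ble_f _ _ _ _ (by omega), ble_f _ _ _ _ (by omega), ble_f _ _ _ _ (by omega), ble_f _ _ _ _ (by omega), ble_f _ _ _ _ (by omega), ble_f _ _ _ _ (by omega), ble_f _ _ _ _ (by omega), ble_t _ _ _ _ (by omega)]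
    rw [e]; exact ⟨99487, 98110, 7014, 8397, by norm_num, by norm_num, by norm_num, by norm_num, Or.inr (Or.inr (Or.inr (Or.inr (Or.inr (Or.inr (Or.inr (Or.inr (Or.inr (Or.inr (Or.inr (Or.inr (Or.inr (Or.inl ⟨by omega, by omega, rfl, rfl, rfl, rfl⟩)))))))))))))⟩
  rcases Nat.lt_or_ge 524288 n with g14 | g14
  swap
  · have e : prm n = 115212707709833373032190 := by
      unfold prm; rw [ble_f _ _ _ _ (by omega), ble_f _ _ _ _ (by omega), ble_f _ _ _ _ (by omega), ble_f _ _ _ _ (by omega), ble_f _ _ _ _ (by omega), ble_f _ _ _ _ (by omega), ble_f _ _ _ _ (by omega), ble_f _ _ _ _ (by omega), ble_f _ _ _ _ (by omega), ble_f _ _ _ _ (by omega), ble_f _ _ _ _ (by omega), ble_f _ _ _ _ (by omega), ble_f _ _ _ _ (by omega), ble_f _ _ _ _ (by omega), ble_t _ _ _ _ (by omega)]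
    rw [e]; exact ⟨99931, 98983, 6767, 7934, by norm_num, by norm_num, by norm_num, by norm_num, Or.inr (Or.inr (Or.inr (Or.inr (Or.inr (Or.inr (Or.inr (Or.inr (Or.inr (Or.inr (Or.inr (Or.inr (Or.inr (Or.inr (Or.inl ⟨by omega, by omega, rfl, rfl, rfl, rfl⟩))))))))))))))⟩
  · have e : prm n = 115226543666189613144921 := by
      unfold prm; rw [ble_f _ _ _ _ (by omega), ble_f _ _ _ _ (by omega), ble_f _ _ _ _ (by omega), ble_f _ _ _ _ (by omega), ble_f _ _ _ _ (by omega), ble_f _ _ _ _ (by omega), ble_f _ _ _ _ (by omega), ble_f _ _ _ _ (by omega), ble_f _ _ _ _ (by omega), ble_f _ _ _ _ (by omega), ble_f _ _ _ _ (by omega), ble_f _ _ _ _ (by omega), ble_f _ _ _ _ (by omega), ble_f _ _ _ _ (by omega), ble_f _ _ _ _ (by omega)]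
    rw [e]; exact ⟨99943, 99800, 6727, 7001, by norm_num, by norm_num, by norm_num, by norm_num, Or.inr (Or.inr (Or.inr (Or.inr (Or.inr (Or.inr (Or.inr (Or.inr (Or.inr (Or.inr (Or.inr (Or.inr (Or.inr (Or.inr (Or.inr ⟨by omega, rfl, rfl, rfl, rfl⟩))))))))))))))⟩

lemma prmchk_small : ∀ t < 103, @Finset.prod ℕ ℕ _ (@Finset.filter ℕ Nat.Prime (fun p => Nat.decidablePrime p) (range (t+1))) (fun p => p) * 1000 ^ t ≤ 2685 ^ t := by decide +kernel

lemma th_small (t : ℕ) (ht : t < 103) : th t ≤ 0.988 * t := by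
  rw [th_eq, Chebyshev.theta_eq_log_primorial, Nat.floor_natCast]
  have h := prmchk_small t ht
  have e : primorial t = @Finset.prod ℕ ℕ _ (@Finset.filter ℕ Nat.Prime (fun p => Nat.decidablePrime p) (range (t+1))) (fun p => p) := by
    unfold primorial; congr
  rw [← e] at h
  have h' : (primorial t : ℝ) ≤ 2.685 ^ t := by
    have : (primorial t : ℝ) * 1000 ^ t ≤ 2685 ^ t := by exact_mod_cast h
    have e2 : (2.685 : ℝ) ^ t = 2685 ^ t / 1000 ^ t := by rw [← div_pow]; norm_num
    rw [e2, le_div_iff₀ (by positivity)]; exact this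
  have h0 : (0:ℝ) < primorial t := by exact_mod_cast primorial_pos t
  have hlog : Real.log 2.685 ≤ 0.988 := by
    rw [Real.log_le_iff_le_exp (by norm_num)]
    have := Real.sum_le_exp_of_nonneg (show (0:ℝ) ≤ 0.988 by norm_num) 9
    refine le_trans ?_ this
    simp [sum_range_succ, Nat.factorial]; norm_num
  calc Real.log (primorial t) ≤ Real.log (2.685 ^ t) := Real.log_le_log h0 h'
    _ = t * Real.log 2.685 := by rw [Real.log_pow]
    _ ≤ _ := by nlinarith [(Nat.cast_nonneg t : (0:ℝ) ≤ t)]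

/-- the greatest prime `≤ w` -/
lemma prev_prime (w : ℕ) (hw : 103 ≤ w) : ∃ P, P.Prime ∧ 103 ≤ P ∧ P ≤ w ∧ ∀ p, p.Prime → P < p → w < p := by
  have hn : Nat.Prime 103 := by norm_num
  refine ⟨Nat.findGreatest Nat.Prime w, Nat.findGreatest_spec hw hn, Nat.le_findGreatest hw hn, Nat.findGreatest_le w, ?_⟩
  intro p hp h
  by_contra hc
  exact absurd hp (Nat.findGreatest_is_greatest h (by omega))

lemma th_seg (c : ℝ) (B : ℕ) (hB : B < 1000550) (hc : 0.988 ≤ c)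
    (h : ∀ n ≤ B, ((prm n / 1152921504606846976 : ℕ) : ℝ) / 10 ^ 5 ≤ c) (t : ℕ) (ht : t ≤ B) : th t ≤ c * t := by
  rcases Nat.lt_or_ge t 103 with h1 | h1
  · have := th_small t h1
    have : (0.988:ℝ) * t ≤ c * t := by gcongr
    linarith
  · obtain ⟨P, hP, hP1, hP2, hg⟩ := prev_prime t h1
    rw [(th_gap P t hP2 hg).1]
    refine (good_all P hP (by omega) (by omega)).1.trans ?_
    have := h P (by omega)
    have h2 : (P:ℝ) ≤ t := by exact_mod_cast hP2
    gcongr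

lemma prm_c (n c : ℕ) (h : prm n / 1152921504606846976 ≤ c) : ((prm n / 1152921504606846976 : ℕ) : ℝ) / 10 ^ 5 ≤ c / 10 ^ 5 := by
  gcongr

theorem th988 (t : ℕ) (ht : t ≤ 5199) : th t ≤ 0.988 * t := by
  refine th_seg 0.988 5199 (by norm_num) le_rfl (fun n hn => ?_) t ht
  refine (prm_c n 98800 ?_).trans (by norm_num)
  obtain ⟨c, t, s, h, e1, e2, e3, e4, H⟩ := prm_val n
  rw [e1]; clear e1 e2 e3 e4; iterate 15 (rcases H with H | H; · omega)
  omega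
theorem th995 (t : ℕ) (ht : t ≤ 23910) : th t ≤ 0.995 * t := by
  refine th_seg 0.995 23910 (by norm_num) (by norm_num) (fun n hn => ?_) t ht
  refine (prm_c n 99500 ?_).trans (by norm_num)
  obtain ⟨c, t, s, h, e1, e2, e3, e4, H⟩ := prm_val n
  rw [e1]; clear e1 e2 e3 e4; iterate 15 (rcases H with H | H; · omega)
  omega
theorem th1 (t : ℕ) (ht : t ≤ 1000549) : th t ≤ t := by
  have := th_seg 1 1000549 (by norm_num) (by norm_num) (fun n hn => ?_) t ht
  · linarith
  refine (prm_c n 100000 ?_).trans (by norm_num)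
  obtain ⟨c, t, s, h, e1, e2, e3, e4, H⟩ := prm_val n
  rw [e1]; clear e1 e2 e3 e4; iterate 15 (rcases H with H | H; · omega)
  omega

theorem psi104 (t : ℕ) : psi t ≤ 1.04 * t := (psi_all (fun t ht => th988 t ht) (fun t ht => th1 t (by omega))).2 t
theorem psi102 (t : ℕ) (ht : 5000 ≤ t) : psi t ≤ 1.02 * t := (psi_all (fun t ht => th988 t ht) (fun t ht => th1 t (by omega))).1 t ht
theorem th102 (t : ℕ) : th t ≤ 1.02 * t := by
  rcases Nat.lt_or_ge t 5000 with h | h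
  · have := th1 t (by omega)
    have : (0:ℝ) ≤ t := Nat.cast_nonneg t
    linarith
  · exact (th_le_psi t).trans (psi102 t h)
theorem th_lo (n : ℕ) (hn : 524288 ≤ n) : 0.919 * n ≤ th n := th_low psi104 n hn

/-- lower bounds for theta at primes -/
lemma tau_of (q v : ℕ) (hq : q.Prime) (h1 : 102 ≤ q) (h2 : q < 1000550)
    (h : v ≤ prm q / 1099511627776 % 1048576) : (v : ℝ) / 10 ^ 5 * q ≤ th (q-1) := by
  refine le_trans ?_ (good_all q hq h1 h2).2.1
  gcongr

lemma slo_of (q v : ℕ) (hq : q.Prime) (h1 : 102 ≤ q) (h2 : q < 1000550)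
    (h : v ≤ prm q / 1048576 % 1048576) : Real.log q + (v : ℝ) / 10 ^ 5 ≤ sg (q-1) + 1.4 := by
  refine le_trans ?_ (good_all q hq h1 h2).2.2.1
  gcongr

lemma shi_of (w v a B : ℕ) (h0 : 103 ≤ a) (haw : ∃ p, p.Prime ∧ a ≤ p ∧ p ≤ w) (h2 : w ≤ B) (hB : B < 1000550)
    (h : ∀ n, a ≤ n → n ≤ B → prm n % 1048576 ≤ v) : sg w + 1.4 ≤ Real.log w + (v : ℝ) / 10 ^ 5 := by
  obtain ⟨p, hp, hp1, hp2⟩ := haw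
  obtain ⟨P, hP, hP1, hP2, hg⟩ := prev_prime w (by omega)
  have hpP : p ≤ P := by
    by_contra hc
    have := hg p hp (by omega)
    omega
  rw [(th_gap P w hP2 hg).2]
  refine (good_all P hP (by omega) (by omega)).2.2.2.trans ?_
  have := h P (by omega) (by omega)
  have h3 : (0:ℝ) < P := by exact_mod_cast hP.pos
  gcongr

lemma next_prime (w : ℕ) (hw : w < 999983) : ∃ n, n.Prime ∧ w < n ∧ n ≤ 999983 ∧ th w = th (n-1) := by
  have hp : Nat.Prime 999983 := by norm_num
  have hex : ∃ n, n.Prime ∧ w < n := ⟨999983, hp, hw⟩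
  refine ⟨Nat.find hex, (Nat.find_spec hex).1, (Nat.find_spec hex).2, Nat.find_min' hex ⟨hp, hw⟩, ?_⟩
  have h2 := (Nat.find_spec hex).2
  refine ((th_gap w _ (by omega) fun p hp h => ?_).1).symm
  have := Nat.find_min' hex ⟨hp, h⟩
  omega

/-- lower bound for theta of the integer part -/
lemma thw (a v : ℕ) (ha : 102 ≤ a) (hv : v ≤ 91890) (h : ∀ n, a ≤ n → n < 1000550 → v ≤ prm n / 1099511627776 % 1048576)
    (w : ℕ) (x : ℝ) (haw : a ≤ w) (hx : x ≤ w + 1) : (v : ℝ) / 10 ^ 5 * x ≤ th w := by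
  have hv0 : (0:ℝ) ≤ (v : ℝ) / 10 ^ 5 := by positivity
  rcases Nat.lt_or_ge w 999983 with h1 | h1
  · obtain ⟨n, hn, hn1, hn2, e⟩ := next_prime w h1
    rw [e]
    refine le_trans ?_ (tau_of n v hn (by omega) (by omega) (h n (by omega) (by omega)))
    have : x ≤ n := hx.trans (by exact_mod_cast hn1)
    gcongr
  · have h3 := th_lo w (by omega)
    have h4 : (999983:ℝ) ≤ w := by exact_mod_cast h1
    have h5 : (v:ℝ) ≤ 91890 := by exact_mod_cast hv
    have h6 : (v : ℝ) / 10 ^ 5 * x ≤ (v : ℝ) / 10 ^ 5 * (w + 1) := by gcongr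
    have h7 : (v : ℝ) / 10 ^ 5 * (w + 1) ≤ 0.9189 * (w + 1) := by
      gcongr
      rw [div_le_iff₀ (by norm_num)]; linarith
    linarith
end PS
end


section
open ArithmeticFunction
namespace PS

/-- discrete partial summation -/
lemma abel (a f : ℕ → ℝ) (c : ℝ) (M N : ℕ) (hMN : M ≤ N)
    (h : ∀ m, M ≤ m → m < N → (f (m+1) ≤ f m ∧ ∑ i ∈ Ioc 0 m, a i ≤ c * m) ∨ f m = f (m+1)) :
    ∑ m ∈ Ioc M N, a m * f m + (c * N - ∑ i ∈ Ioc 0 N, a i) * f N ≤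
      c * ∑ m ∈ Ioc M N, f m + (c * M - ∑ i ∈ Ioc 0 M, a i) * f M := by
  induction N, hMN using Nat.le_induction with
  | base => simp
  | succ N hN ih =>
    have ih' := ih fun m h1 h2 => h m h1 (by omega)
    rw [← Finset.insert_Ioc_right_eq_Ioc_add_one hN, sum_insert (by simp), sum_insert (by simp),
      ← Finset.insert_Ioc_right_eq_Ioc_add_one (Nat.zero_le N), sum_insert (by simp)]
    push_cast
    rcases h N hN (by omega) with ⟨h1, h2⟩ | h1
    · have h3 : (c * N - ∑ i ∈ Ioc 0 N, a i) * f (N+1) ≤ (c * N - ∑ i ∈ Ioc 0 N, a i) * f N :=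
        mul_le_mul_of_nonneg_left h1 (by linarith)
      linarith
    · rw [h1] at ih'
      linarith

lemma sum_inv_le (M N : ℕ) (hM : 1 ≤ M) (hMN : M ≤ N) : ∑ m ∈ Ioc M N, (1:ℝ) / m ≤ Real.log N - Real.log M := by
  induction N, hMN using Nat.le_induction with
  | base => simp
  | succ N hN ih =>
    rw [← Finset.insert_Ioc_right_eq_Ioc_add_one hN, sum_insert (by simp)]
    have hN0 : (0:ℝ) < N := by exact_mod_cast (by omega : 0 < N)
    have : 1 / ((N:ℝ) + 1) ≤ Real.log (N+1) - Real.log N := by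
      rw [← Real.log_div (by positivity) (by positivity)]
      have := Real.one_sub_inv_le_log_of_pos (show (0:ℝ) < (N+1)/N by positivity)
      refine le_trans (le_of_eq ?_) this
      field_simp; ring
    push_cast
    linarith

noncomputable def sL (n : ℕ) : ℝ := ∑ m ∈ Ioc 0 n, Λ m / m

lemma sL_le (n : ℕ) (hn : 1000000 ≤ n) : sL n ≤ Real.log n - 1 + 0.70712 := by
  have hn0 : (1000000:ℝ) ≤ n := by exact_mod_cast hn
  set h := n / 2 with hh
  have h2a : 2 * h ≤ n := by omega
  have h2b : n ≤ 2 * h + 1 := by omega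
  have r2a : 2 * (h:ℝ) ≤ n := by exact_mod_cast h2a
  have r2b : (n:ℝ) ≤ 2 * h + 1 := by exact_mod_cast h2b
  set g : ℕ → ℝ := fun m => if m ≤ h then 1 else n / m - 1 with hg
  have e1 : (n:ℝ) * sL n - Tf n ≤ ∑ m ∈ Ioc 0 n, Λ m * g m := by
    rw [Tf_eq, sL, mul_sum, ← sum_sub_distrib]
    refine sum_le_sum fun m hm => ?_
    rw [mem_Ioc] at hm
    have hm0 : (0:ℝ) < m := by exact_mod_cast hm.1
    have : (n:ℝ) * (Λ m / m) - Λ m * ((n / m : ℕ) : ℝ) = Λ m * (n / m - (n / m : ℕ)) := by ring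
    rw [this]
    refine mul_le_mul_of_nonneg_left ?_ vonMangoldt_nonneg
    have hfl : (n:ℝ) / m < (n / m : ℕ) + 1 := by
      rw [← Nat.floor_div_eq_div (K := ℝ)]; exact Nat.lt_floor_add_one _
    simp only [hg]
    split_ifs with hc
    · linarith
    · have : 1 ≤ n / m := by rw [Nat.one_le_div_iff (by omega)]; exact hm.2
      have : (1:ℝ) ≤ (n / m : ℕ) := by exact_mod_cast this
      linarith
  have e2 := abel (fun m => Λ m) g 1.02 0 n (Nat.zero_le n) (by
    intro m _ hmn
    rcases Nat.lt_or_ge m h with h1 | h1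
    · right; simp only [hg]; rw [if_pos (by omega), if_pos (by omega)]
    · left
      constructor
      · have hm0 : (0:ℝ) < m := by exact_mod_cast (by omega : 0 < m)
        have hstep : (n:ℝ) / ((m+1 : ℕ) : ℝ) ≤ n / m := by
          push_cast; gcongr; linarith
        simp only [hg]
        rw [if_neg (by omega)]
        split_ifs with hc
        · obtain rfl : m = h := by omega
          rw [tsub_le_iff_right, div_le_iff₀ (by positivity)]
          push_cast; linarith
        · linarith
      · exact psi102 m (by omega))
  have e3 : g n = 0 := by
    simp only [hg]; rw [if_neg (by omega), div_self (by positivity)]; ring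
  have e4 : ∑ m ∈ Ioc 0 n, g m ≤ h + n * (Real.log n - Real.log h) - (n - h) := by
    rw [← sum_Ioc_consecutive _ (Nat.zero_le h) (by omega : h ≤ n)]
    have a1 : ∑ m ∈ Ioc 0 h, g m = h := by
      rw [sum_congr rfl (g := fun _ => (1:ℝ)) fun m hm => by simp only [hg]; rw [if_pos (mem_Ioc.1 hm).2]]
      simp
    have a2 : ∑ m ∈ Ioc h n, g m = n * ∑ m ∈ Ioc h n, (1:ℝ) / m - (n - h) := by
      rw [sum_congr rfl (g := fun m : ℕ => n * ((1:ℝ) / m) - 1) fun m hm => by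
        simp only [hg]; rw [if_neg (by have := (mem_Ioc.1 hm).1; omega)]; ring]
      rw [sum_sub_distrib, mul_sum]
      simp [Nat.cast_sub (by omega : h ≤ n)]
    have a3 := sum_inv_le h n (by omega) (by omega)
    have : (n:ℝ) * ∑ m ∈ Ioc h n, (1:ℝ) / m ≤ n * (Real.log n - Real.log h) := by gcongr
    linarith
  have hh0 : (0:ℝ) < h := by linarith
  have e5 : Real.log n - Real.log h ≤ 0.693148 + 0.000003 := by
    rw [← Real.log_div (by positivity) (by positivity)]
    have : (n:ℝ) / h ≤ 2 * (1 + 0.000003) := by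
      rw [div_le_iff₀ hh0]; linarith
    calc Real.log (n / h) ≤ Real.log (2 * (1 + 0.000003)) := Real.log_le_log (by positivity) this
      _ = Real.log 2 + Real.log (1 + 0.000003) := Real.log_mul (by norm_num) (by norm_num)
      _ ≤ _ := by
        have := Real.log_two_lt_d9
        have := Real.log_le_sub_one_of_pos (show (0:ℝ) < 1 + 0.000003 by norm_num)
        linarith
  have e6 := Tf_le n (by omega)
  have e7 : Real.log n ≤ 0.00003 * n := by
    have h1 := Real.log_le_sub_one_of_pos (show (0:ℝ) < n / 100000 by positivity)
    rw [Real.log_div (by positivity) (by norm_num)] at h1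
    have h2 : Real.log 100000 ≤ 11.6 := by
      rw [show (100000:ℝ) = 10 ^ 5 by norm_num, Real.log_pow]
      have : Real.log 10 ≤ 2.31 := by
        have h := log_hi 10 (by norm_num)
        have hk : lgL (10-1) + 17 * 9 ≤ 2310000000000000 := by decide +kernel
        have hk' : ((lgL (10-1) : ℕ) : ℝ) + 17 * 9 ≤ 2310000000000000 := by exact_mod_cast hk
        push_cast at h
        linarith
      push_cast; linarith
    linarith
  rw [e3] at e2
  simp only [Nat.cast_zero, mul_zero, Ioc_self, sum_empty, sub_zero, zero_mul, add_zero] at e2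
  have e8 : (n:ℝ) * sL n ≤ n * (Real.log n - 1 + 0.70712) := by
    have : (n:ℝ) * (Real.log n - Real.log h) ≤ n * (0.693148 + 0.000003) := by gcongr
    linarith
  exact le_of_mul_le_mul_left e8 (by linarith)

/-- proper prime powers up to 10^6 with base up to 313 -/
def ppl : List (ℕ × ℕ) := [(2,2), (2,3), (2,4), (2,5), (2,6), (2,7), (2,8), (2,9), (2,10), (2,11), (2,12), (2,13), (2,14), (2,15), (2,16), (2,17), (2,18), (2,19), (3,2), (3,3),
  (3,4), (3,5), (3,6), (3,7), (3,8), (3,9), (3,10), (3,11), (3,12), (5,2), (5,3), (5,4), (5,5), (5,6), (5,7), (5,8), (7,2), (7,3), (7,4), (7,5), (7,6),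
  (7,7), (11,2), (11,3), (11,4), (11,5), (13,2), (13,3), (13,4), (13,5), (17,2), (17,3), (17,4), (19,2), (19,3), (19,4), (23,2), (23,3), (23,4), (29,2),
  (29,3), (29,4), (31,2), (31,3), (31,4), (37,2), (37,3), (41,2), (41,3), (43,2), (43,3), (47,2), (47,3), (53,2), (53,3), (59,2), (59,3), (61,2),
  (61,3), (67,2), (67,3), (71,2), (71,3), (73,2), (73,3), (79,2), (79,3), (83,2), (83,3), (89,2), (89,3), (97,2), (97,3), (101,2), (103,2), (107,2),
  (109,2), (113,2), (127,2), (131,2), (137,2), (139,2), (149,2), (151,2), (157,2), (163,2), (167,2), (173,2), (179,2), (181,2), (191,2), (193,2),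
  (197,2), (199,2), (211,2), (223,2), (227,2), (229,2), (233,2), (239,2), (241,2), (251,2), (257,2), (263,2), (269,2), (271,2), (277,2), (281,2),
  (283,2), (293,2), (307,2), (311,2), (313,2)]

lemma ppl_ok : ∀ x ∈ ppl, x.1.Prime ∧ 2 ≤ x.2 ∧ x.1 ^ x.2 ≤ 1000000 := by decide +kernel
def ppv : List ℕ := ppl.map fun x => x.1 ^ x.2
lemma ppv_nodup : ppv.Nodup := by decide +kernel
lemma pp_sum : 752230000000000 ≤ (ppl.map fun x => Nat.div (lgL (x.1 - 1)) (x.1 ^ x.2)).sum := by decide +kernel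

lemma sum_ge (L : List (ℕ × ℕ)) (f : ℕ × ℕ → ℝ) (a : ℕ × ℕ → ℕ) (h : ∀ p ∈ L, (a p : ℝ) / 10 ^ 15 ≤ f p) :
    ((L.map a).sum : ℕ) / (10 ^ 15 : ℝ) ≤ (L.map f).sum := by
  induction L with
  | nil => simp
  | cons x L ih =>
    have h1 := ih fun p hp => h p (by simp [hp])
    have h2 := h x (by simp)
    simp only [List.map_cons, List.sum_cons, Nat.cast_add, add_div]
    linarith

lemma sg_le_sL (n : ℕ) (hn : 1000000 ≤ n) : sg n + 0.75223 ≤ sL n := by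
  have hpp : (0.75223:ℝ) ≤ ∑ m ∈ ppv.toFinset, Λ m / m := by
    rw [List.sum_toFinset _ ppv_nodup, ppv, List.map_map]
    refine le_trans ?_ (sum_ge ppl _ (fun x => Nat.div (lgL (x.1 - 1)) (x.1 ^ x.2)) ?_)
    · rw [le_div_iff₀ (by norm_num)]
      have := pp_sum
      generalize (ppl.map fun x => Nat.div (lgL (x.1 - 1)) (x.1 ^ x.2)).sum = z at *
      have : (752230000000000:ℝ) ≤ z := by exact_mod_cast this
      linarith
    · intro x hx
      obtain ⟨h1, h2, h3⟩ := ppl_ok x hx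
      simp only [Function.comp]
      rw [vonMangoldt_apply_pow (by omega), vonMangoldt_apply_prime h1]
      have hx0 : (0:ℝ) < x.1 := by exact_mod_cast h1.pos
      have : ((Nat.div (lgL (x.1 - 1)) (x.1 ^ x.2) : ℕ) : ℝ) ≤ (lgL (x.1-1) : ℝ) / ((x.1 ^ x.2 : ℕ) : ℝ) := Nat.cast_div_le
      calc ((Nat.div (lgL (x.1 - 1)) (x.1 ^ x.2) : ℕ) : ℝ) / 10 ^ 15 ≤ ((lgL (x.1-1) : ℝ) / ((x.1 ^ x.2 : ℕ) : ℝ)) / 10 ^ 15 := by gcongr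
        _ = ((lgL (x.1-1) : ℝ) / 10 ^ 15) / ((x.1 ^ x.2 : ℕ) : ℝ) := by ring
        _ ≤ _ := by
          have := log_lo x.1 h1.pos
          gcongr
  have hsg : sg n = ∑ m ∈ Ioc 0 n with m.Prime, Λ m / m := by
    unfold sg
    refine sum_congr rfl fun p hp => ?_
    rw [vonMangoldt_apply_prime (mem_filter.1 hp).2]
  have hd : Disjoint ({m ∈ Ioc 0 n | m.Prime} : Finset ℕ) ppv.toFinset := by
    rw [Finset.disjoint_left]
    intro m hm hm2
    rw [List.mem_toFinset, ppv, List.mem_map] at hm2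
    obtain ⟨x, hx, rfl⟩ := hm2
    have hp := (mem_filter.1 hm).2
    exact Nat.Prime.not_prime_pow (ppl_ok x hx).2.1 hp
  calc sg n + 0.75223 ≤ ∑ m ∈ Ioc 0 n with m.Prime, Λ m / m + ∑ m ∈ ppv.toFinset, Λ m / m := by rw [hsg]; linarith
    _ = ∑ m ∈ ({m ∈ Ioc 0 n | m.Prime} ∪ ppv.toFinset), Λ m / m := (sum_union hd).symm
    _ ≤ _ := by
      refine sum_le_sum_of_subset_of_nonneg ?_ fun m _ _ => div_nonneg vonMangoldt_nonneg (Nat.cast_nonneg m)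
      intro m hm
      rw [mem_union] at hm
      rcases hm with hm | hm
      · exact (mem_filter.1 hm).1
      · rw [List.mem_toFinset, ppv, List.mem_map] at hm
        obtain ⟨x, hx, rfl⟩ := hm
        rw [mem_Ioc]
        exact ⟨Nat.pow_pos (ppl_ok x hx).1.pos, (ppl_ok x hx).2.2.trans hn⟩

/-- Mertens type upper bound, valid for all `w ≥ 512` -/
theorem sg_up (w : ℕ) (hw : 521 ≤ w) : sg w + 1.4 ≤ Real.log w + 0.3549 := by
  rcases Nat.lt_or_ge w 1000000 with h | h
  · have := shi_of w 13350 512 1000000 (by norm_num) ⟨521, by norm_num, by norm_num, hw⟩ h.le (by norm_num) (by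
      intro n h1 h2
      obtain ⟨c, t, s, h, e1, e2, e3, e4, H⟩ := prm_val n
      rw [e4]; clear e1 e2 e3 e4; iterate 15 (rcases H with H | H; · omega)
      omega)
    push_cast at this
    linarith
  · have h1 := sL_le w h
    have h2 := sg_le_sL w h
    linarith
end PS
end


section
open ArithmeticFunction
namespace PS

/-- all prime factors are at least `q` -/
def Rq (q n : ℕ) : Prop := ∀ p : ℕ, p.Prime → p ∣ n → q ≤ p

noncomputable def F (q N : ℕ) : ℕ := ((Ioc 0 N).filter (Rq q)).card

noncomputable def la (p : ℕ) : ℝ := if p.Prime then Real.log p else 0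

lemma la_nonneg (p : ℕ) : 0 ≤ la p := by
  unfold la; split_ifs with h
  · exact Real.log_natCast_nonneg p
  · exact le_rfl

lemma th_la (n : ℕ) : th n = ∑ p ∈ Ioc 0 n, la p := by
  unfold th la; rw [sum_filter]

lemma sg_la (n : ℕ) : sg n = ∑ p ∈ Ioc 0 n, la p / p := by
  unfold sg la; rw [sum_filter]
  refine sum_congr rfl fun p _ => ?_
  split_ifs <;> simp

lemma Ioc_sub {M : Type*} [AddCommGroup M] (f : ℕ → M) (a b : ℕ) (h : a ≤ b) :
    ∑ i ∈ Ioc a b, f i = ∑ i ∈ Ioc 0 b, f i - ∑ i ∈ Ioc 0 a, f i := by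
  rw [← sum_Ioc_consecutive f (Nat.zero_le a) h]; abel

lemma th_mono {a b : ℕ} (h : a ≤ b) : th a ≤ th b := by
  rw [th_la, th_la, ← sum_Ioc_consecutive la (Nat.zero_le a) h]
  have := sum_nonneg (s := Ioc a b) fun p _ => la_nonneg p
  linarith

lemma F_succ (q N : ℕ) : F q (N+1) = F q N + if Rq q (N+1) then 1 else 0 := by
  unfold F
  rw [← Finset.insert_Ioc_right_eq_Ioc_add_one (Nat.zero_le N), filter_insert]
  split_ifs with h
  · rw [card_insert_of_notMem (by simp)]
  · rfl

lemma F_mono (q : ℕ) : Monotone (F q) := monotone_nat_of_le_succ fun n => by rw [F_succ]; omega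

lemma F_le (q N : ℕ) : F q N ≤ N := by
  induction N with
  | zero => simp [F]
  | succ n ih => rw [F_succ]; split_ifs <;> omega

lemma F_le3 (q N : ℕ) (hq : 5 ≤ q) : 3 * F q N ≤ N + 2 := by
  have : F q N ≤ (N + 5) / 6 + (N + 1) / 6 := by
    induction N with
    | zero => simp [F]
    | succ n ih =>
      rw [F_succ]
      split_ifs with h
      · have h2 : ¬ 2 ∣ n + 1 := fun hd => by have := h 2 Nat.prime_two hd; omega
        have h3 : ¬ 3 ∣ n + 1 := fun hd => by have := h 3 Nat.prime_three hd; omega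
        have h6 : n % 6 = 0 ∨ n % 6 = 4 := by omega
        clear h2 h3
        omega
      · omega
  omega

lemma Rq_one (q : ℕ) : Rq q 1 := fun p hp h => absurd (Nat.dvd_one.1 h) hp.one_lt.ne'

lemma Rq_mul (q a b : ℕ) : Rq q (a * b) ↔ Rq q a ∧ Rq q b := by
  constructor
  · intro h; exact ⟨fun p hp hd => h p hp (hd.mul_right _), fun p hp hd => h p hp (hd.mul_left _)⟩
  · rintro ⟨h1, h2⟩ p hp hd
    rcases (Nat.Prime.dvd_mul hp).1 hd with h | h
    · exact h1 p hp h
    · exact h2 p hp h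

lemma Rq_prime (q p : ℕ) (hp : p.Prime) : Rq q p ↔ q ≤ p := by
  constructor
  · intro h; exact h p hp dvd_rfl
  · intro h r hr hd; rw [(Nat.prime_dvd_prime_iff_eq hr hp).1 hd]; exact h

lemma Rq_small (q n : ℕ) (h1 : 1 < n) (h2 : n < q ^ 2) : Rq q n ↔ n.Prime ∧ q ≤ n := by
  constructor
  · intro h
    have hm := h n.minFac (Nat.minFac_prime h1.ne') (Nat.minFac_dvd n)
    have hp : n.Prime := by
      by_contra hc
      have := Nat.minFac_sq_le_self (by omega) hc
      have : q ^ 2 ≤ n.minFac ^ 2 := Nat.pow_le_pow_left hm 2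
      omega
    exact ⟨hp, h n hp dvd_rfl⟩
  · rintro ⟨h1, h2⟩; exact (Rq_prime q n h1).2 h2

/-- deficit sum -/
noncomputable def Dd (q N : ℕ) : ℝ := ∑ n ∈ (Ioc 0 N).filter (Rq q), (Real.log N - Real.log n)
noncomputable def Ls (q N : ℕ) : ℝ := ∑ n ∈ (Ioc 0 N).filter (Rq q), Real.log n

lemma F_log (q N : ℕ) : F q N * Real.log N = Ls q N + Dd q N := by
  unfold Ls Dd F
  rw [sum_sub_distrib]; simp

lemma Dd_succ (q N : ℕ) : Dd q (N+1) = Dd q N + F q N * (Real.log (N+1) - Real.log N) := by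
  unfold Dd F
  have : (Ioc 0 (N+1)).filter (Rq q) = if Rq q (N+1) then insert (N+1) ((Ioc 0 N).filter (Rq q)) else (Ioc 0 N).filter (Rq q) := by
    rw [← Finset.insert_Ioc_right_eq_Ioc_add_one (Nat.zero_le N), filter_insert]
  have e : ∑ n ∈ (Ioc 0 (N+1)).filter (Rq q), (Real.log ((N+1 : ℕ):ℝ) - Real.log n) = ∑ n ∈ (Ioc 0 N).filter (Rq q), (Real.log ((N+1 : ℕ):ℝ) - Real.log n) := by
    rw [this]
    split_ifs
    · rw [sum_insert (by simp)]; simp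
    · rfl
  rw [e, sum_sub_distrib, sum_sub_distrib]
  simp; ring

lemma Dd_le (q M N : ℕ) (c : ℝ) (hc : 0 ≤ c) (hM : 1 ≤ M) (hMN : M ≤ N) (h : ∀ m, M ≤ m → m < N → (F q m : ℝ) ≤ c * m) :
    Dd q N ≤ Dd q M + c * (N - M) := by
  induction N, hMN using Nat.le_induction with
  | base => simp
  | succ N hN ih =>
    have h1 := ih fun m h1 h2 => h m h1 (by omega)
    rw [Dd_succ]
    have hN0 : (0:ℝ) < N := by exact_mod_cast (by omega : 0 < N)
    have h2 : Real.log (N+1) - Real.log N ≤ 1 / N := by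
      rw [← Real.log_div (by positivity) (by positivity)]
      have := Real.log_le_sub_one_of_pos (show (0:ℝ) < (N+1)/N by positivity)
      refine this.trans (le_of_eq ?_); field_simp; ring
    have h0 : 0 ≤ Real.log (N+1) - Real.log N := by
      rw [sub_nonneg]; exact Real.log_le_log hN0 (by linarith)
    have h3 := h N hN (by omega)
    have : (F q N : ℝ) * (Real.log (N+1) - Real.log N) ≤ c * N * (1 / N) := by gcongr
    have e : c * N * (1 / N) = c := by field_simp
    push_cast; linarith

lemma sum_Rq_small (q : ℕ) (hq : 2 ≤ q) (f : ℕ → ℝ) (m : ℕ) (h1 : 1 ≤ m) (h2 : m < q ^ 2) :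
    ∑ n ∈ (Ioc 0 m).filter (Rq q), f n = f 1 + ∑ n ∈ (Ioc 0 m).filter (fun p => p.Prime ∧ q ≤ p), f n := by
  have : (Ioc 0 m).filter (Rq q) = insert 1 ((Ioc 0 m).filter (fun p => p.Prime ∧ q ≤ p)) := by
    ext n
    simp only [mem_filter, mem_insert, mem_Ioc]
    constructor
    · rintro ⟨⟨h3, h4⟩, h5⟩
      rcases Nat.lt_or_ge 1 n with h6 | h6
      · right; exact ⟨⟨h3, h4⟩, (Rq_small q n h6 (by omega)).1 h5⟩
      · left; omega
    · rintro (rfl | ⟨h3, h4, h5⟩)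
      · exact ⟨⟨by omega, h1⟩, Rq_one q⟩
      · exact ⟨h3, (Rq_prime q n h4).2 h5⟩
  rw [this, sum_insert]
  simp only [mem_filter, not_and]; intro _ h; exact absurd h Nat.not_prime_one

/-- prime indicator -/
noncomputable def pr1 (p : ℕ) : ℝ := if p.Prime then 1 else 0

lemma sum_Rq_small' (q : ℕ) (hq : 2 ≤ q) (f : ℕ → ℝ) (m : ℕ) (h1 : 1 ≤ m) (h2 : m < q ^ 2) :
    ∑ n ∈ (Ioc 0 m).filter (Rq q), f n = f 1 + ∑ n ∈ Ioc (q-1) m, pr1 n * f n := by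
  rw [sum_Rq_small q hq f m h1 h2]
  congr 1
  have : (Ioc 0 m).filter (fun p => p.Prime ∧ q ≤ p) = (Ioc (q-1) m).filter Nat.Prime := by
    ext n; simp only [mem_filter, mem_Ioc]
    constructor
    · rintro ⟨h3, h4, h5⟩; exact ⟨⟨by omega, by omega⟩, h4⟩
    · rintro ⟨h3, h4⟩; exact ⟨⟨by omega, by omega⟩, h4, by omega⟩
  rw [this, sum_filter]
  refine sum_congr rfl fun n _ => ?_
  unfold pr1; split_ifs <;> simp

lemma F_small (q : ℕ) (hq : 2 ≤ q) (m : ℕ) (h1 : 1 ≤ m) (h2 : m < q ^ 2) :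
    (F q m : ℝ) = 1 + ∑ r ∈ Ioc (q-1) m, pr1 r := by
  have := sum_Rq_small' q hq (fun _ => 1) m h1 h2
  unfold F
  simpa using this

lemma Ls_eq (q N : ℕ) : Ls q N = ∑ d ∈ (Ioc 0 N).filter (Rq q), Λ d * F q (N / d) := by
  unfold Ls
  have e1 : ∀ n ∈ (Ioc 0 N).filter (Rq q), Real.log n = ∑ d ∈ (Ioc 0 N).filter (Rq q), if d ∣ n then Λ d else 0 := by
    intro n hn
    simp only [mem_filter, mem_Ioc] at hn
    rw [← vonMangoldt_sum, ← sum_filter]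
    refine sum_congr ?_ fun _ _ => rfl
    ext d
    simp only [Nat.mem_divisors, mem_filter, mem_Ioc]
    constructor
    · rintro ⟨h1, h2⟩
      have := Nat.le_of_dvd (by omega) h1
      have := Nat.pos_of_dvd_of_pos h1 (by omega)
      exact ⟨⟨⟨this, by omega⟩, fun p hp hd => hn.2 p hp (hd.trans h1)⟩, h1⟩
    · rintro ⟨_, h2⟩; exact ⟨h2, by omega⟩
  rw [sum_congr rfl e1, sum_comm]
  refine sum_congr rfl fun d hd => ?_
  simp only [mem_filter, mem_Ioc] at hd
  rw [← sum_filter, sum_const, nsmul_eq_mul, mul_comm]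
  congr 2
  unfold F
  symm
  apply Finset.card_bij (fun k _ => d * k)
  · intro k hk
    simp only [mem_filter, mem_Ioc] at hk ⊢
    refine ⟨⟨⟨Nat.mul_pos hd.1.1 hk.1.1, ?_⟩, (Rq_mul q d k).2 ⟨hd.2, hk.2⟩⟩, dvd_mul_right _ _⟩
    calc d * k ≤ d * (N / d) := Nat.mul_le_mul_left _ hk.1.2
      _ ≤ N := Nat.mul_div_le N d
  · intro a _ b _ h; exact Nat.eq_of_mul_eq_mul_left hd.1.1 h
  · intro n hn
    simp only [mem_filter, mem_Ioc] at hn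
    obtain ⟨k, rfl⟩ := hn.2
    refine ⟨k, ?_, rfl⟩
    simp only [mem_filter, mem_Ioc]
    refine ⟨⟨Nat.pos_of_mul_pos_left hn.1.1.1, ?_⟩, ((Rq_mul q d k).1 hn.1.2).2⟩
    rw [Nat.le_div_iff_mul_le hd.1.1, mul_comm]; exact hn.1.1.2

/-- proper prime powers part -/
noncomputable def Pp (q N : ℕ) : ℝ := ∑ d ∈ (Ioc 0 N).filter (fun d => Rq q d ∧ ¬ d.Prime), Λ d * F q (N / d)

lemma Ls_split (q N : ℕ) (hq : 2 ≤ q) (hN : q ≤ N) : Ls q N = ∑ p ∈ Ioc (q-1) N, la p * F q (N / p) + Pp q N := by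
  rw [Ls_eq, Pp, ← sum_filter_add_sum_filter_not _ Nat.Prime, filter_filter, filter_filter]
  congr 1
  have : (Ioc 0 N).filter (fun d => Rq q d ∧ d.Prime) = (Ioc (q-1) N).filter Nat.Prime := by
    ext d; simp only [mem_filter, mem_Ioc]
    constructor
    · rintro ⟨h1, h2, h3⟩; have := (Rq_prime q d h3).1 h2; exact ⟨by omega, h3⟩
    · rintro ⟨h1, h2⟩; exact ⟨by omega, (Rq_prime q d h2).2 (by omega), h2⟩
  rw [this, sum_filter]
  refine sum_congr rfl fun p _ => ?_
  unfold la; split_ifs with h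
  · rw [vonMangoldt_apply_prime h]
  · simp

/-- the part with large primes -/
lemma big_part (q N w : ℕ) (hq : 2 ≤ q) (hw : q - 1 ≤ w) (hwN : w ≤ N) (hN : N < q ^ 2 * (w + 1)) :
    ∑ p ∈ Ioc w N, la p * F q (N / p) = th N - th w + ∑ r ∈ Ioc (q-1) (q^2-1), pr1 r * (th (max (N / r) w) - th w) := by
  have hq2 : 1 ≤ q ^ 2 := Nat.one_le_pow _ _ (by omega)
  have e1 : ∀ p ∈ Ioc w N, la p * F q (N / p) = la p + ∑ r ∈ Ioc (q-1) (q^2-1), if p * r ≤ N then la p * pr1 r else 0 := by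
    intro p hp
    rw [mem_Ioc] at hp
    have hp0 : 0 < p := by omega
    have hlt : N / p < q ^ 2 := by
      rw [Nat.div_lt_iff_lt_mul hp0]
      exact hN.trans_le (Nat.mul_le_mul_left _ (by omega))
    rw [F_small q hq (N / p) (by rw [Nat.one_le_div_iff hp0]; exact hp.2) hlt, mul_add, mul_one, ← sum_filter, mul_sum]
    congr 1
    refine sum_congr ?_ fun _ _ => rfl
    ext r; simp only [mem_filter, mem_Ioc]
    rw [Nat.le_div_iff_mul_le hp0, mul_comm r p]
    constructor
    · rintro ⟨h1, h2⟩
      refine ⟨⟨h1, ?_⟩, h2⟩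
      have : r ≤ N / p := by rw [Nat.le_div_iff_mul_le hp0, mul_comm]; exact h2
      omega
    · rintro ⟨h1, h2⟩; exact ⟨h1.1, h2⟩
  rw [sum_congr rfl e1, sum_add_distrib, sum_comm]
  congr 1
  · rw [Ioc_sub la w N hwN, th_la, th_la]
  · refine sum_congr rfl fun r hr => ?_
    rw [mem_Ioc] at hr
    have hr0 : 0 < r := by omega
    rw [← sum_filter, ← sum_mul, mul_comm]
    congr 1
    rw [th_la, th_la, ← Ioc_sub la w _ (le_max_right _ _)]
    refine sum_congr ?_ fun _ _ => rfl
    ext p; simp only [mem_filter, mem_Ioc]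
    have : p * r ≤ N ↔ p ≤ N / r := (Nat.le_div_iff_mul_le hr0).symm
    rw [this]
    have := Nat.div_le_self N r
    omega
end PS
end


section
open ArithmeticFunction
namespace PS

/-- prime sum bound by partial summation -/
lemma prime_sum (q W : ℕ) (hq : 2 ≤ q) (hqW : q ≤ W) (c : ℝ) (f : ℕ → ℝ)
    (hf : ∀ m, q ≤ m → m < W → f (m+1) ≤ f m) (hW : 0 ≤ f W) (hc : ∀ m, q ≤ m → m ≤ W → th m ≤ c * m) :
    ∑ m ∈ Ioc (q-1) W, la m * f m ≤ (c * q - th (q-1)) * f q + c * ∑ m ∈ Ioc q W, f m := by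
  have h := abel la (fun m => f (max m q)) c (q-1) W (by omega) (by
    intro m h1 h2
    rcases Nat.lt_or_ge m q with h3 | h3
    · right; congr 1; omega
    · left
      rw [max_eq_left h3, max_eq_left (by omega), ← th_la]
      exact ⟨hf m h3 h2, hc m h3 h2.le⟩)
  rw [← th_la, ← th_la, max_eq_left hqW, max_eq_right (by omega : q - 1 ≤ q)] at h
  have e1 : ∑ m ∈ Ioc (q-1) W, la m * f (max m q) = ∑ m ∈ Ioc (q-1) W, la m * f m :=
    sum_congr rfl fun m hm => by rw [max_eq_left (by have := mem_Ioc.1 hm; omega)]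
  have e2 : ∑ m ∈ Ioc (q-1) W, f (max m q) = f q + ∑ m ∈ Ioc q W, f m := by
    have : ∑ m ∈ Ioc (q-1) W, f (max m q) = ∑ m ∈ Ioc (q-1) W, f m :=
      sum_congr rfl fun m hm => by rw [max_eq_left (by have := mem_Ioc.1 hm; omega)]
    rw [this, ← sum_Ioc_consecutive f (by omega : q - 1 ≤ q) hqW]
    have : Ioc (q-1) q = {q} := by ext x; simp; omega
    rw [this]; simp
  have h3 : ((q - 1 : ℕ) : ℝ) = q - 1 := by rw [Nat.cast_sub (by omega)]; simp
  have h4 := mul_nonneg (sub_nonneg.2 (hc W hqW le_rfl)) hW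
  rw [e1, e2, h3] at h
  linarith

lemma sum_inv_mul_log (M N : ℕ) (hM : 2 ≤ M) (hMN : M ≤ N) :
    ∑ m ∈ Ioc M N, 1 / ((m:ℝ) * Real.log m) ≤ Real.log (Real.log N / Real.log M) := by
  have hlog : ∀ n : ℕ, 2 ≤ n → 0 < Real.log n := fun n hn => Real.log_pos (by exact_mod_cast (by omega : 1 < n))
  induction N, hMN using Nat.le_induction with
  | base => simp [div_self (hlog M hM).ne']
  | succ N hN ih =>
    rw [← Finset.insert_Ioc_right_eq_Ioc_add_one hN, sum_insert (by simp)]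
    have l1 := hlog N (by omega)
    have l2 := hlog (N+1) (by omega)
    have l3 := hlog M hM
    have hN0 : (0:ℝ) < N := by exact_mod_cast (by omega : 0 < N)
    have h1 := sum_inv_le N (N+1) (by omega) (by omega)
    have : Ioc N (N+1) = {N+1} := by ext x; simp
    rw [this, sum_singleton] at h1
    rw [Real.log_div l1.ne' l3.ne'] at ih
    rw [Real.log_div l2.ne' l3.ne']
    have h2 := Real.one_sub_inv_le_log_of_pos (div_pos l2 l1)
    rw [Real.log_div l2.ne' l1.ne', inv_div] at h2
    have h3 : 1 / (((N+1 : ℕ):ℝ) * Real.log ((N+1 : ℕ):ℝ)) ≤ 1 - Real.log N / Real.log ((N+1 : ℕ):ℝ) := by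
      rw [one_sub_div l2.ne', ← div_div]
      gcongr
    linarith

/-- comparison function for `li` -/
noncomputable def Hf (c t : ℝ) : ℝ := t / Real.log t + t / Real.log t ^ 2 + c * t / Real.log t ^ 3

lemma Hf_deriv (c t : ℝ) (ht : 1 < t) : HasDerivAt (Hf c)
    (1 / Real.log t + (c - 2) / Real.log t ^ 3 - 3 * c / Real.log t ^ 4) t := by
  have l : 0 < Real.log t := Real.log_pos ht
  have hd := Real.hasDerivAt_log (by linarith : t ≠ 0)
  have h1 := (hasDerivAt_id t).div hd l.ne'
  have h2 := (hasDerivAt_id t).div (hd.pow 2) (pow_pos l 2).ne'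
  have h3 := ((hasDerivAt_id t).const_mul c).div (hd.pow 3) (pow_pos l 3).ne'
  have := (h1.add h2).add h3
  refine this.congr_deriv ?_
  simp
  have : t ≠ 0 := by linarith
  field_simp
  ring

lemma sum_inv_log (c : ℝ) (M N : ℕ) (hM : 2 ≤ M) (hMN : M ≤ N) (hl : 3 < Real.log M)
    (hc : 2 ≤ c * (1 - 3 / Real.log M)) :
    ∑ m ∈ Ioc M N, 1 / Real.log m ≤ Hf c N - Hf c M := by
  have hc0 : 0 < c := by
    have : 0 < 1 - 3 / Real.log M := by rw [sub_pos, div_lt_one (by linarith)]; exact hl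
    by_contra h
    nlinarith
  induction N, hMN using Nat.le_induction with
  | base => simp
  | succ N hN ih =>
    rw [← Finset.insert_Ioc_right_eq_Ioc_add_one hN, sum_insert (by simp)]
    have hN1 : (1:ℝ) < N := by exact_mod_cast (by omega : 1 < N)
    obtain ⟨z, hz, e⟩ := exists_hasDerivAt_eq_slope (Hf c) (fun t => 1 / Real.log t + (c - 2) / Real.log t ^ 3 - 3 * c / Real.log t ^ 4)
      (show (N:ℝ) < N + 1 by linarith)
      (fun t ht => (Hf_deriv c t (by linarith [ht.1])).continuousAt.continuousWithinAt)
      (fun t ht => Hf_deriv c t (by linarith [ht.1]))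
    have e' : Hf c (N+1) - Hf c N = 1 / Real.log z + (c - 2) / Real.log z ^ 3 - 3 * c / Real.log z ^ 4 := by
      rw [e]; simp
    have hMz : (M:ℝ) ≤ z := by
      have : (M:ℝ) ≤ N := by exact_mod_cast hN
      linarith [hz.1]
    have hM0 : (0:ℝ) < M := by exact_mod_cast (by omega : 0 < M)
    have lz : Real.log M ≤ Real.log z := Real.log_le_log hM0 hMz
    have lz0 : 0 < Real.log z := by linarith
    have lz1 : Real.log z ≤ Real.log (N+1) := Real.log_le_log (by linarith) hz.2.le
    have h1 : 1 / Real.log (N+1) ≤ 1 / Real.log z := one_div_le_one_div_of_le lz0 lz1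
    have h2 : 0 ≤ (c - 2) / Real.log z ^ 3 - 3 * c / Real.log z ^ 4 := by
      have : (c - 2) / Real.log z ^ 3 - 3 * c / Real.log z ^ 4 = (c * (1 - 3 / Real.log z) - 2) / Real.log z ^ 3 := by
        field_simp; ring
      rw [this]
      apply div_nonneg _ (by positivity)
      have : 3 / Real.log z ≤ 3 / Real.log M := by gcongr
      nlinarith
    push_cast
    linarith

lemma psi_sub_th_gen (N : ℕ) (hN : 10609 ≤ N) : psi N - th N ≤ 1.35 * Real.sqrt N := by
  have hn' : (10609:ℝ) ≤ N := by exact_mod_cast hN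
  have key : ∀ k : ℕ, Chebyshev.psi ((N:ℝ) ^ (k:ℝ)⁻¹) ≤ 1.04 * (N:ℝ) ^ (k:ℝ)⁻¹ := by
    intro k
    rw [Chebyshev.psi_eq_psi_coe_floor, ← psi_eq]
    refine (psi104 _).trans ?_
    have := Nat.floor_le (show 0 ≤ (N:ℝ) ^ (k:ℝ)⁻¹ by positivity); gcongr
  have h := Chebyshev.psi_sub_theta_le_psi_add_psi_add_psi N
  rw [← psi_eq, ← th_eq] at h
  have k2 := key 2
  have k3 := key 3
  have k5 := key 5
  push_cast at k2 k3 k5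
  have hs : Real.sqrt N = (N:ℝ) ^ (2:ℝ)⁻¹ := by rw [Real.sqrt_eq_rpow]; norm_num
  have hN0 : (0:ℝ) < N := by linarith
  have hpos : (0:ℝ) < (N:ℝ) ^ (2:ℝ)⁻¹ := by positivity
  have r3 : (N:ℝ) ^ (3:ℝ)⁻¹ ≤ 0.2134 * (N:ℝ) ^ (2:ℝ)⁻¹ := by
    refine le_of_pow_le_pow_left₀ (n := 6) (by norm_num) (by positivity) ?_
    rw [mul_pow, ← Real.rpow_natCast, ← Real.rpow_natCast ((N:ℝ) ^ (2:ℝ)⁻¹), ← Real.rpow_mul hN0.le, ← Real.rpow_mul hN0.le]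
    have e1 : (3:ℝ)⁻¹ * ((6:ℕ):ℝ) = ((2:ℕ):ℝ) := by norm_num
    have e2 : (2:ℝ)⁻¹ * ((6:ℕ):ℝ) = ((3:ℕ):ℝ) := by norm_num
    rw [e1, e2, Real.rpow_natCast, Real.rpow_natCast]
    have : (N:ℝ)^3 = N * N^2 := by ring
    rw [this]
    have : 0 < (N:ℝ)^2 := by positivity
    nlinarith
  have r5 : (N:ℝ) ^ (5:ℝ)⁻¹ ≤ 0.0622 * (N:ℝ) ^ (2:ℝ)⁻¹ := by
    refine le_of_pow_le_pow_left₀ (n := 10) (by norm_num) (by positivity) ?_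
    rw [mul_pow, ← Real.rpow_natCast, ← Real.rpow_natCast ((N:ℝ) ^ (2:ℝ)⁻¹), ← Real.rpow_mul hN0.le, ← Real.rpow_mul hN0.le]
    have e1 : (5:ℝ)⁻¹ * ((10:ℕ):ℝ) = ((2:ℕ):ℝ) := by norm_num
    have e2 : (2:ℝ)⁻¹ * ((10:ℕ):ℝ) = ((5:ℕ):ℝ) := by norm_num
    rw [e1, e2, Real.rpow_natCast, Real.rpow_natCast]
    have : (N:ℝ)^5 = N^3 * N^2 := by ring
    rw [this]
    have : 0 < (N:ℝ)^2 := by positivity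
    have h3 : (10609:ℝ)^3 ≤ (N:ℝ)^3 := by gcongr
    nlinarith
  rw [hs]
  linarith

lemma pp_geom (p K : ℕ) (hp : 2 ≤ p) : ∑ k ∈ Icc 2 K, (1:ℝ) / (p:ℝ) ^ k ≤ 1 / ((p:ℝ) * (p - 1)) := by
  have hp' : (2:ℝ) ≤ p := by exact_mod_cast hp
  have : ∑ k ∈ Icc 2 K, (1:ℝ) / (p:ℝ) ^ k ≤ (1 / (p - 1)) * (1 / p - if 2 ≤ K then 1 / (p:ℝ) ^ K else 1 / p) := by
    induction K with
    | zero => simp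
    | succ K ih =>
      rcases Nat.lt_or_ge K 1 with h | h
      · obtain rfl : K = 0 := by omega
        simp
      · rcases Nat.lt_or_ge K 2 with h2 | h2
        · obtain rfl : K = 1 := by omega
          simp
          have : (p:ℝ) - 1 ≠ 0 := by linarith
          field_simp
          nlinarith
        · rw [sum_Icc_succ_top (by omega), if_pos (by omega)]
          rw [if_pos h2] at ih
          have : (p:ℝ) - 1 ≠ 0 := by linarith
          have e : (1 / ((p:ℝ) - 1)) * (1 / p - 1 / (p:ℝ) ^ (K+1)) = (1 / ((p:ℝ) - 1)) * (1 / p - 1 / (p:ℝ) ^ K) + 1 / (p:ℝ) ^ (K+1) := by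
            field_simp; ring
          linarith
  refine this.trans ?_
  have h1 : (0:ℝ) < p - 1 := by linarith
  have : (0:ℝ) ≤ if 2 ≤ K then 1 / (p:ℝ) ^ K else 1 / p := by split_ifs <;> positivity
  have : (1 / ((p:ℝ) - 1)) * (1 / p - if 2 ≤ K then 1 / (p:ℝ) ^ K else 1 / p) ≤ (1 / (p - 1)) * (1 / p) := by
    gcongr; linarith
  refine this.trans (le_of_eq ?_)
  field_simp

lemma pp_sum_le (q N : ℕ) (hq : 2 ≤ q) (hqN : q ≤ N) :
    ∑ d ∈ (Ioc 0 N).filter (fun d => Rq q d ∧ ¬ d.Prime), Λ d / d ≤ ∑ p ∈ Ioc (q-1) N, la p * (1 / ((p:ℝ) * (p-1))) := by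
  have hnn : ∀ d : ℕ, 0 ≤ Λ d / (d:ℝ) := fun d => div_nonneg vonMangoldt_nonneg (Nat.cast_nonneg d)
  set S := ((Ioc (q-1) N).filter Nat.Prime) ×ˢ (Icc 2 N) with hS
  have h1 : ∑ d ∈ (Ioc 0 N).filter (fun d => Rq q d ∧ ¬ d.Prime), Λ d / d ≤ ∑ d ∈ S.image (fun x => x.1 ^ x.2), Λ d / (d:ℝ) := by
    rw [← sum_filter_add_sum_filter_not _ (fun d => IsPrimePow d)]
    have z : ∑ d ∈ ((Ioc 0 N).filter (fun d => Rq q d ∧ ¬ d.Prime)).filter (fun d => ¬ IsPrimePow d), Λ d / (d:ℝ) = 0 := by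
      refine sum_eq_zero fun d hd => ?_
      rw [vonMangoldt_eq_zero_iff.2 (mem_filter.1 hd).2, zero_div]
    rw [z, add_zero]
    refine sum_le_sum_of_subset_of_nonneg ?_ fun d _ _ => hnn d
    intro d hd
    simp only [mem_filter, mem_Ioc] at hd
    obtain ⟨⟨⟨h0, hN⟩, hR, hnp⟩, hpp⟩ := hd
    obtain ⟨p, k, hp, hk, rfl⟩ := (isPrimePow_nat_iff d).1 hpp
    have hqp := hR p hp (dvd_pow_self p hk.ne')
    have hk2 : 2 ≤ k := by
      by_contra hc
      obtain rfl : k = 1 := by omega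
      exact hnp (by simpa using hp)
    have hpk : p ≤ p ^ k := Nat.le_self_pow hk.ne' p
    have hkk : k < p ^ k := Nat.lt_pow_self hp.one_lt
    rw [mem_image]
    refine ⟨(p, k), ?_, rfl⟩
    rw [hS, mem_product, mem_filter, mem_Ioc, mem_Icc]
    exact ⟨⟨⟨by simp; omega, by simp; omega⟩, hp⟩, hk2, by simp; omega⟩
  refine h1.trans ((sum_image_le_of_nonneg (fun d _ => hnn d)).trans ?_)
  rw [hS, sum_product, sum_filter]
  refine sum_le_sum fun p hp => ?_
  rw [mem_Ioc] at hp
  unfold la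
  split_ifs with hpr
  · have e : ∀ k ∈ Icc 2 N, Λ (p ^ k) / ((p ^ k : ℕ) : ℝ) = Real.log p * (1 / (p:ℝ) ^ k) := by
      intro k hk
      rw [vonMangoldt_apply_pow (by have := (mem_Icc.1 hk).1; omega), vonMangoldt_apply_prime hpr]
      push_cast; ring
    rw [sum_congr rfl e, ← mul_sum]
    exact mul_le_mul_of_nonneg_left (pp_geom p N (by omega)) (Real.log_natCast_nonneg p)
  · simp

lemma inv_tel (q N : ℕ) (hq : 1 ≤ q) (h : q ≤ N) : ∑ m ∈ Ioc q N, 1 / ((m:ℝ) * (m-1)) = 1 / q - 1 / N := by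
  induction N, h using Nat.le_induction with
  | base => simp
  | succ N hN ih =>
    rw [← Finset.insert_Ioc_right_eq_Ioc_add_one hN, sum_insert (by simp), ih]
    have : (0:ℝ) < N := by exact_mod_cast (by omega : 0 < N)
    push_cast
    rw [add_sub_cancel_right]
    have hq0 : (0:ℝ) < q := by exact_mod_cast hq
    field_simp; ring

lemma pp_bound (q N : ℕ) (hq : 2 ≤ q) (hqN : q ≤ N) (t : ℝ) (ht : t * q ≤ th (q-1)) :
    ∑ d ∈ (Ioc 0 N).filter (fun d => Rq q d ∧ ¬ d.Prime), Λ d / d ≤ (1.02 - t) / (q - 1) + 1.02 / q := by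
  refine (pp_sum_le q N hq hqN).trans ?_
  have hq' : (2:ℝ) ≤ q := by exact_mod_cast hq
  have h1 : (0:ℝ) < q - 1 := by linarith
  have hN' : (2:ℝ) ≤ N := by exact_mod_cast hq.trans hqN
  have := prime_sum q N hq hqN 1.02 (fun m => 1 / ((m:ℝ) * (m-1))) (by
    intro m hm _
    have hm' : (2:ℝ) ≤ m := by exact_mod_cast hq.trans hm
    have : (0:ℝ) < m - 1 := by linarith
    push_cast
    gcongr <;> linarith) (by
      have : (0:ℝ) < N - 1 := by linarith
      positivity) (fun m _ _ => th102 m)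
  refine this.trans ?_
  rw [inv_tel q N (by omega) hqN]
  have a1 : (1.02 * q - th (q-1)) * (1 / ((q:ℝ) * (q-1))) ≤ (1.02 * q - t * q) * (1 / ((q:ℝ) * (q-1))) := by gcongr
  have a2 : (1.02 * q - t * q) * (1 / ((q:ℝ) * (q-1))) = (1.02 - t) / (q - 1) := by field_simp
  have a3 : (0:ℝ) < 1 / N := by positivity
  have a4 : (1.02:ℝ) / q = 1.02 * (1 / q) := by ring
  linarith

lemma Pp_le (q N : ℕ) (hq : 2 ≤ q) (hqN : q ≤ N) (t : ℝ) (ht : t * q ≤ th (q-1)) :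
    Pp q N ≤ N * ((1.02 - t) / (q - 1) + 1.02 / q) := by
  have := mul_le_mul_of_nonneg_left (pp_bound q N hq hqN t ht) (Nat.cast_nonneg (α := ℝ) N)
  refine le_trans ?_ this
  rw [mul_sum, Pp]
  refine sum_le_sum fun d _ => ?_
  have h1 : (F q (N / d) : ℝ) ≤ N / d := le_trans (by exact_mod_cast F_le q _) Nat.cast_div_le
  have := mul_le_mul_of_nonneg_left h1 (vonMangoldt_nonneg (n := d))
  refine this.trans (le_of_eq ?_); ring

lemma Pp_le3 (q N : ℕ) (hq : 5 ≤ q) (hqN : q ≤ N) (hN : 10609 ≤ N) (t : ℝ) (ht : t * q ≤ th (q-1)) :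
    Pp q N ≤ N * ((1.02 - t) / (q - 1) + 1.02 / q) / 3 + 0.9 * Real.sqrt N := by
  have h1 := mul_le_mul_of_nonneg_left (pp_bound q N (by omega) hqN t ht) (Nat.cast_nonneg (α := ℝ) N)
  have h2 := psi_sub_th_gen N hN
  have h3 : ∑ d ∈ (Ioc 0 N).filter (fun d => Rq q d ∧ ¬ d.Prime), Λ d ≤ psi N - th N := by
    unfold psi th
    rw [← sum_filter_add_sum_filter_not (Ioc 0 N) Nat.Prime]
    rw [sum_congr rfl (fun p hp => vonMangoldt_apply_prime (mem_filter.1 hp).2)]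
    rw [add_sub_cancel_left]
    refine sum_le_sum_of_subset_of_nonneg ?_ fun d _ _ => vonMangoldt_nonneg
    intro d hd; simp only [mem_filter] at hd ⊢; exact ⟨hd.1, hd.2.2⟩
  have h4 : Pp q N ≤ (N * ∑ d ∈ (Ioc 0 N).filter (fun d => Rq q d ∧ ¬ d.Prime), Λ d / d) / 3 + 2 / 3 * ∑ d ∈ (Ioc 0 N).filter (fun d => Rq q d ∧ ¬ d.Prime), Λ d := by
    rw [mul_sum, sum_div, mul_sum, ← sum_add_distrib, Pp]
    refine sum_le_sum fun d _ => ?_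
    have h1 : 3 * (F q (N / d) : ℝ) ≤ (N / d : ℕ) + 2 := by exact_mod_cast F_le3 q _ hq
    have h2 : ((N / d : ℕ) : ℝ) ≤ N / d := Nat.cast_div_le
    have h3 : (F q (N / d) : ℝ) ≤ N / d / 3 + 2 / 3 := by linarith
    have := mul_le_mul_of_nonneg_left h3 (vonMangoldt_nonneg (n := d))
    refine this.trans (le_of_eq ?_); ring
  linarith
end PS
end


section
open ArithmeticFunction
namespace PS

lemma log_nat_pos (n : ℕ) (hn : 2 ≤ n) : 0 < Real.log n := Real.log_pos (by exact_mod_cast (by omega : 1 < n))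

lemma pr1_log (n : ℕ) (hn : 2 ≤ n) (x : ℝ) : pr1 n * x = la n * (x / Real.log n) := by
  have := log_nat_pos n hn
  unfold pr1 la; split_ifs
  · field_simp
  · simp

lemma G1_le (q : ℕ) (hq : 2 ≤ q) (L : ℝ) (hL : L = Real.log q) (hL3 : 3 < L) (c c3 : ℝ) (hc0 : 0 ≤ c) (hc3 : 2 ≤ c3 * (1 - 3 / L))
    (hc : ∀ m, q ≤ m → m ≤ q ^ 2 → th m ≤ c * m) :
    Dd q (q^2) ≤ 2 * L + c * (q^2 * (1 / (2 * L) + c3 / (4 * L^2)) - q * (2 / L + 2 * c3 / L^2)) - th (q-1) := by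
  have hq2 : q < q ^ 2 := by nlinarith
  have hl2 : Real.log ((q^2 : ℕ) : ℝ) = 2 * L := by push_cast; rw [Real.log_pow, hL]; push_cast; ring
  have hL0 : 0 < L := by linarith
  have e1 : Dd q (q^2) = 2 * L + ∑ n ∈ Ioc (q-1) (q^2-1), la n * (2 * L / Real.log n - 1) := by
    unfold Dd
    rw [hl2]
    have : Ioc 0 (q^2) = insert (q^2) (Ioc 0 (q^2-1)) := by ext x; simp only [mem_Ioc, mem_insert]; omega
    have e : ∑ n ∈ (Ioc 0 (q^2)).filter (Rq q), (2 * L - Real.log n) = ∑ n ∈ (Ioc 0 (q^2-1)).filter (Rq q), (2 * L - Real.log n) := by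
      rw [this, filter_insert]
      split_ifs
      · rw [sum_insert (by rw [mem_filter, mem_Ioc]; omega), hl2]; ring
      · rfl
    rw [e, sum_Rq_small' q hq _ _ (by omega) (by omega)]
    simp only [Nat.cast_one, Real.log_one, sub_zero]
    congr 1
    refine sum_congr rfl fun n hn => ?_
    have hn2 : 2 ≤ n := by have := mem_Ioc.1 hn; omega
    rw [pr1_log n hn2]
    have := log_nat_pos n hn2
    congr 1; field_simp
  have e2 : ∑ n ∈ Ioc (q-1) (q^2), la n * (2 * L / Real.log n - 1) = ∑ n ∈ Ioc (q-1) (q^2-1), la n * (2 * L / Real.log n - 1) := by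
    have : Ioc (q-1) (q^2) = insert (q^2) (Ioc (q-1) (q^2-1)) := by ext x; simp only [mem_Ioc, mem_insert]; omega
    rw [this, sum_insert (by simp; omega), hl2, div_self (by linarith)]; ring
  have h := prime_sum q (q^2) hq hq2.le c (fun n => 2 * L / Real.log n - 1) (by
    intro m hm _
    have h1 := log_nat_pos m (by omega)
    have : Real.log m ≤ Real.log ((m+1 : ℕ) : ℝ) := Real.log_le_log (by exact_mod_cast (by omega : 0 < m)) (by push_cast; linarith)
    have : 2 * L / Real.log ((m+1 : ℕ) : ℝ) ≤ 2 * L / Real.log m := by gcongr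
    linarith) (by simp only [hl2]; rw [div_self (by linarith)]; simp) hc
  rw [← hL, e2] at h
  have h1 := sum_inv_log c3 q (q^2) hq hq2.le (by rw [← hL]; exact hL3) (by rw [← hL]; exact hc3)
  have e3 : ∑ m ∈ Ioc q (q^2), (2 * L / Real.log m - 1) = 2 * L * ∑ m ∈ Ioc q (q^2), 1 / Real.log m - (q^2 - q) := by
    rw [mul_sum, sum_sub_distrib]
    congr 1
    · refine sum_congr rfl fun m _ => by ring
    · simp [Nat.cast_sub hq2.le]
  rw [e3] at h
  have e4 : 2 * L * (Hf c3 ((q^2 : ℕ) : ℝ) - Hf c3 q) = q^2 * (1 + 1 / (2 * L) + c3 / (4 * L^2)) - q * (2 + 2 / L + 2 * c3 / L^2) := by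
    unfold Hf
    rw [hl2, ← hL]; push_cast; field_simp; ring
  have h2 : 2 * L * ∑ m ∈ Ioc q (q^2), 1 / Real.log m ≤ q^2 * (1 + 1 / (2 * L) + c3 / (4 * L^2)) - q * (2 + 2 / L + 2 * c3 / L^2) := by
    rw [← e4]; gcongr
  have h3 : c * (2 * L * ∑ m ∈ Ioc q (q^2), 1 / Real.log m - (q^2 - q)) ≤ c * (q^2 * (1 + 1 / (2 * L) + c3 / (4 * L^2)) - q * (2 + 2 / L + 2 * c3 / L^2) - (q^2 - q)) := by
    gcongr
  rw [e1]
  have e5 : (c * q - th (q-1)) * (2 * L / L - 1) = c * q - th (q-1) := by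
    have : 2 * L / L - 1 = 1 := by field_simp; ring
    rw [this, mul_one]
  rw [e5] at h
  nlinarith

/-- main term, two almost-prime range -/
lemma main2 (q N : ℕ) (hq : 2 ≤ q) (h2 : q^2 ≤ N) (h3 : N < q^3) (L v s c c' t : ℝ) (hL : L = Real.log q)
    (hv : Real.log N = (v + 1) * L) (hs : s * N = q^2) (ht0 : 0 ≤ t) (htc' : t ≤ c')
    (ht : t * q ≤ th (q-1)) (hc0 : 0 ≤ c) (hc : ∀ m, m ≤ N / q → th m ≤ c * m) (hc' : ∀ m, q ≤ m → m < q^2 → th m ≤ c' * m) :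
    ∑ p ∈ Ioc (q-1) N, la p * F q (N / p) ≤ N * (1.02 + (c' - t) * (c - t * s) / L + c' * c * Real.log v - c' * t * (1 - s * (1 + 1 / q)) / (v * L)) := by
  have hq0 : 0 < q := by omega
  have hqr : (0:ℝ) < q := by exact_mod_cast hq0
  have hL0 : 0 < L := by rw [hL]; exact log_nat_pos q hq
  have hqN : q ≤ N := le_trans (by nlinarith) h2
  have hNr : (0:ℝ) < N := by exact_mod_cast hq0.trans_le hqN
  set W := N / q with hW
  have hqW : q ≤ W := by rw [hW, Nat.le_div_iff_mul_le hq0]; nlinarith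
  have hWq2 : W < q ^ 2 := by rw [hW, Nat.div_lt_iff_lt_mul hq0]; nlinarith
  have hWr : (W:ℝ) ≤ N / q := Nat.cast_div_le
  have hW2 : (N:ℝ) - q ≤ q * W := by
    have := Nat.div_add_mod N q; have h' := Nat.mod_lt N hq0
    rw [← hW] at this
    have : N ≤ q * W + q := by omega
    have : (N:ℝ) ≤ q * W + q := by exact_mod_cast this
    linarith
  have hth : th (q-1) ≤ c * q := by
    refine (hc (q-1) (by omega)).trans ?_
    have : ((q-1 : ℕ):ℝ) ≤ q := by exact_mod_cast (by omega : q - 1 ≤ q)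
    gcongr
  rw [big_part q N (q-1) hq le_rfl (by omega) (by
    have : q - 1 + 1 = q := by omega
    rw [this]; calc N < q ^ 3 := h3
      _ = q^2 * q := by ring)]
  have hsub : Ioc (q-1) W ⊆ Ioc (q-1) (q^2-1) := Ioc_subset_Ioc_right (by omega)
  have e1 : ∑ r ∈ Ioc (q-1) (q^2-1), pr1 r * (th (max (N / r) (q-1)) - th (q-1)) = ∑ r ∈ Ioc (q-1) W, pr1 r * (th (max (N / r) (q-1)) - th (q-1)) := by
    symm
    refine sum_subset hsub fun r h4 h5 => ?_
    simp only [mem_Ioc, not_and, not_le] at h4 h5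
    have : W < r := h5 h4.1
    have : N / r < q := by
      rw [Nat.div_lt_iff_lt_mul (by omega)]
      rw [hW, Nat.div_lt_iff_lt_mul hq0] at this
      nlinarith
    rw [max_eq_right (by omega)]; ring
  set f : ℕ → ℝ := fun r => (c * N / r - th (q-1)) / Real.log r with hf
  have hnum : ∀ m : ℕ, q ≤ m → m ≤ W → 0 ≤ c * N / m - th (q-1) := by
    intro m h4 h5
    have hm0 : (0:ℝ) < m := by exact_mod_cast hq0.trans_le h4
    have : (m:ℝ) ≤ N / q := le_trans (by exact_mod_cast h5) hWr
    have : (m:ℝ) * q ≤ N := by rwa [le_div_iff₀ hqr] at this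
    have : c * q ≤ c * N / m := by rw [le_div_iff₀ hm0]; nlinarith
    linarith
  have e2 : ∑ r ∈ Ioc (q-1) W, pr1 r * (th (max (N / r) (q-1)) - th (q-1)) ≤ ∑ r ∈ Ioc (q-1) W, la r * f r := by
    refine sum_le_sum fun r hr => ?_
    rw [mem_Ioc] at hr
    rw [pr1_log r (by omega)]
    have hl := log_nat_pos r (by omega)
    have hNr : q ≤ N / r := by
      rw [Nat.le_div_iff_mul_le (by omega)]
      have := (Nat.le_div_iff_mul_le hq0).1 hr.2
      nlinarith
    rw [max_eq_left (by omega)]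
    have h5 := hc (N / r) (Nat.div_le_div_left (by omega) hq0)
    have h6 : ((N / r : ℕ) : ℝ) ≤ N / r := Nat.cast_div_le
    have h7 : c * ((N / r : ℕ) : ℝ) ≤ c * N / r := by rw [mul_div_assoc]; gcongr
    have := la_nonneg r
    simp only [hf]
    gcongr
    linarith
  have e3 := prime_sum q W hq hqW c' f (by
    intro m h4 h5
    have hl := log_nat_pos m (by omega)
    have hm0 : (0:ℝ) < m := by exact_mod_cast hq0.trans_le h4
    simp only [hf]
    have := hnum m h4 h5.le
    have h8 : Real.log m ≤ Real.log ((m+1 : ℕ) : ℝ) := Real.log_le_log hm0 (by push_cast; linarith)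
    apply div_le_div₀ this _ hl h8
    push_cast
    gcongr; linarith) (by
      simp only [hf]; exact div_nonneg (hnum W hqW le_rfl) (log_nat_pos W (by omega)).le) (fun m h4 h5 => hc' m h4 (by omega))
  have hc'0 : 0 ≤ c' := ht0.trans htc'
  have e4 : ∑ m ∈ Ioc q W, f m = c * N * ∑ m ∈ Ioc q W, 1 / ((m:ℝ) * Real.log m) - th (q-1) * ∑ m ∈ Ioc q W, 1 / Real.log m := by
    rw [mul_sum, mul_sum, ← sum_sub_distrib]
    refine sum_congr rfl fun m hm => ?_
    have hm := mem_Ioc.1 hm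
    have hl := log_nat_pos m (by omega)
    have hm0 : (0:ℝ) < m := by exact_mod_cast (by omega : 0 < m)
    simp only [hf]; field_simp
  have hlW : Real.log W ≤ v * L := by
    have : Real.log W ≤ Real.log (N / q) := Real.log_le_log (by exact_mod_cast (by omega : 0 < W)) hWr
    rw [Real.log_div hNr.ne' hqr.ne', hv, ← hL] at this
    linarith
  have hlW0 : 0 < Real.log W := log_nat_pos W (by omega)
  have hLW : L ≤ Real.log W := by rw [hL]; exact Real.log_le_log hqr (by exact_mod_cast hqW)
  have hv1 : 1 ≤ v := by
    by_contra hcon; push Not at hcon; nlinarith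
  have e5 : ∑ m ∈ Ioc q W, 1 / ((m:ℝ) * Real.log m) ≤ Real.log v := by
    refine (sum_inv_mul_log q W hq hqW).trans ?_
    rw [← hL]
    apply Real.log_le_log (by positivity)
    rw [div_le_iff₀ hL0]; exact hlW
  have e6 : ((W:ℝ) - q) / (v * L) ≤ ∑ m ∈ Ioc q W, 1 / Real.log m := by
    have : ∑ m ∈ Ioc q W, 1 / (v * L) ≤ ∑ m ∈ Ioc q W, 1 / Real.log m := by
      refine sum_le_sum fun m hm => ?_
      have hm := mem_Ioc.1 hm
      have hl := log_nat_pos m (by omega)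
      have : Real.log m ≤ Real.log W := Real.log_le_log (by exact_mod_cast (by omega : 0 < m)) (by exact_mod_cast hm.2)
      exact one_div_le_one_div_of_le hl (by linarith)
    refine le_trans (le_of_eq ?_) this
    simp [Nat.cast_sub hqW]; ring
  have e7 : t * (N * (1 - s * (1 + 1 / q))) / (v * L) ≤ th (q-1) * ∑ m ∈ Ioc q W, 1 / Real.log m := by
    have h8 : N * (1 - s * (1 + 1 / q)) ≤ q * (W - q) := by
      have : N * (1 - s * (1 + 1 / q)) = N - (s * N) * (1 + 1/q) := by ring
      rw [this, hs]
      have : (q:ℝ)^2 * (1 + 1 / q) = q^2 + q := by field_simp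
      rw [this]; linarith
    have hWq' : (0:ℝ) ≤ W - q := by rw [sub_nonneg]; exact_mod_cast hqW
    have h9 : 0 ≤ ∑ m ∈ Ioc q W, 1 / Real.log m := le_trans (by positivity) e6
    calc t * (N * (1 - s * (1 + 1 / q))) / (v * L) ≤ t * (q * (W - q)) / (v * L) := by gcongr
      _ = (t * q) * ((W - q) / (v * L)) := by ring
      _ ≤ th (q-1) * ∑ m ∈ Ioc q W, 1 / Real.log m := by
        gcongr
        exact (mul_nonneg ht0 hqr.le).trans ht
  have e8 : (c' * q - th (q-1)) * f q ≤ N * ((c' - t) * (c - t * s) / L) := by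
    have hfq : f q ≤ N / q * (c - t * s) / L := by
      simp only [hf]; rw [← hL]
      have : (N:ℝ) / q * (c - t * s) = c * N / q - t * ((s * N) / q) := by ring
      rw [this, hs]
      have : (q:ℝ)^2 / q = q := by field_simp
      rw [this]
      gcongr
    have hfq0 : 0 ≤ f q := by simp only [hf]; rw [← hL]; exact div_nonneg (hnum q le_rfl hqW) hL0.le
    calc (c' * q - th (q-1)) * f q ≤ ((c' - t) * q) * (N / q * (c - t * s) / L) := by
          apply mul_le_mul _ hfq hfq0
          · exact mul_nonneg (by linarith) hqr.le
          · linarith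
      _ = _ := by field_simp
  have e9 : c' * ∑ m ∈ Ioc q W, f m ≤ c' * (c * N * Real.log v - t * (N * (1 - s * (1 + 1 / q))) / (v * L)) := by
    rw [e4]; gcongr
  have e10 := th102 N
  have e11 : 0 ≤ th (q-1) := (mul_nonneg ht0 hqr.le).trans ht
  rw [e1]
  have : N * (1.02 + (c' - t) * (c - t * s) / L + c' * c * Real.log v - c' * t * (1 - s * (1 + 1 / q)) / (v * L))
    = 1.02 * N + N * ((c' - t) * (c - t * s) / L) + c' * (c * N * Real.log v - t * (N * (1 - s * (1 + 1 / q))) / (v * L)) := by ring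
  rw [this]
  linarith

/-- main term, larger range, with induction hypothesis -/
lemma main3 (q N : ℕ) (hq : 2 ≤ q) (h3 : q^3 ≤ N) (L v c c' t d sig : ℝ) (hL : L = Real.log q)
    (hv : Real.log N = (v + 1) * L) (ht0 : 0 ≤ t) (htc' : t ≤ c') (hd : 0 ≤ c - 1 + d)
    (ht : t * q ≤ th (q-1)) (hc0 : 0 ≤ c) (hc : ∀ m, m ≤ N / q → th m ≤ c * m) (hc' : ∀ m, q ≤ m → m ≤ q^2 → th m ≤ c' * m)
    (hth : (1 - d) * (N / q^2 : ℝ) ≤ th (N / q^2)) (hsg : sg (N / q^2) - sg (q-1) ≤ Real.log ((N / q^2 : ℕ) : ℝ) - L + sig)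
    (ih : ∀ m, q^2 ≤ m → m < N → (F q m : ℝ) ≤ 0.6 / L * m) :
    ∑ p ∈ Ioc (q-1) N, la p * F q (N / p) ≤ N * (1.02 + (c' - t) * c / L + c' * c * Real.log 2 - c' * c * (1 - 1 / q) / (2 * L) + 0.6 * (c - 1 + d) / L + 0.6 * (v - 2) + 0.6 * sig / L) := by
  have hq0 : 0 < q := by omega
  have hqr : (0:ℝ) < q := by exact_mod_cast hq0
  have hL0 : 0 < L := by rw [hL]; exact log_nat_pos q hq
  have hq2 : q < q^2 := by nlinarith
  have hq23 : q^2 < q^3 := by nlinarith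
  have hqN : q ≤ N := by omega
  have hNr : (0:ℝ) < N := by exact_mod_cast hq0.trans_le hqN
  have hq20 : 0 < q^2 := by omega
  have hc'0 : 0 ≤ c' := ht0.trans htc'
  set w := N / q^2 with hw
  have hqw : q ≤ w := by rw [hw, Nat.le_div_iff_mul_le hq20]; calc q * q^2 = q^3 := by ring
      _ ≤ N := h3
  have hwr : (w:ℝ) ≤ N / q^2 := by have : (w:ℝ) ≤ N / ((q^2 : ℕ):ℝ) := Nat.cast_div_le
                                   simpa using this
  have hwN : w ≤ N := Nat.div_le_self _ _
  rw [← sum_Ioc_consecutive _ (by omega : q - 1 ≤ w) hwN]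
  have a1 : ∑ p ∈ Ioc (q-1) w, la p * F q (N / p) ≤ N * (0.6 * (v - 2) + 0.6 * sig / L) := by
    have b1 : ∑ p ∈ Ioc (q-1) w, la p * F q (N / p) ≤ ∑ p ∈ Ioc (q-1) w, 0.6 / L * N * (la p / p) := by
      refine sum_le_sum fun p hp => ?_
      rw [mem_Ioc] at hp
      have hp0 : 0 < p := by omega
      have hp2 := (Nat.le_div_iff_mul_le hq20).1 hp.2
      have b2 := ih (N / p) (by rw [Nat.le_div_iff_mul_le hp0, mul_comm]; exact hp2) (Nat.div_lt_self (by omega) (by omega))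
      have b3 : ((N / p : ℕ) : ℝ) ≤ N / p := Nat.cast_div_le
      have b4 : (F q (N / p) : ℝ) ≤ 0.6 / L * (N / p) := b2.trans (by gcongr)
      have := mul_le_mul_of_nonneg_left b4 (la_nonneg p)
      refine this.trans (le_of_eq ?_); ring
    rw [← mul_sum, Ioc_sub (fun p : ℕ => la p / p) _ _ (by omega : q - 1 ≤ w), ← sg_la, ← sg_la] at b1
    have b5 : Real.log w ≤ (v - 1) * L := by
      have : Real.log w ≤ Real.log (N / q^2) := Real.log_le_log (by exact_mod_cast (by omega : 0 < w)) hwr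
      rw [Real.log_div hNr.ne' (by positivity), hv, Real.log_pow, ← hL] at this
      push_cast at this; linarith
    have b6 : 0.6 / L * N * (sg w - sg (q-1)) ≤ 0.6 / L * N * ((v - 2) * L + sig) := by
      gcongr; linarith
    refine b1.trans (b6.trans (le_of_eq ?_)); field_simp
  have hbig := big_part q N w hq (by omega) hwN (by
    have := Nat.div_add_mod N (q^2); have h' := Nat.mod_lt N hq20
    rw [← hw] at this; nlinarith)
  rw [hbig]
  set f : ℕ → ℝ := fun r => c * N * (1 / r - 1 / q^2) / Real.log r with hf
  have hS : ∑ r ∈ Ioc (q-1) (q^2-1), pr1 r ≤ 0.6 / L * q^2 := by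
    have b1 := F_small q hq (q^2-1) (by omega) (by omega)
    have b2 := ih (q^2) le_rfl (by omega)
    have b3 : (F q (q^2-1) : ℝ) ≤ F q (q^2) := by exact_mod_cast F_mono q (by omega)
    push_cast at b2
    linarith
  have hS0 : 0 ≤ ∑ r ∈ Ioc (q-1) (q^2-1), pr1 r := sum_nonneg fun r _ => by unfold pr1; split_ifs <;> simp
  have a2 : ∑ r ∈ Ioc (q-1) (q^2-1), pr1 r * (th (max (N / r) w) - th w) ≤ ∑ r ∈ Ioc (q-1) (q^2-1), la r * f r + (c * N / q^2 - th w) * ∑ r ∈ Ioc (q-1) (q^2-1), pr1 r := by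
    rw [mul_sum, ← sum_add_distrib]
    refine sum_le_sum fun r hr => ?_
    rw [mem_Ioc] at hr
    have hl := log_nat_pos r (by omega)
    have hr0 : (0:ℝ) < r := by exact_mod_cast (by omega : 0 < r)
    rw [max_eq_left (Nat.div_le_div_left (by omega) (by omega))]
    have h5 := hc (N / r) (Nat.div_le_div_left (by omega) hq0)
    have h6 : ((N / r : ℕ) : ℝ) ≤ N / r := Nat.cast_div_le
    have h7 : c * ((N / r : ℕ) : ℝ) ≤ c * N / r := by rw [mul_div_assoc]; gcongr
    have e : la r * f r = pr1 r * (c * N * (1 / r - 1 / q^2)) := by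
      rw [pr1_log r (by omega)]
    rw [e, mul_comm (c * N / (q:ℝ)^2 - th w), ← mul_add]
    have hp : 0 ≤ pr1 r := by unfold pr1; split_ifs <;> simp
    refine mul_le_mul_of_nonneg_left ?_ hp
    have : c * N * (1 / (r:ℝ) - 1 / q^2) = c * N / r - c * N / q^2 := by ring
    linarith
  have a3 : (c * N / q^2 - th w) * ∑ r ∈ Ioc (q-1) (q^2-1), pr1 r ≤ N * (0.6 * (c - 1 + d) / L) := by
    have b1 : c * N / q^2 - th w ≤ (c - 1 + d) * (N / q^2) := by
      have : c * N / q^2 = c * (N / q^2) := by ring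
      linarith
    calc (c * N / q^2 - th w) * ∑ r ∈ Ioc (q-1) (q^2-1), pr1 r ≤ ((c - 1 + d) * (N / q^2)) * ∑ r ∈ Ioc (q-1) (q^2-1), pr1 r := by gcongr
      _ ≤ ((c - 1 + d) * (N / q^2)) * (0.6 / L * q^2) := by gcongr
      _ = _ := by field_simp
  have hfz : f (q^2) = 0 := by simp [hf]
  have a4 : ∑ r ∈ Ioc (q-1) (q^2-1), la r * f r = ∑ r ∈ Ioc (q-1) (q^2), la r * f r := by
    have : Ioc (q-1) (q^2) = insert (q^2) (Ioc (q-1) (q^2-1)) := by ext x; simp only [mem_Ioc, mem_insert]; omega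
    rw [this, sum_insert (by simp; omega), hfz]; ring
  have a5 := prime_sum q (q^2) hq hq2.le c' f (by
    intro m h4 h5
    have hl := log_nat_pos m (by omega)
    have hm0 : (0:ℝ) < m := by exact_mod_cast hq0.trans_le h4
    simp only [hf]
    have h8 : Real.log m ≤ Real.log ((m+1 : ℕ) : ℝ) := Real.log_le_log hm0 (by push_cast; linarith)
    have h9 : (1:ℝ) / q^2 ≤ 1 / m := one_div_le_one_div_of_le hm0 (by exact_mod_cast h5.le)
    have h10 : (1:ℝ) / ((m+1 : ℕ):ℝ) ≤ 1 / m := one_div_le_one_div_of_le hm0 (by push_cast; linarith)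
    apply div_le_div₀ _ _ hl h8
    · exact mul_nonneg (by positivity) (by linarith)
    · gcongr) hfz.ge hc'
  have hfq : f q ≤ c * N / q / L := by
    simp only [hf]; rw [← hL]
    gcongr
    have : c * N / q = c * N * (1 / q) := by ring
    rw [this]
    gcongr
    have : (0:ℝ) < 1 / q^2 := by positivity
    linarith
  have hfq0 : 0 ≤ f q := by
    simp only [hf]; rw [← hL]
    have h9 : (1:ℝ) / q^2 ≤ 1 / q := one_div_le_one_div_of_le hqr (by exact_mod_cast hq2.le)
    have : 0 ≤ (1:ℝ) / q - 1 / q^2 := by linarith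
    positivity
  have a6 : (c' * q - th (q-1)) * f q ≤ N * ((c' - t) * c / L) := by
    calc (c' * q - th (q-1)) * f q ≤ ((c' - t) * q) * (c * N / q / L) := by
          apply mul_le_mul _ hfq hfq0
          · exact mul_nonneg (by linarith) hqr.le
          · linarith
      _ = _ := by field_simp
  have a7 : ∑ m ∈ Ioc q (q^2), f m = c * N * ∑ m ∈ Ioc q (q^2), 1 / ((m:ℝ) * Real.log m) - c * N / q^2 * ∑ m ∈ Ioc q (q^2), 1 / Real.log m := by
    rw [mul_sum, mul_sum, ← sum_sub_distrib]
    refine sum_congr rfl fun m hm => ?_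
    have hm := mem_Ioc.1 hm
    have hl := log_nat_pos m (by omega)
    have hm0 : (0:ℝ) < m := by exact_mod_cast (by omega : 0 < m)
    simp only [hf]; field_simp
  have hl2 : Real.log ((q^2 : ℕ) : ℝ) = 2 * L := by push_cast; rw [Real.log_pow, hL]; push_cast; ring
  have a8 : ∑ m ∈ Ioc q (q^2), 1 / ((m:ℝ) * Real.log m) ≤ Real.log 2 := by
    refine (sum_inv_mul_log q (q^2) hq hq2.le).trans (le_of_eq ?_)
    rw [hl2, ← hL]; congr 1; field_simp
  have a9 : ((q:ℝ)^2 - q) / (2 * L) ≤ ∑ m ∈ Ioc q (q^2), 1 / Real.log m := by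
    have : ∑ m ∈ Ioc q (q^2), 1 / (2 * L) ≤ ∑ m ∈ Ioc q (q^2), 1 / Real.log m := by
      refine sum_le_sum fun m hm => ?_
      have hm := mem_Ioc.1 hm
      have hl := log_nat_pos m (by omega)
      have : Real.log m ≤ Real.log ((q^2 : ℕ):ℝ) := Real.log_le_log (by exact_mod_cast (by omega : 0 < m)) (by exact_mod_cast hm.2)
      exact one_div_le_one_div_of_le hl (by linarith)
    refine le_trans (le_of_eq ?_) this
    simp [Nat.cast_sub hq2.le]; ring
  have a10 : c' * ∑ m ∈ Ioc q (q^2), f m ≤ N * (c' * c * Real.log 2 - c' * c * (1 - 1 / q) / (2 * L)) := by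
    have b1 : c * N / q^2 * (((q:ℝ)^2 - q) / (2 * L)) ≤ c * N / q^2 * ∑ m ∈ Ioc q (q^2), 1 / Real.log m := by gcongr
    have b2 : c * N / q^2 * (((q:ℝ)^2 - q) / (2 * L)) = c * N * (1 - 1 / q) / (2 * L) := by field_simp
    rw [b2] at b1
    have b3 : c * N * ∑ m ∈ Ioc q (q^2), 1 / ((m:ℝ) * Real.log m) ≤ c * N * Real.log 2 := by gcongr
    have b4 : ∑ m ∈ Ioc q (q^2), f m ≤ c * N * Real.log 2 - c * N * (1 - 1 / q) / (2 * L) := by rw [a7]; linarith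
    calc c' * ∑ m ∈ Ioc q (q^2), f m ≤ c' * (c * N * Real.log 2 - c * N * (1 - 1 / q) / (2 * L)) := by gcongr
      _ = _ := by ring
  have a11 := th102 N
  have a12 : 0 ≤ th w := by
    have := th_mono (Nat.zero_le w)
    have h0 : th 0 = 0 := by simp [th]
    linarith
  rw [a4] at a2
  have : N * (1.02 + (c' - t) * c / L + c' * c * Real.log 2 - c' * c * (1 - 1 / q) / (2 * L) + 0.6 * (c - 1 + d) / L + 0.6 * (v - 2) + 0.6 * sig / L)
    = 1.02 * N + N * ((c' - t) * c / L) + N * (c' * c * Real.log 2 - c' * c * (1 - 1 / q) / (2 * L)) + N * (0.6 * (c - 1 + d) / L) + N * (0.6 * (v - 2) + 0.6 * sig / L) := by ring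
  rw [this]
  linarith
end PS
end


section
open ArithmeticFunction
namespace PS

lemma Dq2 (q : ℕ) (hq : 2 ≤ q) (L : ℝ) (hL : L = Real.log q) (c c3 t L0 B0 Z iq e0 : ℝ) (hL3 : 3 < L0) (hL0 : L0 ≤ L) (hc0 : 0 ≤ c)
    (hc30 : 0 ≤ c3) (hc3 : 2 ≤ c3 * (1 - 3 / L0))
    (hc : ∀ m, q ≤ m → m ≤ q ^ 2 → th m ≤ c * m) (ht : t * q ≤ th (q-1))
    (hB : c / 2 - 0.6 + c * c3 / (4 * L0) ≤ B0) (hB0 : 0 ≤ B0) (hZ0 : 0 ≤ Z)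
    (hZ : 2 * L / q - t - 2 * c / L - 2 * c * c3 / L^2 ≤ - Z) (hiq : iq ≤ 1 / q) (he : B0 / L0 - Z * iq ≤ e0) :
    Dd q (q^2) ≤ (q:ℝ)^2 * (0.6 / L + e0) := by
  have hL1 : 0 < L := by linarith
  have hL01 : 0 < L0 := by linarith
  have hqr : (0:ℝ) < q := by positivity
  have h3 : 2 ≤ c3 * (1 - 3 / L) := by
    refine hc3.trans (mul_le_mul_of_nonneg_left ?_ hc30)
    have : 3 / L ≤ 3 / L0 := by gcongr
    linarith
  have h := G1_le q hq L hL (by linarith) c c3 hc0 h3 hc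
  have hb : c / 2 - 0.6 + c * c3 / (4 * L) ≤ B0 := by
    refine le_trans ?_ hB
    have : c * c3 / (4 * L) ≤ c * c3 / (4 * L0) := by gcongr
    linarith
  have h1 : (c / 2 - 0.6 + c * c3 / (4 * L)) / L ≤ B0 / L0 :=
    (div_le_div_of_nonneg_right hb hL1.le).trans (by gcongr)
  have h2 : (2 * L / q - t - 2 * c / L - 2 * c * c3 / L^2) * (1 / q) ≤ - Z * iq := by
    refine (mul_le_mul_of_nonneg_right hZ (by positivity)).trans ?_
    nlinarith [mul_le_mul_of_nonneg_left hiq hZ0]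
  have h4 : (c / 2 - 0.6 + c * c3 / (4 * L)) / L + (2 * L / q - t - 2 * c / L - 2 * c * c3 / L^2) * (1 / q) ≤ e0 := by linarith
  have h5 := mul_le_mul_of_nonneg_left h4 (by positivity : (0:ℝ) ≤ q^2)
  have e : (q:ℝ)^2 * ((c / 2 - 0.6 + c * c3 / (4 * L)) / L + (2 * L / q - t - 2 * c / L - 2 * c * c3 / L^2) * (1 / q))
    = 2 * L + c * (q^2 * (1 / (2 * L) + c3 / (4 * L^2)) - q * (2 / L + 2 * c3 / L^2)) - t * q - q^2 * (0.6 / L) := by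
    field_simp
    ring
  linarith

lemma comb2 (q N : ℕ) (hq : 2 ≤ q) (h2 : q^2 ≤ N) (h3 : N < q^3) (L v s c c' t e pb : ℝ) (hL : L = Real.log q)
    (hv : Real.log N = (v + 1) * L) (hs : s * N = q^2) (ht0 : 0 ≤ t) (htc' : t ≤ c')
    (ht : t * q ≤ th (q-1)) (hc0 : 0 ≤ c) (hc : ∀ m, m ≤ N / q → th m ≤ c * m) (hc' : ∀ m, q ≤ m → m < q^2 → th m ≤ c' * m)
    (hD : Dd q (q^2) ≤ (q:ℝ)^2 * (0.6 / L + e)) (hPp : Pp q N ≤ N * pb)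
    (ih : ∀ m, q^2 ≤ m → m < N → (F q m : ℝ) ≤ 0.6 / L * m)
    (H : 1.02 + ((c' - t) * (c - t * s) + 0.6 - c' * t * (1 - s * (1 + 1 / q)) / v) / L + e * s + pb + c' * c * Real.log v < 0.6 * (v + 1)) :
    (F q N : ℝ) < 0.6 / L * N := by
  have hqr : (0:ℝ) < q := by positivity
  have hL0 : 0 < L := by rw [hL]; exact log_nat_pos q hq
  have hqN : q ≤ N := le_trans (by nlinarith) h2
  have hNr : (0:ℝ) < N := by exact_mod_cast (show 0 < q by omega).trans_le hqN
  have hlN : 0 < Real.log N := log_nat_pos N (hq.trans hqN)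
  have h1 := main2 q N hq h2 h3 L v s c c' t hL hv hs ht0 htc' ht hc0 hc hc'
  have hDd := Dd_le q (q^2) N (0.6 / L) (by positivity) (by nlinarith) h2 ih
  have h4 := F_log q N
  rw [Ls_split q N hq hqN] at h4
  push_cast at hDd
  have h5 : (F q N : ℝ) * Real.log N ≤ N * (1.02 + ((c' - t) * (c - t * s) + 0.6 - c' * t * (1 - s * (1 + 1 / q)) / v) / L + e * s + pb + c' * c * Real.log v) := by
    have e1 : (q:ℝ)^2 * e = N * (e * s) := by rw [← hs]; ring
    have e2 : c' * t * (1 - s * (1 + 1 / q)) / (v * L) = c' * t * (1 - s * (1 + 1 / q)) / v / L := by rw [div_div]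
    rw [e2] at h1
    have e3 : (N:ℝ) * (1.02 + ((c' - t) * (c - t * s) + 0.6 - c' * t * (1 - s * (1 + 1 / q)) / v) / L + e * s + pb + c' * c * Real.log v)
      = N * (1.02 + (c' - t) * (c - t * s) / L + c' * c * Real.log v - c' * t * (1 - s * (1 + 1 / q)) / v / L) + 0.6 / L * N + N * (e * s) + N * pb := by
      ring
    rw [e3, h4]
    have e4 : 0.6 / L * ((N:ℝ) - q^2) = 0.6 / L * N - q^2 * (0.6 / L) := by ring
    rw [e4] at hDd
    have e5 : (q:ℝ)^2 * (0.6 / L + e) = q^2 * (0.6 / L) + q^2 * e := by ring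
    rw [e5] at hD
    linarith
  have h6 := h5.trans_lt (mul_lt_mul_of_pos_left H hNr)
  have e6 : (N:ℝ) * (0.6 * (v + 1)) = 0.6 / L * N * Real.log N := by rw [hv]; field_simp
  rw [e6] at h6
  exact lt_of_mul_lt_mul_right h6 hlN.le

lemma comb3 (q N : ℕ) (hq : 2 ≤ q) (h3 : q^3 ≤ N) (L c c' t d sig e pb : ℝ) (hL : L = Real.log q)
    (ht0 : 0 ≤ t) (htc' : t ≤ c') (hd : 0 ≤ c - 1 + d)
    (ht : t * q ≤ th (q-1)) (hc0 : 0 ≤ c) (hc : ∀ m, m ≤ N / q → th m ≤ c * m) (hc' : ∀ m, q ≤ m → m ≤ q^2 → th m ≤ c' * m)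
    (hth : (1 - d) * (N / q^2 : ℝ) ≤ th (N / q^2)) (hsg : sg (N / q^2) - sg (q-1) ≤ Real.log ((N / q^2 : ℕ) : ℝ) - L + sig)
    (hD : Dd q (q^2) ≤ (q:ℝ)^2 * (0.6 / L + e)) (he : 0 ≤ e) (hPp : Pp q N ≤ N * pb)
    (ih : ∀ m, q^2 ≤ m → m < N → (F q m : ℝ) ≤ 0.6 / L * m)
    (L0 q0 : ℝ) (hL0 : 0 < L0) (hLL : L0 ≤ L) (hq0 : 0 < q0) (hqq : q0 ≤ q)
    (hX : 0 ≤ (c' - t) * c - c' * c * (1 - 1 / q0) / 2 + 0.6 * (c - 1 + d) + 0.6 * sig + 0.6)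
    (H : 1.02 + c' * c * 0.6931472 + ((c' - t) * c - c' * c * (1 - 1 / q0) / 2 + 0.6 * (c - 1 + d) + 0.6 * sig + 0.6) / L0 + e / q0 + pb < 1.8) :
    (F q N : ℝ) < 0.6 / L * N := by
  have hqr : (0:ℝ) < q := by positivity
  have hL0 : 0 < L := by rw [hL]; exact log_nat_pos q hq
  have h23 : q^2 ≤ q^3 := Nat.pow_le_pow_right (by omega) (by norm_num)
  have h2 : q^2 ≤ N := h23.trans h3
  have hqN : q ≤ N := le_trans (by nlinarith) h2
  have hNr : (0:ℝ) < N := by exact_mod_cast (show 0 < q by omega).trans_le hqN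
  have hlN : 0 < Real.log N := log_nat_pos N (hq.trans hqN)
  obtain ⟨v, hv⟩ : ∃ v, Real.log N = (v + 1) * L := ⟨Real.log N / L - 1, by field_simp; ring⟩
  have h1 := main3 q N hq h3 L v c c' t d sig hL hv ht0 htc' hd ht hc0 hc hc' hth hsg ih
  have hDd := Dd_le q (q^2) N (0.6 / L) (by positivity) (by nlinarith) h2 ih
  have h4 := F_log q N
  rw [Ls_split q N hq hqN] at h4
  push_cast at hDd
  set X := (c' - t) * c - c' * c * (1 - 1 / q0) / 2 + 0.6 * (c - 1 + d) + 0.6 * sig + 0.6 with hXd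
  have hc'0 : 0 ≤ c' := ht0.trans htc'
  have hX2 : ((c' - t) * c - c' * c * (1 - 1 / q) / 2 + 0.6 * (c - 1 + d) + 0.6 * sig + 0.6) / L ≤ X / L0 := by
    have : ((c' - t) * c - c' * c * (1 - 1 / q) / 2 + 0.6 * (c - 1 + d) + 0.6 * sig + 0.6) ≤ X := by
      have i : (1:ℝ) / q ≤ 1 / q0 := by gcongr
      have := mul_le_mul_of_nonneg_left i (mul_nonneg hc'0 hc0)
      rw [hXd]; linarith
    exact (div_le_div_of_nonneg_right this hL0.le).trans (by gcongr)
  have hl2 : c' * c * Real.log 2 ≤ c' * c * 0.6931472 :=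
    mul_le_mul_of_nonneg_left (by have := Real.log_two_lt_d9; linarith) (mul_nonneg hc'0 hc0)
  have hqe : (q:ℝ)^2 * e ≤ N * (e / q0) := by
    have i1 : (q:ℝ)^3 ≤ N := by exact_mod_cast h3
    have i2 : (q:ℝ)^2 * q0 ≤ N := le_trans (by nlinarith [sq_nonneg (q:ℝ)]) i1
    have : (q:ℝ)^2 * e = q^2 * q0 * (e / q0) := by field_simp
    rw [this]
    exact mul_le_mul_of_nonneg_right i2 (by positivity)
  have h5 : (F q N : ℝ) * Real.log N ≤ N * (1.02 + c' * c * 0.6931472 + X / L0 + e / q0 + pb + 0.6 * (v - 2)) := by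
    have e1 : (1.02 + (c' - t) * c / L + c' * c * Real.log 2 - c' * c * (1 - 1 / q) / (2 * L) + 0.6 * (c - 1 + d) / L + 0.6 * (v - 2) + 0.6 * sig / L)
      = 1.02 + ((c' - t) * c - c' * c * (1 - 1 / q) / 2 + 0.6 * (c - 1 + d) + 0.6 * sig + 0.6) / L + c' * c * Real.log 2 + 0.6 * (v - 2) - 0.6 / L := by
      field_simp; ring
    rw [e1] at h1
    have e2 : (1.02 + ((c' - t) * c - c' * c * (1 - 1 / q) / 2 + 0.6 * (c - 1 + d) + 0.6 * sig + 0.6) / L + c' * c * Real.log 2 + 0.6 * (v - 2) - 0.6 / L) ≤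
      1.02 + X / L0 + c' * c * 0.6931472 + 0.6 * (v - 2) - 0.6 / L := by linarith
    have h1' := h1.trans (mul_le_mul_of_nonneg_left e2 hNr.le)
    have e3 : (N:ℝ) * (1.02 + X / L0 + c' * c * 0.6931472 + 0.6 * (v - 2) - 0.6 / L) = N * (1.02 + c' * c * 0.6931472 + X / L0 + 0.6 * (v - 2)) - 0.6 / L * N := by ring
    rw [e3] at h1'
    have e4 : 0.6 / L * ((N:ℝ) - q^2) = 0.6 / L * N - q^2 * (0.6 / L) := by ring
    rw [e4] at hDd
    have e5 : (q:ℝ)^2 * (0.6 / L + e) = q^2 * (0.6 / L) + q^2 * e := by ring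
    rw [e5] at hD
    rw [h4]
    linarith
  have h6 := h5.trans_lt (mul_lt_mul_of_pos_left (by linarith : _ < 0.6 * (v + 1)) hNr)
  have e6 : (N:ℝ) * (0.6 * (v + 1)) = 0.6 / L * N * Real.log N := by rw [hv]; field_simp
  rw [e6] at h6
  exact lt_of_mul_lt_mul_right h6 hlN.le

/-- one cell of the numerical verification -/
lemma cell (q0 c c' t L0 e pb s0 lv v0 v1 : ℝ) (hq0 : 0 < q0) (hc : 0 ≤ c) (hc' : 0 ≤ c') (ht : 0 ≤ t) (htc : c' ≤ 2 * t) (he : 0 ≤ e) (hL0 : 0 < L0)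
    (hv0 : 1 ≤ v0) (hv1 : v1 ≤ 2) (hs0 : 1 ≤ s0 * (1 + (v0 - 1) * L0 / 16)^16) (hlv : Real.log v0 ≤ lv)
    (A1 : ℝ) (hA1 : A1 = (c' - t) * (c - t * s0) + 0.6 - c' * t * (1 - s0 * (1 + 1 / q0)) / v0)
    (A2 : ℝ) (hA2 : A2 = (c' - t) * (c - t * s0) + 0.6 - c' * t * (1 - s0 * (1 + 1 / q0)) / v1)
    (h1 : 0 ≤ A1) (h2 : 0 ≤ A2)
    (h3 : 1.02 + A1 / L0 + e * s0 + pb + c' * c * lv < 0.6 * (v0 + 1))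
    (h4 : 1.02 + A2 / L0 + e * s0 + pb + c' * c * lv < 0.6 * (v0 + 1))
    (h5 : 1.02 + A1 / L0 + e * s0 + pb + c' * c * lv + c' * c * (v1 - v0) / v0 < 0.6 * (v1 + 1))
    (h6 : 1.02 + A2 / L0 + e * s0 + pb + c' * c * lv + c' * c * (v1 - v0) / v0 < 0.6 * (v1 + 1))
    (q L v s : ℝ) (hq : q0 ≤ q) (hL : L0 ≤ L) (hv : v0 ≤ v) (hvv : v ≤ v1) (hsn : 0 ≤ s) (hs : s * Real.exp ((v - 1) * L) = 1) :
    1.02 + ((c' - t) * (c - t * s) + 0.6 - c' * t * (1 - s * (1 + 1 / q)) / v) / L + e * s + pb + c' * c * Real.log v < 0.6 * (v + 1) := by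
  have hss : s ≤ s0 := by
    have i1 : (1 + (v0 - 1) * L0 / 16)^16 ≤ Real.exp ((v - 1) * L) := by
      have j : (v0 - 1) * L0 ≤ (v - 1) * L := mul_le_mul (by linarith) hL hL0.le (by linarith)
      have j2 : 1 + (v0 - 1) * L0 / 16 ≤ Real.exp ((v - 1) * L / 16) := by
        have := Real.add_one_le_exp ((v - 1) * L / 16); linarith
      have : Real.exp ((v - 1) * L) = Real.exp ((v - 1) * L / 16) ^ 16 := by
        rw [← Real.exp_nat_mul]; congr 1; push_cast; ring
      rw [this]
      have : 0 ≤ (v0 - 1) * L0 := mul_nonneg (by linarith) hL0.le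
      exact pow_le_pow_left₀ (by positivity) j2 16
    have hs00 : 0 < s0 := by
      by_contra hh
      push Not at hh
      have : 0 ≤ (v0 - 1) * L0 := mul_nonneg (by linarith) hL0.le
      have := mul_nonpos_of_nonpos_of_nonneg hh (by positivity : 0 ≤ (1 + (v0 - 1) * L0 / 16)^16)
      linarith
    have i2 := hs0.trans (mul_le_mul_of_nonneg_left i1 hs00.le)
    exact le_of_mul_le_mul_right (hs.le.trans i2) (Real.exp_pos _)
  have hvp : 0 < v := by linarith
  have hv0p : 0 < v0 := by linarith
  have hv1p : 0 < v1 := by linarith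
  have hLp : 0 < L := by linarith
  have hlog : Real.log v ≤ lv + (v - v0) / v0 := by
    have := Real.log_le_sub_one_of_pos (div_pos hvp hv0p)
    rw [Real.log_div hvp.ne' hv0p.ne'] at this
    have e : v / v0 - 1 = (v - v0) / v0 := by field_simp
    linarith
  have hA : (c' - t) * (c - t * s) + 0.6 - c' * t * (1 - s * (1 + 1 / q)) / v ≤
      (c' - t) * (c - t * s0) + 0.6 - c' * t * (1 - s0 * (1 + 1 / q0)) / v := by
    have i1 : (1:ℝ) / q ≤ 1 / q0 := by gcongr
    have hqi : 0 ≤ 1 / q := by have : 0 < q := by linarith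
                               positivity
    have i3 : c' * t * (1 - s0 * (1 + 1 / q0)) / v ≤ c' * t * (1 - s0 * (1 + 1 / q)) / v := by
      gcongr; linarith
    have i4 : c' * t * (1 - s * (1 + 1 / q)) / v - c' * t * (1 - s0 * (1 + 1 / q)) / v = c' * t * ((s0 - s) * (1 + 1 / q)) / v := by ring
    have i5 : c' * t * ((s0 - s) * (1 + 1 / q)) / v ≥ c' * t * (s0 - s) / 2 := by
      have : c' * t * (s0 - s) / 2 ≤ c' * t * (s0 - s) / v := by
        have : 0 ≤ s0 - s := by linarith
        gcongr; linarith
      refine this.trans ?_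
      gcongr
      have : 0 ≤ s0 - s := by linarith
      exact le_mul_of_one_le_right this (by linarith)
    have i6 : (c' - t) * t * (s0 - s) ≤ c' * t * (s0 - s) / 2 := by
      have : 0 ≤ t * (s0 - s) := mul_nonneg ht (by linarith)
      have i7 := mul_le_mul_of_nonneg_right htc this
      have i8 : (c' - t) * t * (s0 - s) = c' * (t * (s0 - s)) - t * (t * (s0 - s)) := by ring
      have i9 : c' * t * (s0 - s) / 2 = c' * (t * (s0 - s)) / 2 := by ring
      rw [i8, i9]; linarith
    have i10 : (c' - t) * (c - t * s) - (c' - t) * (c - t * s0) = (c' - t) * t * (s0 - s) := by ring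
    linarith
  obtain ⟨A, hAA, hA0, hA3, hA4⟩ : ∃ A, (c' - t) * (c - t * s0) + 0.6 - c' * t * (1 - s0 * (1 + 1 / q0)) / v ≤ A ∧ 0 ≤ A ∧
      1.02 + A / L0 + e * s0 + pb + c' * c * lv < 0.6 * (v0 + 1) ∧ 1.02 + A / L0 + e * s0 + pb + c' * c * lv + c' * c * (v1 - v0) / v0 < 0.6 * (v1 + 1) := by
    rcases le_total 0 (c' * t * (1 - s0 * (1 + 1 / q0))) with h | h
    · refine ⟨A2, ?_, h2, h4, h6⟩
      rw [hA2]
      have := div_le_div_of_nonneg_left h hvp hvv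
      linarith
    · refine ⟨A1, ?_, h1, h3, h5⟩
      rw [hA1]
      have := div_le_div_of_nonneg_left (neg_nonneg.2 h) hv0p hv
      rw [neg_div, neg_div] at this
      linarith
  have hA5 : ((c' - t) * (c - t * s) + 0.6 - c' * t * (1 - s * (1 + 1 / q)) / v) / L ≤ A / L0 :=
    (div_le_div_of_nonneg_right (hA.trans hAA) hLp.le).trans (by gcongr)
  have hes : e * s ≤ e * s0 := by gcongr
  have hcc : c' * c * Real.log v ≤ c' * c * lv + c' * c / v0 * (v - v0) := by
    have := mul_le_mul_of_nonneg_left hlog (mul_nonneg hc' hc)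
    refine this.trans (le_of_eq ?_); ring
  have hK : c' * c * (v1 - v0) / v0 = c' * c / v0 * (v1 - v0) := by ring
  rw [hK] at hA4
  generalize c' * c / v0 = K at *
  clear hA hAA hs0 hs hA1 hA2 h1 h2 h3 h4 h5 h6 hK
  rcases le_total K 0.6 with h | h
  · have := mul_nonneg (sub_nonneg.2 h) (sub_nonneg.2 hv)
    linarith
  · have := mul_nonneg (sub_nonneg.2 h) (sub_nonneg.2 hvv)
    linarith

end PS
end


section
open ArithmeticFunction
set_option maxRecDepth 100000
namespace PS

/-- rational inequalities of one cell; the cell is [k/200, k1/200] -/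
def cellQ (q0 c c' t L0 e pb s0 lv v0 v1 : ℚ) : Prop :=
  1 ≤ v0 ∧ v1 ≤ 2 ∧
  0 ≤ (c' - t) * (c - t * s0) + 3/5 - c' * t * (1 - s0 * (1 + 1 / q0)) / v0 ∧
  0 ≤ (c' - t) * (c - t * s0) + 3/5 - c' * t * (1 - s0 * (1 + 1 / q0)) / v1 ∧
  51/50 + ((c' - t) * (c - t * s0) + 3/5 - c' * t * (1 - s0 * (1 + 1 / q0)) / v0) / L0 + e * s0 + pb + c' * c * lv < 3/5 * (v0 + 1) ∧
  51/50 + ((c' - t) * (c - t * s0) + 3/5 - c' * t * (1 - s0 * (1 + 1 / q0)) / v1) / L0 + e * s0 + pb + c' * c * lv < 3/5 * (v0 + 1) ∧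
  51/50 + ((c' - t) * (c - t * s0) + 3/5 - c' * t * (1 - s0 * (1 + 1 / q0)) / v0) / L0 + e * s0 + pb + c' * c * lv + c' * c * (v1 - v0) / v0 < 3/5 * (v1 + 1) ∧
  51/50 + ((c' - t) * (c - t * s0) + 3/5 - c' * t * (1 - s0 * (1 + 1 / q0)) / v1) / L0 + e * s0 + pb + c' * c * lv + c' * c * (v1 - v0) / v0 < 3/5 * (v1 + 1)

instance (q0 c c' t L0 e pb s0 lv v0 v1 : ℚ) : Decidable (cellQ q0 c c' t L0 e pb s0 lv v0 v1) := by
  unfold cellQ; infer_instance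

def grid : List (ℕ × ℕ) := [(200, 1), (201, 4987543), (202, 9950332), (203, 14888614), (204, 19802629), (206, 29558804), (210, 48790166), (214, 67658650), (220, 95310181), (230, 139761944), (240, 182321558), (250, 223143553), (260, 262364266), (270, 300104594), (280, 336472238), (290, 371563558), (300, 405465110), (310, 438254932), (320, 470003631), (330, 500775289), (340, 530628253), (346, 548121410), (352, 565313811), (358, 582215621), (364, 598836503), (370, 615185641), (380, 641853888), (390, 667829374), (400, 693147182)]

/-- upper bound for exp(-(k/200-1) l/10^4), in units 10^-6 -/
def sN (l k : ℕ) : ℕ := 1000000 * 32000000 ^ 16 / (32000000 + (k - 200) * l) ^ 16 + 1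

def allc (q0 c c' t : ℚ) (l : ℕ) (e pb : ℚ) : ℕ × ℕ → List (ℕ × ℕ) → Prop
  | k, [] => k.1 = 400
  | k, k1 :: r => cellQ q0 c c' t ((l:ℚ) / 10000) e pb ((sN l k.1 : ℚ) / 1000000) ((k.2 : ℚ) / 1000000000) ((k.1:ℚ)/200) ((k1.1:ℚ)/200) ∧ allc q0 c c' t l e pb k1 r

instance decAllc (q0 c c' t : ℚ) (l : ℕ) (e pb : ℚ) : ∀ (k : ℕ × ℕ) (r : List (ℕ × ℕ)), Decidable (allc q0 c c' t l e pb k r)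
  | k, [] => by unfold allc; infer_instance
  | k, k1 :: r => by
    have := decAllc q0 c c' t l e pb k1 r
    unfold allc; infer_instance

lemma grid_ok : ∀ k ∈ grid, lgL (k.1 - 1) + 17 * (k.1 - 1) ≤ k.2 * 1000000 + lgL (200 - 1) ∧ 200 ≤ k.1 := by decide +kernel

lemma grid_log (k : ℕ × ℕ) (hk : k ∈ grid) : Real.log ((k.1 : ℝ) / 200) ≤ (k.2 : ℝ) / 1000000000 := by
  obtain ⟨h, h200⟩ := grid_ok k hk
  have h1 := log_hi k.1 (by omega)
  have h2 := log_lo 200 (by norm_num)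
  generalize lgL (200 - 1) = A at *
  generalize lgL (k.1 - 1) = B at *
  have h3 : (B : ℝ) + 17 * ((k.1 - 1 : ℕ) : ℝ) ≤ k.2 * 1000000 + A := by exact_mod_cast h
  rw [Nat.cast_sub (by omega)] at h3
  have hk0 : (0:ℝ) < k.1 := by exact_mod_cast (by omega : 0 < k.1)
  rw [Real.log_div hk0.ne' (by norm_num)]
  push_cast at *
  have h4 : Real.log k.1 - Real.log 200 ≤ (B + 17 * ((k.1:ℝ) - 1)) / 10^15 - A / 10^15 := by linarith
  refine h4.trans ?_
  rw [← sub_div, div_le_div_iff₀ (by norm_num) (by norm_num)]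
  linarith

lemma sN_ok (l k : ℕ) (hk : 200 ≤ k) : (1:ℝ) ≤ ((sN l k : ℝ) / 1000000) * (1 + ((k:ℝ)/200 - 1) * ((l:ℝ)/10000) / 16)^16 := by
  have h : 1000000 * 32000000 ^ 16 ≤ sN l k * (32000000 + (k - 200) * l) ^ 16 := by
    unfold sN
    generalize 1000000 * 32000000 ^ 16 = A
    have hp : 0 < (32000000 + (k - 200) * l) ^ 16 := by positivity
    generalize (32000000 + (k - 200) * l) ^ 16 = B at *
    exact (Nat.lt_succ_iff.1 (by have := Nat.lt_div_mul_add hp (a := A); rw [add_mul]; omega))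
  have h' : (1000000 * 32000000 ^ 16 : ℝ) ≤ sN l k * (32000000 + ((k:ℝ) - 200) * l) ^ 16 := by
    have := (Nat.cast_le (α := ℝ)).2 h
    push_cast [Nat.cast_sub hk] at this
    linarith
  have e : 1 + ((k:ℝ)/200 - 1) * ((l:ℝ)/10000) / 16 = (32000000 + ((k:ℝ) - 200) * l) / 32000000 := by
    field_simp; ring
  rw [e, div_pow, div_mul_div_comm, le_div_iff₀ (by positivity), one_mul]
  exact h'

lemma cells (q0 c c' t : ℚ) (l : ℕ) (e pb : ℚ) (hq0 : 0 < q0) (hc : 0 ≤ c) (hc' : 0 ≤ c') (ht : 0 ≤ t) (htc : c' ≤ 2 * t) (he : 0 ≤ e) (hl : 0 < l)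
    (q L v s : ℝ) (hq : q0 ≤ q) (hL : (l:ℝ) / 10000 ≤ L) (hv2 : v < 2) (hsn : 0 ≤ s) (hs : s * Real.exp ((v - 1) * L) = 1) :
    ∀ (r : List (ℕ × ℕ)) (k : ℕ × ℕ), k ∈ grid → (∀ x ∈ r, x ∈ grid) → allc q0 c c' t l e pb k r → (k.1:ℝ)/200 ≤ v →
    1.02 + (((c':ℝ) - t) * (c - t * s) + 0.6 - c' * t * (1 - s * (1 + 1 / q)) / v) / L + e * s + pb + c' * c * Real.log v < 0.6 * (v + 1)
  | [], k, _, _, h, hv => by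
    simp only [allc] at h
    rw [h] at hv
    norm_num at hv
    linarith
  | k1 :: r, k, hk, hr, h, hv => by
    simp only [allc] at h
    rcases lt_or_ge ((k1.1:ℝ)/200) v with h1 | h1
    · exact cells q0 c c' t l e pb hq0 hc hc' ht htc he hl q L v s hq hL hv2 hsn hs r k1 (hr _ (by simp)) (fun x hx => hr x (by simp [hx])) h.2 h1.le
    · obtain ⟨a1, a2, a3, a4, a5, a6, a7, a8⟩ := h.1
      have hsN := sN_ok l k.1 (grid_ok k hk).2
      have hg := grid_log k hk
      generalize sN l k.1 = S at *
      have b1 := (Rat.cast_le (K := ℝ)).2 a1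
      have b2 := (Rat.cast_le (K := ℝ)).2 a2
      have b3 := (Rat.cast_le (K := ℝ)).2 a3
      have b4 := (Rat.cast_le (K := ℝ)).2 a4
      have b5 := (Rat.cast_lt (K := ℝ)).2 a5
      have b6 := (Rat.cast_lt (K := ℝ)).2 a6
      have b7 := (Rat.cast_lt (K := ℝ)).2 a7
      have b8 := (Rat.cast_lt (K := ℝ)).2 a8
      push_cast at b1 b2 b3 b4 b5 b6 b7 b8
      have e1 : (0.6:ℝ) = 3/5 := by norm_num
      have e2 : (1.02:ℝ) = 51/50 := by norm_num
      have hl' : (0:ℝ) < (l:ℝ)/10000 := by positivity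
      refine cell q0 c c' t (l/10000) e pb (S/1000000) (k.2/1000000000) (k.1/200) (k1.1/200) (by exact_mod_cast hq0) (by exact_mod_cast hc)
        (by exact_mod_cast hc') (by exact_mod_cast ht) (by exact_mod_cast htc) (by exact_mod_cast he) hl' b1 b2 hsN hg _ rfl _ rfl ?_ ?_ ?_ ?_ ?_ ?_ q L v s hq hL hv h1 hsn hs
      all_goals (rw [e1]; try rw [e2]); assumption

/-- everything needed for one prime `q` and `N ≤ T` -/
lemma group (q T : ℕ) (hq : 2 ≤ q) (L : ℝ) (hL : L = Real.log q) (q0 c c' t d sig e pb2 pb3 : ℚ) (l : ℕ)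
    (hq0 : 0 < q0) (hc0 : 0 ≤ c) (hc'0 : 0 ≤ c') (ht0 : 0 ≤ t) (htc : c' ≤ 2 * t) (he : 0 ≤ e) (hl : 0 < l) (htc' : t ≤ c') (hd : 0 ≤ c - 1 + d)
    (hcell : allc q0 c c' t l e pb2 (200, 1) grid.tail)
    (hX : 0 ≤ (c' - t) * c - c' * c * (1 - 1 / q0) / 2 + 3/5 * (c - 1 + d) + 3/5 * sig + 3/5)
    (H : 51/50 + c' * c * (6931472/10000000) + ((c' - t) * c - c' * c * (1 - 1 / q0) / 2 + 3/5 * (c - 1 + d) + 3/5 * sig + 3/5) / (l/10000) + e / q0 + pb3 < 9/5)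
    (hqq : q0 ≤ q) (hLL : (l:ℝ) / 10000 ≤ L)
    (ht : t * q ≤ th (q-1)) (hc : ∀ m, m ≤ T / q → th m ≤ c * m) (hc' : ∀ m, q ≤ m → m ≤ q^2 → th m ≤ c' * m)
    (hD : Dd q (q^2) ≤ (q:ℝ)^2 * (0.6 / L + e))
    (hP2 : ∀ N, q^2 ≤ N → Pp q N ≤ N * pb2) (hP3 : ∀ N, q^3 ≤ N → Pp q N ≤ N * pb3)
    (hth : ∀ N, q^3 ≤ N → N ≤ T → (1 - d) * (N / q^2 : ℝ) ≤ th (N / q^2))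
    (hsg : ∀ N, q^3 ≤ N → N ≤ T → sg (N / q^2) - sg (q-1) ≤ Real.log ((N / q^2 : ℕ) : ℝ) - L + sig) :
    ∀ N, q^2 ≤ N → N ≤ T → (F q N : ℝ) < 0.6 / L * N := by
  intro N
  have hL0 : 0 < L := by rw [hL]; exact log_nat_pos q hq
  have hqr : (0:ℝ) < q := by positivity
  have hqq' : (q0:ℝ) ≤ q := by exact_mod_cast hqq
  induction N using Nat.strong_induction_on with
  | _ N ih =>
  intro h2 hT
  have ih' : ∀ m, q^2 ≤ m → m < N → (F q m : ℝ) ≤ 0.6 / L * m := fun m h1 h3 => (ih m h3 h1 (by omega)).le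
  have hcN : ∀ m, m ≤ N / q → th m ≤ c * m := fun m hm => hc m (hm.trans (Nat.div_le_div_right hT))
  rcases Nat.lt_or_ge N (q^3) with h3 | h3
  · have hN0 : 0 < N := lt_of_lt_of_le (by positivity) h2
    have hNr : (0:ℝ) < N := by exact_mod_cast hN0
    obtain ⟨v, hv⟩ : ∃ v, Real.log N = (v + 1) * L := ⟨Real.log N / L - 1, by field_simp; ring⟩
    obtain ⟨s, hs⟩ : ∃ s : ℝ, s * N = q^2 := ⟨q^2 / N, by field_simp⟩
    have hs0 : 0 ≤ s := by
      by_contra hh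
      push Not at hh
      nlinarith [sq_nonneg (q:ℝ)]
    have hv1 : 1 ≤ v := by
      have : Real.log ((q:ℝ)^2) ≤ Real.log N := Real.log_le_log (by positivity) (by exact_mod_cast h2)
      rw [hv, Real.log_pow, ← hL] at this
      push_cast at this
      by_contra hh
      push Not at hh
      nlinarith
    have hv2 : v < 2 := by
      have : Real.log N < Real.log ((q:ℝ)^3) := Real.log_lt_log hNr (by exact_mod_cast h3)
      rw [hv, Real.log_pow, ← hL] at this
      push_cast at this
      by_contra hh
      push Not at hh
      nlinarith
    have hse : s * Real.exp ((v - 1) * L) = 1 := by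
      have e1 : (v - 1) * L = Real.log N - (L + L) := by rw [hv]; ring
      rw [e1, Real.exp_sub, Real.exp_log hNr, Real.exp_add, hL, Real.exp_log hqr, ← mul_div_assoc, hs]
      field_simp
    refine comb2 q N hq h2 h3 L v s c c' t e pb2 hL hv hs (by exact_mod_cast ht0) (by exact_mod_cast htc') ht (by exact_mod_cast hc0) hcN (fun m h1 h2 => hc' m h1 h2.le) hD (hP2 N h2) ih' ?_
    refine cells q0 c c' t l e pb2 hq0 hc0 hc'0 ht0 htc he hl q L v s hqq' hLL hv2 hs0 hse grid.tail (200, 1) (by decide) (by decide) hcell ?_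
    norm_num; exact hv1
  · have H' := (Rat.cast_lt (K := ℝ)).2 H
    have hX' := (Rat.cast_le (K := ℝ)).2 hX
    push_cast at H' hX'
    refine comb3 q N hq h3 L c c' t d sig e pb3 hL (by exact_mod_cast ht0) (by exact_mod_cast htc') (by exact_mod_cast hd) ht (by exact_mod_cast hc0) hcN hc'
      (hth N h3 hT) (hsg N h3 hT) hD (by exact_mod_cast he) (hP3 N h3) ih' (l/10000) q0 (by positivity) hLL (by exact_mod_cast hq0) hqq' ?_ ?_
    · have e1 : (0.6:ℝ) = 3/5 := by norm_num
      rw [e1]; exact hX'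
    · have e1 : (0.6:ℝ) = 3/5 := by norm_num
      have e2 : (1.02:ℝ) = 51/50 := by norm_num
      have e3 : (0.6931472:ℝ) = 6931472/10000000 := by norm_num
      have e4 : (1.8:ℝ) = 9/5 := by norm_num
      rw [e1, e2, e3, e4]; exact H'
end PS
end


section
open ArithmeticFunction
set_option maxRecDepth 100000
namespace PS

lemma ppT (q0 q N : ℕ) (h0 : 103 ≤ q0) (hq : q0 ≤ q) (hqN : q^2 ≤ N) (t r : ℝ) (ht1 : t ≤ 1.02) (ht : t * q ≤ th (q-1)) (hr : 0 < r) (hr2 : r^2 ≤ N) :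
    Pp q N ≤ N * (((1.02 - t) / (q0 - 1) + 1.02 / q0) / 3 + 0.9 / r) := by
  have hN : 10609 ≤ N := le_trans (by nlinarith) hqN
  have h1 := Pp_le3 q N (by omega) (le_trans (by nlinarith) hqN) hN t ht
  have hNr : (0:ℝ) < N := by exact_mod_cast (by omega : 0 < N)
  have h0r : (103:ℝ) ≤ q0 := by exact_mod_cast h0
  have hqr : (q0:ℝ) ≤ q := by exact_mod_cast hq
  have h2 : (1.02 - t) / ((q:ℝ) - 1) + 1.02 / q ≤ (1.02 - t) / (q0 - 1) + 1.02 / q0 := by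
    have i1 : (1.02 - t) / ((q:ℝ) - 1) ≤ (1.02 - t) / (q0 - 1) := by
      apply div_le_div_of_nonneg_left <;> linarith
    have i2 : (1.02:ℝ) / q ≤ 1.02 / q0 := by apply div_le_div_of_nonneg_left <;> linarith
    linarith
  have h3 : Real.sqrt N ≤ N / r := by
    rw [le_div_iff₀ hr]
    have : r ≤ Real.sqrt N := Real.le_sqrt_of_sq_le hr2
    calc Real.sqrt N * r ≤ Real.sqrt N * Real.sqrt N := by gcongr
      _ = N := Real.mul_self_sqrt hNr.le
  have h4 := mul_le_mul_of_nonneg_left h2 hNr.le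
  have e : (N:ℝ) * (((1.02 - t) / (q0 - 1) + 1.02 / q0) / 3 + 0.9 / r) = N * ((1.02 - t) / (q0 - 1) + 1.02 / q0) / 3 + 0.9 * (N / r) := by ring
  rw [e]
  linarith

/-- the rational conditions for a group -/
def chkA (q0 : ℕ) (c c' t d sig e pb2 pb3 c3 B0 Z iq : ℚ) (l r : ℕ) : Prop :=
  0 ≤ c ∧ 0 ≤ c' ∧ 0 ≤ t ∧ c' ≤ 2 * t ∧ 0 ≤ e ∧ 0 < l ∧ t ≤ c' ∧ 0 ≤ c - 1 + d ∧ allc q0 c c' t l e pb2 (200, 1) grid.tail ∧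
  0 ≤ (c' - t) * c - c' * c * (1 - 1 / q0) / 2 + 3/5 * (c - 1 + d) + 3/5 * sig + 3/5 ∧
  51/50 + c' * c * (6931472/10000000) + ((c' - t) * c - c' * c * (1 - 1 / q0) / 2 + 3/5 * (c - 1 + d) + 3/5 * sig + 3/5) / (l/10000) + e / q0 + pb3 < 9/5 ∧
  3 < (l:ℚ)/10000 ∧ 0 ≤ c3 ∧ 2 ≤ c3 * (1 - 3 / (l/10000)) ∧ c' / 2 - 3/5 + c' * c3 / (4 * (l/10000)) ≤ B0 ∧ 0 ≤ B0 ∧ 0 ≤ Z ∧ B0 / (l/10000) - Z * iq ≤ e ∧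
  t ≤ 51/50 ∧ 0 < r ∧ r^2 ≤ q0^3 ∧
  ((51/50 - t) / (q0 - 1) + (51/50) / q0) / 3 + (9/10) / q0 ≤ pb2 ∧ ((51/50 - t) / (q0 - 1) + (51/50) / q0) / 3 + (9/10) / r ≤ pb3

instance (q0 : ℕ) (c c' t d sig e pb2 pb3 c3 B0 Z iq : ℚ) (l r : ℕ) : Decidable (chkA q0 c c' t d sig e pb2 pb3 c3 B0 Z iq l r) := by
  unfold chkA; infer_instance

lemma gA (q0 : ℕ) (c c' t d sig e pb2 pb3 c3 B0 Z iq : ℚ) (l r : ℕ) (chk : chkA q0 c c' t d sig e pb2 pb3 c3 B0 Z iq l r) (h103 : 103 ≤ q0)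
    (q T : ℕ) (hqq : q0 ≤ q)
    (hLL : (l:ℝ) / 10000 ≤ Real.log q)
    (hZ : 2 * Real.log q / q - t - 2 * c' / Real.log q - 2 * c' * c3 / Real.log q ^2 ≤ - Z) (hiq : (iq:ℝ) ≤ 1 / q)
    (ht : t * q ≤ th (q-1)) (hc : ∀ m, m ≤ T / q → th m ≤ c * m) (hc' : ∀ m, q ≤ m → m ≤ q^2 → th m ≤ c' * m)
    (hth : ∀ N, q^3 ≤ N → N ≤ T → (1 - d) * (N / q^2 : ℝ) ≤ th (N / q^2))
    (hsg : ∀ w, q ≤ w → w ≤ T / q^2 → sg w - sg (q-1) ≤ Real.log w - Real.log q + sig) :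
    ∀ N, q^2 ≤ N → N ≤ T → (F q N : ℝ) < 0.6 / Real.log q * N := by
  obtain ⟨k1, k2, k3, k4, k5, k6, k7, k8, k9, k10, k11, k12, k13, k14, k15, k16, k17, k18, k19, k20, k21, k22, k23⟩ := chk
  have hq0r : (103:ℝ) ≤ q0 := by exact_mod_cast h103
  have hqr : (q0:ℝ) ≤ q := by exact_mod_cast hqq
  have e06 : (0.6:ℝ) = 3/5 := by norm_num
  have k12' := (Rat.cast_lt (K := ℝ)).2 k12
  have k14' := (Rat.cast_le (K := ℝ)).2 k14
  have k15' := (Rat.cast_le (K := ℝ)).2 k15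
  have k18' := (Rat.cast_le (K := ℝ)).2 k18
  have k19' := (Rat.cast_le (K := ℝ)).2 k19
  have k22' := (Rat.cast_le (K := ℝ)).2 k22
  have k23' := (Rat.cast_le (K := ℝ)).2 k23
  push_cast at k12' k14' k15' k18' k19' k22' k23'
  rw [← e06] at k15'
  have e2 : (1.02:ℝ) = 51/50 := by norm_num
  have e3 : (0.9:ℝ) = 9/10 := by norm_num
  have hD := Dq2 q (by omega) _ rfl c' c3 t (l/10000) B0 Z iq e k12' hLL (by exact_mod_cast k2) (by exact_mod_cast k13) k14' hc' ht k15'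
    (by exact_mod_cast k16) (by exact_mod_cast k17) hZ hiq k18'
  refine group q T (by omega) _ rfl q0 c c' t d sig e pb2 pb3 l (by exact_mod_cast (by omega : 0 < q0)) k1 k2 k3 k4 k5 k6 k7 k8 k9 k10 k11 (by exact_mod_cast hqq) hLL ht hc hc' hD ?_ ?_ hth ?_
  · intro N hN
    have := ppT q0 q N h103 hqq hN t q0 (by rw [e2]; exact k19') ht (by linarith) (by
      have : (q0:ℝ)^2 ≤ q^2 := by gcongr
      exact this.trans (by exact_mod_cast hN))
    refine this.trans (mul_le_mul_of_nonneg_left ?_ (Nat.cast_nonneg N))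
    rw [e2, e3]; exact k22'
  · intro N hN
    have hN2 : q^2 ≤ N := le_trans (Nat.pow_le_pow_right (by omega) (by norm_num)) hN
    have := ppT q0 q N h103 hqq hN2 t r (by rw [e2]; exact k19') ht (by exact_mod_cast k20) (by
      have : r^2 ≤ N := k21.trans ((Nat.pow_le_pow_left hqq 3).trans hN)
      exact_mod_cast this)
    refine this.trans (mul_le_mul_of_nonneg_left ?_ (Nat.cast_nonneg N))
    rw [e2, e3]; exact k23'
  · intro N hN hNT
    refine hsg _ ?_ (Nat.div_le_div_right hNT)
    rw [Nat.le_div_iff_mul_le (pow_pos (by omega) 2)]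
    rw [← pow_succ']; exact hN

lemma log_ge (q0 q l : ℕ) (h0 : 1 ≤ q0) (hq : q0 ≤ q) (h : l * 10^11 ≤ lgL (q0 - 1)) : (l:ℝ) / 10000 ≤ Real.log q := by
  have h1 := log_lo q0 h0
  have h2 : Real.log q0 ≤ Real.log q := Real.log_le_log (by exact_mod_cast h0) (by exact_mod_cast hq)
  generalize lgL (q0 - 1) = A at *
  have h3 : (l:ℝ) * 10^11 ≤ A := by exact_mod_cast h
  refine le_trans ?_ (h1.trans h2)
  rw [div_le_div_iff₀ (by norm_num) (by norm_num)]
  linarith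

lemma hZ0 (q : ℕ) (hq : 149 ≤ q) (c t c3 Z : ℝ) (hc : 0 ≤ c) (hc3 : 0 ≤ c3) (ht : 0.3 ≤ t) (hZ : Z = 0) :
    2 * Real.log q / q - t - 2 * c / Real.log q - 2 * c * c3 / Real.log q ^2 ≤ - Z := by
  have hqr : (149:ℝ) ≤ q := by exact_mod_cast hq
  have hL : 0 < Real.log q := log_nat_pos q (by omega)
  have h1 := Real.log_le_sub_one_of_pos (show (0:ℝ) < q / 8 by positivity)
  rw [Real.log_div (by positivity) (by norm_num), show (8:ℝ) = 2^3 by norm_num, Real.log_pow] at h1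
  have h2 := Real.log_two_lt_d9
  push_cast at h1
  have h3 : 2 * Real.log q / q ≤ 0.3 := by
    rw [div_le_iff₀ (by linarith)]; linarith
  have h4 : 0 ≤ 2 * c / Real.log q := by positivity
  have h5 : 0 ≤ 2 * c * c3 / Real.log q ^ 2 := by positivity
  linarith

lemma hZ1 (q q0 : ℕ) (h0 : 2 ≤ q0) (hq : q0 ≤ q) (L1 c t c3 Z : ℝ) (hc : 0 ≤ c) (hc3 : 0 ≤ c3) (hL1 : Real.log q ≤ L1)
    (h : Z ≤ t + 2 * c / L1 + 2 * c * c3 / L1^2 - 2 * L1 / q0) :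
    2 * Real.log q / q - t - 2 * c / Real.log q - 2 * c * c3 / Real.log q ^2 ≤ - Z := by
  have hL : 0 < Real.log q := log_nat_pos q (by omega)
  have hq0 : (0:ℝ) < q0 := by positivity
  have hqr : (q0:ℝ) ≤ q := by exact_mod_cast hq
  have hL1' : 0 ≤ L1 := by linarith
  have i1 : 2 * Real.log q / q ≤ 2 * L1 / q0 := by gcongr
  have i2 : 2 * c / L1 ≤ 2 * c / Real.log q := by gcongr
  have i3 : 2 * c * c3 / L1^2 ≤ 2 * c * c3 / Real.log q ^ 2 := by gcongr
  linarith
end PS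
end


section
open ArithmeticFunction
set_option maxRecDepth 100000
namespace PS
lemma chk1 : chkA 103 (995/1000) (995/1000) (85770/100000) (15694/100000) (810/10000) (28581/1000000) (125694/10000000) (46928/10000000) (5670400/1000000) (2018374/10000000) (16916/10000) (1/113) 46347 1045 := by decide +kernel
lemma chk2 : chkA 127 (1) (995/1000) (84306/100000) (15694/100000) (570/10000) (23039/1000000) (102320/10000000) (37743/10000000) (5253621/1000000) (1672795/10000000) (15978/10000) (1/139) 48441 1431 := by decide +kernel
lemma chk3 : chkA 149 (1) (1) (84995/100000) (15005/100000) (673/10000) (29881/1000000) (87053/10000000) (31601/10000000) (4994163/1000000) (1495137/10000000) (0) (0) 50039 1818 := by decide +kernel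
lemma chk4 : chkA 191 (1) (1) (86957/100000) (13043/100000) (886/10000) (23231/1000000) (67562/10000000) (23852/10000000) (4664063/1000000) (1220054/10000000) (0) (0) 52522 2639 := by decide +kernel
lemma chk5 : chkA 241 (102/100) (1) (89803/100000) (10197/100000) (761/10000) (18459/1000000) (53148/10000000) (18209/10000000) (4414780/1000000) (1012318/10000000) (0) (0) 54847 3741 := by decide +kernel
lemma chk6 : chkA 367 (102/100) (1) (91300/100000) (8700/100000) (428/10000) (12211/1000000) (34763/10000000) (11521/10000000) (4065193/1000000) (720995/10000000) (0) (0) 59053 7030 := by decide +kernel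
lemma chk7 : chkA 512 (102/100) (1) (91942/100000) (8110/100000) (2618/10000) (8722/1000000) (24876/10000000) (8075/10000000) (3852826/1000000) (544022/10000000) (0) (0) 62383 11585 := by decide +kernel
lemma chk9 : chkA 1000 (102/100) (102/100) (94771/100000) (8110/100000) (2700/10000) (5866/1000000) (12643/10000000) (3927/10000000) (3535432/1000000) (405118/10000000) (0) (0) 69077 31622 := by decide +kernel
lemma chk10 : chkA 1400 (102/100) (102/100) (94558/100000) (8110/100000) (2873/10000) (4165/1000000) (9036/10000000) (2779/10000000) (3413695/1000000) (301642/10000000) (0) (0) 72442 52383 := by decide +kernel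
lemma chk13 : chkA 524288 (102/100) (102/100) (88/100) (8110/100000) (7450/10000) (2/1000000) (26/10000000) (9/10000000) (2589989/1000000) (1/10000000) (0) (0) 131697 379625062 := by decide +kernel

lemma x_le_div (N q : ℕ) (hq : 0 < q) : (N:ℝ) / (q:ℝ)^2 ≤ ((N / q^2 : ℕ) : ℝ) + 1 := by
  rw [div_le_iff₀ (by positivity)]
  have := Nat.lt_div_mul_add (pow_pos hq 2) (a := N)
  have : N ≤ (N / q^2 + 1) * q^2 := by rw [add_mul]; omega
  exact_mod_cast this

lemma w_le_div (q T0 w : ℕ) (hq : 0 < q) (hw : w ≤ q * T0 / q^2) : w ≤ T0 := by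
  rw [pow_two, ← Nat.div_div_eq_div_mul, Nat.mul_div_cancel_left _ hq] at hw
  exact hw.trans (Nat.div_le_self _ _)

lemma w_le_div2 (q T0 w : ℕ) (hq : 0 < q) (hw : w ≤ q^2 * T0 / q^2) : w ≤ T0 := by
  rwa [Nat.mul_div_cancel_left _ (pow_pos hq 2)] at hw

lemma g1 (q N : ℕ) (hq : q.Prime) (h0 : 103 ≤ q) (h1 : q ≤ 113) (hN : q^2 ≤ N) (hT : N ≤ q * 23910) : (F q N : ℝ) < 0.6 / Real.log q * N := by
  have hqr : (103:ℝ) ≤ q := by exact_mod_cast h0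
  have hqr1 : (q:ℝ) ≤ 113 := by exact_mod_cast h1
  have htau := tau_of q 85770 hq (by omega) (by omega) (by
      obtain ⟨c, t, s, h, e1, e2, e3, e4, H⟩ := prm_val q
      rw [e2]; clear e1 e2 e3 e4; iterate 15 (rcases H with H | H; · omega)
      omega)
  have hslo := slo_of q 18043 hq (by omega) (by omega) (by
      obtain ⟨c, t, s, h, e1, e2, e3, e4, H⟩ := prm_val q
      rw [e3]; clear e1 e2 e3 e4; iterate 15 (rcases H with H | H; · omega)
      omega)
  have hsq : q^2 ≤ 12769 := by nlinarith
  refine gA 103 (995/1000) (995/1000) (85770/100000) (15694/100000) (810/10000) (28581/1000000) (125694/10000000) (46928/10000000) (5670400/1000000) (2018374/10000000) (16916/10000) (1/113) 46347 1045 chk1 (by norm_num) q (q * 23910) h0 (log_ge 103 q 46347 (by norm_num) h0 (by decide +kernel)) ?_ ?_ ?_ ?_ ?_ ?_ ?_ N hN hT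
  · refine hZ1 q 103 (by norm_num) h0 (47274/10000) _ _ _ _ (by norm_num) (by norm_num) ?_ (by norm_num)
    have i1 := log_hi 113 (by norm_num)
    have i2 : Real.log q ≤ Real.log ((113:ℕ):ℝ) := Real.log_le_log (by linarith) (by exact_mod_cast h1)
    have hk : lgL (113-1) + 17*112 ≤ 47274 * 10^11 := by decide +kernel
    generalize lgL (113-1) = A at *
    have hk' : (A:ℝ) + 17*112 ≤ 47274 * 10^11 := by exact_mod_cast hk
    refine i2.trans (i1.trans ?_)
    rw [div_le_div_iff₀ (by norm_num) (by norm_num)]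
    push_cast
    linarith
  · push_cast
    apply one_div_le_one_div_of_le <;> linarith
  · push_cast at htau ⊢
    linarith
  · intro m hm
    rw [Nat.mul_div_cancel_left _ (by omega)] at hm
    have := th995 m (by omega)
    norm_num at this ⊢
    linarith
  · intro m hm1 hm2
    have := th995 m (by omega)
    norm_num at this ⊢
    linarith
  · intro M hM hMT
    have hw : q ≤ M / q^2 := by
      rw [Nat.le_div_iff_mul_le (pow_pos (by omega) 2), ← pow_succ']; exact hM
    have := thw 103 84306 (by norm_num) (by norm_num) (by
      intro n h1 h2
      obtain ⟨c, t, s, h, e1, e2, e3, e4, H⟩ := prm_val n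
      rw [e2]; clear e1 e2 e3 e4; iterate 15 (rcases H with H | H; · omega)
      omega) (M / q^2) _ (by omega) (x_le_div M q (by omega))
    refine le_trans (le_of_eq ?_) this
    norm_num
  · intro w hw1 hw2
    have hw3 := w_le_div q 23910 w (by omega) hw2
    have := shi_of w 26133 103 524288 (by norm_num) ⟨q, hq, h0, hw1⟩ (by omega) (by norm_num) (by
      intro n h1 h2
      obtain ⟨c, t, s, h, e1, e2, e3, e4, H⟩ := prm_val n
      rw [e4]; clear e1 e2 e3 e4; iterate 15 (rcases H with H | H; · omega)
      omega)
    norm_num at this hslo ⊢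
    linarith

lemma g2 (q N : ℕ) (hq : q.Prime) (h0 : 127 ≤ q) (h1 : q ≤ 139) (hN : q^2 ≤ N) (hT : N ≤ q * 524288) : (F q N : ℝ) < 0.6 / Real.log q * N := by
  have hqr : (127:ℝ) ≤ q := by exact_mod_cast h0
  have hqr1 : (q:ℝ) ≤ 139 := by exact_mod_cast h1
  have htau := tau_of q 84306 hq (by omega) (by omega) (by
      obtain ⟨c, t, s, h, e1, e2, e3, e4, H⟩ := prm_val q
      rw [e2]; clear e1 e2 e3 e4; iterate 15 (rcases H with H | H; · omega)
      omega)
  have hslo := slo_of q 14408 hq (by omega) (by omega) (by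
      obtain ⟨c, t, s, h, e1, e2, e3, e4, H⟩ := prm_val q
      rw [e3]; clear e1 e2 e3 e4; iterate 15 (rcases H with H | H; · omega)
      omega)
  have hsq : q^2 ≤ 19321 := by nlinarith
  refine gA 127 (1) (995/1000) (84306/100000) (15694/100000) (570/10000) (23039/1000000) (102320/10000000) (37743/10000000) (5253621/1000000) (1672795/10000000) (15978/10000) (1/139) 48441 1431 chk2 (by norm_num) q (q * 524288) h0 (log_ge 127 q 48441 (by norm_num) h0 (by decide +kernel)) ?_ ?_ ?_ ?_ ?_ ?_ ?_ N hN hT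
  · refine hZ1 q 127 (by norm_num) h0 (49345/10000) _ _ _ _ (by norm_num) (by norm_num) ?_ (by norm_num)
    have i1 := log_hi 139 (by norm_num)
    have i2 : Real.log q ≤ Real.log ((139:ℕ):ℝ) := Real.log_le_log (by linarith) (by exact_mod_cast h1)
    have hk : lgL (139-1) + 17*138 ≤ 49345 * 10^11 := by decide +kernel
    generalize lgL (139-1) = A at *
    have hk' : (A:ℝ) + 17*138 ≤ 49345 * 10^11 := by exact_mod_cast hk
    refine i2.trans (i1.trans ?_)
    rw [div_le_div_iff₀ (by norm_num) (by norm_num)]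
    push_cast
    linarith
  · push_cast
    apply one_div_le_one_div_of_le <;> linarith
  · push_cast at htau ⊢
    linarith
  · intro m hm
    rw [Nat.mul_div_cancel_left _ (by omega)] at hm
    have := th1 m (by omega)
    norm_num at this ⊢
    linarith
  · intro m hm1 hm2
    have := th995 m (by omega)
    norm_num at this ⊢
    linarith
  · intro M hM hMT
    have hw : q ≤ M / q^2 := by
      rw [Nat.le_div_iff_mul_le (pow_pos (by omega) 2), ← pow_succ']; exact hM
    have := thw 127 84306 (by norm_num) (by norm_num) (by
      intro n h1 h2
      obtain ⟨c, t, s, h, e1, e2, e3, e4, H⟩ := prm_val n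
      rw [e2]; clear e1 e2 e3 e4; iterate 15 (rcases H with H | H; · omega)
      omega) (M / q^2) _ (by omega) (x_le_div M q (by omega))
    refine le_trans (le_of_eq ?_) this
    norm_num
  · intro w hw1 hw2
    have hw3 := w_le_div q 524288 w (by omega) hw2
    have := shi_of w 20101 127 524288 (by norm_num) ⟨q, hq, h0, hw1⟩ (by omega) (by norm_num) (by
      intro n h1 h2
      obtain ⟨c, t, s, h, e1, e2, e3, e4, H⟩ := prm_val n
      rw [e4]; clear e1 e2 e3 e4; iterate 15 (rcases H with H | H; · omega)
      omega)
    norm_num at this hslo ⊢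
    linarith

lemma g3 (q N : ℕ) (hq : q.Prime) (h0 : 149 ≤ q) (h1 : q ≤ 181) (hN : q^2 ≤ N) (hT : N ≤ q * 524288) : (F q N : ℝ) < 0.6 / Real.log q * N := by
  have hqr : (149:ℝ) ≤ q := by exact_mod_cast h0
  have hqr1 : (q:ℝ) ≤ 181 := by exact_mod_cast h1
  have htau := tau_of q 84995 hq (by omega) (by omega) (by
      obtain ⟨c, t, s, h, e1, e2, e3, e4, H⟩ := prm_val q
      rw [e2]; clear e1 e2 e3 e4; iterate 15 (rcases H with H | H; · omega)
      omega)
  have hslo := slo_of q 13153 hq (by omega) (by omega) (by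
      obtain ⟨c, t, s, h, e1, e2, e3, e4, H⟩ := prm_val q
      rw [e3]; clear e1 e2 e3 e4; iterate 15 (rcases H with H | H; · omega)
      omega)
  have hsq : q^2 ≤ 32761 := by nlinarith
  refine gA 149 (1) (1) (84995/100000) (15005/100000) (673/10000) (29881/1000000) (87053/10000000) (31601/10000000) (4994163/1000000) (1495137/10000000) (0) (0) 50039 1818 chk3 (by norm_num) q (q * 524288) h0 (log_ge 149 q 50039 (by norm_num) h0 (by decide +kernel)) ?_ ?_ ?_ ?_ ?_ ?_ ?_ N hN hT
  · exact hZ0 q (by omega) _ _ _ _ (by norm_num) (by norm_num) (by norm_num) (by norm_num)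
  · push_cast; positivity
  · push_cast at htau ⊢
    linarith
  · intro m hm
    rw [Nat.mul_div_cancel_left _ (by omega)] at hm
    have := th1 m (by omega)
    norm_num at this ⊢
    linarith
  · intro m hm1 hm2
    have := th1 m (by omega)
    norm_num at this ⊢
    linarith
  · intro M hM hMT
    have hw : q ≤ M / q^2 := by
      rw [Nat.le_div_iff_mul_le (pow_pos (by omega) 2), ← pow_succ']; exact hM
    have := thw 149 84995 (by norm_num) (by norm_num) (by
      intro n h1 h2
      obtain ⟨c, t, s, h, e1, e2, e3, e4, H⟩ := prm_val n
      rw [e2]; clear e1 e2 e3 e4; iterate 15 (rcases H with H | H; · omega)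
      omega) (M / q^2) _ (by omega) (x_le_div M q (by omega))
    refine le_trans (le_of_eq ?_) this
    norm_num
  · intro w hw1 hw2
    have hw3 := w_le_div q 524288 w (by omega) hw2
    have := shi_of w 19877 149 524288 (by norm_num) ⟨q, hq, h0, hw1⟩ (by omega) (by norm_num) (by
      intro n h1 h2
      obtain ⟨c, t, s, h, e1, e2, e3, e4, H⟩ := prm_val n
      rw [e4]; clear e1 e2 e3 e4; iterate 15 (rcases H with H | H; · omega)
      omega)
    norm_num at this hslo ⊢
    linarith

lemma g4 (q N : ℕ) (hq : q.Prime) (h0 : 191 ≤ q) (h1 : q ≤ 239) (hN : q^2 ≤ N) (hT : N ≤ q * 524288) : (F q N : ℝ) < 0.6 / Real.log q * N := by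
  have hqr : (191:ℝ) ≤ q := by exact_mod_cast h0
  have hqr1 : (q:ℝ) ≤ 239 := by exact_mod_cast h1
  have htau := tau_of q 86957 hq (by omega) (by omega) (by
      obtain ⟨c, t, s, h, e1, e2, e3, e4, H⟩ := prm_val q
      rw [e2]; clear e1 e2 e3 e4; iterate 15 (rcases H with H | H; · omega)
      omega)
  have hslo := slo_of q 11025 hq (by omega) (by omega) (by
      obtain ⟨c, t, s, h, e1, e2, e3, e4, H⟩ := prm_val q
      rw [e3]; clear e1 e2 e3 e4; iterate 15 (rcases H with H | H; · omega)
      omega)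
  have hsq : q^2 ≤ 57121 := by nlinarith
  refine gA 191 (1) (1) (86957/100000) (13043/100000) (886/10000) (23231/1000000) (67562/10000000) (23852/10000000) (4664063/1000000) (1220054/10000000) (0) (0) 52522 2639 chk4 (by norm_num) q (q * 524288) h0 (log_ge 191 q 52522 (by norm_num) h0 (by decide +kernel)) ?_ ?_ ?_ ?_ ?_ ?_ ?_ N hN hT
  · exact hZ0 q (by omega) _ _ _ _ (by norm_num) (by norm_num) (by norm_num) (by norm_num)
  · push_cast; positivity
  · push_cast at htau ⊢
    linarith
  · intro m hm
    rw [Nat.mul_div_cancel_left _ (by omega)] at hm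
    have := th1 m (by omega)
    norm_num at this ⊢
    linarith
  · intro m hm1 hm2
    have := th1 m (by omega)
    norm_num at this ⊢
    linarith
  · intro M hM hMT
    have hw : q ≤ M / q^2 := by
      rw [Nat.le_div_iff_mul_le (pow_pos (by omega) 2), ← pow_succ']; exact hM
    have := thw 191 86957 (by norm_num) (by norm_num) (by
      intro n h1 h2
      obtain ⟨c, t, s, h, e1, e2, e3, e4, H⟩ := prm_val n
      rw [e2]; clear e1 e2 e3 e4; iterate 15 (rcases H with H | H; · omega)
      omega) (M / q^2) _ (by omega) (x_le_div M q (by omega))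
    refine le_trans (le_of_eq ?_) this
    norm_num
  · intro w hw1 hw2
    have hw3 := w_le_div q 524288 w (by omega) hw2
    have := shi_of w 19877 191 524288 (by norm_num) ⟨q, hq, h0, hw1⟩ (by omega) (by norm_num) (by
      intro n h1 h2
      obtain ⟨c, t, s, h, e1, e2, e3, e4, H⟩ := prm_val n
      rw [e4]; clear e1 e2 e3 e4; iterate 15 (rcases H with H | H; · omega)
      omega)
    norm_num at this hslo ⊢
    linarith

lemma g5 (q N : ℕ) (hq : q.Prime) (h0 : 241 ≤ q) (h1 : q ≤ 366) (hN : q^2 ≤ N) (hT : N ≤ q^2 * 524288) : (F q N : ℝ) < 0.6 / Real.log q * N := by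
  have hqr : (241:ℝ) ≤ q := by exact_mod_cast h0
  have hqr1 : (q:ℝ) ≤ 366 := by exact_mod_cast h1
  have htau := tau_of q 89803 hq (by omega) (by omega) (by
      obtain ⟨c, t, s, h, e1, e2, e3, e4, H⟩ := prm_val q
      rw [e2]; clear e1 e2 e3 e4; iterate 15 (rcases H with H | H; · omega)
      omega)
  have hslo := slo_of q 10344 hq (by omega) (by omega) (by
      obtain ⟨c, t, s, h, e1, e2, e3, e4, H⟩ := prm_val q
      rw [e3]; clear e1 e2 e3 e4; iterate 15 (rcases H with H | H; · omega)
      omega)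
  have hsq : q^2 ≤ 133956 := by nlinarith
  refine gA 241 (102/100) (1) (89803/100000) (10197/100000) (761/10000) (18459/1000000) (53148/10000000) (18209/10000000) (4414780/1000000) (1012318/10000000) (0) (0) 54847 3741 chk5 (by norm_num) q (q^2 * 524288) h0 (log_ge 241 q 54847 (by norm_num) h0 (by decide +kernel)) ?_ ?_ ?_ ?_ ?_ ?_ ?_ N hN hT
  · exact hZ0 q (by omega) _ _ _ _ (by norm_num) (by norm_num) (by norm_num) (by norm_num)
  · push_cast; positivity
  · push_cast at htau ⊢
    linarith
  · intro m hm
    have := th102 m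
    norm_num at this ⊢
    linarith
  · intro m hm1 hm2
    have := th1 m (by omega)
    norm_num at this ⊢
    linarith
  · intro M hM hMT
    have hw : q ≤ M / q^2 := by
      rw [Nat.le_div_iff_mul_le (pow_pos (by omega) 2), ← pow_succ']; exact hM
    have := thw 241 89803 (by norm_num) (by norm_num) (by
      intro n h1 h2
      obtain ⟨c, t, s, h, e1, e2, e3, e4, H⟩ := prm_val n
      rw [e2]; clear e1 e2 e3 e4; iterate 15 (rcases H with H | H; · omega)
      omega) (M / q^2) _ (by omega) (x_le_div M q (by omega))
    refine le_trans (le_of_eq ?_) this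
    norm_num
  · intro w hw1 hw2
    have hw3 := w_le_div2 q 524288 w (by omega) hw2
    have := shi_of w 17951 241 524288 (by norm_num) ⟨q, hq, h0, hw1⟩ (by omega) (by norm_num) (by
      intro n h1 h2
      obtain ⟨c, t, s, h, e1, e2, e3, e4, H⟩ := prm_val n
      rw [e4]; clear e1 e2 e3 e4; iterate 15 (rcases H with H | H; · omega)
      omega)
    norm_num at this hslo ⊢
    linarith

lemma g6 (q N : ℕ) (hq : q.Prime) (h0 : 367 ≤ q) (h1 : q ≤ 511) (hN : q^2 ≤ N) (hT : N ≤ q^2 * 524288) : (F q N : ℝ) < 0.6 / Real.log q * N := by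
  have hqr : (367:ℝ) ≤ q := by exact_mod_cast h0
  have hqr1 : (q:ℝ) ≤ 511 := by exact_mod_cast h1
  have htau := tau_of q 91300 hq (by omega) (by omega) (by
      obtain ⟨c, t, s, h, e1, e2, e3, e4, H⟩ := prm_val q
      rw [e2]; clear e1 e2 e3 e4; iterate 15 (rcases H with H | H; · omega)
      omega)
  have hslo := slo_of q 10475 hq (by omega) (by omega) (by
      obtain ⟨c, t, s, h, e1, e2, e3, e4, H⟩ := prm_val q
      rw [e3]; clear e1 e2 e3 e4; iterate 15 (rcases H with H | H; · omega)
      omega)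
  have hsq : q^2 ≤ 261121 := by nlinarith
  refine gA 367 (102/100) (1) (91300/100000) (8700/100000) (428/10000) (12211/1000000) (34763/10000000) (11521/10000000) (4065193/1000000) (720995/10000000) (0) (0) 59053 7030 chk6 (by norm_num) q (q^2 * 524288) h0 (log_ge 367 q 59053 (by norm_num) h0 (by decide +kernel)) ?_ ?_ ?_ ?_ ?_ ?_ ?_ N hN hT
  · exact hZ0 q (by omega) _ _ _ _ (by norm_num) (by norm_num) (by norm_num) (by norm_num)
  · push_cast; positivity
  · push_cast at htau ⊢
    linarith
  · intro m hm
    have := th102 m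
    norm_num at this ⊢
    linarith
  · intro m hm1 hm2
    have := th1 m (by omega)
    norm_num at this ⊢
    linarith
  · intro M hM hMT
    have hw : q ≤ M / q^2 := by
      rw [Nat.le_div_iff_mul_le (pow_pos (by omega) 2), ← pow_succ']; exact hM
    have := thw 367 91300 (by norm_num) (by norm_num) (by
      intro n h1 h2
      obtain ⟨c, t, s, h, e1, e2, e3, e4, H⟩ := prm_val n
      rw [e2]; clear e1 e2 e3 e4; iterate 15 (rcases H with H | H; · omega)
      omega) (M / q^2) _ (by omega) (x_le_div M q (by omega))
    refine le_trans (le_of_eq ?_) this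
    norm_num
  · intro w hw1 hw2
    have hw3 := w_le_div2 q 524288 w (by omega) hw2
    have := shi_of w 14751 367 524288 (by norm_num) ⟨q, hq, h0, hw1⟩ (by omega) (by norm_num) (by
      intro n h1 h2
      obtain ⟨c, t, s, h, e1, e2, e3, e4, H⟩ := prm_val n
      rw [e4]; clear e1 e2 e3 e4; iterate 15 (rcases H with H | H; · omega)
      omega)
    norm_num at this hslo ⊢
    linarith

lemma g7 (q N : ℕ) (hq : q.Prime) (h0 : 512 ≤ q) (h1 : q ≤ 999) (hN : q^2 ≤ N) : (F q N : ℝ) < 0.6 / Real.log q * N := by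
  have hqr : (512:ℝ) ≤ q := by exact_mod_cast h0
  have hqr1 : (q:ℝ) ≤ 999 := by exact_mod_cast h1
  have htau := tau_of q 91942 hq (by omega) (by omega) (by
      obtain ⟨c, t, s, h, e1, e2, e3, e4, H⟩ := prm_val q
      rw [e2]; clear e1 e2 e3 e4; iterate 15 (rcases H with H | H; · omega)
      omega)
  have hslo := slo_of q 9317 hq (by omega) (by omega) (by
      obtain ⟨c, t, s, h, e1, e2, e3, e4, H⟩ := prm_val q
      rw [e3]; clear e1 e2 e3 e4; iterate 15 (rcases H with H | H; · omega)
      omega)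
  have hsq : q^2 ≤ 998001 := by nlinarith
  refine gA 512 (102/100) (1) (91942/100000) (8110/100000) (2618/10000) (8722/1000000) (24876/10000000) (8075/10000000) (3852826/1000000) (544022/10000000) (0) (0) 62383 11585 chk7 (by norm_num) q (N) h0 (log_ge 512 q 62383 (by norm_num) h0 (by decide +kernel)) ?_ ?_ ?_ ?_ ?_ ?_ ?_ N hN le_rfl
  · exact hZ0 q (by omega) _ _ _ _ (by norm_num) (by norm_num) (by norm_num) (by norm_num)
  · push_cast; positivity
  · push_cast at htau ⊢
    linarith
  · intro m hm
    have := th102 m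
    norm_num at this ⊢
    linarith
  · intro m hm1 hm2
    have := th1 m (by omega)
    norm_num at this ⊢
    linarith
  · intro M hM hMT
    have hw : q ≤ M / q^2 := by
      rw [Nat.le_div_iff_mul_le (pow_pos (by omega) 2), ← pow_succ']; exact hM
    have := thw 512 91890 (by norm_num) (by norm_num) (by
      intro n h1 h2
      obtain ⟨c, t, s, h, e1, e2, e3, e4, H⟩ := prm_val n
      rw [e2]; clear e1 e2 e3 e4; iterate 15 (rcases H with H | H; · omega)
      omega) (M / q^2) _ (by omega) (x_le_div M q (by omega))
    refine le_trans (le_of_eq ?_) this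
    norm_num
  · intro w hw1 hw2
    have h521 : 521 ≤ w := by
      by_contra hc
      have h521 : q < 521 := by omega
      revert hq; clear * - h0 h521; interval_cases q <;> norm_num
    have := sg_up w h521
    norm_num at this hslo ⊢
    linarith

lemma g9 (q N : ℕ) (hq : q.Prime) (h0 : 1000 ≤ q) (h1 : q ≤ 1399) (hN : q^2 ≤ N) : (F q N : ℝ) < 0.6 / Real.log q * N := by
  have hqr : (1000:ℝ) ≤ q := by exact_mod_cast h0
  have hqr1 : (q:ℝ) ≤ 1399 := by exact_mod_cast h1
  have htau := tau_of q 94771 hq (by omega) (by omega) (by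
      obtain ⟨c, t, s, h, e1, e2, e3, e4, H⟩ := prm_val q
      rw [e2]; clear e1 e2 e3 e4; iterate 15 (rcases H with H | H; · omega)
      omega)
  have hslo := slo_of q 8500 hq (by omega) (by omega) (by
      obtain ⟨c, t, s, h, e1, e2, e3, e4, H⟩ := prm_val q
      rw [e3]; clear e1 e2 e3 e4; iterate 15 (rcases H with H | H; · omega)
      omega)
  have hsq : q^2 ≤ 1957201 := by nlinarith
  refine gA 1000 (102/100) (102/100) (94771/100000) (8110/100000) (2700/10000) (5866/1000000) (12643/10000000) (3927/10000000) (3535432/1000000) (405118/10000000) (0) (0) 69077 31622 chk9 (by norm_num) q (N) h0 (log_ge 1000 q 69077 (by norm_num) h0 (by decide +kernel)) ?_ ?_ ?_ ?_ ?_ ?_ ?_ N hN le_rfl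
  · exact hZ0 q (by omega) _ _ _ _ (by norm_num) (by norm_num) (by norm_num) (by norm_num)
  · push_cast; positivity
  · push_cast at htau ⊢
    linarith
  · intro m hm
    have := th102 m
    norm_num at this ⊢
    linarith
  · intro m hm1 hm2
    have := th102 m
    norm_num at this ⊢
    linarith
  · intro M hM hMT
    have hw : q ≤ M / q^2 := by
      rw [Nat.le_div_iff_mul_le (pow_pos (by omega) 2), ← pow_succ']; exact hM
    have := thw 1000 91890 (by norm_num) (by norm_num) (by
      intro n h1 h2
      obtain ⟨c, t, s, h, e1, e2, e3, e4, H⟩ := prm_val n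
      rw [e2]; clear e1 e2 e3 e4; iterate 15 (rcases H with H | H; · omega)
      omega) (M / q^2) _ (by omega) (x_le_div M q (by omega))
    refine le_trans (le_of_eq ?_) this
    norm_num
  · intro w hw1 hw2
    have h521 : 521 ≤ w := by omega
    have := sg_up w h521
    norm_num at this hslo ⊢
    linarith

lemma g10 (q N : ℕ) (hq : q.Prime) (h0 : 1400 ≤ q) (h1 : q ≤ 524287) (hN : q^2 ≤ N) : (F q N : ℝ) < 0.6 / Real.log q * N := by
  have hqr : (1400:ℝ) ≤ q := by exact_mod_cast h0
  have hqr1 : (q:ℝ) ≤ 524287 := by exact_mod_cast h1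
  have htau := tau_of q 94558 hq (by omega) (by omega) (by
      obtain ⟨c, t, s, h, e1, e2, e3, e4, H⟩ := prm_val q
      rw [e2]; clear e1 e2 e3 e4; iterate 15 (rcases H with H | H; · omega)
      omega)
  have hslo := slo_of q 6767 hq (by omega) (by omega) (by
      obtain ⟨c, t, s, h, e1, e2, e3, e4, H⟩ := prm_val q
      rw [e3]; clear e1 e2 e3 e4; iterate 15 (rcases H with H | H; · omega)
      omega)
  have hsq : q^2 ≤ 274876858369 := by nlinarith
  refine gA 1400 (102/100) (102/100) (94558/100000) (8110/100000) (2873/10000) (4165/1000000) (9036/10000000) (2779/10000000) (3413695/1000000) (301642/10000000) (0) (0) 72442 52383 chk10 (by norm_num) q (N) h0 (log_ge 1400 q 72442 (by norm_num) h0 (by decide +kernel)) ?_ ?_ ?_ ?_ ?_ ?_ ?_ N hN le_rfl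
  · exact hZ0 q (by omega) _ _ _ _ (by norm_num) (by norm_num) (by norm_num) (by norm_num)
  · push_cast; positivity
  · push_cast at htau ⊢
    linarith
  · intro m hm
    have := th102 m
    norm_num at this ⊢
    linarith
  · intro m hm1 hm2
    have := th102 m
    norm_num at this ⊢
    linarith
  · intro M hM hMT
    have hw : q ≤ M / q^2 := by
      rw [Nat.le_div_iff_mul_le (pow_pos (by omega) 2), ← pow_succ']; exact hM
    have := thw 1400 91890 (by norm_num) (by norm_num) (by
      intro n h1 h2
      obtain ⟨c, t, s, h, e1, e2, e3, e4, H⟩ := prm_val n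
      rw [e2]; clear e1 e2 e3 e4; iterate 15 (rcases H with H | H; · omega)
      omega) (M / q^2) _ (by omega) (x_le_div M q (by omega))
    refine le_trans (le_of_eq ?_) this
    norm_num
  · intro w hw1 hw2
    have h521 : 521 ≤ w := by omega
    have := sg_up w h521
    norm_num at this hslo ⊢
    linarith
end PS
end


section
open ArithmeticFunction
set_option maxRecDepth 100000
namespace PS

def ppb (p : ℕ) : ℕ := (lgL (p - 1) + 17 * (p - 1)) / (p * (p - 1)) + 1

lemma ppb_sum : (pl.map ppb).sum ≤ 750000000000000 := by decide +kernel

lemma pp101 : ∑ p ∈ Ioc 1 101, la p * (1 / ((p:ℝ) * (p-1))) ≤ 0.75 := by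
  have e : ∑ p ∈ Ioc 1 101, la p * (1 / ((p:ℝ) * (p-1))) = (pl.map fun p : ℕ => Real.log p * (1 / ((p:ℝ) * (p-1)))).sum := by
    have h1 : ∑ p ∈ Ioc 1 101, la p * (1 / ((p:ℝ) * (p-1))) = ∑ p ∈ (Ioc 0 101).filter Nat.Prime, Real.log p * (1 / ((p:ℝ) * (p-1))) := by
      rw [sum_filter, ← sum_subset (show Ioc 1 101 ⊆ Ioc 0 101 from Ioc_subset_Ioc_left (by norm_num))]
      · refine sum_congr rfl fun p _ => ?_
        unfold la; split_ifs <;> simp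
      · intro x hx hx2
        simp only [mem_Ioc] at hx hx2
        obtain rfl : x = 1 := by omega
        simp
    have : ((Ioc 0 101).filter Nat.Prime : Finset ℕ) = pl.toFinset := by
      rw [← pl_eq]
    rw [h1, this, List.sum_toFinset _ pl_nodup]
  rw [e]
  have h := (sum_bd pl (fun p : ℕ => Real.log p * (1 / ((p:ℝ) * (p-1)))) (fun _ => 0) ppb (by
    intro p hp
    have hp2 : 2 ≤ p := by
      have : p ∈ (Ioc 0 101).filter Nat.Prime := by
        have h := List.mem_toFinset.2 hp
        rw [← pl_eq] at h
        convert h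
      exact (mem_filter.1 this).2.two_le
    have hp2' : (2:ℝ) ≤ p := by exact_mod_cast hp2
    have hl := log_hi p (by omega)
    have hl0 : 0 ≤ Real.log p := Real.log_nonneg (by linarith)
    have hd : (0:ℝ) < (p:ℝ) * (p-1) := by nlinarith
    constructor
    · simp
      have : (0:ℝ) ≤ p - 1 := by linarith
      positivity
    · rw [mul_one_div, div_le_div_iff₀ hd (by norm_num)]
      have hb : lgL (p - 1) + 17 * (p - 1) ≤ ppb p * (p * (p-1)) := by
        unfold ppb
        have := Nat.lt_div_mul_add (Nat.mul_pos (by omega : 0 < p) (by omega : 0 < p - 1)) (a := lgL (p - 1) + 17 * (p - 1))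
        rw [add_mul]; omega
      have hb' : (lgL (p - 1) : ℝ) + 17 * ((p:ℝ) - 1) ≤ ppb p * (p * (p-1)) := by
        have := (Nat.cast_le (α := ℝ)).2 hb
        push_cast [Nat.cast_sub (by omega : 1 ≤ p)] at this
        exact this
      generalize lgL (p-1) = A at *
      rw [le_div_iff₀ (by norm_num)] at hl
      linarith)).2
  have h2 := ppb_sum
  generalize (pl.map ppb).sum = z at *
  have h3 : (z:ℝ) ≤ 750000000000000 := by exact_mod_cast h2
  refine h.trans ?_
  rw [div_le_iff₀ (by norm_num)]
  linarith

lemma sL_ge (n : ℕ) (hn : 1 ≤ n) : Real.log n - 1 ≤ sL n := by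
  have hn' : (1:ℝ) ≤ n := by exact_mod_cast hn
  have h1 := Tf_ge n hn
  have h2 : Tf n ≤ n * sL n := by
    rw [Tf_eq, sL, mul_sum]
    refine sum_le_sum fun m hm => ?_
    have : Λ m * ((n / m : ℕ) : ℝ) ≤ Λ m * ((n:ℝ) / m) := mul_le_mul_of_nonneg_left Nat.cast_div_le vonMangoldt_nonneg
    refine this.trans (le_of_eq (by ring))
  have h3 : 0 ≤ Real.log n := Real.log_nonneg hn'
  have h4 : (n:ℝ) * (Real.log n - 1) ≤ n * sL n := by linarith
  exact le_of_mul_le_mul_left h4 (by linarith)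

lemma sg_ge_sL (n : ℕ) (hn : 103 ≤ n) : sL n - 0.78 ≤ sg n := by
  have h1 : sL n = sg n + ∑ d ∈ (Ioc 0 n).filter (fun d => Rq 2 d ∧ ¬ d.Prime), Λ d / d := by
    unfold sL
    rw [← sum_filter_add_sum_filter_not (Ioc 0 n) Nat.Prime]
    congr 1
    · unfold sg
      refine sum_congr rfl fun p hp => ?_
      rw [vonMangoldt_apply_prime (mem_filter.1 hp).2]
    · refine sum_congr ?_ fun _ _ => rfl
      ext d; simp only [mem_filter]
      constructor
      · rintro ⟨a, b⟩; exact ⟨a, fun p hp _ => hp.two_le, b⟩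
      · rintro ⟨a, _, b⟩; exact ⟨a, b⟩
  have h2 := pp_sum_le 2 n (by norm_num) (by omega)
  rw [show 2 - 1 = 1 from rfl, ← sum_Ioc_consecutive _ (by norm_num : 1 ≤ 101) (by omega : 101 ≤ n)] at h2
  have h3 : ∑ p ∈ Ioc 101 n, la p * (1 / ((p:ℝ) * (p-1))) ≤ 1.02 / 102 + 1.02 / 103 := by
    have hN' : (103:ℝ) ≤ n := by exact_mod_cast hn
    have e : ∑ p ∈ Ioc 101 n, la p * (1 / ((p:ℝ) * (p-1))) = ∑ p ∈ Ioc (103-1) n, la p * (1 / ((p:ℝ) * (p-1))) := by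
      rw [← sum_subset (show Ioc (103-1) n ⊆ Ioc 101 n from Ioc_subset_Ioc_left (by norm_num))]
      intro x hx hx2
      simp only [mem_Ioc] at hx hx2
      obtain rfl : x = 102 := by omega
      have : la 102 = 0 := by unfold la; rw [if_neg (by norm_num)]
      rw [this]; simp
    rw [e]
    have := prime_sum 103 n (by norm_num) hn 1.02 (fun m => 1 / ((m:ℝ) * (m-1))) (by
      intro m hm _
      have hm' : (2:ℝ) ≤ m := by exact_mod_cast (by omega : 2 ≤ m)
      have : (0:ℝ) < m - 1 := by linarith
      push_cast
      gcongr <;> linarith) (by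
        have : (0:ℝ) < n - 1 := by linarith
        positivity) (fun m _ _ => th102 m)
    refine this.trans ?_
    rw [inv_tel 103 n (by norm_num) hn]
    have ht : 0 ≤ th (103-1) := by
      unfold th
      exact sum_nonneg fun p hp => Real.log_natCast_nonneg p
    have a3 : (0:ℝ) < (n:ℝ)⁻¹ := by positivity
    push_cast
    norm_num at ht ⊢
    linarith
  have := pp101
  rw [h1]
  norm_num at *
  linarith

lemma g13 (q N : ℕ) (hq : q.Prime) (h0 : 524288 ≤ q) (hN : q^2 ≤ N) : (F q N : ℝ) < 0.6 / Real.log q * N := by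
  have hq1 : 524289 ≤ q := by
    rcases Nat.lt_or_ge q 524289 with h | h
    · obtain rfl : q = 524288 := by omega
      norm_num at hq
    · exact h
  have hqr : (524289:ℝ) ≤ q := by exact_mod_cast hq1
  refine gA 524288 (102/100) (102/100) (88/100) (8110/100000) (7450/10000) (2/1000000) (26/10000000) (9/10000000) (2589989/1000000) (1/10000000) (0) (0) 131697 379625062 chk13 (by norm_num) q N h0 ?_ ?_ ?_ ?_ ?_ ?_ ?_ ?_ N hN le_rfl
  · have : Real.log ((2:ℝ)^19) ≤ Real.log q := Real.log_le_log (by norm_num) (by norm_num; linarith)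
    rw [Real.log_pow] at this
    have := Real.log_two_gt_d9
    norm_num at *
    linarith
  · exact hZ0 q (by omega) _ _ _ _ (by norm_num) (by norm_num) (by norm_num) (by norm_num)
  · push_cast; positivity
  · have := th_lo (q-1) (by omega)
    rw [Nat.cast_sub (by omega)] at this
    norm_num at this ⊢
    linarith
  · intro m hm
    have := th102 m
    norm_num at this ⊢
    linarith
  · intro m hm1 hm2
    have := th102 m
    norm_num at this ⊢
    linarith
  · intro M hM hMT
    have hw : q ≤ M / q^2 := by
      rw [Nat.le_div_iff_mul_le (pow_pos (by omega) 2), ← pow_succ']; exact hM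
    have := thw 524288 91890 (by norm_num) (by norm_num) (by
      intro n h1 h2
      obtain ⟨c, t, s, h, e1, e2, e3, e4, H⟩ := prm_val n
      rw [e2]; clear e1 e2 e3 e4; iterate 15 (rcases H with H | H; · omega)
      omega) (M / q^2) _ (by omega) (x_le_div M q (by omega))
    refine le_trans (le_of_eq ?_) this
    norm_num
  · intro w hw1 hw2
    have h1 := sg_up w (by omega)
    have h2 := sg_ge_sL (q-1) (by omega)
    have h3 := sL_ge (q-1) (by omega)
    have h4 : Real.log q ≤ Real.log ((q-1:ℕ):ℝ) + 0.00001 := by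
      rw [Nat.cast_sub (by omega)]
      push_cast
      have := Real.log_le_sub_one_of_pos (show (0:ℝ) < q / (q-1) from div_pos (by linarith) (by linarith))
      rw [Real.log_div (by linarith) (by linarith)] at this
      have h5 : (q:ℝ) / (q-1) ≤ 1.00001 := by
        rw [div_le_iff₀ (by linarith)]; linarith
      linarith
    norm_num at h1 h2 h3 h4 ⊢
    linarith

/-- all primes above 512 -/
theorem big_q (q N : ℕ) (hq : q.Prime) (h0 : 512 ≤ q) (hN : q^2 ≤ N) : (F q N : ℝ) < 0.6 / Real.log q * N := by
  rcases Nat.lt_or_ge q 1000 with h | h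
  · exact g7 q N hq h0 (by omega) hN
  rcases Nat.lt_or_ge q 1400 with h | h
  · exact g9 q N hq (by omega) (by omega) hN
  rcases Nat.lt_or_ge q 524288 with h | h
  · exact g10 q N hq (by omega) (by omega) hN
  · exact g13 q N hq h hN
end PS
end


section
set_option maxRecDepth 100000
namespace PS

lemma dvd_30030 (p : ℕ) (hp : p.Prime) (h : p ∣ 30030) : p < 17 := by
  have e : 30030 = 2*(3*(5*(7*(11*13)))) := by norm_num
  rw [e] at h
  simp only [hp.dvd_mul] at h
  rcases h with h|h|h|h|h|h <;> exact lt_of_le_of_lt (Nat.le_of_dvd (by norm_num) h) (by norm_num)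

lemma Rq17 (n : ℕ) : Rq 17 n ↔ Nat.gcd n 30030 = 1 := by
  constructor
  · intro h
    by_contra hc
    obtain ⟨p, hp, hd⟩ := Nat.exists_prime_and_dvd hc
    have h1 := h p hp (hd.trans (Nat.gcd_dvd_left _ _))
    have h2 := dvd_30030 p hp (hd.trans (Nat.gcd_dvd_right _ _))
    omega
  · intro h p hp hd
    by_contra hc
    push Not at hc
    have : p ∣ 30030 := by
      interval_cases p <;> first | (norm_num; done) | (exfalso; revert hp; norm_num; done)
    have := Nat.dvd_gcd hd this
    rw [h] at this
    exact hp.one_lt.ne' (Nat.dvd_one.1 this)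

lemma F17_per (n : ℕ) : F 17 (n + 30030) = F 17 n + 5760 := by
  have h := Nat.filter_coprime_Ico_eq_totient 30030 (n+1)
  have ht : Nat.totient 30030 = 5760 := by
    have e : 30030 = 2*(3*(5*(7*(11*13)))) := by norm_num
    rw [e]
    repeat rw [Nat.totient_mul (by norm_num)]
    repeat rw [Nat.totient_prime (by norm_num)]
  rw [ht] at h
  have e1 : Ioc 0 (n + 30030) = Ioc 0 n ∪ Ico (n+1) (n+1+30030) := by
    ext t; simp only [mem_union, mem_Ioc, mem_Ico]; omega
  unfold F
  rw [e1, filter_union, card_union_of_disjoint, add_right_inj, ← h]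
  · congr 1
    ext t
    simp only [mem_filter, Rq17, Nat.Coprime, Nat.gcd_comm t]
  · rw [disjoint_left]
    intro t h1 h2
    simp only [mem_filter, mem_Ioc, mem_Ico] at h1 h2
    omega

def bst2 (n S : ℕ) : ℕ := gd (Nat.ble (Nat.pow (Nat.sub (Nat.mul 30030 S) (Nat.mul 5760 n)) 2) (Nat.mul 589032900 n))
  (gd (Nat.ble (Nat.pow (Nat.sub (Nat.mul 5760 (Nat.succ n)) (Nat.mul 30030 S)) 2) (Nat.mul 589032900 n)) (Nat.succ S))

def bst (n S : ℕ) : ℕ := force (Bool.rec (Nat.pred S) S (Nat.beq (Nat.gcd n 30030) 1)) fun S' => gd (Nat.blt 0 S) (bst2 n S')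

def BI (n : ℕ) : Prop := (30030 * F 17 n - 5760 * n) ^ 2 ≤ 589032900 * n ∧ (5760 * (n+1) - 30030 * F 17 n)^2 ≤ 589032900 * n

lemma bst_spec (n S : ℕ) (h : bst (n+1) S ≠ 0) (hS : S ≠ 0 → S = F 17 n + 1) : BI (n+1) ∧ bst (n+1) S = F 17 (n+1) + 1 ∧ S ≠ 0 := by
  unfold bst at h ⊢
  rw [force_eq] at h ⊢
  obtain ⟨h0, e0⟩ := gd_ne h
  rw [e0] at h ⊢
  have hS0 : S ≠ 0 := by
    have : 1 ≤ S := by simpa [Nat.blt] using h0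
    omega
  have hS := hS hS0
  have e : Bool.rec (Nat.pred S) S (Nat.beq (Nat.gcd (n+1) 30030) 1) = F 17 (n+1) := by
    rw [F_succ]
    simp only [Rq17]
    by_cases hg : Nat.gcd (n+1) 30030 = 1
    · have hb : Nat.beq (Nat.gcd (n+1) 30030) 1 = true := by rw [hg]; rfl
      rw [hb, if_pos hg]; exact hS
    · have : Nat.beq (Nat.gcd (n+1) 30030) 1 = false := by
        rw [Bool.eq_false_iff]; intro h; exact hg (Nat.eq_of_beq_eq_true h)
      rw [this, if_neg hg]; simp [hS]
  rw [e] at h ⊢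
  unfold bst2 at h ⊢
  obtain ⟨h1, e1⟩ := gd_ne h
  rw [e1] at h ⊢
  obtain ⟨h2, e2⟩ := gd_ne h
  rw [e2]
  exact ⟨⟨Nat.le_of_ble_eq_true h1, Nat.le_of_ble_eq_true h2⟩, rfl, hS0⟩

lemma brun_spec (d : ℕ) : ∀ n S, run bst d (n+1) S ≠ 0 → (S ≠ 0 → S = F 17 n + 1) →
    (∀ m, n < m → m ≤ n + 2^d → BI m) ∧ run bst d (n+1) S = F 17 (n+2^d) + 1 ∧ S ≠ 0 := by
  induction d with
  | zero =>
    intro n S h hS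
    obtain ⟨h1, h2, h3⟩ := bst_spec n S h hS
    refine ⟨fun m hm hm2 => ?_, h2, h3⟩
    obtain rfl : m = n+1 := by simp at hm2; omega
    exact h1
  | succ d ih =>
    intro n S h hS
    rw [run_succ, add_right_comm n 1] at h
    have key : run bst d (n+1) S ≠ 0 → run bst d (n+1) S = F 17 (n+2^d) + 1 := fun hne => (ih n S hne hS).2.1
    obtain ⟨a1, a2, a3⟩ := ih (n + 2^d) _ h key
    obtain ⟨b1, b2, b3⟩ := ih n S a3 hS
    have hp : 2^(d+1) = 2^d + 2^d := by ring
    refine ⟨fun m hm hm2 => ?_, ?_, b3⟩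
    · rcases le_or_gt m (n+2^d) with hh | hh
      · exact b1 m hm hh
      · exact a1 m hh (by omega)
    · rw [run_succ, add_right_comm n 1, a2, hp]; ring_nf

lemma brun : run bst 15 1 1 ≠ 0 := by decide +kernel

lemma BI_all (n : ℕ) (h1 : 1 ≤ n) (h2 : n ≤ 30030) : BI n :=
  (brun_spec 15 0 1 brun (fun _ => by simp [F])).1 n (by omega) (by norm_num; omega)

lemma sub_sq (A B C n : ℕ) (h : (A - B)^2 ≤ C^2 * n) : (A:ℝ) ≤ B + C * Real.sqrt n := by
  have h1 : (((A - B : ℕ) : ℝ))^2 ≤ (C * Real.sqrt n)^2 := by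
    rw [mul_pow, Real.sq_sqrt (by positivity)]; exact_mod_cast h
  have h2 := (pow_le_pow_iff_left₀ (by positivity) (by positivity) two_ne_zero).1 h1
  have h3 : (A:ℝ) ≤ B + ((A - B : ℕ):ℝ) := by exact_mod_cast (by omega : A ≤ B + (A-B))
  linarith

/-- Rankin type estimate -/
def Rk (q : ℕ) (V C : ℝ) : Prop := ∀ x : ℝ, 0 ≤ x → |(F q ⌊x⌋₊ : ℝ) - x * V| ≤ C * Real.sqrt x

lemma base_nat (n : ℕ) (h1 : 1 ≤ n) : (30030 * F 17 n : ℝ) ≤ 5760 * n + 24270 * Real.sqrt n ∧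
    (5760 * (n+1) : ℝ) ≤ 30030 * F 17 n + 24270 * Real.sqrt n := by
  induction n using Nat.strong_induction_on with
  | _ n ih =>
    rcases le_or_gt n 30030 with h2 | h2
    · obtain ⟨a, b⟩ := BI_all n h1 h2
      have a' := sub_sq _ _ 24270 n (by norm_num; exact a)
      have b' := sub_sq _ _ 24270 n (by norm_num; exact b)
      push_cast at a' b'
      exact ⟨a', b'⟩
    · obtain ⟨m, rfl⟩ := Nat.exists_eq_add_of_le' h2.le
      obtain ⟨a, b⟩ := ih m (by omega) (by omega)
      rw [F17_per]
      have : Real.sqrt m ≤ Real.sqrt ((m + 30030 : ℕ):ℝ) := Real.sqrt_le_sqrt (by push_cast; linarith)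
      push_cast at this ⊢
      constructor <;> linarith

lemma Rk_base : Rk 17 (5760/30030) (24270/30030) := by
  intro x hx
  rcases lt_or_ge x 1 with h | h
  · rw [(Nat.floor_eq_zero).2 h]
    have : x ≤ Real.sqrt x := Real.le_sqrt_of_sq_le (by nlinarith)
    simp only [F, Ioc_self, filter_empty, card_empty, Nat.cast_zero, zero_sub, abs_neg]
    rw [abs_of_nonneg (by positivity)]
    linarith
  · have h1 : 1 ≤ ⌊x⌋₊ := Nat.one_le_floor_iff x |>.2 h
    obtain ⟨a, b⟩ := base_nat _ h1
    have f1 := Nat.floor_le hx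
    have f2 := Nat.lt_floor_add_one x
    have := Real.sqrt_le_sqrt f1
    rw [abs_le]
    constructor <;> linarith

lemma Rq_succ (r n : ℕ) (hr : r.Prime) : Rq (r+1) n ↔ Rq r n ∧ ¬ r ∣ n := by
  constructor
  · intro h
    exact ⟨fun p hp hd => by have := h p hp hd; omega, fun hd => by have := h r hr hd; omega⟩
  · rintro ⟨h1, h2⟩ p hp hd
    have := h1 p hp hd
    rcases this.eq_or_lt with rfl | h
    · exact absurd hd h2
    · omega

lemma F_step (r N : ℕ) (hr : r.Prime) : F r N = F (r+1) N + F r (N / r) := by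
  unfold F
  rw [← card_filter_add_card_filter_not (s := (Ioc 0 N).filter (Rq r)) (fun n => ¬ r ∣ n)]
  congr 1
  · rw [filter_filter]
    congr 1
    ext n; simp only [mem_filter, Rq_succ _ _ hr]
  · simp only [not_not]
    symm
    refine card_bij (fun a _ => r * a) ?_ ?_ ?_
    · intro a ha
      simp only [mem_filter, mem_Ioc] at ha ⊢
      have := (Nat.le_div_iff_mul_le hr.pos).1 ha.1.2
      exact ⟨⟨⟨Nat.mul_pos hr.pos ha.1.1, by linarith [mul_comm r a]⟩, (Rq_mul _ _ _).2 ⟨(Rq_prime _ _ hr).2 le_rfl, ha.2⟩⟩, dvd_mul_right _ _⟩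
    · intro a _ b _ h
      exact Nat.eq_of_mul_eq_mul_left hr.pos h
    · intro b hb
      simp only [mem_filter, mem_Ioc] at hb
      obtain ⟨a, rfl⟩ := hb.2
      refine ⟨a, ?_, rfl⟩
      simp only [mem_filter, mem_Ioc]
      exact ⟨⟨Nat.pos_of_mul_pos_left hb.1.1.1, (Nat.le_div_iff_mul_le hr.pos).2 (by linarith [mul_comm r a, hb.1.1.2])⟩, ((Rq_mul _ _ _).1 hb.1.2).2⟩

lemma F_gap (a b N : ℕ) (hab : a ≤ b) (h : ∀ s, a ≤ s → s < b → ¬ s.Prime) : F a N = F b N := by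
  unfold F
  congr 1
  ext n
  simp only [mem_filter, and_congr_right_iff]
  intro _
  constructor
  · intro h1 p hp hd
    by_contra hc
    exact h p (h1 p hp hd) (by omega) hp
  · intro h1 p hp hd
    exact hab.trans (h1 p hp hd)

lemma Rk_step (r : ℕ) (V C : ℝ) (hr : r.Prime) (h : Rk r V C) : Rk (r+1) (V * (1 - 1/r)) (C * (1 + 1/Real.sqrt r)) := by
  intro x hx
  have h1 := h x hx
  have h2 := h (x / r) (by positivity)
  rw [Nat.floor_div_natCast, Real.sqrt_div hx] at h2
  have e : (F r ⌊x⌋₊ : ℝ) = F (r+1) ⌊x⌋₊ + F r (⌊x⌋₊ / r) := by exact_mod_cast F_step r _ hr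
  rw [abs_le] at *
  have e2 : C * (1 + 1/Real.sqrt r) * Real.sqrt x = C * Real.sqrt x + C * (Real.sqrt x / Real.sqrt r) := by ring
  have e3 : x * (V * (1 - 1/r)) = x * V - x / r * V := by ring
  rw [e2, e3]
  constructor <;> linarith

lemma Rk_congr (a b : ℕ) (V C : ℝ) (hab : a ≤ b) (h : ∀ s, a ≤ s → s < b → ¬ s.Prime) (h1 : Rk a V C) : Rk b V C := by
  intro x hx; rw [← F_gap a b _ hab h]; exact h1 x hx

def Rk' (q v c : ℕ) : Prop := ∃ V C : ℝ, 0 ≤ V ∧ 0 ≤ C ∧ V ≤ v / 10^12 ∧ C ≤ c / 10^9 ∧ Rk q V C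

lemma Rk'_step (r a v c r' v' c' : ℕ) (hr : r.Prime) (ha : 10^12 ≤ a*a*r) (hv : v * (r-1) ≤ v' * r) (hc : c * (10^6+a) ≤ c' * 10^6)
    (hrr : r < r') (hg : ∀ s, r+1 ≤ s → s < r' → ¬ s.Prime) (h : Rk' r v c) : Rk' r' v' c' := by
  obtain ⟨V, C, hV, hC, hVv, hCc, hk⟩ := h
  have hr0 : (0:ℝ) < r := by exact_mod_cast hr.pos
  have hr1 : (1:ℝ) ≤ r := by exact_mod_cast hr.one_lt.le
  have i1 : 1 / (r:ℝ) ≤ 1 := by rw [div_le_one hr0]; exact hr1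
  have i2 : 1 / Real.sqrt r ≤ a / 10^6 := by
    rw [div_le_div_iff₀ (Real.sqrt_pos.2 hr0) (by norm_num)]
    have : (10:ℝ)^6 ≤ Real.sqrt (a*a*r) := by
      apply Real.le_sqrt_of_sq_le
      have : ((10^12:ℕ):ℝ) ≤ ((a*a*r : ℕ):ℝ) := by exact_mod_cast ha
      push_cast at this; linarith
    rw [Real.sqrt_mul (by positivity), Real.sqrt_mul_self (by positivity)] at this
    linarith
  refine ⟨V * (1 - 1/r), C * (1 + 1/Real.sqrt r), mul_nonneg hV (by linarith), by positivity, ?_, ?_, Rk_congr _ _ _ _ hrr hg (Rk_step r V C hr hk)⟩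
  · have h1 : V * (1 - 1/r) ≤ v/10^12 * (1 - 1/r) := mul_le_mul_of_nonneg_right hVv (by linarith)
    refine h1.trans ?_
    have h2 : (v:ℝ) * (r - 1) ≤ v' * r := by
      have : ((v * (r-1) : ℕ):ℝ) ≤ ((v' * r : ℕ):ℝ) := by exact_mod_cast hv
      rw [Nat.cast_mul, Nat.cast_mul, Nat.cast_sub hr.one_lt.le] at this
      simpa using this
    have e : (v:ℝ)/10^12 * (1 - 1/r) = v * (r-1) / r / 10^12 := by field_simp
    rw [e]
    gcongr
    rw [div_le_iff₀ hr0]; exact h2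
  · have h1 : C * (1 + 1/Real.sqrt r) ≤ c/10^9 * (1 + a/10^6) := mul_le_mul hCc (by linarith) (by positivity) (by positivity)
    refine h1.trans ?_
    have h2 : (c:ℝ) * (10^6+a) ≤ c' * 10^6 := by exact_mod_cast hc
    have e : (c:ℝ)/10^9 * (1 + a/10^6) = c * (10^6+a) / 10^6 / 10^9 := by field_simp
    rw [e]
    gcongr
    rw [div_le_iff₀ (by norm_num)]; exact h2

def pb (r : ℕ) : Bool := (List.range 21).all fun i => Nat.ble r (i+2) || !(Nat.beq (r % (i+2)) 0)

lemma pb_spec (r : ℕ) (h1 : 2 ≤ r) (h2 : r < 529) : pb r = true ↔ r.Prime := by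
  unfold pb
  rw [List.all_eq_true]
  constructor
  · intro h
    by_contra hc
    have m1 := Nat.minFac_prime (show r ≠ 1 by omega)
    have m2 := Nat.minFac_sq_le_self (show 0 < r by omega) hc
    have m3 := Nat.minFac_dvd r
    have m4 : r.minFac < 23 := by nlinarith
    have := h (r.minFac - 2) (List.mem_range.2 (by have := m1.two_le; omega))
    rw [Nat.sub_add_cancel m1.two_le, Nat.mod_eq_zero_of_dvd m3] at this
    simp at this
    have m5 := m1.two_le
    rw [sq] at m2
    have := Nat.mul_le_mul_right r.minFac m5
    omega
  · intro h i hi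
    rcases le_or_gt r (i+2) with h3 | h3
    · simp [h3]
    · have : r % (i+2) ≠ 0 := by
        intro h0
        have := (Nat.dvd_prime h).1 (Nat.dvd_of_mod_eq_zero h0)
        omega
      have h5 : (r % (i+2)).beq 0 = false := by
        rw [Bool.eq_false_iff]; intro h; exact this (Nat.eq_of_beq_eq_true h)
      simp [h5]

def chl (q v c g : ℕ) : Bool := Nat.blt 0 g && Nat.blt ((v * g + 1000 * c) * (lgL (q-1) + 17 * (q-1))) (6 * 10^26 * g)

lemma chl_spec (q v c g N : ℕ) (hq : q.Prime) (h : Rk' q v c) (hc : chl q v c g = true) (hN : g^2 ≤ N) :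
    (F q N : ℝ) < 0.6 / Real.log q * N := by
  obtain ⟨V, C, hV, hC, hVv, hCc, hk⟩ := h
  unfold chl at hc
  simp only [Bool.and_eq_true, Nat.blt_eq] at hc
  obtain ⟨hg, hc⟩ := hc
  have hl := log_hi q hq.one_lt.le
  have hlp := log_nat_pos q hq.two_le
  have hc' : ((v:ℝ) * g + 1000 * c) * (lgL (q-1) + 17 * (q-1 : ℕ)) < 6 * 10^26 * g := by exact_mod_cast hc
  rw [Nat.cast_sub hq.one_lt.le] at hc'
  push_cast at hc' hl
  generalize (lgL (q-1) : ℝ) + 17 * ((q:ℝ)-1) = A at hc' hl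
  have h1 := hk N (by positivity)
  rw [Nat.floor_natCast] at h1
  have h2 := (abs_le.1 h1).2
  have hg0 : (0:ℝ) < g := by exact_mod_cast hg
  have hs : (g:ℝ) ≤ Real.sqrt N := Real.le_sqrt_of_sq_le (by exact_mod_cast hN)
  have hN0 : (0:ℝ) < N := by
    have : 0 < N := lt_of_lt_of_le (by positivity) hN
    exact_mod_cast this
  have hs0 : (0:ℝ) < Real.sqrt N := Real.sqrt_pos.2 hN0
  have hsN : Real.sqrt N * Real.sqrt N = N := Real.mul_self_sqrt hN0.le
  have h3 : C * Real.sqrt N ≤ c/10^9/g * N := by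
    have : C * Real.sqrt N * g ≤ c/10^9 * N := by
      calc C * Real.sqrt N * g ≤ C * Real.sqrt N * Real.sqrt N := by gcongr
        _ = C * N := by rw [mul_assoc, hsN]
        _ ≤ _ := by gcongr
    rw [div_mul_eq_mul_div, le_div_iff₀ hg0]; exact this
  have h4 : (F q N : ℝ) ≤ (v/10^12 + c/10^9/g) * N := by nlinarith
  refine lt_of_le_of_lt h4 (mul_lt_mul_of_pos_right ?_ hN0)
  rw [lt_div_iff₀ hlp]
  have e : (v:ℝ)/10^12 + c/10^9/g = (v * g + 1000 * c) / (10^12 * g) := by field_simp; ring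
  calc ((v:ℝ)/10^12 + c/10^9/g) * Real.log q ≤ (v/10^12 + c/10^9/g) * (A / 10^15) := by gcongr
    _ = ((v:ℝ) * g + 1000 * c) * A / (10^27 * g) := by rw [e]; field_simp
    _ < 0.6 := by rw [div_lt_iff₀ (by positivity)]; linarith

def rch : List (ℕ × ℕ × ℕ × ℕ × ℕ) → Bool
  | [] => true
  | (r,a,g,v,c) :: l => pb r && Nat.ble 2 r && Nat.blt r 529 && chl r v c g && (match l with
    | [] => true
    | (r',_,_,v',c') :: _ => Nat.blt r' 529 && Nat.blt r r' && Nat.ble (10^12) (a*a*r) && Nat.ble (v * (r-1)) (v' * r) && Nat.ble (c * (10^6+a)) (c' * 10^6)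
      && (List.range (r' - (r+1))).all fun i => !pb (r+1+i)) && rch l

lemma rch_spec (l : List (ℕ × ℕ × ℕ × ℕ × ℕ)) : ∀ (r a g v c : ℕ), rch ((r,a,g,v,c)::l) = true → Rk' r v c →
    ∀ x ∈ (r,a,g,v,c)::l, ∀ N, x.2.2.1^2 ≤ N → (F x.1 N : ℝ) < 0.6 / Real.log x.1 * N := by
  induction l with
  | nil =>
    intro r a g v c h hk x hx N hN
    simp only [List.mem_singleton] at hx
    subst hx
    simp only [rch, Bool.and_eq_true, Nat.blt_eq] at h
    exact chl_spec r v c g N ((pb_spec r (Nat.le_of_ble_eq_true h.1.1.1.1.2) h.1.1.1.2).1 h.1.1.1.1.1) hk h.1.1.2 hN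
  | cons y l ih =>
    intro r a g v c h hk x hx N hN
    obtain ⟨r', a', g', v', c'⟩ := y
    rw [rch] at h
    simp only [Bool.and_eq_true, Nat.blt_eq] at h
    obtain ⟨⟨⟨⟨⟨h1, h2⟩, h3⟩, h4⟩, h5⟩, h6⟩ := h
    have hp := (pb_spec r (Nat.le_of_ble_eq_true h2) h3).1 h1
    rcases List.mem_cons.1 hx with rfl | hx
    · exact chl_spec r v c g N hp hk h4 hN
    · obtain ⟨⟨⟨⟨⟨i0, i1⟩, i2⟩, i3⟩, i4⟩, i5⟩ := h5
      refine ih r' a' g' v' c' h6 (Rk'_step r a v c r' v' c' hp (Nat.le_of_ble_eq_true i2) (Nat.le_of_ble_eq_true i3) (Nat.le_of_ble_eq_true i4) i1 ?_ hk) x hx N hN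
      intro s s1 s2 s3
      rw [List.all_eq_true] at i5
      have := i5 (s - (r+1)) (List.mem_range.2 (by omega))
      rw [show r + 1 + (s - (r+1)) = s by omega, (pb_spec s s3.two_le (by omega)).2 s3] at this
      simp at this

def rtab : List (ℕ × ℕ × ℕ × ℕ × ℕ) := [(17,242536,42,191808191809,808191809),
 (19,229416,45,180525356997,1004207418),
 (23,208515,62,171024022419,1234588668),
 (29,185696,104,163588195358,1492018925),
 (31,179606,107,157947223105,1769080872),
 (37,164399,158,152852151392,2086818412),
 (41,156174,191,148721012166,2429889273),
 (43,152499,196,145093670406,2809374801),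
 (47,145865,231,141719399002,3237801649),
 (53,137361,300,138704092641,3710083587),
 (59,130189,383,136087034290,4219704379),
 (61,128037,393,133780474387,4769063473),
 (67,122170,486,131587351857,5379680053),
 (71,118679,544,129623361531,6036915566),
 (73,117042,562,127797680383,6753370669),
 (79,112509,671,126047027228,7543798679),
 (83,109765,742,124451495238,8392543925),
 (89,106000,870,122952079633,9313751509),
 (97,101535,1076,121570595593,10301009169),
 (101,99504,1172,120317290484,11346922135),
 (103,98533,1569,119126030183,12475986276),
 (107,96674,1599,117969466784,13705282632),
 (109,95783,1614,116866948403,15030227126),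
 (113,94073,1643,115794774565,16469867371),
 (127,88736,8159,114770042047,18019237205),
 (131,87371,8287,113866340929,19618192238),
 (137,85436,8475,112997132220,21332253313),
 (139,84819,8536,112172335635,23154795708),
 (149,81924,8838,111365340415,25118762326),
 (151,81379,8897,110617922023,27176591811),
 (157,79809,9072,109885353003,29388195676),
 (163,78327,9244,109185446296,31733638185),
 (167,77383,9357,108515596933,34219238864),
 (173,76029,9523,107865802940,36867226226),
 (179,74744,9687,107242301189,39670204569),
 (181,74330,9741,106643182188,42635314340),
 (191,72358,10006,106053993337,45804397255),
 (193,71982,10059,105498736828,49118711832),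
 (197,71248,10162,104952111249,52654374948),
 (199,70889,10214,104419359416,56405893855),
 (211,68843,10517,103894639017,60404451265),
 (223,66965,10812,103402247363,64562874904),
 (227,66373,10909,102938560156,68886327822),
 (229,66082,10957,102485086323,73458520059),
 (233,65513,11052,102037553195,78312805982),
 (239,64685,11193,101599623783,83443312841),
 (241,64416,174502,101174520755,88840843533),
 (251,63120,181743,100754709466,94563615311),
 (257,62379,186087,100353296281,100532470710),
 (263,61663,190432,99962816529,106803585701),
 (269,60972,194776,99582729775,113389415207),
 (271,60746,196224,99212533754,120302994632),
 (277,60085,200569,98846435844,127610920344),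
 (281,59655,203465,98489589506,135278422493),
 (283,59444,204913,98139092747,143348456787),
 (293,58421,212154,97792311501,151869662453),
 (307,57074,222291,97458549346,160742040004),
 (311,56705,225188,97141094788,169916231196),
 (313,56524,226636,96828744001,179551331086),
 (317,56166,229532,96519386992,189700290525),
 (331,54965,239669,96214909431,200354997043),
 (337,54474,244014,95924229947,211367509456),
 (347,53683,251254,95639588316,222881543167),
 (349,53529,252702,95363969906,234846493049),
 (353,53225,255599,95090720709,247417590976),
 (359,52778,259943,94821341897,260586392256),
 (367,52200,265736,94557215597,274339620867),
 (373,51779,270080,94299566509,288660149077),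
 (379,51367,274425,94046752658,303606682937),
 (383,51098,277321,93798608192,319202047420),
 (389,50703,281666,93553703210,335512633640),
 (397,50189,287458,93313205259,352524130704),
 (401,49938,290355,93078159402,370216964300),
 (409,49447,296147,92846044292,388704859064),
 (419,48854,303388,92619036849,407925148231),
 (421,48738,304836,92397989029,427853923423),
 (431,48169,312077,92178516371,448706667943),
 (433,48057,313525,91964645104,470320419432),
 (439,47728,317869,91752255624,492922607829),
 (443,47512,320766,91543252764,516448818056),
 (449,47193,325110,91336608853,540986334300),
 (457,46779,330903,91133186562,566517102375),
 (461,46575,333799,90933770399,593018205908),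
 (463,46474,335247,90736517101,620638028849),
 (467,46275,338144,90540541903,649481560602),
 (479,45692,346833,90346664940,679536319819),
 (487,45315,352625,90158049774,710585693345),
 (491,45130,355521,89972920309,742785884039),
 (499,44767,361314,89789676073,776307810986),
 (503,44588,364210,89609736843,811060782761),
 (509,44325,368555,89431586273,847224360943)]
lemma rtab_ok : rch rtab = true := by decide +kernel

lemma Rk'_base : Rk' 17 191808191809 808191809 :=
  ⟨5760/30030, 24270/30030, by norm_num, by norm_num, by norm_num, by norm_num, Rk_base⟩

def XB (q : ℕ) : ℕ := Bool.rec (Bool.rec (Bool.rec (q^2*524288) (q*524288) (Nat.ble q 239)) (q*23910) (Nat.ble q 113)) 0 (Nat.ble q 101)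

lemma rtab_cov : ((List.range 512).all fun q => Nat.ble q 16 || !pb q || rtab.any fun x => Nat.beq x.1 q && (Nat.ble q 101 || Nat.ble (x.2.2.1^2) (XB q))) = true := by
  decide +kernel

lemma rank_tab : ∀ x ∈ rtab, ∀ N, x.2.2.1^2 ≤ N → (F x.1 N : ℝ) < 0.6 / Real.log x.1 * N :=
  rch_spec _ _ _ _ _ _ rtab_ok Rk'_base

lemma rank_big (q N : ℕ) (hq : q.Prime) (h1 : 103 ≤ q) (h2 : q < 512) (hN : XB q ≤ N) : (F q N : ℝ) < 0.6 / Real.log q * N := by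
  have h := List.all_eq_true.1 rtab_cov q (List.mem_range.2 h2)
  rw [(pb_spec q hq.two_le (by omega)).2 hq] at h
  simp only [Bool.or_eq_true, List.any_eq_true, Bool.and_eq_true, Bool.not_true, Nat.ble_eq] at h
  rcases h with (h | h) | ⟨x, hx, hx1, hx2⟩
  · omega
  · cases h
  · rcases hx2 with hx2 | hx2
    · omega
    · have := Nat.eq_of_beq_eq_true hx1
      rw [← this]
      exact rank_tab x hx N (hx2.trans hN)

lemma mid_q (q N : ℕ) (hq : q.Prime) (h1 : 103 ≤ q) (hN : q^2 ≤ N) : (F q N : ℝ) < 0.6 / Real.log q * N := by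
  rcases le_or_gt 512 q with h | h
  · exact big_q q N hq h hN
  rcases le_or_gt (XB q) N with h' | h'
  · exact rank_big q N hq h1 h h'
  have e1 : Nat.ble q 101 = false := by rw [Bool.eq_false_iff]; intro h; have := Nat.le_of_ble_eq_true h; omega
  unfold XB at h'
  rw [e1] at h'
  have np : ∀ a, a < 529 → 2 ≤ a → pb a = false → q ≠ a := fun a ha ha2 hb hqa => by
    subst hqa; rw [(pb_spec q ha2 ha).2 hq] at hb; cases hb
  rcases le_or_gt q 113 with hh | hh
  · rw [Nat.ble_eq_true_of_le hh] at h'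
    exact g1 q N hq h1 hh hN h'.le
  have e2 : Nat.ble q 113 = false := by rw [Bool.eq_false_iff]; intro h; have := Nat.le_of_ble_eq_true h; omega
  rw [e2] at h'
  have big : ∀ a, 114 ≤ a → a ≤ 126 → q ≠ a := fun a ha hb => np a (by omega) (by omega) (by interval_cases a <;> decide)
  have big2 : ∀ a, 140 ≤ a → a ≤ 148 → q ≠ a := fun a ha hb => np a (by omega) (by omega) (by interval_cases a <;> decide)
  have big3 : ∀ a, 182 ≤ a → a ≤ 190 → q ≠ a := fun a ha hb => np a (by omega) (by omega) (by interval_cases a <;> decide)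
  have q0 : 127 ≤ q := by
    by_contra hc; exact big q (by omega) (by omega) rfl
  rcases le_or_gt q 239 with h3 | h3
  · rw [Nat.ble_eq_true_of_le h3] at h'
    rcases le_or_gt q 139 with h4 | h4
    · exact g2 q N hq q0 h4 hN h'.le
    rcases le_or_gt q 181 with h5 | h5
    · exact g3 q N hq (by by_contra hc; exact big2 q (by omega) (by omega) rfl) h5 hN h'.le
    · exact g4 q N hq (by by_contra hc; exact big3 q (by omega) (by omega) rfl) h3 hN h'.le
  · have e3 : Nat.ble q 239 = false := by rw [Bool.eq_false_iff]; intro h; have := Nat.le_of_ble_eq_true h; omega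
    rw [e3] at h'
    have q2 : 241 ≤ q := by
      by_contra hc
      exact np 240 (by omega) (by omega) (by decide) (by omega)
    rcases le_or_gt q 366 with h4 | h4
    · exact g5 q N hq q2 h4 hN h'.le
    · exact g6 q N hq h4 (by omega) hN h'.le
end PS
end


section
set_option maxRecDepth 100000
namespace PS

lemma pk_and {w : ℕ} {a b : ℕ → ℕ} {n : ℕ} (ha : ∀ t < n, a t < 2 ^ w) (hb : ∀ t < n, b t < 2 ^ w) :
    (pk w a n &&& pk w b n) = pk w (fun t => a t &&& b t) n := by
  induction n with
  | zero => simp [pk]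
  | succ n ih =>
    have e : ∀ f : ℕ → ℕ, pk w f (n + 1) = pk w f n + f n * 2 ^ (w * n) := by
      intro f; rw [pk, sum_range_succ, ← pk]
    have hal : pk w a n < 2 ^ (w * n) := pk_lt fun t ht => ha t (by omega)
    have hbl : pk w b n < 2 ^ (w * n) := pk_lt fun t ht => hb t (by omega)
    rw [e, e, e, ← ih (fun t ht => ha t (by omega)) (fun t ht => hb t (by omega))]
    rw [← Nat.mod_add_div' ((pk w a n + a n * 2 ^ (w * n)) &&& (pk w b n + b n * 2 ^ (w * n))) (2 ^ (w*n))]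
    congr 1
    · rw [Nat.and_mod_two_pow, Nat.add_mul_mod_self_right, Nat.add_mul_mod_self_right,
        Nat.mod_eq_of_lt hal, Nat.mod_eq_of_lt hbl]
    · rw [Nat.and_div_two_pow, Nat.add_mul_div_right _ _ (Nat.two_pow_pos _),
        Nat.add_mul_div_right _ _ (Nat.two_pow_pos _), Nat.div_eq_of_lt hal, Nat.div_eq_of_lt hbl]
      simp

lemma pk_modsum (w : ℕ) (hw : 1 ≤ w) (f : ℕ → ℕ) (n : ℕ) (h : ∑ t ∈ range n, f t < 2^w - 1) :
    pk w f n % (2^w - 1) = ∑ t ∈ range n, f t := by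
  have h1 : pk w f n ≡ ∑ t ∈ range n, f t [MOD (2^w - 1)] := by
    have : ∀ m, pk w f m ≡ ∑ t ∈ range m, f t [MOD (2^w - 1)] := by
      intro m
      induction m with
      | zero => simp [pk]; rfl
      | succ m ih =>
        rw [pk, sum_range_succ, ← pk, sum_range_succ]
        refine ih.add ?_
        have h0 : 2^w ≡ 1 [MOD (2^w - 1)] := by
          have : 1 ≤ 2^w := Nat.one_le_two_pow
          exact ((Nat.modEq_iff_dvd' this).2 dvd_rfl).symm
        have := (h0.pow m).mul_left (f m)
        rw [← pow_mul, one_pow, mul_one] at this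
        exact this
    exact this n
  rw [h1, Nat.mod_eq_of_lt h]

lemma pk_geo (w n : ℕ) (hw : 1 ≤ w) : (2^(w*n) - 1) / (2^w - 1) = pk w (fun _ => 1) n := by
  have h2 : 2 ≤ 2^w := by calc 2 = 2^1 := rfl
    _ ≤ 2^w := Nat.pow_le_pow_right (by norm_num) hw
  apply Nat.div_eq_of_eq_mul_left (by omega)
  have : pk w (fun _ => 1) n * (2^w - 1) + 1 = 2^(w*n) := by
    induction n with
    | zero => simp [pk]
    | succ n ih =>
      rw [pk, sum_range_succ, ← pk, add_mul, add_right_comm, ih, mul_add, pow_add]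
      obtain ⟨k, hk⟩ := Nat.exists_eq_add_of_le (show 1 ≤ 2^w by omega)
      rw [mul_one, hk]; simp; ring
  omega

lemma pk_shift {w : ℕ} (f : ℕ → ℕ) (a K L : ℕ) (hK : a + L ≤ K) (hf : ∀ t, f t < 2^w) :
    ((pk w f K) >>> (w * a)) &&& (2^(w*L) - 1) = pk w (fun t => f (a + t)) L := by
  obtain ⟨k, rfl⟩ := Nat.exists_eq_add_of_le hK
  rw [add_assoc, pk_split, Nat.shiftRight_eq_div_pow, Nat.add_mul_div_right _ _ (Nat.two_pow_pos _),
    Nat.div_eq_of_lt (pk_lt fun t _ => hf t), zero_add, Nat.and_two_pow_sub_one_eq_mod, pk_mod (by omega) (fun t _ => hf _)]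

/-- indicator of divisibility -/
def dv (p t : ℕ) : ℕ := if p ∣ t then 1 else 0

lemma dv_le (p t : ℕ) : dv p t ≤ 1 := by unfold dv; split_ifs <;> omega

lemma pk_dv (w p : ℕ) (hp : 1 ≤ p) : pk w (dv p) p = 1 := by
  unfold pk
  rw [sum_eq_single 0]
  · simp [dv]
  · intro b hb h0
    have : ¬ p ∣ b := fun hd => by
      have := Nat.le_of_dvd (by omega) hd
      simp at hb; omega
    simp [dv, this]
  · intro h; simp at h; omega

lemma rp_dv (w p i : ℕ) (hp : 1 ≤ p) : rp (w*p) 1 i = pk w (dv p) (p * 2^i) := by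
  have := rp_eq w p (dv p) (fun t => by simp [dv]) i
  rwa [pk_dv w p hp] at this

lemma dv_mod (p n t : ℕ) : dv p (n % p + t) = dv p (n + t) := by
  unfold dv
  congr 1
  simp only [eq_iff_iff, Nat.dvd_iff_mod_eq_zero, Nat.mod_add_mod]

def sG (ts : List (ℕ × ℕ)) (n1 fl : ℕ) : ℕ :=
  List.rec 0 (fun x _ r => force r fun v => Nat.add v (Nat.land (Nat.shiftRight x.2 (Nat.mul 20 (Nat.mod n1 x.1))) fl)) ts

lemma sG_cons (x : ℕ × ℕ) (ts : List (ℕ × ℕ)) (n1 fl : ℕ) : sG (x::ts) n1 fl = sG ts n1 fl + ((x.2 >>> (20 * (n1 % x.1))) &&& fl) := by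
  unfold sG; dsimp only; rw [force_eq]; rfl

def sct (ts : List (ℕ × ℕ)) (n L : ℕ) : ℕ :=
  force (Nat.sub (Nat.pow 2 (Nat.mul 20 L)) 1) fun fl => force (Nat.mul 32 (Nat.div fl 1048575)) fun H =>
   force (sG ts (Nat.succ n) fl) fun G => Nat.div (Nat.mod (Nat.land (Nat.sub H G) H) 1048575) 32

/-- table of patterns -/
def tb (ps : List (ℕ × ℕ)) : List (ℕ × ℕ) := ps.map fun x => (x.1, rp (20 * x.1) 1 x.2)

def dvs (ps : List (ℕ × ℕ)) (m : ℕ) : ℕ := (ps.map fun x => dv x.1 m).sum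

lemma dvs_le (ps : List (ℕ × ℕ)) (m : ℕ) : dvs ps m ≤ ps.length := by
  induction ps with
  | nil => simp [dvs]
  | cons x l ih => simp only [dvs, List.map_cons, List.sum_cons, List.length_cons] at ih ⊢; have := dv_le x.1 m; omega

lemma dvs_zero (ps : List (ℕ × ℕ)) (m : ℕ) : dvs ps m = 0 ↔ ∀ x ∈ ps, ¬ x.1 ∣ m := by
  unfold dvs
  rw [List.sum_eq_zero_iff]
  constructor
  · intro h x hx hd
    have := h (dv x.1 m) (List.mem_map.2 ⟨x, hx, rfl⟩)
    simp [dv, hd] at this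
  · intro h y hy
    obtain ⟨x, hx, rfl⟩ := List.mem_map.1 hy
    simp [dv, h x hx]

lemma sG_tb (ps : List (ℕ × ℕ)) (n1 L : ℕ) (h : ∀ x ∈ ps, 1 ≤ x.1 ∧ L + x.1 ≤ x.1 * 2^x.2) :
    sG (tb ps) n1 (2^(20*L) - 1) = pk 20 (fun t => dvs ps (n1 + t)) L := by
  induction ps with
  | nil => simp [sG, tb, dvs, pk]
  | cons x l ih =>
    have hx := h x (by simp)
    have e : tb (x::l) = (x.1, rp (20 * x.1) 1 x.2) :: tb l := rfl
    rw [e, sG_cons, ih (fun y hy => h y (by simp [hy]))]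
    dsimp only
    rw [rp_dv 20 x.1 x.2 hx.1, pk_shift (dv x.1) (n1 % x.1) (x.1 * 2^x.2) L
      (by have := Nat.mod_lt n1 hx.1; omega) (fun t => lt_of_le_of_lt (dv_le _ t) (by norm_num)), pk_add]
    refine pk_congr fun t _ => ?_
    rw [dv_mod]
    simp only [dvs, List.map_cons, List.sum_cons]; omega

lemma and32 : ∀ g, g < 32 → ((32 - g) &&& 32) = 32 * (if g = 0 then 1 else 0) := by decide

lemma sct_tb (ps : List (ℕ × ℕ)) (n L : ℕ) (h : ∀ x ∈ ps, 1 ≤ x.1 ∧ L + x.1 ≤ x.1 * 2^x.2) (hl : ps.length < 32) (hL : L < 32767) :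
    sct (tb ps) n L = ∑ t ∈ range L, if dvs ps (n + 1 + t) = 0 then 1 else 0 := by
  unfold sct
  simp only [force_eq]
  have e1 : Nat.sub (Nat.pow 2 (Nat.mul 20 L)) 1 = 2^(20*L) - 1 := rfl
  have e2 : Nat.mul 32 (Nat.div (2^(20*L) - 1) 1048575) = pk 20 (fun _ => 32) L := by
    have := pk_geo 20 L (by norm_num)
    have e3 : (2:ℕ)^20 - 1 = 1048575 := by norm_num
    rw [e3] at this
    change 32 * ((2^(20*L) - 1)/1048575) = _
    rw [this, pk_smul]
  rw [e1, sG_tb ps _ L h, e2]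
  have hg : ∀ t, dvs ps (n.succ + t) < 32 := fun t => lt_of_le_of_lt (dvs_le _ _) hl
  have e3 : Nat.sub (pk 20 (fun _ => 32) L) (pk 20 (fun t => dvs ps (n.succ + t)) L) = pk 20 (fun t => 32 - dvs ps (n.succ + t)) L := by
    change (pk 20 (fun _ => 32) L) - (pk 20 (fun t => dvs ps (n.succ + t)) L) = _
    rw [Nat.sub_eq_iff_eq_add, pk_add]
    · exact pk_congr fun t ht => by have := hg t; omega
    · exact sum_le_sum fun t ht => Nat.mul_le_mul_right _ (hg t).le
  rw [e3]
  change ((pk 20 (fun t => 32 - dvs ps (n.succ + t)) L &&& pk 20 (fun _ => 32) L) % 1048575) / 32 = _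
  rw [pk_and (fun t _ => lt_of_le_of_lt (Nat.sub_le _ _) (by norm_num)) (fun t _ => by norm_num)]
  have e4 : pk 20 (fun t => (32 - dvs ps (n.succ + t)) &&& 32) L = pk 20 (fun t => 32 * (if dvs ps (n+1+t) = 0 then 1 else 0)) L :=
    pk_congr fun t _ => and32 _ (hg t)
  rw [e4]
  have hs : ∑ t ∈ range L, 32 * (if dvs ps (n+1+t) = 0 then 1 else 0) ≤ 32 * L := by
    calc _ ≤ ∑ t ∈ range L, 32 := sum_le_sum fun t _ => by split_ifs <;> omega
      _ = 32 * L := by simp [mul_comm]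
  have := pk_modsum 20 (by norm_num) (fun t => 32 * (if dvs ps (n+1+t) = 0 then 1 else 0)) L (lt_of_le_of_lt hs (by norm_num; omega))
  rw [show (2:ℕ)^20 - 1 = 1048575 by norm_num] at this
  rw [this, ← mul_sum]
  omega

/-- `ps` lists the primes below `q` with sufficient pattern lengths -/
def Pok (q Lm : ℕ) (ps : List (ℕ × ℕ)) : Prop := (∀ m, Rq q m ↔ dvs ps m = 0) ∧ ps.length < 32 ∧ Lm < 32767 ∧
   ∀ x ∈ ps, 1 ≤ x.1 ∧ Lm + x.1 ≤ x.1 * 2^x.2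

lemma sct_F (q Lm : ℕ) (ps : List (ℕ × ℕ)) (h : Pok q Lm ps) (n L : ℕ) (hL : L ≤ Lm) : F q n + sct (tb ps) n L = F q (n+L) := by
  rw [sct_tb ps n L (fun x hx => ⟨(h.2.2.2 x hx).1, by have := (h.2.2.2 x hx).2; omega⟩) h.2.1 (by have := h.2.2.1; omega)]
  clear hL
  induction L with
  | zero => simp
  | succ L ih =>
    rw [sum_range_succ, ← add_assoc, ih, ← add_assoc, F_succ]
    congr 1
    rw [add_right_comm]
    by_cases hh : dvs ps (n + L + 1) = 0
    · rw [if_pos hh, if_pos ((h.1 _).2 hh)]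
    · rw [if_neg hh, if_neg (fun h' => hh ((h.1 _).1 h'))]

def psq (q Lm : ℕ) : List (ℕ × ℕ) := ((List.range q).filter fun p => Nat.ble 2 p && pb p).map fun p => (p, Nat.log2 (Lm / p) + 2)

lemma psq_ok (q Lm : ℕ) (hq : q < 512) (hl : (psq q Lm).length < 32) (hLm : Lm < 32767)
    (hc : ((psq q Lm).all fun x => Nat.ble (Lm + x.1) (x.1 * 2^x.2)) = true) : Pok q Lm (psq q Lm) := by
  have hmem : ∀ p i, (p, i) ∈ psq q Lm → p.Prime ∧ p < q := by
    intro p i hp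
    unfold psq at hp
    simp only [List.mem_map, List.mem_filter, List.mem_range, Bool.and_eq_true, Nat.ble_eq] at hp
    obtain ⟨a, ⟨h1, h2, h3⟩, h4⟩ := hp
    obtain ⟨rfl, -⟩ := Prod.mk.inj h4
    exact ⟨(pb_spec _ h2 (by omega)).1 h3, h1⟩
  refine ⟨fun m => ?_, hl, hLm, fun x hx => ⟨(hmem x.1 x.2 hx).1.pos, ?_⟩⟩
  · rw [dvs_zero]
    constructor
    · intro h x hx hd
      obtain ⟨h1, h2⟩ := hmem x.1 x.2 hx
      have := h _ h1 hd
      omega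
    · intro h p hp hd
      by_contra hcc
      refine h (p, Nat.log2 (Lm / p) + 2) ?_ hd
      unfold psq
      simp only [List.mem_map, List.mem_filter, List.mem_range, Bool.and_eq_true, Nat.ble_eq]
      exact ⟨p, ⟨by omega, hp.two_le, (pb_spec p hp.two_le (by omega)).2 hp⟩, rfl⟩
  · exact Nat.le_of_ble_eq_true (List.all_eq_true.1 hc x hx)

def bld (ps : List (ℕ × ℕ)) : (List (ℕ × ℕ) → ℕ) → ℕ :=
  List.rec (fun k => k []) (fun x _ r k => force (rp (Nat.mul 20 x.1) 1 x.2) fun t => r fun ts => k ((x.1, t)::ts)) ps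

lemma bld_eq (ps : List (ℕ × ℕ)) : ∀ k, bld ps k = k (tb ps) := by
  induction ps with
  | nil => intro k; rfl
  | cons x l ih =>
    intro k
    change force (rp (Nat.mul 20 x.1) 1 x.2) (fun t => bld l fun ts => k ((x.1, t)::ts)) = _
    rw [force_eq, ih]; rfl

def st9b (A Lm : ℕ) (ts : List (ℕ × ℕ)) (n c L : ℕ) : ℕ :=
  force (Nat.add c (sct ts n L)) fun c' => gd (Nat.ble L Lm) (gd (Nat.blt (Nat.mul c' A) (Nat.mul 600000000000000 (Nat.succ n)))
    (Nat.add (Nat.mul (Nat.add n L) 4294967296) c'))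

def st9 (A X Lm : ℕ) (ts : List (ℕ × ℕ)) (_lo S : ℕ) : ℕ :=
  gd (Nat.blt 0 S) (force (Nat.div S 4294967296) fun n => Bool.rec (force (Nat.mod S 4294967296) fun c => force (Nat.succ (Nat.div n 64)) fun L => st9b A Lm ts n c L) S (Nat.ble X n))

def ch9 (q A X Lm d : ℕ) (ps : List (ℕ × ℕ)) : ℕ := bld ps fun ts => force (Nat.pred (Nat.mul q q)) fun n0 =>
  force (Nat.add (Nat.mul n0 4294967296) (sct ts 0 n0)) fun S => run (st9 A X Lm ts) d 0 S

def I9 (q A S : ℕ) : Prop := ∃ n, n < 4294967296 ∧ S = n * 4294967296 + F q n ∧ ∀ m, q*q ≤ m → m ≤ n → F q m * A < 600000000000000 * m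

lemma run_inv (step : ℕ → ℕ → ℕ) (I : ℕ → Prop) (h : ∀ lo S, step lo S ≠ 0 → S ≠ 0 ∧ (I S → I (step lo S))) (d : ℕ) :
    ∀ lo S, run step d lo S ≠ 0 → S ≠ 0 ∧ (I S → I (run step d lo S)) := by
  induction d with
  | zero => exact h
  | succ d ih =>
    intro lo S hr
    rw [run_succ] at hr ⊢
    obtain ⟨a, b⟩ := ih _ _ hr
    obtain ⟨a', b'⟩ := ih _ _ a
    exact ⟨a', fun hS => b (b' hS)⟩

lemma st9_spec (q A X Lm : ℕ) (ps : List (ℕ × ℕ)) (h : Pok q Lm ps) (hX : X < 4294967296 - 40000) (lo S : ℕ) (hr : st9 A X Lm (tb ps) lo S ≠ 0) :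
    S ≠ 0 ∧ (I9 q A S → I9 q A (st9 A X Lm (tb ps) lo S)) := by
  unfold st9 at hr ⊢
  obtain ⟨h0, e0⟩ := gd_ne hr
  have h0' : 1 ≤ S := by simpa [Nat.blt] using h0
  refine ⟨by omega, fun hI => ?_⟩
  rw [e0] at hr ⊢
  obtain ⟨n, hn, hS, hm⟩ := hI
  have hF := F_le q n
  have e1 : Nat.div S 4294967296 = n := by change S / _ = n; omega
  have e2 : Nat.mod S 4294967296 = F q n := by change S % _ = _; omega
  simp only [force_eq] at hr ⊢
  rw [e1, e2] at hr ⊢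
  cases hb : Nat.ble X n with
  | true => exact ⟨n, hn, hS, hm⟩
  | false =>
    rw [hb] at hr
    change st9b A Lm (tb ps) n (F q n) (n / 64 + 1) ≠ 0 at hr
    change I9 q A (st9b A Lm (tb ps) n (F q n) (n / 64 + 1))
    unfold st9b at hr ⊢
    rw [force_eq] at hr ⊢
    obtain ⟨h1, f1⟩ := gd_ne hr
    rw [f1] at hr ⊢
    obtain ⟨h2, f2⟩ := gd_ne hr
    rw [f2]
    have hL := Nat.le_of_ble_eq_true h1
    have hc : Nat.add (F q n) (sct (tb ps) n (n/64+1)) = F q (n + (n/64+1)) := sct_F q Lm ps h n _ hL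
    rw [hc] at h2 ⊢
    have h2' : F q (n + (n/64+1)) * A < 600000000000000 * (n+1) := by simpa using h2
    have hnX : n < X := by
      by_contra hcc
      rw [Nat.ble_eq_true_of_le (by omega)] at hb
      cases hb
    refine ⟨n + (n/64+1), by have := h.2.2.1; omega, rfl, fun m hm1 hm2 => ?_⟩
    rcases le_or_gt m n with hh | hh
    · exact hm m hm1 hh
    · calc F q m * A ≤ F q (n + (n/64+1)) * A := Nat.mul_le_mul_right _ (F_mono q hm2)
        _ < _ := h2'
        _ ≤ _ := by omega

lemma ch9_spec (q A X Lm d : ℕ) (ps : List (ℕ × ℕ)) (h : Pok q Lm ps) (hq : 2 ≤ q) (hqL : q * q ≤ Lm) (hX : X < 4294967296 - 40000) (hX1 : 1 ≤ X)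
    (hc : X * 4294967296 ≤ ch9 q A X Lm d ps) (m : ℕ) (h1 : q * q ≤ m) (h2 : m ≤ X) : F q m * A < 600000000000000 * m := by
  unfold ch9 at hc
  rw [bld_eq] at hc
  simp only [force_eq] at hc
  have e : Nat.add (Nat.mul (Nat.pred (Nat.mul q q)) 4294967296) (sct (tb ps) 0 (Nat.pred (Nat.mul q q))) = (q*q-1) * 4294967296 + F q (q*q-1) := by
    have := sct_F q Lm ps h 0 (q*q-1) (by omega)
    have h0 : F q 0 = 0 := by simp [F]
    rw [h0, zero_add, zero_add] at this
    change (q*q-1) * 4294967296 + sct (tb ps) 0 (q*q-1) = _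
    rw [this]
  rw [e] at hc
  obtain ⟨n, hn, hS, hm⟩ := (run_inv _ (I9 q A) (st9_spec q A X Lm ps h hX) d 0 _ (by omega)).2
    ⟨q*q-1, by have := h.2.2.1; omega, rfl, fun m hm1 hm2 => by
      have : 4 ≤ q * q := by nlinarith
      omega⟩
  have := F_le q n
  exact hm m h1 (by omega)

lemma sm9 (q N X Lm d A : ℕ) (hq : q.Prime) (hq2 : q < 512) (hA : A = lgL (q-1) + 17 * (q-1)) (hl : (psq q Lm).length < 32) (hLm : Lm < 32767)
    (hc : ((psq q Lm).all fun x => Nat.ble (Lm + x.1) (x.1 * 2^x.2)) = true) (hqL : q * q ≤ Lm) (hX : X < 4294967296 - 40000) (hX1 : 1 ≤ X)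
    (hch : X * 4294967296 ≤ ch9 q A X Lm d (psq q Lm)) (h1 : q^2 ≤ N) (h2 : N ≤ X) : (F q N : ℝ) < 0.6 / Real.log q * N := by
  have h := ch9_spec q A X Lm d _ (psq_ok q Lm hq2 hl hLm hc) hq.two_le hqL hX hX1 hch N (by rw [← sq]; exact h1) h2
  have hl := log_hi q hq.one_lt.le
  have hlp := log_nat_pos q hq.two_le
  have hA' : (A:ℝ) = lgL (q-1) + 17 * ((q:ℝ)-1) := by
    rw [hA]; push_cast [Nat.cast_sub hq.one_lt.le]; ring
  have hl' : Real.log q ≤ A / 10^15 := by rw [hA']; exact hl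
  have h' : (F q N : ℝ) * A < 600000000000000 * N := by exact_mod_cast h
  rw [div_mul_eq_mul_div, lt_div_iff₀ hlp]
  calc (F q N : ℝ) * Real.log q ≤ F q N * (A / 10^15) := by gcongr
    _ = F q N * A / 10^15 := by ring
    _ < 0.6 * N := by rw [div_lt_iff₀ (by norm_num)]; linarith

end PS
end


section
set_option maxRecDepth 100000
namespace PS
lemma sm_13 (N : ℕ) (h1 : 13^2 ≤ N) (h2 : N ≤ 200) : (F 13 N : ℝ) < 0.6 / Real.log ((13:ℕ):ℝ) * N :=
  sm9 13 N 200 169 4 _ (by norm_num) (by norm_num) rfl (by decide +kernel) (by norm_num) (by decide +kernel) (by norm_num) (by norm_num) (by norm_num)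
    (by decide +kernel) h1 h2
lemma sm_17 (N : ℕ) (h1 : 17^2 ≤ N) (h2 : N ≤ 1764) : (F 17 N : ℝ) < 0.6 / Real.log ((17:ℕ):ℝ) * N :=
  sm9 17 N 1764 289 7 _ (by norm_num) (by norm_num) rfl (by decide +kernel) (by norm_num) (by decide +kernel) (by norm_num) (by norm_num) (by norm_num)
    (by decide +kernel) h1 h2
lemma sm_19 (N : ℕ) (h1 : 19^2 ≤ N) (h2 : N ≤ 2025) : (F 19 N : ℝ) < 0.6 / Real.log ((19:ℕ):ℝ) * N :=
  sm9 19 N 2025 361 7 _ (by norm_num) (by norm_num) rfl (by decide +kernel) (by norm_num) (by decide +kernel) (by norm_num) (by norm_num) (by norm_num)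
    (by decide +kernel) h1 h2
lemma sm_23 (N : ℕ) (h1 : 23^2 ≤ N) (h2 : N ≤ 3844) : (F 23 N : ℝ) < 0.6 / Real.log ((23:ℕ):ℝ) * N :=
  sm9 23 N 3844 529 7 _ (by norm_num) (by norm_num) rfl (by decide +kernel) (by norm_num) (by decide +kernel) (by norm_num) (by norm_num) (by norm_num)
    (by decide +kernel) h1 h2
lemma sm_29 (N : ℕ) (h1 : 29^2 ≤ N) (h2 : N ≤ 10816) : (F 29 N : ℝ) < 0.6 / Real.log ((29:ℕ):ℝ) * N :=
  sm9 29 N 10816 841 8 _ (by norm_num) (by norm_num) rfl (by decide +kernel) (by norm_num) (by decide +kernel) (by norm_num) (by norm_num) (by norm_num)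
    (by decide +kernel) h1 h2
lemma sm_31 (N : ℕ) (h1 : 31^2 ≤ N) (h2 : N ≤ 11449) : (F 31 N : ℝ) < 0.6 / Real.log ((31:ℕ):ℝ) * N :=
  sm9 31 N 11449 961 8 _ (by norm_num) (by norm_num) rfl (by decide +kernel) (by norm_num) (by decide +kernel) (by norm_num) (by norm_num) (by norm_num)
    (by decide +kernel) h1 h2
lemma sm_37 (N : ℕ) (h1 : 37^2 ≤ N) (h2 : N ≤ 24964) : (F 37 N : ℝ) < 0.6 / Real.log ((37:ℕ):ℝ) * N :=
  sm9 37 N 24964 1369 8 _ (by norm_num) (by norm_num) rfl (by decide +kernel) (by norm_num) (by decide +kernel) (by norm_num) (by norm_num) (by norm_num)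
    (by decide +kernel) h1 h2
lemma sm_41 (N : ℕ) (h1 : 41^2 ≤ N) (h2 : N ≤ 36481) : (F 41 N : ℝ) < 0.6 / Real.log ((41:ℕ):ℝ) * N :=
  sm9 41 N 36481 1681 8 _ (by norm_num) (by norm_num) rfl (by decide +kernel) (by norm_num) (by decide +kernel) (by norm_num) (by norm_num) (by norm_num)
    (by decide +kernel) h1 h2
lemma sm_43 (N : ℕ) (h1 : 43^2 ≤ N) (h2 : N ≤ 38416) : (F 43 N : ℝ) < 0.6 / Real.log ((43:ℕ):ℝ) * N :=
  sm9 43 N 38416 1849 8 _ (by norm_num) (by norm_num) rfl (by decide +kernel) (by norm_num) (by decide +kernel) (by norm_num) (by norm_num) (by norm_num)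
    (by decide +kernel) h1 h2
lemma sm_47 (N : ℕ) (h1 : 47^2 ≤ N) (h2 : N ≤ 53361) : (F 47 N : ℝ) < 0.6 / Real.log ((47:ℕ):ℝ) * N :=
  sm9 47 N 53361 2209 8 _ (by norm_num) (by norm_num) rfl (by decide +kernel) (by norm_num) (by decide +kernel) (by norm_num) (by norm_num) (by norm_num)
    (by decide +kernel) h1 h2
lemma sm_53 (N : ℕ) (h1 : 53^2 ≤ N) (h2 : N ≤ 90000) : (F 53 N : ℝ) < 0.6 / Real.log ((53:ℕ):ℝ) * N :=
  sm9 53 N 90000 2809 8 _ (by norm_num) (by norm_num) rfl (by decide +kernel) (by norm_num) (by decide +kernel) (by norm_num) (by norm_num) (by norm_num)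
    (by decide +kernel) h1 h2
lemma sm_59 (N : ℕ) (h1 : 59^2 ≤ N) (h2 : N ≤ 146689) : (F 59 N : ℝ) < 0.6 / Real.log ((59:ℕ):ℝ) * N :=
  sm9 59 N 146689 3481 8 _ (by norm_num) (by norm_num) rfl (by decide +kernel) (by norm_num) (by decide +kernel) (by norm_num) (by norm_num) (by norm_num)
    (by decide +kernel) h1 h2
lemma sm_61 (N : ℕ) (h1 : 61^2 ≤ N) (h2 : N ≤ 154449) : (F 61 N : ℝ) < 0.6 / Real.log ((61:ℕ):ℝ) * N :=
  sm9 61 N 154449 3721 8 _ (by norm_num) (by norm_num) rfl (by decide +kernel) (by norm_num) (by decide +kernel) (by norm_num) (by norm_num) (by norm_num)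
    (by decide +kernel) h1 h2
lemma sm_67 (N : ℕ) (h1 : 67^2 ≤ N) (h2 : N ≤ 236196) : (F 67 N : ℝ) < 0.6 / Real.log ((67:ℕ):ℝ) * N :=
  sm9 67 N 236196 4489 8 _ (by norm_num) (by norm_num) rfl (by decide +kernel) (by norm_num) (by decide +kernel) (by norm_num) (by norm_num) (by norm_num)
    (by decide +kernel) h1 h2
lemma sm_71 (N : ℕ) (h1 : 71^2 ≤ N) (h2 : N ≤ 295936) : (F 71 N : ℝ) < 0.6 / Real.log ((71:ℕ):ℝ) * N :=
  sm9 71 N 295936 5041 9 _ (by norm_num) (by norm_num) rfl (by decide +kernel) (by norm_num) (by decide +kernel) (by norm_num) (by norm_num) (by norm_num)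
    (by decide +kernel) h1 h2
lemma sm_73 (N : ℕ) (h1 : 73^2 ≤ N) (h2 : N ≤ 315844) : (F 73 N : ℝ) < 0.6 / Real.log ((73:ℕ):ℝ) * N :=
  sm9 73 N 315844 5329 9 _ (by norm_num) (by norm_num) rfl (by decide +kernel) (by norm_num) (by decide +kernel) (by norm_num) (by norm_num) (by norm_num)
    (by decide +kernel) h1 h2
lemma sm_79 (N : ℕ) (h1 : 79^2 ≤ N) (h2 : N ≤ 450241) : (F 79 N : ℝ) < 0.6 / Real.log ((79:ℕ):ℝ) * N :=
  sm9 79 N 450241 7078 9 _ (by norm_num) (by norm_num) rfl (by decide +kernel) (by norm_num) (by decide +kernel) (by norm_num) (by norm_num) (by norm_num)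
    (by decide +kernel) h1 h2
lemma sm_83 (N : ℕ) (h1 : 83^2 ≤ N) (h2 : N ≤ 550564) : (F 83 N : ℝ) < 0.6 / Real.log ((83:ℕ):ℝ) * N :=
  sm9 83 N 550564 8700 9 _ (by norm_num) (by norm_num) rfl (by decide +kernel) (by norm_num) (by decide +kernel) (by norm_num) (by norm_num) (by norm_num)
    (by decide +kernel) h1 h2
lemma sm_89 (N : ℕ) (h1 : 89^2 ≤ N) (h2 : N ≤ 756900) : (F 89 N : ℝ) < 0.6 / Real.log ((89:ℕ):ℝ) * N :=
  sm9 89 N 756900 11854 9 _ (by norm_num) (by norm_num) rfl (by decide +kernel) (by norm_num) (by decide +kernel) (by norm_num) (by norm_num) (by norm_num)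
    (by decide +kernel) h1 h2
lemma sm_97 (N : ℕ) (h1 : 97^2 ≤ N) (h2 : N ≤ 1157776) : (F 97 N : ℝ) < 0.6 / Real.log ((97:ℕ):ℝ) * N :=
  sm9 97 N 1157776 18318 9 _ (by norm_num) (by norm_num) rfl (by decide +kernel) (by norm_num) (by decide +kernel) (by norm_num) (by norm_num) (by norm_num)
    (by decide +kernel) h1 h2
lemma sm_101 (N : ℕ) (h1 : 101^2 ≤ N) (h2 : N ≤ 1373584) : (F 101 N : ℝ) < 0.6 / Real.log ((101:ℕ):ℝ) * N :=
  sm9 101 N 1373584 21795 9 _ (by norm_num) (by norm_num) rfl (by decide +kernel) (by norm_num) (by decide +kernel) (by norm_num) (by norm_num) (by norm_num)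
    (by decide +kernel) h1 h2

lemma F2 (N : ℕ) : F 2 N = N := by
  unfold F
  rw [filter_true_of_mem, Nat.card_Ioc, Nat.sub_zero]
  intro n _ p hp _
  exact hp.two_le

lemma F3_eq (N : ℕ) : F 3 N + N / 2 = N := by
  have := F_step 2 N Nat.prime_two
  rw [F2, F2, show 2 + 1 = 3 from rfl] at this; omega

lemma F5_bd (N : ℕ) : 3 * F 5 N ≤ N + 2 ∧ N ≤ 3 * F 5 N + 1 := by
  have h1 := F_step 3 N Nat.prime_three
  have h2 := F3_eq N
  have h3 := F3_eq (N/3)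
  rw [F_gap 4 5 N (by norm_num) (fun s a b => by obtain rfl : s = 4 := by omega
                                                 norm_num)] at h1
  omega

lemma F7_bd (N : ℕ) : 15 * F 7 N ≤ 4 * N + 19 ∧ 4 * N ≤ 15 * F 7 N + 15 := by
  have h1 := F_step 5 N Nat.prime_five
  have h2 := F5_bd N
  have h3 := F5_bd (N/5)
  rw [F_gap 6 7 N (by norm_num) (fun s a b => by obtain rfl : s = 6 := by omega
                                                 norm_num)] at h1
  omega

lemma F11_bd (N : ℕ) : 105 * F 11 N ≤ 24 * N + 263 ∧ 24 * N ≤ 105 * F 11 N + 239 := by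
  have h1 := F_step 7 N (by norm_num)
  have h2 := F7_bd N
  have h3 := F7_bd (N/7)
  rw [F_gap 8 11 N (by norm_num) (fun s a b => by interval_cases s <;> norm_num)] at h1
  omega

lemma F13_bd (N : ℕ) : 1155 * F 13 N ≤ 240 * N + 5775 := by
  have h1 := F_step 11 N (by norm_num)
  have h2 := F11_bd N
  have h3 := F11_bd (N/11)
  rw [F_gap 12 13 N (by norm_num) (fun s a b => by interval_cases s; norm_num)] at h1
  omega

/-- from a linear bound `u F ≤ v N + w` -/
lemma lin_q (q N u v w A N0 : ℕ) (hq : 2 ≤ q) (hu : 0 < u) (hA : A = lgL (q-1) + 17 * (q-1)) (hb : u * F q N ≤ v * N + w) (hN0 : N0 ≤ N)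
    (hv : v * A ≤ 600000000000000 * u) (hc : (v * N0 + w) * A < 600000000000000 * (u * N0)) : (F q N : ℝ) < 0.6 / Real.log q * N := by
  have hl := log_hi q (by omega)
  have hlp := log_nat_pos q hq
  have hA' : (A:ℝ) = lgL (q-1) + 17 * ((q:ℝ)-1) := by
    rw [hA]; push_cast [Nat.cast_sub (show 1 ≤ q by omega)]; ring
  have hl' : Real.log q ≤ A / 10^15 := by rw [hA']; exact hl
  have h1 : (v * N + w) * A < 600000000000000 * (u * N) := by
    obtain ⟨k, rfl⟩ := Nat.exists_eq_add_of_le hN0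
    nlinarith [Nat.mul_le_mul_right k hv]
  have h2 : u * F q N * A < 600000000000000 * (u * N) := lt_of_le_of_lt (Nat.mul_le_mul_right _ hb) h1
  have h3 : F q N * A < 600000000000000 * N := by
    have : u * (F q N * A) < u * (600000000000000 * N) := by linarith
    exact lt_of_mul_lt_mul_left this (Nat.zero_le _)
  have h' : (F q N : ℝ) * A < 600000000000000 * N := by exact_mod_cast h3
  rw [div_mul_eq_mul_div, lt_div_iff₀ hlp]
  calc (F q N : ℝ) * Real.log q ≤ F q N * (A / 10^15) := by gcongr
    _ = F q N * A / 10^15 := by ring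
    _ < 0.6 * N := by rw [div_lt_iff₀ (by norm_num)]; linarith

lemma q_3 (N : ℕ) (hN : 10 ≤ N) : (F 3 N : ℝ) < 0.6 / Real.log ((3:ℕ):ℝ) * N := by
  have h := F3_eq N
  rcases hN.eq_or_lt with rfl | hN
  · exact lin_q 3 10 2 1 0 _ 10 (by norm_num) (by norm_num) rfl (by omega) le_rfl (by decide +kernel) (by decide +kernel)
  · exact lin_q 3 N 2 1 1 _ 11 (by norm_num) (by norm_num) rfl (by omega) hN (by decide +kernel) (by decide +kernel)

lemma q_5 (N : ℕ) (hN : 5^2 ≤ N) : (F 5 N : ℝ) < 0.6 / Real.log ((5:ℕ):ℝ) * N := by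
  have h := F5_bd N
  exact lin_q 5 N 3 1 2 _ (5^2) (by norm_num) (by norm_num) rfl (by omega) hN (by decide +kernel) (by decide +kernel)

lemma q_7 (N : ℕ) (hN : 7^2 ≤ N) : (F 7 N : ℝ) < 0.6 / Real.log ((7:ℕ):ℝ) * N := by
  have h := F7_bd N
  exact lin_q 7 N 15 4 19 _ (7^2) (by norm_num) (by norm_num) rfl (by omega) hN (by decide +kernel) (by decide +kernel)

lemma q_11 (N : ℕ) (hN : 11^2 ≤ N) : (F 11 N : ℝ) < 0.6 / Real.log ((11:ℕ):ℝ) * N := by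
  have h := F11_bd N
  exact lin_q 11 N 105 24 263 _ (11^2) (by norm_num) (by norm_num) rfl (by omega) hN (by decide +kernel) (by decide +kernel)

lemma q_13 (N : ℕ) (hN : 13^2 ≤ N) : (F 13 N : ℝ) < 0.6 / Real.log ((13:ℕ):ℝ) * N := by
  rcases le_or_gt N 200 with hh | hh
  · exact sm_13 N hN hh
  have h := F13_bd N
  exact lin_q 13 N 1155 240 5775 _ 200 (by norm_num) (by norm_num) rfl (by omega) hh.le (by decide +kernel) (by decide +kernel)

lemma rank_at (q g N : ℕ) (hm : (rtab.any fun x => Nat.beq x.1 q && Nat.beq x.2.2.1 g) = true) (hN : g^2 ≤ N) : (F q N : ℝ) < 0.6 / Real.log q * N := by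
  simp only [List.any_eq_true, Bool.and_eq_true] at hm
  obtain ⟨x, hx, h1, h2⟩ := hm
  have e1 := Nat.eq_of_beq_eq_true h1
  have e2 := Nat.eq_of_beq_eq_true h2
  have := rank_tab x hx N (by rw [e2]; exact hN)
  rwa [e1] at this

lemma q_17 (N : ℕ) (hN : 17^2 ≤ N) : (F 17 N : ℝ) < 0.6 / Real.log ((17:ℕ):ℝ) * N := by
  rcases le_or_gt N 1764 with hh | hh
  · exact sm_17 N hN hh
  · exact rank_at 17 42 N (by decide +kernel) (by norm_num; omega)
lemma q_19 (N : ℕ) (hN : 19^2 ≤ N) : (F 19 N : ℝ) < 0.6 / Real.log ((19:ℕ):ℝ) * N := by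
  rcases le_or_gt N 2025 with hh | hh
  · exact sm_19 N hN hh
  · exact rank_at 19 45 N (by decide +kernel) (by norm_num; omega)
lemma q_23 (N : ℕ) (hN : 23^2 ≤ N) : (F 23 N : ℝ) < 0.6 / Real.log ((23:ℕ):ℝ) * N := by
  rcases le_or_gt N 3844 with hh | hh
  · exact sm_23 N hN hh
  · exact rank_at 23 62 N (by decide +kernel) (by norm_num; omega)
lemma q_29 (N : ℕ) (hN : 29^2 ≤ N) : (F 29 N : ℝ) < 0.6 / Real.log ((29:ℕ):ℝ) * N := by
  rcases le_or_gt N 10816 with hh | hh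
  · exact sm_29 N hN hh
  · exact rank_at 29 104 N (by decide +kernel) (by norm_num; omega)
lemma q_31 (N : ℕ) (hN : 31^2 ≤ N) : (F 31 N : ℝ) < 0.6 / Real.log ((31:ℕ):ℝ) * N := by
  rcases le_or_gt N 11449 with hh | hh
  · exact sm_31 N hN hh
  · exact rank_at 31 107 N (by decide +kernel) (by norm_num; omega)
lemma q_37 (N : ℕ) (hN : 37^2 ≤ N) : (F 37 N : ℝ) < 0.6 / Real.log ((37:ℕ):ℝ) * N := by
  rcases le_or_gt N 24964 with hh | hh
  · exact sm_37 N hN hh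
  · exact rank_at 37 158 N (by decide +kernel) (by norm_num; omega)
lemma q_41 (N : ℕ) (hN : 41^2 ≤ N) : (F 41 N : ℝ) < 0.6 / Real.log ((41:ℕ):ℝ) * N := by
  rcases le_or_gt N 36481 with hh | hh
  · exact sm_41 N hN hh
  · exact rank_at 41 191 N (by decide +kernel) (by norm_num; omega)
lemma q_43 (N : ℕ) (hN : 43^2 ≤ N) : (F 43 N : ℝ) < 0.6 / Real.log ((43:ℕ):ℝ) * N := by
  rcases le_or_gt N 38416 with hh | hh
  · exact sm_43 N hN hh
  · exact rank_at 43 196 N (by decide +kernel) (by norm_num; omega)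
lemma q_47 (N : ℕ) (hN : 47^2 ≤ N) : (F 47 N : ℝ) < 0.6 / Real.log ((47:ℕ):ℝ) * N := by
  rcases le_or_gt N 53361 with hh | hh
  · exact sm_47 N hN hh
  · exact rank_at 47 231 N (by decide +kernel) (by norm_num; omega)
lemma q_53 (N : ℕ) (hN : 53^2 ≤ N) : (F 53 N : ℝ) < 0.6 / Real.log ((53:ℕ):ℝ) * N := by
  rcases le_or_gt N 90000 with hh | hh
  · exact sm_53 N hN hh
  · exact rank_at 53 300 N (by decide +kernel) (by norm_num; omega)
lemma q_59 (N : ℕ) (hN : 59^2 ≤ N) : (F 59 N : ℝ) < 0.6 / Real.log ((59:ℕ):ℝ) * N := by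
  rcases le_or_gt N 146689 with hh | hh
  · exact sm_59 N hN hh
  · exact rank_at 59 383 N (by decide +kernel) (by norm_num; omega)
lemma q_61 (N : ℕ) (hN : 61^2 ≤ N) : (F 61 N : ℝ) < 0.6 / Real.log ((61:ℕ):ℝ) * N := by
  rcases le_or_gt N 154449 with hh | hh
  · exact sm_61 N hN hh
  · exact rank_at 61 393 N (by decide +kernel) (by norm_num; omega)
lemma q_67 (N : ℕ) (hN : 67^2 ≤ N) : (F 67 N : ℝ) < 0.6 / Real.log ((67:ℕ):ℝ) * N := by
  rcases le_or_gt N 236196 with hh | hh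
  · exact sm_67 N hN hh
  · exact rank_at 67 486 N (by decide +kernel) (by norm_num; omega)
lemma q_71 (N : ℕ) (hN : 71^2 ≤ N) : (F 71 N : ℝ) < 0.6 / Real.log ((71:ℕ):ℝ) * N := by
  rcases le_or_gt N 295936 with hh | hh
  · exact sm_71 N hN hh
  · exact rank_at 71 544 N (by decide +kernel) (by norm_num; omega)
lemma q_73 (N : ℕ) (hN : 73^2 ≤ N) : (F 73 N : ℝ) < 0.6 / Real.log ((73:ℕ):ℝ) * N := by
  rcases le_or_gt N 315844 with hh | hh
  · exact sm_73 N hN hh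
  · exact rank_at 73 562 N (by decide +kernel) (by norm_num; omega)
lemma q_79 (N : ℕ) (hN : 79^2 ≤ N) : (F 79 N : ℝ) < 0.6 / Real.log ((79:ℕ):ℝ) * N := by
  rcases le_or_gt N 450241 with hh | hh
  · exact sm_79 N hN hh
  · exact rank_at 79 671 N (by decide +kernel) (by norm_num; omega)
lemma q_83 (N : ℕ) (hN : 83^2 ≤ N) : (F 83 N : ℝ) < 0.6 / Real.log ((83:ℕ):ℝ) * N := by
  rcases le_or_gt N 550564 with hh | hh
  · exact sm_83 N hN hh
  · exact rank_at 83 742 N (by decide +kernel) (by norm_num; omega)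
lemma q_89 (N : ℕ) (hN : 89^2 ≤ N) : (F 89 N : ℝ) < 0.6 / Real.log ((89:ℕ):ℝ) * N := by
  rcases le_or_gt N 756900 with hh | hh
  · exact sm_89 N hN hh
  · exact rank_at 89 870 N (by decide +kernel) (by norm_num; omega)
lemma q_97 (N : ℕ) (hN : 97^2 ≤ N) : (F 97 N : ℝ) < 0.6 / Real.log ((97:ℕ):ℝ) * N := by
  rcases le_or_gt N 1157776 with hh | hh
  · exact sm_97 N hN hh
  · exact rank_at 97 1076 N (by decide +kernel) (by norm_num; omega)
lemma q_101 (N : ℕ) (hN : 101^2 ≤ N) : (F 101 N : ℝ) < 0.6 / Real.log ((101:ℕ):ℝ) * N := by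
  rcases le_or_gt N 1373584 with hh | hh
  · exact sm_101 N hN hh
  · exact rank_at 101 1172 N (by decide +kernel) (by norm_num; omega)

/-- the bound for `N ≥ q²` -/
theorem all_q (q N : ℕ) (hq : q.Prime) (h3 : 3 ≤ q) (hN : q^2 ≤ N) (h10 : 10 ≤ N) : (F q N : ℝ) < 0.6 / Real.log q * N := by
  rcases le_or_gt 102 q with h | h
  · refine mid_q q N hq ?_ hN
    by_contra hc
    obtain rfl : q = 102 := by omega
    revert hq; norm_num
  have hp := (pb_spec q hq.two_le (by omega)).2 hq
  clear hq
  have : q ∈ [3,5,7,11,13,17,19,23,29,31,37,41,43,47,53,59,61,67,71,73,79,83,89,97,101] := by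
    have key : ((List.range 102).all fun q => Nat.ble q 2 || !pb q || [3,5,7,11,13,17,19,23,29,31,37,41,43,47,53,59,61,67,71,73,79,83,89,97,101].contains q) = true := by decide +kernel
    have := List.all_eq_true.1 key q (List.mem_range.2 h)
    rw [hp] at this
    simp only [Bool.or_eq_true, Nat.ble_eq, Bool.not_true, List.contains_iff_mem] at this
    rcases this with (h | h) | h
    · omega
    · cases h
    · exact h
  simp only [List.mem_cons, List.not_mem_nil, or_false] at this
  rcases this with rfl | rfl | rfl | rfl | rfl | rfl | rfl | rfl | rfl | rfl | rfl | rfl | rfl | rfl | rfl | rfl | rfl | rfl | rfl | rfl | rfl | rfl | rfl | rfl | rfl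
  · exact q_3 N h10
  · exact q_5 N hN
  · exact q_7 N hN
  · exact q_11 N hN
  · exact q_13 N hN
  · exact q_17 N hN
  · exact q_19 N hN
  · exact q_23 N hN
  · exact q_29 N hN
  · exact q_31 N hN
  · exact q_37 N hN
  · exact q_41 N hN
  · exact q_43 N hN
  · exact q_47 N hN
  · exact q_53 N hN
  · exact q_59 N hN
  · exact q_61 N hN
  · exact q_67 N hN
  · exact q_71 N hN
  · exact q_73 N hN
  · exact q_79 N hN
  · exact q_83 N hN
  · exact q_89 N hN
  · exact q_97 N hN
  · exact q_101 N hN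
end PS
end


section
set_option maxRecDepth 100000
namespace PS

lemma log_ratio (a b : ℝ) (ha : 3 ≤ a) (hab : a ≤ b) : a * Real.log b ≤ b * Real.log a := by
  have he := Real.exp_one_lt_d9
  have h := Real.log_div_self_antitoneOn (show a ∈ {x | Real.exp 1 ≤ x} by simp only [Set.mem_ofPred_eq]; linarith)
    (show b ∈ {x | Real.exp 1 ≤ x} by simp only [Set.mem_ofPred_eq]; linarith) hab
  simp only at h
  rw [div_le_div_iff₀ (by linarith) (by linarith)] at h
  linarith

/-- crude logarithm bound -/
def lb (m : ℕ) : ℕ := Nat.mul (Nat.succ (Nat.log2 (Nat.pow m 64))) 6931471808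

lemma lb_spec (m : ℕ) (hm : 1 ≤ m) : Real.log m ≤ (lb m : ℝ) / 640000000000 := by
  have h : m ^ 64 < 2 ^ (Nat.log2 (m^64) + 1) := Nat.lt_log2_self
  have h1 : (m:ℝ) ^ 64 ≤ 2 ^ (Nat.log2 (m^64) + 1) := by exact_mod_cast h.le
  have hm0 : (0:ℝ) < m := by exact_mod_cast hm
  have h2 := Real.log_le_log (by positivity) h1
  rw [Real.log_pow, Real.log_pow] at h2
  have e : (lb m : ℝ) = ((Nat.log2 (m^64) + 1 : ℕ) : ℝ) * 6931471808 := by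
    have : lb m = (Nat.log2 (m^64) + 1) * 6931471808 := rfl
    rw [this, Nat.cast_mul]; norm_num
  rw [e]
  have h3 := Real.log_two_lt_d9
  have h4 : ((Nat.log2 (m^64) + 1 : ℕ) : ℝ) * Real.log 2 ≤ ((Nat.log2 (m^64) + 1 : ℕ) : ℝ) * 0.6931471808 := by gcongr
  push_cast at *
  linarith

lemma fl_of (f m : ℕ) (hm : 1 ≤ m) (h : f * lb m < 768000000000 * m) : (f : ℝ) * Real.log m < 1.2 * m := by
  have h1 := lb_spec m hm
  have h2 : (f : ℝ) * Real.log m ≤ f * (lb m / 640000000000) := by gcongr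
  have h3 : (f : ℝ) * lb m < 768000000000 * m := by exact_mod_cast h
  linarith

lemma seg_le (c c' a m : ℝ) (h4 : c' ≤ c) (hc' : 0 ≤ c') (ha : 3 ≤ a) (h7 : a ≤ m) (h3 : c * Real.log a < 1.2 * a) : c' * Real.log m < 1.2 * m := by
  have h5 := log_ratio a m ha h7
  have hl : 0 ≤ Real.log m := Real.log_nonneg (by linarith)
  have hc0 : 0 ≤ c := hc'.trans h4
  have h8 : c * Real.log m * a < 1.2 * m * a := by
    calc c * Real.log m * a = c * (a * Real.log m) := by ring
      _ ≤ c * (m * Real.log a) := by gcongr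
      _ = (c * Real.log a) * m := by ring
      _ < 1.2 * a * m := by
        have : (0:ℝ) < m := by linarith
        gcongr
      _ = _ := by ring
  have h9 := lt_of_mul_lt_mul_right h8 (by linarith)
  exact lt_of_le_of_lt (by gcongr) h9

def st10b (Lm : ℕ) (ts : List (ℕ × ℕ)) (n c L : ℕ) : ℕ :=
  force (Nat.add c (sct ts n L)) fun c' => gd (Nat.ble L Lm) (gd (Nat.blt (Nat.mul (Nat.add c' 14) (lb (Nat.succ n))) (Nat.mul 768000000000 (Nat.succ n)))
    (Nat.add (Nat.mul (Nat.add n L) 4294967296) c'))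

def st10 (X Lm : ℕ) (ts : List (ℕ × ℕ)) (_lo S : ℕ) : ℕ :=
  gd (Nat.blt 0 S) (force (Nat.div S 4294967296) fun n => Bool.rec (force (Nat.mod S 4294967296) fun c => force (Nat.succ (Nat.div n 64)) fun L => st10b Lm ts n c L) S (Nat.ble X n))

def ch10 (X Lm d : ℕ) (ps : List (ℕ × ℕ)) : ℕ := bld ps fun ts =>
  force (Nat.add (Nat.mul 120 4294967296) (sct ts 0 120)) fun S => run (st10 X Lm ts) d 0 S

def I10 (S : ℕ) : Prop := ∃ n, 120 ≤ n ∧ n < 4294967296 ∧ S = n * 4294967296 + F 71 n ∧ ∀ m : ℕ, 121 ≤ m → m ≤ n → ((F 71 m + 14 : ℕ) : ℝ) * Real.log m < 1.2 * m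

lemma st10_spec (X Lm : ℕ) (ps : List (ℕ × ℕ)) (h : Pok 71 Lm ps) (hX : X < 4294967296 - 40000) (lo S : ℕ) (hr : st10 X Lm (tb ps) lo S ≠ 0) :
    S ≠ 0 ∧ (I10 S → I10 (st10 X Lm (tb ps) lo S)) := by
  unfold st10 at hr ⊢
  obtain ⟨h0, e0⟩ := gd_ne hr
  have h0' : 1 ≤ S := by simpa [Nat.blt] using h0
  refine ⟨by omega, fun hI => ?_⟩
  rw [e0] at hr ⊢
  obtain ⟨n, hn0, hn, hS, hm⟩ := hI
  have hF := F_le 71 n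
  have e1 : Nat.div S 4294967296 = n := by change S / _ = n; omega
  have e2 : Nat.mod S 4294967296 = F 71 n := by change S % _ = _; omega
  simp only [force_eq] at hr ⊢
  rw [e1, e2] at hr ⊢
  cases hb : Nat.ble X n with
  | true => exact ⟨n, hn0, hn, hS, hm⟩
  | false =>
    rw [hb] at hr
    change st10b Lm (tb ps) n (F 71 n) (n / 64 + 1) ≠ 0 at hr
    change I10 (st10b Lm (tb ps) n (F 71 n) (n / 64 + 1))
    unfold st10b at hr ⊢
    rw [force_eq] at hr ⊢
    obtain ⟨h1, f1⟩ := gd_ne hr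
    rw [f1] at hr ⊢
    obtain ⟨h2, f2⟩ := gd_ne hr
    rw [f2]
    have hL := Nat.le_of_ble_eq_true h1
    have hc : Nat.add (F 71 n) (sct (tb ps) n (n/64+1)) = F 71 (n + (n/64+1)) := sct_F 71 Lm ps h n _ hL
    rw [hc] at h2 ⊢
    have h2' : (F 71 (n + (n/64+1)) + 14) * lb (n+1) < 768000000000 * (n+1) := by simpa using h2
    have hnX : n < X := by
      by_contra hcc
      rw [Nat.ble_eq_true_of_le (by omega)] at hb
      cases hb
    have h3 := fl_of _ (n+1) (by omega) h2'
    refine ⟨n + (n/64+1), by omega, by have := h.2.2.1; omega, rfl, fun m hm1 hm2 => ?_⟩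
    rcases le_or_gt m n with hh | hh
    · exact hm m hm1 hh
    · have h4 : ((F 71 m + 14 : ℕ) : ℝ) ≤ ((F 71 (n + (n/64+1)) + 14 : ℕ) : ℝ) := by
        exact_mod_cast Nat.add_le_add_right (F_mono 71 hm2) 14
      exact seg_le _ _ _ _ h4 (Nat.cast_nonneg _) (by exact_mod_cast (by omega : 3 ≤ n + 1)) (by exact_mod_cast hh) h3

lemma ch10_spec (X Lm d : ℕ) (ps : List (ℕ × ℕ)) (h : Pok 71 Lm ps) (hqL : 120 ≤ Lm) (hX : X < 4294967296 - 40000) (hX1 : 1 ≤ X)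
    (hc : X * 4294967296 ≤ ch10 X Lm d ps) (m : ℕ) (h1 : 121 ≤ m) (h2 : m ≤ X) : ((F 71 m + 14 : ℕ) : ℝ) * Real.log m < 1.2 * m := by
  unfold ch10 at hc
  rw [bld_eq] at hc
  simp only [force_eq] at hc
  have e : Nat.add (Nat.mul 120 4294967296) (sct (tb ps) 0 120) = 120 * 4294967296 + F 71 120 := by
    have := sct_F 71 Lm ps h 0 120 (by omega)
    have h0 : F 71 0 = 0 := by simp [F]
    rw [h0, zero_add, zero_add] at this
    rw [this]
    rfl
  rw [e] at hc
  obtain ⟨n, hn0, hn, hS, hm⟩ := (run_inv _ I10 (st10_spec X Lm ps h hX) d 0 _ (by omega)).2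
    ⟨120, le_rfl, by norm_num, rfl, fun m hm1 hm2 => by omega⟩
  have := F_le 71 n
  exact hm m h1 (by omega)

lemma pok71 : Pok 71 5040 (psq 71 5040) :=
  psq_ok 71 5040 (by norm_num) (by decide +kernel) (by norm_num) (by decide +kernel)

lemma F71_run (m : ℕ) (h1 : 121 ≤ m) (h2 : m ≤ 5040) : ((F 71 m + 14 : ℕ) : ℝ) * Real.log m < 1.2 * m :=
  ch10_spec 5040 5040 8 (psq 71 5040) pok71 (by norm_num) (by norm_num) (by norm_num) (by decide +kernel) m h1 h2

lemma F_val (q Lm : ℕ) (ps : List (ℕ × ℕ)) (hp : Pok q Lm ps) (L v : ℕ) (hL : L ≤ Lm)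
    (hv : Nat.beq (bld ps fun ts => sct ts 0 L) v = true) : F q L = v := by
  have h := sct_F q Lm ps hp 0 L hL
  have h0 : F q 0 = 0 := by simp [F]
  rw [h0, zero_add, zero_add] at h
  rw [← h]
  rw [bld_eq] at hv
  exact Nat.eq_of_beq_eq_true hv

lemma F71_val : F 71 5040 = 657 := F_val 71 5040 _ pok71 5040 657 le_rfl (by decide +kernel)

lemma F_anti {a b : ℕ} (h : a ≤ b) (N : ℕ) : F b N ≤ F a N := by
  unfold F
  exact card_le_card (monotone_filter_right _ fun n _ hn p hp hd => h.trans (hn p hp hd))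

lemma pr1_nonneg (p : ℕ) : 0 ≤ pr1 p := by unfold pr1; split_ifs <;> norm_num

lemma pr1_sum : ∑ r ∈ Ioc 12 70, pr1 r = 14 := by
  unfold pr1
  rw [sum_boole]
  have : ((Ioc 12 70).filter Nat.Prime).card = 14 := by decide +kernel
  exact_mod_cast this

lemma F_up (a q N : ℕ) (ha : 2 ≤ a) (haq : a ≤ q) (hN1 : 1 ≤ N) (hN : N < q^2) : (F q N : ℝ) ≤ 1 + ∑ r ∈ Ioc (a-1) N, pr1 r := by
  rw [F_small q (by omega) N hN1 hN]
  gcongr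
  · intro i _ _; exact pr1_nonneg i

lemma fl_small : ∀ n < 121, 10 ≤ n → (if n < 25 then (n+2)/3 else if n < 49 then (4*n+19)/15 else (24*n+263)/105) * lb n < 768000000000 * n := by
  decide +kernel

lemma sq_gt {q N a : ℕ} (hN : N < q^2) (h : a^2 ≤ N) : a < q := by
  exact lt_of_pow_lt_pow_left₀ 2 (Nat.zero_le _) (lt_of_le_of_lt h hN)

lemma small_A (q N : ℕ) (hq : q.Prime) (hN : N < q^2) (h10 : 10 ≤ N) (h : N < 121) : (F q N : ℝ) * Real.log N < 1.2 * N := by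
  refine fl_of _ N (by omega) (lt_of_le_of_lt (Nat.mul_le_mul_right _ ?_) (fl_small N h h10))
  have h3 : 3 < q := sq_gt hN (by omega)
  have n4 : q ≠ 4 := by rintro rfl; norm_num at hq
  have n6 : q ≠ 6 := by rintro rfl; norm_num at hq
  have n8 : q ≠ 8 := by rintro rfl; norm_num at hq
  have n9 : q ≠ 9 := by rintro rfl; norm_num at hq
  have n10 : q ≠ 10 := by rintro rfl; norm_num at hq
  split_ifs with h1 h2
  · have := F_anti (show 5 ≤ q by omega) N
    have := F5_bd N
    omega
  · have h5 : 5 < q := sq_gt hN (by omega)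
    have := F_anti (show 7 ≤ q by omega) N
    have := F7_bd N
    omega
  · have h5 : 7 < q := sq_gt hN (by omega)
    have := F_anti (show 11 ≤ q by omega) N
    have := F11_bd N
    omega

lemma small_B (q N : ℕ) (hq : q.Prime) (hN : N < q^2) (h1 : 121 ≤ N) (h2 : N ≤ 5040) : (F q N : ℝ) * Real.log N < 1.2 * N := by
  have h3 : 11 < q := sq_gt hN (by omega)
  have n12 : q ≠ 12 := by rintro rfl; norm_num at hq
  have h := F_up 13 q N (by norm_num) (by omega) (by omega) hN
  have e := F_small 71 (by norm_num) N (by omega) (by omega)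
  have h5 : ∑ r ∈ Ioc (13-1) N, pr1 r = ∑ r ∈ Ioc 12 70, pr1 r + ∑ r ∈ Ioc (71-1) N, pr1 r :=
    (sum_Ioc_consecutive _ (by norm_num) (by omega)).symm
  rw [h5, pr1_sum] at h
  have h6 := F71_run N h1 h2
  push_cast at h6
  refine lt_of_le_of_lt ?_ h6
  have : 0 ≤ Real.log N := Real.log_natCast_nonneg N
  gcongr
  linarith

end PS
end


section
set_option maxRecDepth 100000
namespace PS

lemma lg71 : 4262670000000000 ≤ lgL 70 ∧ lgL 70 + 17 * 70 ≤ 4262690000000000 := by decide +kernel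

lemma log5041 : 8.52534 ≤ Real.log ((5041:ℕ):ℝ) ∧ Real.log ((5041:ℕ):ℝ) ≤ 8.52538 := by
  have e : Real.log ((5041:ℕ):ℝ) = 2 * Real.log ((71:ℕ):ℝ) := by
    rw [show ((5041:ℕ):ℝ) = ((71:ℕ):ℝ) ^ 2 by norm_num, Real.log_pow]; norm_num
  have h1 := log_lo 71 (by norm_num)
  have h2 := log_hi 71 (by norm_num)
  rw [show (71 - 1 : ℕ) = 70 from rfl] at h1 h2
  obtain ⟨a, b⟩ := lg71
  have a' : (4262670000000000 : ℝ) ≤ lgL 70 := by exact_mod_cast a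
  have b' : (lgL 70 : ℝ) + 17 * 70 ≤ 4262690000000000 := by exact_mod_cast b
  generalize (lgL 70 : ℝ) = z at *
  rw [e]
  push_cast at h1 h2 ⊢
  constructor <;> linarith

lemma th5040 : (4884:ℝ) ≤ th 5040 := by
  have h := tau_of 5051 96696 (by norm_num) (by norm_num) (by norm_num) (by decide +kernel)
  have e := (th_gap 5040 5050 (by norm_num) (fun p hp h => by
    by_contra hc
    push Not at hc
    have : 5041 ≤ p := h
    interval_cases p <;> norm_num at hp)).1
  rw [show 5051 - 1 = 5050 from rfl, e] at h
  refine le_trans ?_ h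
  norm_num

lemma pi_sum (N : ℕ) (hN : 5041 ≤ N) : ∑ r ∈ Ioc 5040 N, pr1 r ≤
    (1.02 * 5041 - th 5040) / Real.log ((5041:ℕ):ℝ) + 1.02 * (Hf 3.1 N - Hf 3.1 ((5041:ℕ):ℝ)) := by
  have h := prime_sum 5041 N (by norm_num) hN 1.02 (fun m => 1 / Real.log m) (fun m h1 h2 => by
      have := log_nat_pos m (by omega)
      have h3 : (0:ℝ) < m := by exact_mod_cast (by omega : 0 < m)
      gcongr
      exact Nat.le_succ m) (by
      have := log_nat_pos N (by omega)
      positivity) (fun m _ _ => th102 m)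
  obtain ⟨l1, l2⟩ := log5041
  have h2 := sum_inv_log 3.1 5041 N (by norm_num) hN (lt_of_lt_of_le (by norm_num) l1) (by
    have : 3 / Real.log ((5041:ℕ):ℝ) ≤ 3 / 8.52534 := by gcongr
    norm_num at this ⊢
    linarith)
  have e : ∑ r ∈ Ioc 5040 N, pr1 r = ∑ m ∈ Ioc (5041-1) N, la m * (1 / Real.log m) := by
    refine sum_congr rfl fun m hm => ?_
    have hm' := mem_Ioc.1 hm
    rw [← pr1_log m (by omega), mul_one]
  rw [e]
  refine h.trans ?_
  rw [show 5041 - 1 = 5040 from rfl, mul_one_div]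
  push_cast at h2 ⊢
  linarith

lemma small_C (q N : ℕ) (hN : N < q^2) (h1 : 5041 ≤ N) : (F q N : ℝ) * Real.log N < 1.2 * N := by
  have h3 : 71 < q := sq_gt hN (by omega)
  have h := F_up 71 q N (by norm_num) (by omega) (by omega) hN
  have e := F_small 71 (by norm_num) 5040 (by omega) (by omega)
  rw [F71_val] at e
  have h5 : ∑ r ∈ Ioc (71-1) N, pr1 r = ∑ r ∈ Ioc (71-1) 5040, pr1 r + ∑ r ∈ Ioc 5040 N, pr1 r :=
    (sum_Ioc_consecutive _ (by norm_num) (by omega)).symm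
  have h6 := pi_sum N h1
  have ht := th5040
  obtain ⟨l1, l2⟩ := log5041
  have hL : 8.52534 ≤ Real.log N := l1.trans (Real.log_le_log (by norm_num) (by exact_mod_cast h1))
  have hH : 685.7 ≤ Hf 3.1 ((5041:ℕ):ℝ) := by
    unfold Hf
    generalize Real.log ((5041:ℕ):ℝ) = z at *
    have hz : 0 < z := by linarith
    have g1 : (591.2:ℝ) ≤ ((5041:ℕ):ℝ) / z := by rw [le_div_iff₀ hz]; norm_num; linarith
    have g2 : (69.3:ℝ) ≤ ((5041:ℕ):ℝ) / z^2 := by rw [le_div_iff₀ (by positivity)]; norm_num; nlinarith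
    have g3 : (25.2:ℝ) ≤ 3.1 * ((5041:ℕ):ℝ) / z^3 := by
      rw [le_div_iff₀ (by positivity)]
      have : z^3 ≤ 8.52538^3 := by gcongr
      norm_num at this ⊢; linarith
    linarith
  have hd : (1.02 * 5041 - th 5040) / Real.log ((5041:ℕ):ℝ) ≤ 30.3 := by
    generalize Real.log ((5041:ℕ):ℝ) = z at *
    rw [div_le_iff₀ (by linarith)]
    linarith
  have hF : (F q N : ℝ) ≤ 1.02 * Hf 3.1 N := by
    rw [h5] at h
    push_cast at e
    linarith
  have hn : (0:ℝ) < N := by exact_mod_cast (by omega : 0 < N)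
  unfold Hf at hF
  generalize Real.log (N:ℝ) = L at *
  have hL0 : 0 < L := by linarith
  have k1 : 1 / L ≤ 0.1173 := by rw [div_le_iff₀ hL0]; linarith
  have k2 : 1 / L^2 ≤ 0.01376 := by
    rw [div_le_iff₀ (by positivity)]; nlinarith
  calc (F q N : ℝ) * L ≤ 1.02 * (N / L + N / L^2 + 3.1 * N / L^3) * L := by gcongr
    _ = 1.02 * N * (1 + 1 / L + 3.1 * (1 / L^2)) := by field_simp
    _ ≤ 1.02 * N * (1 + 0.1173 + 3.1 * 0.01376) := by gcongr
    _ < 1.2 * N := by linarith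

lemma small_q (q N : ℕ) (hq : q.Prime) (hN : N < q^2) (h10 : 10 ≤ N) : (F q N : ℝ) * Real.log N < 1.2 * N := by
  rcases lt_or_ge N 121 with h | h
  · exact small_A q N hq hN h10 h
  rcases lt_or_ge N 5041 with h' | h'
  · exact small_B q N hq hN h (by omega)
  · exact small_C q N hN h'

end PS
end

theorem phi_lt_point_six_of_ten_le (x y : ℝ) (hx : 10 ≤ x) (hy : 2 ≤ y)
    (hyx : y ≤ Real.sqrt x) :
    (Phi x y : ℝ) < 0.6 * x / Real.log y := by
  have hex : ∃ p : ℕ, p.Prime ∧ y < (p:ℝ) := by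
    obtain ⟨p, hp1, hp2⟩ := Nat.exists_infinite_primes (⌊y⌋₊ + 1)
    exact ⟨p, hp2, (Nat.floor_lt (by linarith)).1 hp1⟩
  obtain ⟨q, hq, hyq, hmin⟩ : ∃ q : ℕ, q.Prime ∧ y < (q:ℝ) ∧ ∀ p : ℕ, p.Prime → (y < (p:ℝ) ↔ q ≤ p) := by
    refine ⟨Nat.find hex, (Nat.find_spec hex).1, (Nat.find_spec hex).2, fun p hp => ⟨fun h => Nat.find_min' hex ⟨hp, h⟩, fun h => ?_⟩⟩
    exact lt_of_lt_of_le (Nat.find_spec hex).2 (by exact_mod_cast h)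
  have hq3 : 3 ≤ q := by
    have : (2:ℝ) < q := by linarith
    exact_mod_cast this
  have hN10 : 10 ≤ ⌊x⌋₊ := Nat.le_floor (by exact_mod_cast hx)
  have hNx : (⌊x⌋₊ : ℝ) ≤ x := Nat.floor_le (by linarith)
  have hPhi : Phi x y = PS.F q ⌊x⌋₊ := by
    unfold Phi PS.F
    congr 1
    ext n
    simp only [mem_filter, mem_Icc, mem_Ioc, PS.Rq]
    constructor
    · rintro ⟨⟨a, b⟩, c⟩
      exact ⟨⟨by omega, b⟩, fun p hp hd => (hmin p hp).1 (c p hp hd)⟩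
    · rintro ⟨⟨a, b⟩, c⟩
      exact ⟨⟨by omega, b⟩, fun p hp hd => (hmin p hp).2 (c p hp hd)⟩
  rw [hPhi]
  generalize ⌊x⌋₊ = N at *
  have hly : 0 < Real.log y := Real.log_pos (by linarith)
  have hn : (10:ℝ) ≤ N := by exact_mod_cast hN10
  rcases le_or_gt (q^2) N with h | h
  · refine lt_of_lt_of_le (PS.all_q q N hq hq3 h hN10) ?_
    have hlq : Real.log y ≤ Real.log q := Real.log_le_log (by linarith) hyq.le
    calc 0.6 / Real.log q * N ≤ 0.6 / Real.log y * x := by gcongr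
      _ = _ := by ring
  · have h1 := PS.seg_le _ _ N x le_rfl (Nat.cast_nonneg _) (by linarith) hNx (PS.small_q q N hq h hN10)
    have h2 : Real.log y ≤ Real.log x / 2 := by
      rw [← Real.log_sqrt (by linarith)]
      exact Real.log_le_log (by linarith) hyx
    rw [lt_div_iff₀ hly]
    calc (PS.F q N : ℝ) * Real.log y ≤ PS.F q N * (Real.log x / 2) := by gcongr
      _ < _ := by linarith
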